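/- Let p be a prime and G an abelian group of order 9p. Then G is separable with respect to the class 𝒦_A of all finite abelian groups; that is, every algebraic isomorphism from any S-ring over G to an S-ring over a finite abelian group is induced by a combinatorial isomorphism. -/

import Mathlib

open scoped Pointwise

/-- The number of representations of `z` as `x * y` with `x ∈ X`, `y ∈ Y`
(used for the structure constants of an S-ring). -/
def structConst {G : Type*} [Group G] [DecidableEq G] (X Y : Finset G) (z : G) : ℕ :=
  ((X ×ˢ Y).filter (fun q => q.1 * q.2 = z)).card

/-- An S-ring (Schur ring) over a finite group `G`, given by its partition into basic sets:
the partition contains `{1}`, is closed under inversion, and the products of the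
characteristic sums of two blocks are integral linear combinations of characteristic sums,
i.e. the number of representations `z = x * y` (`x ∈ X`, `y ∈ Y`) is constant for `z`
ranging over a block `Z`. -/
structure SRing (G : Type*) [Group G] [Fintype G] [DecidableEq G] where
  basicSets : Finset (Finset G)
  nonempty_mem : ∀ X ∈ basicSets, X.Nonempty
  exists_mem : ∀ g : G, ∃ X ∈ basicSets, g ∈ X
  disj : ∀ X ∈ basicSets, ∀ Y ∈ basicSets, X ≠ Y → Disjoint X Y
  one_mem : ({1} : Finset G) ∈ basicSets
  inv_mem : ∀ X ∈ basicSets, X.image (fun x => x⁻¹) ∈ basicSets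
  structConst_eq : ∀ X ∈ basicSets, ∀ Y ∈ basicSets, ∀ Z ∈ basicSets,
    ∀ z ∈ Z, ∀ z' ∈ Z, structConst X Y z = structConst X Y z'

namespace SRing

variable {G G' : Type*} [Group G] [Fintype G] [DecidableEq G]
  [Group G'] [Fintype G'] [DecidableEq G']

/-- An algebraic isomorphism between S-rings: a bijection between the sets of basic sets
preserving the structure constants. -/
def IsAlgIso (A : SRing G) (B : SRing G') (φ : Finset G → Finset G') : Prop :=
  Set.BijOn φ (A.basicSets : Set (Finset G)) (B.basicSets : Set (Finset G')) ∧
  ∀ X ∈ A.basicSets, ∀ Y ∈ A.basicSets, ∀ Z ∈ A.basicSets,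
    ∀ z ∈ Z, ∀ z' ∈ φ Z, structConst X Y z = structConst (φ X) (φ Y) z'

/-- `φ` is induced by the bijection `f : G → G'` if `R(X)^f = R(X^φ)` for every basic set `X`,
where `R(X) = {(g, xg) : x ∈ X, g ∈ G}`; equivalently (for bijective `f`),
`h * g⁻¹ ∈ X ↔ f h * (f g)⁻¹ ∈ φ X` for all `g h`. -/
def Induces (A : SRing G) (B : SRing G') (φ : Finset G → Finset G') (f : G → G') : Prop :=
  Function.Bijective f ∧
  ∀ X ∈ A.basicSets, ∀ g h : G, h * g⁻¹ ∈ X ↔ f h * (f g)⁻¹ ∈ φ X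

/-- Separability with respect to the class of all finite abelian groups. -/
def SeparableA (A : SRing G) : Prop :=
  ∀ (H : Type) [CommGroup H] [Fintype H] [DecidableEq H],
    ∀ (B : SRing H) (φ : Finset G → Finset H),
      A.IsAlgIso B φ → ∃ f : G → H, A.Induces B φ f

/-- `X` is an `A`-set: a union of basic sets of `A`. -/
def IsASet (A : SRing G) (X : Finset G) : Prop :=
  ∀ Y ∈ A.basicSets, (Y ∩ X).Nonempty → Y ⊆ X

end SRing

namespace SchurSep

set_option linter.unusedSectionVars false
set_option linter.unusedVariables false

/-- A joint colouring: the classes of `c` and of `d` are the basic sets of two S-rings, and equality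
of colours is an algebraic isomorphism between them. -/
structure Joint {G H C : Type} [CommGroup G] [CommGroup H] (c : G → C) (d : H → C) : Prop where
  map_one : c 1 = d 1
  one_iff : ∀ {g h}, c g = d h → (g = 1 ↔ h = 1)
  inv : ∀ {g h}, c g = d h → c g⁻¹ = d h⁻¹
  exists_equiv : ∀ {z z'}, c z = d z' →
    ∃ e : G ≃ H, ∀ x, c x = d (e x) ∧ c (x⁻¹ * z) = d ((e x)⁻¹ * z')

/-- `f` carries the colouring of quotients by `c` to that by `d`. -/
def JI {G H C : Type} [CommGroup G] [CommGroup H] (c : G → C) (d : H → C) (f : G → H) : Prop :=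
  ∀ g h, c (h * g⁻¹) = d (f h * (f g)⁻¹)

/-- `X` and `Y` are corresponding unions of classes. -/
def JS {G H C : Type} (c : G → C) (d : H → C) (X : Set G) (Y : Set H) : Prop :=
  ∀ ⦃g h⦄, c g = d h → (g ∈ X ↔ h ∈ Y)

/-- Every joint colouring of a group of order `n` is induced by a bijection. -/
def Sep (n : ℕ) : Prop :=
  ∀ (G H C : Type) [CommGroup G] [CommGroup H] [Finite G] [Finite H] (c : G → C) (d : H → C),
    Nat.card G = n → Joint c d → ∃ f : G → H, JI c d f

theorem exists_equiv_of_card_fiber {α β K : Type*} [Finite α] [Finite β] (F : α → K) (F' : β → K)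
    (h : ∀ k, Nat.card {a // F a = k} = Nat.card {b // F' b = k}) :
    ∃ e : α ≃ β, ∀ a, F a = F' (e a) := by
  have h1 : ∀ k, Nonempty ({a // F a = k} ≃ {b // F' b = k}) := fun k => Finite.card_eq.1 (h k)
  let e := fun k => (h1 k).some
  refine ⟨(Equiv.sigmaFiberEquiv F).symm.trans
    ((Equiv.sigmaCongrRight e).trans (Equiv.sigmaFiberEquiv F')), fun a => ?_⟩
  exact ((e (F a) ⟨a, rfl⟩).2).symm

namespace Joint

variable {G H C : Type} [CommGroup G] [CommGroup H] {c : G → C} {d : H → C}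

theorem symm (J : Joint c d) : Joint d c where
  map_one := J.map_one.symm
  one_iff h := (J.one_iff h.symm).symm
  inv h := (J.inv h.symm).symm
  exists_equiv h := by
    obtain ⟨e, he⟩ := J.exists_equiv h.symm
    refine ⟨e.symm, fun x => ?_⟩
    have := he (e.symm x)
    simp only [Equiv.apply_symm_apply] at this
    exact ⟨this.1.symm, this.2.symm⟩

theorem exists_right (J : Joint c d) (g : G) : ∃ h, c g = d h := by
  obtain ⟨e, he⟩ := J.exists_equiv J.map_one
  exact ⟨e g, (he g).1⟩

theorem exists_left (J : Joint c d) (h : H) : ∃ g, c g = d h := by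
  obtain ⟨g, hg⟩ := J.symm.exists_right h
  exact ⟨g, hg.symm⟩

theorem trans {K : Type} [CommGroup K] {k : K → C} (J : Joint c d) (J' : Joint d k) :
    Joint c k where
  map_one := J.map_one.trans J'.map_one
  one_iff {g h} e := by
    obtain ⟨x, hx⟩ := J.exists_right g
    exact (J.one_iff hx).trans (J'.one_iff (hx.symm.trans e))
  inv {g h} e := by
    obtain ⟨x, hx⟩ := J.exists_right g
    exact (J.inv hx).trans (J'.inv (hx.symm.trans e))
  exists_equiv {z z'} h := by
    obtain ⟨x, hx⟩ := J.exists_right z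
    obtain ⟨e, he⟩ := J.exists_equiv hx
    obtain ⟨e', he'⟩ := J'.exists_equiv (hx.symm.trans h)
    exact ⟨e.trans e', fun y => ⟨(he y).1.trans (he' _).1, (he y).2.trans (he' _).2⟩⟩

theorem left (J : Joint c d) : Joint c c := J.trans J.symm

theorem right (J : Joint c d) : Joint d d := J.symm.trans J

theorem card_eq (J : Joint c d) : Nat.card G = Nat.card H := by
  obtain ⟨e, -⟩ := J.exists_equiv J.map_one
  exact Nat.card_congr e

/-- Products: if `c (x * y) = d z'` then `z' = x' * y'` with matching factors. -/
theorem exists_mul (J : Joint c d) {x y : G} {z' : H} (h : c (x * y) = d z') :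
    ∃ x' y', c x = d x' ∧ c y = d y' ∧ x' * y' = z' := by
  obtain ⟨e, he⟩ := J.exists_equiv h
  refine ⟨e x, (e x)⁻¹ * z', (he x).1, ?_, by group⟩
  have := (he x).2
  rwa [inv_mul_cancel_left] at this

/-- Convolution of colour-determined functions is colour-determined. -/
theorem sum_eq [Fintype G] [Fintype H] {M : Type*} [AddCommMonoid M] (J : Joint c d)
    {z z'} (h : c z = d z') {Φ : G → G → M} {Ψ : H → H → M}
    (hΦ : ∀ x y x' y', c x = d x' → c y = d y' → Φ x y = Ψ x' y') :
    ∑ x, Φ x (x⁻¹ * z) = ∑ x, Ψ x (x⁻¹ * z') := by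
  obtain ⟨e, he⟩ := J.exists_equiv h
  rw [← Equiv.sum_comp e]
  exact Finset.sum_congr rfl fun x _ => hΦ _ _ _ _ (he x).1 (he x).2

theorem card_conv_eq (J : Joint c d)
    {z z'} (h : c z = d z') {Φ : G → G → Prop} {Ψ : H → H → Prop}
    (hΦ : ∀ x y x' y', c x = d x' → c y = d y' → (Φ x y ↔ Ψ x' y')) :
    Nat.card {x // Φ x (x⁻¹ * z)} = Nat.card {x // Ψ x (x⁻¹ * z')} := by
  obtain ⟨e, he⟩ := J.exists_equiv h
  exact Nat.card_congr (e.subtypeEquiv fun x => hΦ _ _ _ _ (he x).1 (he x).2)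

theorem card_set_eq (J : Joint c d) {X : Set G} {Y : Set H} (h : JS c d X Y) :
    Nat.card X = Nat.card Y := by
  obtain ⟨e, he⟩ := J.exists_equiv J.map_one
  exact Nat.card_congr (e.subtypeEquiv fun x => h (he x).1)

end Joint

namespace JS

variable {G H C : Type} [CommGroup G] [CommGroup H] {c : G → C} {d : H → C}

theorem compl {X : Set G} {Y : Set H} (h : JS c d X Y) : JS c d Xᶜ Yᶜ :=
  fun _ _ e => not_congr (h e)

theorem inter {X X₂ : Set G} {Y Y₂ : Set H} (h : JS c d X Y) (h₂ : JS c d X₂ Y₂) :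
    JS c d (X ∩ X₂) (Y ∩ Y₂) := fun _ _ e => and_congr (h e) (h₂ e)

theorem union {X X₂ : Set G} {Y Y₂ : Set H} (h : JS c d X Y) (h₂ : JS c d X₂ Y₂) :
    JS c d (X ∪ X₂) (Y ∪ Y₂) := fun _ _ e => or_congr (h e) (h₂ e)

theorem symm {X : Set G} {Y : Set H} (h : JS c d X Y) : JS d c Y X :=
  fun _ _ e => (h e.symm).symm

/-- The subset of `H` corresponding to a union of classes. -/
theorem exists_right (J : Joint c d) {X : Set G} (h : JS c c X X) :
    JS c d X {y | ∃ x ∈ X, c x = d y} := fun g y e =>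
  ⟨fun hg => ⟨g, hg, e⟩, fun ⟨_, hx, e'⟩ => (h (e'.trans e.symm)).1 hx⟩

theorem left (J : Joint c d) {X : Set G} {Y : Set H} (h : JS c d X Y) : JS c c X X := by
  intro g g' e
  obtain ⟨y, hy⟩ := J.exists_right g
  exact (h hy).trans (h (e.symm.trans hy)).symm

end JS

/-- The class of `x`. -/
def cls {G C : Type} (c : G → C) (x : G) : Set G := {g | c g = c x}

theorem mem_cls {G C : Type} {c : G → C} {x g : G} : g ∈ cls c x ↔ c g = c x := Iff.rfl

theorem self_mem_cls {G C : Type} {c : G → C} {x : G} : x ∈ cls c x := rfl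

theorem JS.cls {G H C : Type} {c : G → C} {d : H → C} {x : G} {y : H} (h : c x = d y) :
    JS c d (cls c x) (cls d y) := fun g g' e => by
  rw [mem_cls, mem_cls, e, h]

section Subgroup

variable {G H C : Type} [CommGroup G] [CommGroup H] {c : G → C} {d : H → C}

/-- The subgroup corresponding to an `A`-subgroup. -/
theorem Joint.exists_subgroup (J : Joint c d) (L : Subgroup G) (hL : JS c c (L : Set G) L) :
    ∃ L' : Subgroup H, JS c d (L : Set G) (L' : Set H) := by
  have h := JS.exists_right J hL
  refine ⟨{ carrier := {y | ∃ x ∈ (L : Set G), c x = d y}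
            one_mem' := ⟨1, L.one_mem, J.map_one⟩
            inv_mem' := ?_
            mul_mem' := ?_ }, h⟩
  · rintro y y' ⟨x, hx, e⟩ ⟨x', hx', e'⟩
    obtain ⟨z, hz⟩ := J.exists_left (y * y')
    obtain ⟨a, b, ha, hb, rfl⟩ := J.symm.exists_mul hz.symm
    refine ⟨_, L.mul_mem ((h ha.symm).2 ⟨x, hx, e⟩) ((h hb.symm).2 ⟨x', hx', e'⟩), hz⟩
  · rintro y ⟨x, hx, e⟩
    exact ⟨x⁻¹, L.inv_mem hx, J.inv e⟩

theorem Joint.restrict (J : Joint c d) {L : Subgroup G} {L' : Subgroup H}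
    (h : JS c d (L : Set G) (L' : Set H)) :
    Joint (fun u : L => c u) (fun u : L' => d u) where
  map_one := J.map_one
  one_iff {g h} e := by
    have := J.one_iff e
    simpa using this
  inv {g h} e := J.inv e
  exists_equiv {z z'} e := by
    obtain ⟨f, hf⟩ := J.exists_equiv e
    exact ⟨f.subtypeEquiv fun x => h (hf x).1, fun x => hf x⟩

/-- The colouring induced on a quotient. -/
def qcol (c : G → C) (L : Subgroup G) (q : G ⧸ L) : Set C := {k | ∃ g : G, (g : G ⧸ L) = q ∧ c g = k}

theorem mem_qcol {L : Subgroup G} {g : G} {k : C} :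
    k ∈ qcol c L (g : G ⧸ L) ↔ ∃ l ∈ L, c (g * l) = k := by
  constructor
  · rintro ⟨x, hx, rfl⟩
    exact ⟨g⁻¹ * x, QuotientGroup.eq.1 hx.symm, by rw [mul_inv_cancel_left]⟩
  · rintro ⟨l, hl, rfl⟩
    exact ⟨g * l, by simpa using hl, rfl⟩

theorem Joint.exists_mul_mem (J : Joint c d) {L : Subgroup G} {L' : Subgroup H}
    (hL : JS c d (L : Set G) (L' : Set H)) {g : G} {h : H} (e : c g = d h) {l : G} (hl : l ∈ L) :
    ∃ l' ∈ L', c (g * l) = d (h * l') := by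
  have e' : c (g * l * l⁻¹) = d h := by rwa [mul_inv_cancel_right]
  obtain ⟨x, y, hx, hy, rfl⟩ := J.exists_mul e'
  refine ⟨y⁻¹, L'.inv_mem ((hL hy).1 (L.inv_mem hl)), ?_⟩
  rw [hx, mul_inv_cancel_right]

theorem Joint.qcol_eq (J : Joint c d) {L : Subgroup G} {L' : Subgroup H}
    (hL : JS c d (L : Set G) (L' : Set H)) {g : G} {h : H} (e : c g = d h) :
    qcol c L (g : G ⧸ L) = qcol d L' (h : H ⧸ L') := by
  ext k
  rw [mem_qcol, mem_qcol]
  constructor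
  · rintro ⟨l, hl, rfl⟩
    obtain ⟨l', hl', h'⟩ := J.exists_mul_mem hL e hl
    exact ⟨l', hl', h'.symm⟩
  · rintro ⟨l, hl, rfl⟩
    obtain ⟨l', hl', h'⟩ := J.symm.exists_mul_mem hL.symm e.symm hl
    exact ⟨l', hl', h'.symm⟩

theorem exists_mul_of_qcol_eq {L : Subgroup G} {L' : Subgroup H} {g : G} {h : H}
    (e : qcol c L (g : G ⧸ L) = qcol d L' (h : H ⧸ L')) : ∃ l' ∈ L', c g = d (h * l') := by
  have : c g ∈ qcol c L (g : G ⧸ L) := ⟨g, rfl, rfl⟩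
  rw [e, mem_qcol] at this
  obtain ⟨l, hl, h'⟩ := this
  exact ⟨l, hl, h'.symm⟩

theorem card_quotient_fiber (L : Subgroup G) (P : G ⧸ L → Prop) :
    Nat.card {g : G // P g} = Nat.card L * Nat.card {q // P q} := by
  rw [mul_comm, ← Nat.card_prod]
  have e := (Subgroup.groupEquivQuotientProdSubgroup (s := L))
  refine Nat.card_congr ?_
  let e1 : {g : G // P g} ≃ {q : (G ⧸ L) × L // P q.1} :=
    (Subgroup.groupEquivQuotientProdSubgroup (s := L)).subtypeEquiv (fun g => Iff.rfl)
  exact e1.trans (Equiv.prodSubtypeFstEquivSubtypeProd (p := P))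

theorem Joint.quotient [Finite G] [Finite H] (J : Joint c d) {L : Subgroup G} {L' : Subgroup H}
    (hL : JS c d (L : Set G) (L' : Set H)) : Joint (qcol c L) (qcol d L') where
  map_one := J.qcol_eq hL J.map_one
  one_iff {q q'} e := by
    induction q using QuotientGroup.induction_on with | _ g
    induction q' using QuotientGroup.induction_on with | _ h
    obtain ⟨l, hl, h'⟩ := exists_mul_of_qcol_eq e
    rw [QuotientGroup.eq_one_iff, QuotientGroup.eq_one_iff]
    have := hL h'
    simpa [L'.mul_mem_cancel_right hl] using this
  inv {q q'} e := by
    induction q using QuotientGroup.induction_on with | _ g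
    induction q' using QuotientGroup.induction_on with | _ h
    obtain ⟨l, hl, h'⟩ := exists_mul_of_qcol_eq e
    have h2 := J.qcol_eq hL (J.inv h')
    have h3 : ((h * l)⁻¹ : H) = ((h : H ⧸ L')⁻¹ : H ⧸ L') := by
      rw [← QuotientGroup.mk_inv, QuotientGroup.eq]; simpa using hl
    rw [h3] at h2
    exact h2
  exists_equiv {q q'} e := by
    induction q using QuotientGroup.induction_on with | _ z
    induction q' using QuotientGroup.induction_on with | _ z'
    obtain ⟨l, hl, h'⟩ := exists_mul_of_qcol_eq e
    have hz : ((z' * l : H) : H ⧸ L') = z' := by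
      rw [QuotientGroup.eq]; simpa using hl
    have key : ∀ k : Set C × Set C,
        Nat.card {q // (qcol c L q, qcol c L (q⁻¹ * (z : G ⧸ L))) = k} =
        Nat.card {q // (qcol d L' q, qcol d L' (q⁻¹ * (z' : H ⧸ L'))) = k} := by
      intro k
      have h1 := J.card_conv_eq h'
        (Φ := fun x y => (qcol c L (x : G ⧸ L), qcol c L (y : G ⧸ L)) = k)
        (Ψ := fun x y => (qcol d L' (x : H ⧸ L'), qcol d L' (y : H ⧸ L')) = k)
        (fun x y x' y' hx hy => by rw [J.qcol_eq hL hx, J.qcol_eq hL hy])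
      have h2 := card_quotient_fiber L
        (fun q => (qcol c L q, qcol c L (q⁻¹ * (z : G ⧸ L))) = k)
      have h3 := card_quotient_fiber L'
        (fun q => (qcol d L' q, qcol d L' (q⁻¹ * (z' : H ⧸ L'))) = k)
      have h4 : Nat.card L = Nat.card L' := J.card_set_eq hL
      rw [← hz] at h3 ⊢
      have h5 : Nat.card L * _ = Nat.card L * _ := h2.symm.trans (h1.trans (h3.trans (by rw [← h4])))
      exact Nat.eq_of_mul_eq_mul_left Nat.card_pos h5
    obtain ⟨f, hf⟩ := exists_equiv_of_card_fiber _ _ key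
    exact ⟨f, fun x => ⟨(Prod.ext_iff.1 (hf x)).1, (Prod.ext_iff.1 (hf x)).2⟩⟩

end Subgroup

variable {G H C : Type} [CommGroup G] [CommGroup H] {c : G → C} {d : H → C}

theorem JI.mul_const {f : G → H} (hf : JI c d f) (k : H) : JI c d (fun g => f g * k) := by
  intro g h
  rw [hf g h]
  congr 1
  group

theorem JI.comp_mul {f : G → H} (hf : JI c d f) (t : G) : JI c d (fun g => f (t * g)) := by
  intro g h
  rw [← hf (t * g) (t * h)]
  congr 1
  rw [mul_inv_rev, mul_comm g⁻¹, ← mul_assoc, mul_right_comm, mul_assoc t, mul_comm t,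
    mul_inv_cancel_right]

theorem JI.exists_map_one {f : G → H} (hf : JI c d f) : ∃ f : G → H, JI c d f ∧ f 1 = 1 :=
  ⟨fun g => f g * (f 1)⁻¹, hf.mul_const _, mul_inv_cancel _⟩

theorem Sep.exists {n : ℕ} (hn : Sep n) [Finite G] [Finite H] (J : Joint c d)
    (hG : Nat.card G = n) : ∃ f : G → H, JI c d f ∧ f 1 = 1 := by
  obtain ⟨f, hf⟩ := hn G H C c d hG J
  exact hf.exists_map_one

theorem Joint.radical_right (J : Joint c d) {L U : Subgroup G} {L' U' : Subgroup H}
    (hL : JS c d (L : Set G) (L' : Set H)) (hU : JS c d (U : Set G) (U' : Set H))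
    (hr : ∀ x ∉ U, ∀ l ∈ L, c (x * l) = c x) : ∀ y ∉ U', ∀ l ∈ L', d (y * l) = d y := by
  intro y hy l hl
  obtain ⟨x, hx⟩ := J.exists_left y
  obtain ⟨k, hk, e⟩ := J.symm.exists_mul_mem hL.symm hx.symm hl
  rw [e, hr x (fun h => hy ((hU hx).1 h)) k hk, hx]

/-- Induced bijections of a generalized wedge product. -/
theorem Joint.exists_ji_of_wedge (J : Joint c d) {L U : Subgroup G} {L' U' : Subgroup H}
    (hL : JS c d (L : Set G) (L' : Set H)) (hU : JS c d (U : Set G) (U' : Set H))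
    (hr : ∀ x ∉ U, ∀ l ∈ L, c (x * l) = c x)
    (f₂ : G ⧸ L → H ⧸ L') (h₂ : JI (qcol c L) (qcol d L') f₂)
    (h₁ : ∀ t : G, ∃ f₁ : U → U', JI (fun u : U => c u) (fun u : U' => d u) f₁ ∧
      ∀ u : U, (((f₁ u : U') : H) : H ⧸ L') = (f₂ (t : G ⧸ L))⁻¹ * f₂ ((t * u : G) : G ⧸ L)) :
    ∃ f : G → H, JI c d f ∧ ∀ g, (f g : H ⧸ L') = f₂ (g : G ⧸ L) := by
  choose f₁ hf₁ hq using h₁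
  choose r hrr using fun t : G => QuotientGroup.mk_surjective (f₂ (t : G ⧸ L))
  let t : G → G := fun g => (Quotient.out (g : G ⧸ U))
  have ht : ∀ g, (t g)⁻¹ * g ∈ U := fun g => by
    rw [← QuotientGroup.eq]
    exact Quotient.out_eq _
  have htt : ∀ g h, h * g⁻¹ ∈ U → t g = t h := fun g h e => by
    have : (g : G ⧸ U) = h := by rw [QuotientGroup.eq, mul_comm]; exact e
    simp only [t, this]
  let f : G → H := fun g => r (t g) * (f₁ (t g) ⟨_, ht g⟩ : H)
  have hfq : ∀ g, (f g : H ⧸ L') = f₂ (g : G ⧸ L) := fun g => by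
    simp only [f, QuotientGroup.mk_mul, hq, hrr]
    simp
  have hr' := J.radical_right hL hU hr
  refine ⟨f, fun g h => ?_, hfq⟩
  by_cases hgh : h * g⁻¹ ∈ U
  · have e := htt g h hgh
    have := hf₁ (t h) ⟨_, e ▸ ht g⟩ ⟨_, ht h⟩
    simp only at this
    simp only [f]
    have e2 : ∀ (s : G) (hs : s⁻¹ * g ∈ U) (s₁ : G) (hs₁ : s₁⁻¹ * g ∈ U), s = s₁ →
        r s * (f₁ s ⟨_, hs⟩ : H) = r s₁ * (f₁ s₁ ⟨_, hs₁⟩ : H) := by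
      rintro s hs s₁ hs₁ rfl; rfl
    rw [e2 _ _ (t h) (e ▸ ht g) e]
    have e3 : ∀ a b k : H, k * a * (k * b)⁻¹ = a * b⁻¹ := fun a b k => by
      apply Additive.ofMul.injective; simp only [ofMul_mul, ofMul_inv]; abel
    have e4 : h * g⁻¹ = (t h)⁻¹ * h * ((t h)⁻¹ * g)⁻¹ := by
      apply Additive.ofMul.injective; simp only [ofMul_mul, ofMul_inv]; abel
    rw [e3, e4]
    exact this
  · have e := h₂ (g : G ⧸ L) (h : G ⧸ L)
    rw [← hfq, ← hfq] at e
    have e' : qcol c L ((h * g⁻¹ : G) : G ⧸ L) = qcol d L' ((f h * (f g)⁻¹ : H) : H ⧸ L') := e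
    obtain ⟨l, hl, hh⟩ := exists_mul_of_qcol_eq e'
    rw [hh]
    have h3 := fun hy => hr' (f h * (f g)⁻¹) hy l hl
    refine h3 fun hmem => ?_
    have h4 := h3
    by_cases hlU : l ∈ U'
    · exact hgh ((hU hh).2 (U'.mul_mem hmem hlU))
    · have h5 := hr' l hlU l⁻¹ (L'.inv_mem hl)
      rw [mul_inv_cancel] at h5
      exact hlU (((J.right.one_iff h5).1 rfl).symm ▸ U'.one_mem)

theorem coe_eq_one_of_mem {L : Subgroup G} {g : G} (h : g ∈ L) : (g : G ⧸ L) = 1 :=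
  (QuotientGroup.eq_one_iff g).2 h

/-- Induced bijections of a wreath product. -/
theorem Joint.exists_ji_of_wreath (J : Joint c d) {U : Subgroup G} {U' : Subgroup H}
    (hU : JS c d (U : Set G) (U' : Set H)) (hr : ∀ x ∉ U, ∀ l ∈ U, c (x * l) = c x)
    (h₁ : ∃ f : U → U', JI (fun u : U => c u) (fun u : U' => d u) f)
    (f₂ : G ⧸ U → H ⧸ U') (h₂ : JI (qcol c U) (qcol d U') f₂) :
    ∃ f : G → H, JI c d f ∧ ∀ g, (f g : H ⧸ U') = f₂ (g : G ⧸ U) := by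
  obtain ⟨f₁, h₁⟩ := h₁
  refine J.exists_ji_of_wedge hU hU hr f₂ h₂ fun t => ⟨f₁, h₁, fun u => ?_⟩
  rw [coe_eq_one_of_mem (f₁ u).2, QuotientGroup.mk_mul, coe_eq_one_of_mem u.2, mul_one,
    inv_mul_cancel]

section Frobenius

theorem Joint.frobenius [Fintype G] [Fintype H] [DecidableEq G] [DecidableEq H]
    (J : Joint c d) (q : ℕ) [Fact q.Prime]
    {a : G → ZMod q} {b : H → ZMod q} (hab : ∀ ⦃g h⦄, c g = d h → a g = b h) ⦃z : G⦄ ⦃z' : H⦄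
    (hz : c z = d z') :
    ∑ x, (if x ^ q = z then a x else 0) = ∑ y, (if y ^ q = z' then b y else 0) := by
  have key : ∀ {K : Type} [CommGroup K] [Fintype K] [DecidableEq K] (u : K → ZMod q) (z : K),
      ((∑ x, MonoidAlgebra.single x (u x) : MonoidAlgebra (ZMod q) K) ^ q).coeff z =
        ∑ x, (if x ^ q = z then u x else 0) := by
    intro K _ _ _ u z
    have : CharP (MonoidAlgebra (ZMod q) K) q :=
      charP_of_injective_algebraMap (FaithfulSMul.algebraMap_injective (ZMod q) _) q
    rw [sum_pow_char]
    simp only [MonoidAlgebra.single_pow, ZMod.pow_card, MonoidAlgebra.coeff_sum,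
      Finsupp.finsetSum_apply, MonoidAlgebra.coeff_single, Finsupp.single_apply]
  have coef : ∀ {K : Type} [CommGroup K] [Fintype K] [DecidableEq K] (u : K → ZMod q) (z : K),
      (∑ x, MonoidAlgebra.single x (u x) : MonoidAlgebra (ZMod q) K).coeff z = u z := by
    intro K _ _ _ u z
    simp [MonoidAlgebra.coeff_sum, Finsupp.single_apply]
  have hpow : ∀ (n : ℕ) (z : G) (z' : H), c z = d z' →
      ((∑ x, MonoidAlgebra.single x (a x) : MonoidAlgebra (ZMod q) G) ^ n).coeff z =
      ((∑ x, MonoidAlgebra.single x (b x) : MonoidAlgebra (ZMod q) H) ^ n).coeff z' := by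
    intro n
    induction n with
    | zero =>
      intro z z' h
      simp [MonoidAlgebra.one_def, Finsupp.single_apply, eq_comm (a := (1 : G)),
        eq_comm (a := (1 : H)), J.one_iff h]
    | succ n ih =>
      intro z z' h
      rw [pow_succ', pow_succ', MonoidAlgebra.coeff_mul_apply_left,
        MonoidAlgebra.coeff_mul_apply_left,
        Finsupp.sum_fintype _ _ (by simp), Finsupp.sum_fintype _ _ (by simp)]
      exact J.sum_eq h
        (Φ := fun x y => (∑ x, MonoidAlgebra.single x (a x) : MonoidAlgebra (ZMod q) G).coeff x *
          ((∑ x, MonoidAlgebra.single x (a x) : MonoidAlgebra (ZMod q) G) ^ n).coeff y)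
        (Ψ := fun x y => (∑ x, MonoidAlgebra.single x (b x) : MonoidAlgebra (ZMod q) H).coeff x *
          ((∑ x, MonoidAlgebra.single x (b x) : MonoidAlgebra (ZMod q) H) ^ n).coeff y)
        fun x y x' y' hx hy => by rw [coef, coef, hab hx, ih _ _ hy]
  rw [← key, ← key, hpow q z z' hz]

theorem Joint.pow_prime [Finite G] [Finite H] (J : Joint c d) {q : ℕ} (hq : q.Prime)
    (hqG : (Nat.card G).Coprime q) {g : G} {h : H} (e : c g = d h) : c (g ^ q) = d (h ^ q) := by
  classical
  have := Fact.mk hq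
  have := Fintype.ofFinite G
  have := Fintype.ofFinite H
  have hqH : (Nat.card H).Coprime q := J.card_eq ▸ hqG
  let σ : Equiv.Perm G := powCoprime hqG
  let τ : Equiv.Perm H := powCoprime hqH
  have hσ : ∀ x, σ x = x ^ q := fun x => rfl
  have hτ : ∀ x, τ x = x ^ q := fun x => rfl
  have step : ∀ (a : G → ZMod q) (b : H → ZMod q), (∀ ⦃g h⦄, c g = d h → a g = b h) →
      ∀ ⦃g h⦄, c g = d h → a (σ⁻¹ g) = b (τ⁻¹ h) := by
    intro a b hab g h e
    have := J.frobenius q hab e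
    simp only [← hσ, ← hτ, ← Equiv.Perm.eq_inv_iff_eq] at this
    simpa using this
  have iter : ∀ (n : ℕ) (a : G → ZMod q) (b : H → ZMod q), (∀ ⦃g h⦄, c g = d h → a g = b h) →
      ∀ ⦃g h⦄, c g = d h → a ((σ⁻¹ ^ n) g) = b ((τ⁻¹ ^ n) h) := by
    intro n
    induction n with
    | zero => intro a b hab; simpa using hab
    | succ n ih =>
      intro a b hab g h e
      have := ih _ _ (step a b hab) e
      rwa [pow_succ', pow_succ']
  have hN : 0 < Nat.card (Equiv.Perm G) * Nat.card (Equiv.Perm H) :=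
    Nat.mul_pos Nat.card_pos Nat.card_pos
  obtain ⟨n, hn⟩ : ∃ n, Nat.card (Equiv.Perm G) * Nat.card (Equiv.Perm H) = n + 1 :=
    ⟨_, (Nat.succ_pred_eq_of_pos hN).symm⟩
  have hσn : σ⁻¹ ^ n = σ := by
    have : σ⁻¹ ^ (n + 1) = 1 := by rw [← hn, pow_mul, pow_card_eq_one', one_pow]
    rw [pow_succ] at this
    simpa using mul_eq_one_iff_eq_inv.1 this
  have hτn : τ⁻¹ ^ n = τ := by
    have : τ⁻¹ ^ (n + 1) = 1 := by rw [← hn, pow_mul', pow_card_eq_one', one_pow]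
    rw [pow_succ] at this
    simpa using mul_eq_one_iff_eq_inv.1 this
  have := iter n (fun x => if c x = c (g ^ q) then 1 else 0)
    (fun x => if d x = c (g ^ q) then 1 else 0) (fun g h e => by simp only [e]) e
  rw [hσn, hτn, hσ, hτ] at this
  by_contra hne
  simp [Ne.symm hne] at this

/-- Multipliers coprime to the order preserve equality of colours. -/
theorem Joint.pow [Finite G] [Finite H] (J : Joint c d) {m : ℕ}
    (hm : (Nat.card G).Coprime m) {g : G} {h : H} (e : c g = d h) : c (g ^ m) = d (h ^ m) := by
  induction m using induction_on_primes generalizing g h with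
  | zero => simpa using J.map_one
  | one => simpa using e
  | prime_mul q m hq ih =>
    rw [pow_mul, pow_mul]
    exact ih (Nat.Coprime.coprime_mul_left_right hm)
      (J.pow_prime hq (Nat.Coprime.coprime_mul_right_right hm) e)

end Frobenius

variable {G H C : Type} [CommGroup G] [CommGroup H] {c : G → C} {d : H → C}

theorem Joint.thin_right (J : Joint c d) {x : G} {y : H} (hxy : c x = d y)
    (hx : ∀ g, c g = c x → g = x) : ∀ h, d h = d y → h = y := by
  intro h e
  obtain ⟨f, hf⟩ := J.exists_equiv J.map_one
  have h1 := hx (f.symm h) (by rw [(hf _).1, f.apply_symm_apply, e, hxy])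
  have h2 := hx (f.symm y) (by rw [(hf _).1, f.apply_symm_apply, hxy])
  exact f.symm.injective (h1.trans h2.symm)

/-- Translation by singleton classes. -/
theorem Joint.mul_thin (J : Joint c d) {x : G} {y : H} (hxy : c x = d y)
    (hx : ∀ g, c g = c x → g = x) {w : G} {v : H} (h : c w = d v) : c (w * x) = d (v * y) := by
  have e : c (w * x * x⁻¹) = d v := by rwa [mul_inv_cancel_right]
  obtain ⟨a, b, ha, hb, rfl⟩ := J.exists_mul e
  have hb' : b⁻¹ = y := by
    refine J.thin_right hxy hx _ ?_
    have := J.inv hb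
    rw [inv_inv] at this
    rw [← this, hxy]
  rw [ha, ← hb', mul_inv_cancel_right]

theorem mem_or_of_index_three {U : Subgroup G} (hi : U.index = 3) {x : G} (hx : x ∉ U) (g : G) :
    g ∈ U ∨ g * x⁻¹ ∈ U ∨ g * x ∈ U := by
  have hcard : Nat.card (G ⧸ U) = 3 := hi
  have : Fact (Nat.Prime 3) := ⟨Nat.prime_three⟩
  have hne : (x : G ⧸ U) ≠ 1 := fun h => hx ((QuotientGroup.eq_one_iff x).1 h)
  have hmem := mem_powers_of_prime_card hcard hne (g' := (g : G ⧸ U))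
  obtain ⟨n, hn⟩ := hmem
  have hx3 : (x : G ⧸ U) ^ 3 = 1 := by rw [← hcard]; exact pow_card_eq_one'
  simp only at hn
  rw [← Nat.div_add_mod n 3, pow_add, pow_mul, hx3, one_pow, one_mul] at hn
  have hlt := Nat.mod_lt n (show 0 < 3 by norm_num)
  simp only [← QuotientGroup.eq_one_iff, QuotientGroup.mk_mul, QuotientGroup.mk_inv, ← hn]
  interval_cases n % 3
  · left; simp
  · right; left; simp
  · right; right; rw [← pow_succ, hx3]

theorem pow_three_mem {U : Subgroup G} (hi : U.index = 3) (x : G) : x ^ 3 ∈ U := by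
  have hcard : Nat.card (G ⧸ U) = 3 := hi
  rw [← QuotientGroup.eq_one_iff, QuotientGroup.mk_pow, ← hcard]
  exact pow_card_eq_one'

theorem mul_self_notMem {U : Subgroup G} (hi : U.index = 3) {x : G} (hx : x ∉ U) : x * x ∉ U := by
  intro h
  have h3 := pow_three_mem hi x
  rw [pow_succ, pow_two] at h3
  exact hx ((U.mul_mem_cancel_left h).1 h3)

theorem Joint.index_eq [Finite G] [Finite H] (J : Joint c d) {U : Subgroup G} {U' : Subgroup H}
    (hU : JS c d (U : Set G) (U' : Set H)) : U.index = U'.index := by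
  have h1 := U.card_mul_index
  have h2 := U'.card_mul_index
  have h3 : Nat.card U = Nat.card U' := J.card_set_eq hU
  rw [J.card_eq, ← h2, h3] at h1
  exact Nat.eq_of_mul_eq_mul_left Nat.card_pos h1

theorem Joint.pair_right (J : Joint c d) {x : G} {x' : H} (hx' : x' ≠ x'⁻¹) (hxx' : c x = d x')
    (hcx : ∀ g, c g = c x → g = x ∨ g = x⁻¹) : ∀ h, d h = d x' → h = x' ∨ h = x'⁻¹ := by
  intro h e
  obtain ⟨f, hf⟩ := J.exists_equiv J.map_one
  have hs : ∀ k, c (f.symm k) = d k := fun k => by rw [(hf _).1, f.apply_symm_apply]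
  have h1 := hcx (f.symm h) (by rw [hs, e, hxx'])
  have h2 := hcx (f.symm x') (by rw [hs, hxx'])
  by_contra hne
  push Not at hne
  have n1 : f.symm h ≠ f.symm x' := fun t => hne.1 (f.symm.injective t)
  have n2 : f.symm h ≠ f.symm x'⁻¹ := fun t => hne.2 (f.symm.injective t)
  have n3 : f.symm x' ≠ f.symm x'⁻¹ := fun t => hx' (f.symm.injective t)
  have key : c x⁻¹ = c x := by
    rcases h1 with h1 | h1
    · rcases h2 with h2 | h2
      · exact absurd (h1.trans h2.symm) n1
      · rw [← h2, hs, hxx']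
    · rw [← h1, hs, e, hxx']
  have h3 := hcx (f.symm x'⁻¹) (by rw [hs, ← J.inv hxx', key])
  grind

/-- Both elements of a coset pair `{z * x, z * x⁻¹}` are matched, possibly after a swap. -/
theorem Joint.pair_mul (J : Joint c d) {x : G} {x' : H} (hx : x ≠ x⁻¹) (hx' : x' ≠ x'⁻¹)
    (hxx' : c x = d x')
    (hcx : ∀ g, c g = c x → g = x ∨ g = x⁻¹) {z : G} {z' : H} (h : c z = d z') :
    (c (z * x) = d (z' * x') ∧ c (z * x⁻¹) = d (z' * x'⁻¹)) ∨
    (c (z * x) = d (z' * x'⁻¹) ∧ c (z * x⁻¹) = d (z' * x')) := by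
  have hcx' := J.pair_right hx' hxx' hcx
  obtain ⟨f, hf⟩ := J.exists_equiv h
  have h1 := hf (z * x)
  have h2 := hf (z * x⁻¹)
  have e1 : (z * x)⁻¹ * z = x⁻¹ := by rw [mul_inv, mul_right_comm, inv_mul_cancel, one_mul]
  have e2 : (z * x⁻¹)⁻¹ * z = x := by
    rw [mul_inv, inv_inv, mul_right_comm, inv_mul_cancel, one_mul]
  rw [e1] at h1
  rw [e2] at h2
  have k1 := hcx' _ (by rw [← J.inv h1.2, inv_inv, hxx'])
  have k2 := hcx' _ (h2.2.symm.trans hxx')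
  have hne : f (z * x) ≠ f (z * x⁻¹) := fun t => hx (mul_left_cancel (f.injective t))
  rw [mul_inv_rev, inv_inv, inv_mul_eq_iff_eq_mul, inv_mul_eq_iff_eq_mul] at k1
  rw [inv_mul_eq_iff_eq_mul, inv_mul_eq_iff_eq_mul] at k2
  have k2' : f (z * x⁻¹) = z' * x'⁻¹ ∨ f (z * x⁻¹) = z' * x' := by
    rcases k2 with k | k
    · left; rw [k, mul_inv_cancel_right]
    · right; rw [k, inv_mul_cancel_right]
  rcases k1 with k1 | k1 <;> rcases k2' with k2 | k2
  · left; rw [← k1, ← k2]; exact ⟨h1.1, h2.1⟩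
  · exact absurd (k1.trans k2.symm) hne
  · exact absurd (k1.trans k2.symm) hne
  · right; rw [← k1, ← k2]; exact ⟨h1.1, h2.1⟩

section IndexThree

variable {U : Subgroup G} {U' : Subgroup H} {x : G} {x' : H}

theorem ne_inv_of_index_three (hi : U.index = 3) (hx : x ∉ U) : x ≠ x⁻¹ := fun h =>
  mul_self_notMem hi hx (by rw [mul_eq_one_iff_eq_inv.2 h]; exact U.one_mem)

theorem Joint.translate_base (J : Joint c d) (hU : JS c d (U : Set G) (U' : Set H))
    (hi' : U'.index = 3) (hx' : x' ∉ U') (hxx' : c x = d x')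
    (hcx : ∀ g, c g = c x → g = x ∨ g = x⁻¹) {u : G} {u' : H} (hu : u ∈ U) (hu' : u' ∈ U')
    (h : c (u * x) = d (u' * x')) : c u = d u' := by
  have hcx' := J.pair_right (ne_inv_of_index_three hi' hx') hxx' hcx
  obtain ⟨a, b, ha, hb, e⟩ := J.exists_mul h
  have haU : a ∈ U' := (hU ha).1 hu
  rcases hcx' b (hb.symm.trans hxx') with rfl | rfl
  · rw [mul_right_cancel e] at ha
    exact ha
  · exfalso
    have : x' * x' = u'⁻¹ * a := by
      rw [eq_inv_mul_iff_mul_eq, ← mul_assoc, ← e, inv_mul_cancel_right]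
    exact mul_self_notMem hi' hx' (this ▸ U'.mul_mem (U'.inv_mem hu') haU)

theorem Joint.translate_inv (J : Joint c d) (hU : JS c d (U : Set G) (U' : Set H))
    (hi : U.index = 3) (hi' : U'.index = 3) (hx : x ∉ U) (hx' : x' ∉ U') (hxx' : c x = d x')
    (hcx : ∀ g, c g = c x → g = x ∨ g = x⁻¹) {u : G} {u' : H} (hu : u ∈ U) (hu' : u' ∈ U')
    (h : c (u * x) = d (u' * x')) : c (u * x⁻¹) = d (u' * x'⁻¹) := by
  have h1 := J.translate_base hU hi' hx' hxx' hcx hu hu' h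
  rcases J.pair_mul (ne_inv_of_index_three hi hx) (ne_inv_of_index_three hi' hx') hxx' hcx h1
    with h2 | h2
  · exact h2.2
  · rw [h2.2, ← h, h2.1]

theorem sum_count [Fintype G] [DecidableEq C] [DecidablePred (· ∈ U)] (i j : C)
    (hi : U.index = 3) (hx : x ∉ U) {z : G} (hz : z ∈ U) :
    2 * (∑ w, if w ∈ U ∧ c (w * x) = i ∧ c (w⁻¹ * (z * x)) = j then 1 else 0) +
      (∑ y, (if y ∉ U ∧ c y = i ∧ c (y⁻¹ * z) = j then 1 else 0)) =
    (∑ y, (if c y = i ∧ y⁻¹ * (z * x) ∈ U then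
      ((if c (y⁻¹ * (z * x) * x) = j then 1 else 0) +
        (if c (y⁻¹ * (z * x) * x⁻¹) = j then 1 else 0)) else 0)) +
    (∑ y, (if y ∈ U ∧ c (y⁻¹ * (z * x)) = j then
      ((if c (y * x) = i then 1 else 0) + (if c (y * x⁻¹) = i then 1 else 0)) else 0)) := by
  have hxx := mul_self_notMem hi hx
  have s1 : (∑ y, (if y ∉ U ∧ c y = i ∧ c (y⁻¹ * z) = j then 1 else 0)) =
      (∑ w, if w ∈ U ∧ c (w * x) = i ∧ c (w⁻¹ * (z * x⁻¹)) = j then 1 else 0) +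
      (∑ w, if w ∈ U ∧ c (w * x⁻¹) = i ∧ c (w⁻¹ * (z * x)) = j then 1 else 0) := by
    rw [← Equiv.sum_comp (Equiv.mulRight x⁻¹) (fun w => if w ∈ U ∧ c (w * x) = i ∧
      c (w⁻¹ * (z * x⁻¹)) = j then 1 else 0), ← Equiv.sum_comp (Equiv.mulRight x)
      (fun w => if w ∈ U ∧ c (w * x⁻¹) = i ∧ c (w⁻¹ * (z * x)) = j then 1 else 0),
      ← Finset.sum_add_distrib]
    refine Finset.sum_congr rfl fun y _ => ?_
    simp only [Equiv.coe_mulRight, inv_mul_cancel_right, mul_inv_cancel_right, mul_inv_rev, inv_inv]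
    have e1 : x * y⁻¹ * (z * x⁻¹) = y⁻¹ * z := by
      apply Additive.ofMul.injective; simp only [ofMul_mul, ofMul_inv]; abel
    have e2 : x⁻¹ * y⁻¹ * (z * x) = y⁻¹ * z := by
      apply Additive.ofMul.injective; simp only [ofMul_mul, ofMul_inv]; abel
    rw [e1, e2]
    have m := mem_or_of_index_three hi hx y
    have m1 : y * x⁻¹ ∈ U → y ∉ U := fun h h' =>
      hx (by simpa using (U.mul_mem_cancel_left h').1 h)
    have m2 : y * x ∈ U → y ∉ U := fun h h' => hx ((U.mul_mem_cancel_left h').1 h)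
    have m3 : y * x ∈ U → y * x⁻¹ ∉ U := fun h h' => hxx (by
      have := U.mul_mem h (U.inv_mem h')
      rwa [show y * x * (y * x⁻¹)⁻¹ = x * x by
        apply Additive.ofMul.injective; simp only [ofMul_mul, ofMul_inv]; abel] at this)
    by_cases h0 : y ∈ U <;> by_cases h1 : y * x⁻¹ ∈ U <;> by_cases h2 : y * x ∈ U <;> simp_all
  have s2 : (∑ y, (if c y = i ∧ y⁻¹ * (z * x) ∈ U then
      ((if c (y⁻¹ * (z * x) * x) = j then 1 else 0) +
        (if c (y⁻¹ * (z * x) * x⁻¹) = j then 1 else 0)) else 0)) =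
      (∑ w, if w ∈ U ∧ c (w * x) = i ∧ c (w⁻¹ * (z * x)) = j then 1 else 0) +
      (∑ w, if w ∈ U ∧ c (w * x) = i ∧ c (w⁻¹ * (z * x⁻¹)) = j then 1 else 0) := by
    rw [← Equiv.sum_comp (Equiv.mulRight x), ← Finset.sum_add_distrib]
    refine Finset.sum_congr rfl fun y _ => ?_
    have e1 : (y * x)⁻¹ * (z * x) = y⁻¹ * z := by
      apply Additive.ofMul.injective; simp only [ofMul_mul, ofMul_inv]; abel
    have e2 : y⁻¹ * z ∈ U ↔ y ∈ U := by rw [U.mul_mem_cancel_right hz, U.inv_mem_iff]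
    simp only [Equiv.coe_mulRight, e1, e2]
    rw [mul_assoc, mul_assoc]
    by_cases h0 : y ∈ U <;> by_cases h1 : c (y * x) = i <;> simp [h0, h1]
  have s3 : (∑ y, (if y ∈ U ∧ c (y⁻¹ * (z * x)) = j then
      ((if c (y * x) = i then 1 else 0) + (if c (y * x⁻¹) = i then 1 else 0)) else 0)) =
      (∑ w, if w ∈ U ∧ c (w * x) = i ∧ c (w⁻¹ * (z * x)) = j then 1 else 0) +
      (∑ w, if w ∈ U ∧ c (w * x⁻¹) = i ∧ c (w⁻¹ * (z * x)) = j then 1 else 0) := by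
    rw [← Finset.sum_add_distrib]
    refine Finset.sum_congr rfl fun y _ => ?_
    by_cases h0 : y ∈ U <;> by_cases h1 : c (y⁻¹ * (z * x)) = j <;> simp [h0, h1]
  rw [s1, s2, s3]
  ring

theorem Joint.translate [Finite G] [Finite H] (J : Joint c d)
    (hU : JS c d (U : Set G) (U' : Set H)) (hi : U.index = 3) (hx : x ∉ U) (hxx' : c x = d x')
    (hcx : ∀ g, c g = c x → g = x ∨ g = x⁻¹) :
    Joint (fun u : U => c (u * x)) (fun u : U' => d (u * x')) where
  map_one := by simpa using hxx'
  one_iff {u u'} h := by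
    have hi' : U'.index = 3 := (J.index_eq hU).symm.trans hi
    have hx' : x' ∉ U' := fun h => hx ((hU hxx').2 h)
    have := J.one_iff (J.translate_base hU hi' hx' hxx' hcx u.2 u'.2 h)
    simpa using this
  inv {u u'} h := by
    have hi' : U'.index = 3 := (J.index_eq hU).symm.trans hi
    have hx' : x' ∉ U' := fun h => hx ((hU hxx').2 h)
    have := J.inv (J.translate_inv hU hi hi' hx hx' hxx' hcx u.2 u'.2 h)
    simp only [mul_inv_rev, inv_inv, mul_comm x, mul_comm x'] at this
    exact this
  exists_equiv {z z'} h := by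
    classical
    have := Fintype.ofFinite G
    have := Fintype.ofFinite H
    have hi' : U'.index = 3 := (J.index_eq hU).symm.trans hi
    have hx' : x' ∉ U' := fun h => hx ((hU hxx').2 h)
    have hz := J.translate_base hU hi' hx' hxx' hcx z.2 z'.2 h
    have hpm : ∀ (j : C) {v : G} {v' : H}, c v = d v' →
        ((if c (v * x) = j then 1 else 0) + (if c (v * x⁻¹) = j then 1 else 0) : ℕ) =
        (if d (v' * x') = j then 1 else 0) + (if d (v' * x'⁻¹) = j then 1 else 0) := by
      intro j v v' hv
      rcases J.pair_mul (ne_inv_of_index_three hi hx) (ne_inv_of_index_three hi' hx') hxx' hcx hv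
        with h2 | h2
      · rw [h2.1, h2.2]
      · rw [h2.1, h2.2, add_comm]
    have hcount : ∀ i j, (∑ w, if w ∈ U ∧ c (w * x) = i ∧ c (w⁻¹ * (z * x)) = j then 1 else 0) =
        (∑ w, if w ∈ U' ∧ d (w * x') = i ∧ d (w⁻¹ * (z' * x')) = j then 1 else 0) := by
      intro i j
      have t1 := J.sum_eq hz
        (Φ := fun y v => if y ∉ U ∧ c y = i ∧ c v = j then 1 else 0)
        (Ψ := fun y v => if y ∉ U' ∧ d y = i ∧ d v = j then 1 else 0)
        (fun y v y' v' hy hv => by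
          have : y ∈ U ↔ y' ∈ U' := hU hy
          simp only [hy, hv, this])
      have t2 := J.sum_eq h
        (Φ := fun y v => if c y = i ∧ v ∈ U then
          ((if c (v * x) = j then 1 else 0) + (if c (v * x⁻¹) = j then 1 else 0)) else 0)
        (Ψ := fun y v => if d y = i ∧ v ∈ U' then
          ((if d (v * x') = j then 1 else 0) + (if d (v * x'⁻¹) = j then 1 else 0)) else 0)
        (fun y v y' v' hy hv => by
          have : v ∈ U ↔ v' ∈ U' := hU hv
          simp only [hy, hpm j hv, this])
      have t3 := J.sum_eq h
        (Φ := fun y v => if y ∈ U ∧ c v = j then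
          ((if c (y * x) = i then 1 else 0) + (if c (y * x⁻¹) = i then 1 else 0)) else 0)
        (Ψ := fun y v => if y ∈ U' ∧ d v = j then
          ((if d (y * x') = i then 1 else 0) + (if d (y * x'⁻¹) = i then 1 else 0)) else 0)
        (fun y v y' v' hy hv => by
          have : y ∈ U ↔ y' ∈ U' := hU hy
          simp only [hv, hpm i hy, this])
      have s := sum_count (c := c) i j hi hx z.2
      have s' := sum_count (c := d) i j hi' hx' z'.2
      rw [t1, t2, t3, ← s'] at s
      omega
    have key : ∀ k : C × C, Nat.card {w : U // (c (w * x), c ((w⁻¹ * z : U) * x)) = k} =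
        Nat.card {w : U' // (d (w * x'), d ((w⁻¹ * z' : U') * x')) = k} := by
      rintro ⟨i, j⟩
      have conv : ∀ {K : Type} [CommGroup K] [Fintype K] (V : Subgroup K) (k : K → C) (x : K)
          (z : V), Nat.card {w : V // (k (w * x), k ((w⁻¹ * z : V) * x)) = (i, j)} =
          ∑ w, if w ∈ V ∧ k (w * x) = i ∧ k (w⁻¹ * (z * x)) = j then 1 else 0 := by
        intro K _ _ V k x z
        rw [← Finset.card_filter, ← Fintype.card_subtype, ← Nat.card_eq_fintype_card]
        refine Nat.card_congr ((Equiv.subtypeSubtypeEquivSubtypeInter (fun w => w ∈ V)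
          (fun w => k (w * x) = i ∧ k (w⁻¹ * (z * x)) = j)).symm.trans
          (Equiv.subtypeEquivRight fun w => ?_)).symm
        simp [mul_assoc]
      rw [conv, conv, hcount]
    obtain ⟨f, hf⟩ := exists_equiv_of_card_fiber _ _ key
    exact ⟨f, fun x => ⟨(Prod.ext_iff.1 (hf x)).1, (Prod.ext_iff.1 (hf x)).2⟩⟩

theorem Joint.translate_zpow [Finite G] [Finite H] (J : Joint c d) (h2 : (Nat.card G).Coprime 2)
    (hU : JS c d (U : Set G) (U' : Set H)) (hi : U.index = 3) (hx : x ∉ U) (hxx' : c x = d x')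
    (hcx : ∀ g, c g = c x → g = x ∨ g = x⁻¹) {w : G} {w' : H} (hw : w ∈ U) (hw' : w' ∈ U')
    (h : c (w * x) = d (w' * x')) {k : ℤ} (hk : k = 0 ∨ k = 1 ∨ k = -1 ∨ k = 2 ∨ k = -2) :
    c (w * x ^ k) = d (w' * x' ^ k) := by
  have hi' : U'.index = 3 := (J.index_eq hU).symm.trans hi
  have hx' : x' ∉ U' := fun h => hx ((hU hxx').2 h)
  have K := J.translate hU hi hx hxx' hcx
  have h4 : (Nat.card G).Coprime (2 * 2) := Nat.Coprime.mul_right h2 h2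
  have hz : c (x ^ 3 * x) = d (x' ^ 3 * x') := by
    rw [← pow_succ, ← pow_succ]
    exact J.pow h4 hxx'
  have hthin : ∀ g : U, c (g * x) = c (x ^ 3 * x) → g = ⟨x ^ 3, pow_three_mem hi x⟩ := by
    intro g hg
    have hN : 1 < Nat.card G := by
      have := Finite.one_lt_card_iff_nontrivial.2
        (⟨x, 1, fun h => hx (h ▸ U.one_mem)⟩ : Nontrivial G)
      exact this
    obtain ⟨n, -, hn⟩ := Nat.exists_mul_mod_eq_one_of_coprime h4.symm hN
    have hn' : (Nat.card G).Coprime n := by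
      have h1 : (Nat.card G).Coprime (2 * 2 * n) := by
        rw [Nat.coprime_iff_gcd_eq_one, Nat.gcd_rec, hn, Nat.gcd_one_left]
      exact h1.coprime_mul_left_right
    have hpow : ∀ y : G, (y ^ n) ^ 4 = y := fun y => by
      rw [← pow_mul, mul_comm, ← pow_mod_natCard, hn, pow_one]
    have h1 := J.left.pow hn' hg
    rw [← pow_succ, ← pow_mul, mul_comm (3 + 1), pow_mul, hpow] at h1
    ext
    rcases hcx _ h1 with h | h
    · have := hpow (g * x)
      rw [h, pow_succ] at this
      exact (mul_right_cancel this).symm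
    · have := hpow (g * x)
      rw [h] at this
      have h5 : x ^ 5 = (g : G)⁻¹ := by
        rw [eq_inv_iff_mul_eq_one]
        calc x ^ 5 * g = x ^ 4 * (g * x) := by
              rw [pow_succ, mul_assoc, mul_comm x]
          _ = 1 := by rw [← this, inv_pow, mul_inv_cancel]
      have h5' : x ^ 5 ∈ U := h5 ▸ U.inv_mem g.2
      have : x * x ∈ U := by
        have := U.mul_mem h5' (U.inv_mem (pow_three_mem hi x))
        rwa [show x ^ 5 * (x ^ 3)⁻¹ = x * x by
          rw [show x ^ 5 = x * x * x ^ 3 by group, mul_inv_cancel_right]] at this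
      exact absurd this (mul_self_notMem hi hx)
  have key : ∀ {w : G} {w' : H}, w ∈ U → w' ∈ U' → c (w * x) = d (w' * x') →
      c (w * x ^ (2 : ℤ)) = d (w' * x' ^ (2 : ℤ)) := by
    intro w w' hw hw' h
    have t1 := K.mul_thin (x := ⟨x ^ 3, pow_three_mem hi x⟩) (y := ⟨x' ^ 3, pow_three_mem hi' x'⟩)
      hz hthin (w := ⟨w, hw⟩) (v := ⟨w', hw'⟩) h
    have t2 := J.translate_inv hU hi hi' hx hx' hxx' hcx
      (U.mul_mem hw (pow_three_mem hi x)) (U'.mul_mem hw' (pow_three_mem hi' x')) t1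
    have e : ∀ {K : Type} [CommGroup K] (w x : K), w * x ^ 3 * x⁻¹ = w * x ^ (2 : ℤ) := by
      intro K _ w x
      rw [mul_assoc]; congr 1; group
    rwa [e, e] at t2
  rcases hk with rfl | rfl | rfl | rfl | rfl
  · simpa using J.translate_base hU hi' hx' hxx' hcx hw hw' h
  · simpa using h
  · simpa using J.translate_inv hU hi hi' hx hx' hxx' hcx hw hw' h
  · exact key hw hw' h
  · have t := J.inv (key (U.inv_mem hw) (U'.inv_mem hw')
      (K.inv (g := ⟨w, hw⟩) (h := ⟨w', hw'⟩) h))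
    simpa [mul_inv_rev, mul_comm] using t

/-- An `A`-subgroup of index three together with a class `{x}` or `{x, x⁻¹}` outside of it. -/
theorem Joint.exists_ji_of_small_class [Finite G] [Finite H] (J : Joint c d)
    (h2 : (Nat.card G).Coprime 2)
    (hU : JS c d (U : Set G) (U' : Set H)) (hi : U.index = 3) (hx : x ∉ U) (hxx' : c x = d x')
    (hcx : ∀ g, c g = c x → g = x ∨ g = x⁻¹) (hsep : Sep (Nat.card U)) :
    ∃ f : G → H, JI c d f ∧ f 1 = 1 ∧ (∀ g ∈ U, f g ∈ U') ∧
      (∀ g, g * x⁻¹ ∈ U → f g * x'⁻¹ ∈ U') ∧ ∀ g, g * x ∈ U → f g * x' ∈ U' := by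
  have K := J.translate hU hi hx hxx' hcx
  obtain ⟨fU, hfU, hf1⟩ := hsep.exists K rfl
  have hex : ∀ g, ∃ n : ℤ, (n = 0 ∨ n = 1 ∨ n = -1) ∧ g * x ^ (-n) ∈ U := by
    intro g
    rcases mem_or_of_index_three hi hx g with h | h | h
    · exact ⟨0, by simp, by simpa using h⟩
    · exact ⟨1, by simp, by simpa using h⟩
    · exact ⟨-1, by simp, by simpa using h⟩
  choose n hn hnU using hex
  have huniq : ∀ g (m : ℤ), (m = 0 ∨ m = 1 ∨ m = -1) → g * x ^ (-m) ∈ U → n g = m := by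
    intro g m hm hmU
    have hmem : x ^ (n g - m) ∈ U := by
      have := U.mul_mem hmU (U.inv_mem (hnU g))
      rwa [show g * x ^ (-m) * (g * x ^ (-n g))⁻¹ = x ^ (n g - m) by
        apply Additive.ofMul.injective
        simp only [ofMul_mul, ofMul_inv, ofMul_zpow, sub_smul, neg_smul]; abel] at this
    have h2' : x ^ (2 : ℤ) ∉ U := by
      have := mul_self_notMem hi hx
      rwa [zpow_ofNat, pow_two]
    have hinv : ∀ k : ℤ, x ^ k ∈ U → x ^ (-k) ∈ U := fun k h => by
      rw [zpow_neg]; exact U.inv_mem h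
    have h1' : x ^ (1 : ℤ) ∉ U := by simpa using hx
    rcases hn g with h | h | h <;> rcases hm with h' | h' | h' <;> rw [h, h'] at hmem ⊢ <;>
      norm_num at hmem
    · exact absurd hmem hx
    · exact absurd hmem hx
    · exact absurd hmem hx
    · exact absurd (by exact_mod_cast hmem) h2'
    · exact absurd hmem hx
    · exact absurd (by simpa using U.inv_mem hmem) h2'
  refine ⟨fun g => fU ⟨_, hnU g⟩ * x' ^ n g, fun g h => ?_, ?_, ?_, ?_, ?_⟩
  · have e1 : h * g⁻¹ = (h * x ^ (-n h)) * (g * x ^ (-n g))⁻¹ * x ^ (n h - n g) := by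
      apply Additive.ofMul.injective
      simp only [ofMul_mul, ofMul_inv, ofMul_zpow, sub_smul, neg_smul]; abel
    have e2 : (fU ⟨_, hnU h⟩ * x' ^ n h) * (fU ⟨_, hnU g⟩ * x' ^ n g : H)⁻¹ =
        (fU ⟨_, hnU h⟩ * (fU ⟨_, hnU g⟩)⁻¹ : U') * x' ^ (n h - n g) := by
      apply Additive.ofMul.injective
      simp only [Subgroup.coe_mul, Subgroup.coe_inv, ofMul_mul, ofMul_inv, ofMul_zpow, sub_smul]
      abel
    rw [e1, e2]
    refine J.translate_zpow h2 hU hi hx hxx' hcx (U.mul_mem (hnU h) (U.inv_mem (hnU g)))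
      (SetLike.coe_mem _) (hfU ⟨_, hnU g⟩ ⟨_, hnU h⟩) ?_
    rcases hn g with h1 | h1 | h1 <;> rcases hn h with h2 | h2 | h2 <;> rw [h1, h2] <;> simp
  · have h0 : n 1 = 0 := huniq 1 0 (by simp) (by simp)
    have : fU ⟨_, hnU 1⟩ = 1 := by
      rw [← hf1]; congr 1; ext; simp [h0]
    change (fU ⟨1 * x ^ (-n 1), hnU 1⟩ * x' ^ n 1 : H) = 1
    rw [this, h0]; simp
  · intro g hg
    have h0 : n g = 0 := huniq g 0 (by simp) (by simpa using hg)
    simp [h0]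
  · intro g hg
    have h0 : n g = 1 := huniq g 1 (by simp) (by simpa using hg)
    simp [h0]
  · intro g hg
    have h0 : n g = -1 := huniq g (-1) (by simp) (by simpa using hg)
    simp [h0]

end IndexThree

variable {G H C : Type} [CommGroup G] [CommGroup H] {c : G → C} {d : H → C}

theorem sep_one : Sep 1 := by
  intro G H C _ _ _ _ c d hG J
  have : Subsingleton G := (Nat.card_eq_one_iff_unique.1 hG).1
  exact ⟨fun _ => 1, fun g h => by simpa [Subsingleton.elim (h * g⁻¹) 1] using J.map_one⟩

/-- If all non-identity elements have the same colour, then every injection works. -/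
theorem Joint.exists_ji_of_rank_two [Finite G] [Finite H] (J : Joint c d) {x : G}
    (hx : ∀ g, g ≠ 1 → c g = c x) : ∃ f : G → H, JI c d f := by
  obtain ⟨f, -⟩ := J.exists_equiv J.map_one
  refine ⟨f, fun g h => ?_⟩
  by_cases hgh : h * g⁻¹ = 1
  · rw [hgh, mul_inv_eq_one.1 hgh, mul_inv_cancel, J.map_one]
  · have h1 : f h * (f g)⁻¹ ≠ 1 := fun e =>
      hgh (mul_inv_eq_one.2 (f.injective (mul_inv_eq_one.1 e)))
    obtain ⟨y, hy⟩ := J.exists_left (f h * (f g)⁻¹)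
    rw [hx _ hgh, ← hy, hx y fun e => h1 ((J.one_iff hy).1 e)]

theorem JI.injective {G H C : Type} [CommGroup G] [CommGroup H] {c : G → C} {d : H → C}
    (J : Joint c d) {f : G → H} (hf : JI c d f) : Function.Injective f := by
  intro g h e
  have := hf g h
  rw [e, mul_inv_cancel] at this
  exact (mul_inv_eq_one.1 ((J.one_iff this).2 rfl)).symm

theorem ji_of_hom (f : G →* H) (hf : ∀ g, c g = d (f g)) : JI c d f := fun g h => by
  rw [hf, map_mul, map_inv]

theorem sep_three : Sep 3 := by
  intro G H C _ _ _ _ c d hG J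
  have hU : JS c d ((⊥ : Subgroup G) : Set G) ((⊥ : Subgroup H) : Set H) := fun g h e => by
    simpa using J.one_iff e
  have hi : (⊥ : Subgroup G).index = 3 := by rw [Subgroup.index_bot, hG]
  have : Nontrivial G := Finite.one_lt_card_iff_nontrivial.1 (by rw [hG]; norm_num)
  obtain ⟨x, hx⟩ := exists_ne (1 : G)
  obtain ⟨x', hx'⟩ := J.exists_right x
  have hxb : x ∉ (⊥ : Subgroup G) := by simpa using hx
  obtain ⟨f, hf, -⟩ := J.exists_ji_of_small_class (by rw [hG]; norm_num) hU hi hxb hx'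
    (fun g hg => by
      rcases mem_or_of_index_three hi hxb g with h | h | h
      · exact absurd ((J.left.one_iff hg).1 (by simpa using h)) hx
      · left; simpa [mul_inv_eq_one] using h
      · right; simpa [mul_eq_one_iff_eq_inv] using h)
    (by rw [Subgroup.card_bot]; exact sep_one)
  exact ⟨f, hf⟩

theorem mem_of_card_three {L : Subgroup G} (hL : Nat.card L = 3) {l : G} (hl : l ∈ L)
    (hl1 : l ≠ 1) {m : G} (hm : m ∈ L) : m = 1 ∨ m = l ∨ m = l⁻¹ := by
  have hi : (⊥ : Subgroup L).index = 3 := by rw [Subgroup.index_bot, hL]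
  rcases mem_or_of_index_three hi (x := ⟨l, hl⟩) (by simpa using hl1) ⟨m, hm⟩ with h | h | h
  · left; simpa using h
  · right; left; simpa [Subtype.ext_iff, mul_inv_eq_one] using h
  · right; right; simpa [Subtype.ext_iff, mul_eq_one_iff_eq_inv] using h

theorem pow_three_of_card_three {L : Subgroup G} (hL : Nat.card L = 3) {l : G} (hl : l ∈ L) :
    l ^ 3 = 1 := by
  have : (⟨l, hl⟩ : L) ^ 3 = 1 := by rw [← hL]; exact pow_card_eq_one'
  simpa [Subtype.ext_iff] using this

theorem mul_self_of_card_three {L : Subgroup G} (hL : Nat.card L = 3) {l : G} (hl : l ∈ L) :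
    l * l = l⁻¹ := by
  rw [eq_inv_iff_mul_eq_one, ← pow_two, ← pow_succ, pow_three_of_card_three hL hl]

/-- Over an `A`-subgroup of order three and index three, either all outer classes are unions of
cosets, or there is an outer class of the form `{x}` or `{x, x⁻¹}`. -/
theorem Joint.exists_small_class (J : Joint c c) {L : Subgroup G} (hL : JS c c (L : Set G) L)
    (hcL : Nat.card L = 3) (hi : L.index = 3) {y l : G} (hy : y ∉ L) (hl : l ∈ L)
    (hyl : c (y * l) ≠ c y) : ∃ x ∉ L, ∀ g, c g = c x → g = x ∨ g = x⁻¹ := by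
  have hl1 : l ≠ 1 := by rintro rfl; simp at hyl
  obtain ⟨y, hy, hy1⟩ : ∃ y ∉ L, ∀ m ∈ L, c (y * m) = c y → m = 1 := by
    by_cases h : c (y * l⁻¹) = c y
    · refine ⟨y * l, fun h' => hy ((L.mul_mem_cancel_right hl).1 h'), fun m hm e => ?_⟩
      rcases mem_of_card_three hcL hl hl1 hm with rfl | rfl | rfl
      · rfl
      · have := mul_self_of_card_three hcL hl
        rw [mul_assoc, this, h] at e
        exact absurd e.symm hyl
      · rw [mul_inv_cancel_right] at e
        exact absurd e.symm hyl
    · refine ⟨y, hy, fun m hm e => ?_⟩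
      rcases mem_of_card_three hcL hl hl1 hm with rfl | rfl | rfl
      · rfl
      · exact absurd e hyl
      · exact absurd e h
  by_cases hs : ∀ g, c g = c y → g = y
  · exact ⟨y, hy, fun g hg => Or.inl (hs g hg)⟩
  push Not at hs
  obtain ⟨y2, e2, hne⟩ := hs
  have htr : ∀ y2, c y2 = c y → ∀ m ∈ L, c (y2 * m) = c y2 → m = 1 := by
    intro y2 e2 m hm e
    obtain ⟨f, hf⟩ := J.exists_equiv e2.symm
    have h1 : ∀ k ∈ L, c (k⁻¹ * y2) = c y2 → f.symm k = 1 := by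
      intro k hk hc
      have h2 := hf (f.symm k)
      rw [f.apply_symm_apply] at h2
      have h3 : (f.symm k) ∈ L := (hL h2.1).2 hk
      have := hy1 _ (L.inv_mem h3) (by rw [mul_comm, h2.2, hc, e2])
      simpa using this
    have h2 := h1 m⁻¹ (L.inv_mem hm) (by rwa [inv_inv, mul_comm])
    have h3 := h1 1 L.one_mem (by simp)
    simpa using f.symm.injective (h2.trans h3.symm)
  have hcls : ∀ g, c g = c y → g = y ∨ g = y2 := by
    intro g hg
    have hsame : ∀ a b, c a = c y → c b = c y → b * a⁻¹ ∈ L → b = a := fun a b ha hb hab => by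
      have := htr a ha _ hab (by rw [mul_comm, inv_mul_cancel_right, hb, ha])
      exact mul_inv_eq_one.1 this
    have hout : ∀ a, c a = c y → a ∉ L := fun a ha h => hy ((hL ha).1 h)
    have hside : ∀ a, c a = c y → a ≠ y → a * y ∈ L := fun a ha hay => by
      rcases mem_or_of_index_three hi hy a with h | h | h
      · exact absurd h (hout a ha)
      · exact absurd (hsame y a rfl ha h) hay
      · exact h
    by_cases hgy : g = y
    · exact Or.inl hgy
    · right
      refine hsame _ _ e2 hg ?_
      have := L.mul_mem (hside g hg hgy) (L.inv_mem (hside y2 e2 hne))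
      rwa [mul_inv_rev, ← mul_assoc, mul_inv_cancel_right] at this
  have hyy2 : y2 * y ∈ L := by
    rcases mem_or_of_index_three hi hy y2 with h | h | h
    · exact absurd ((hL e2).1 h) hy
    · have := hy1 _ h (by rw [mul_comm, inv_mul_cancel_right, e2])
      exact absurd (mul_inv_eq_one.1 this) hne
    · exact h
  have hx : y * y2⁻¹ ∉ L := fun h => mul_self_notMem hi hy (by
    have := L.mul_mem h hyy2
    rwa [← mul_assoc, inv_mul_cancel_right] at this)
  refine ⟨_, hx, fun g hg => ?_⟩
  obtain ⟨a, b, ha, hb, rfl⟩ := J.exists_mul hg.symm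
  have hb' := J.inv hb
  rw [inv_inv] at hb'
  rcases hcls a ha.symm with rfl | rfl <;> rcases hcls b⁻¹ (hb'.symm.trans e2) with h | h <;>
    rw [inv_eq_iff_eq_inv] at h <;> subst h
  · exact absurd ((J.one_iff hg).1 (by simp)) (fun h => hx (h ▸ L.one_mem))
  · left; rfl
  · right; simp
  · exact absurd ((J.one_iff hg).1 (by simp)) (fun h => hx (h ▸ L.one_mem))

/-- Every induced bijection of the quotient by an `A`-subgroup of order three lifts. -/
theorem Joint.lift_of_card_nine [Finite G] [Finite H] (J : Joint c d) {L : Subgroup G}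
    {L' : Subgroup H} (hL : JS c d (L : Set G) (L' : Set H)) (hG : Nat.card G = 9)
    (hcL : Nat.card L = 3) {g : G ⧸ L → H ⧸ L'} (hg : JI (qcol c L) (qcol d L') g)
    (hg1 : g 1 = 1) : ∃ f : G → H, JI c d f ∧ f 1 = 1 ∧ ∀ x, (f x : H ⧸ L') = g (x : G ⧸ L) := by
  have hi : L.index = 3 := by
    have := L.card_mul_index
    rw [hcL, hG] at this; omega
  by_cases hr : ∀ x ∉ L, ∀ l ∈ L, c (x * l) = c x
  · obtain ⟨f, hf, hfg⟩ := J.exists_ji_of_wreath hL hr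
      (sep_three L L' C _ _ hcL (J.restrict hL)) g hg
    refine ⟨fun x => f x * (f 1)⁻¹, hf.mul_const _, mul_inv_cancel _, fun x => ?_⟩
    rw [QuotientGroup.mk_mul, QuotientGroup.mk_inv, hfg, hfg, QuotientGroup.mk_one, hg1, inv_one,
      mul_one]
  · push Not at hr
    obtain ⟨y, hy, l, hl, hyl⟩ := hr
    obtain ⟨x, hx, hcx⟩ := J.left.exists_small_class (J.left |> fun _ => hL.left J) hcL hi hy hl hyl
    obtain ⟨r, hr⟩ := QuotientGroup.mk_surjective (g (x : G ⧸ L))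
    have e := hg 1 (x : G ⧸ L)
    rw [hg1, inv_one, inv_one, mul_one, mul_one, ← hr] at e
    obtain ⟨l', hl', e⟩ := exists_mul_of_qcol_eq e
    have hr' : ((r * l' : H) : H ⧸ L') = g (x : G ⧸ L) := by
      rw [QuotientGroup.mk_mul, coe_eq_one_of_mem hl', mul_one, hr]
    generalize r * l' = x' at e hr'
    obtain ⟨f, hf, h1, hfL, hfx, hfy⟩ := J.exists_ji_of_small_class (by rw [hG]; norm_num) hL hi hx
      e hcx (hcL ▸ sep_three)
    have hi' := (J.index_eq hL).symm.trans hi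
    have hinj := JI.injective (J.quotient hL) hg
    have hx' : x' ∉ L' := fun h => hx ((hL e).2 h)
    have hgL : ∀ a : G, a ∈ L → g (a : G ⧸ L) = 1 := fun a ha => by rw [coe_eq_one_of_mem ha, hg1]
    refine ⟨f, hf, h1, fun a => ?_⟩
    rcases mem_or_of_index_three hi hx a with h | h | h
    · rw [hgL a h, coe_eq_one_of_mem (hfL a h)]
    · have h2 : (a : G ⧸ L) = x := by
        rw [QuotientGroup.eq, mul_comm, ← inv_mem_iff]; simpa using h
      rw [h2, ← hr', QuotientGroup.eq, mul_comm, ← inv_mem_iff]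
      simpa using hfx a h
    · have h2 : (a : G ⧸ L) = (x⁻¹ : G) := by
        rw [QuotientGroup.eq, mul_comm, ← inv_mem_iff]; simpa [mul_comm] using h
      have h3 : (f a : H ⧸ L') = (x'⁻¹ : H) := by
        rw [QuotientGroup.eq, mul_comm, ← inv_mem_iff]
        simpa [mul_comm] using hfy a h
      rw [h2, h3]
      obtain ⟨s, hs⟩ := QuotientGroup.mk_surjective (g ((x⁻¹ : G) : G ⧸ L))
      rw [← hs]
      rcases mem_or_of_index_three hi' hx' s with h | h | h
      · rw [coe_eq_one_of_mem h, ← hg1] at hs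
        have := (QuotientGroup.eq_one_iff _).1 (hinj hs).symm
        exact absurd (by simpa using this) hx
      · have h4 : (s : H ⧸ L') = x' := by
          rw [QuotientGroup.eq, mul_comm, ← inv_mem_iff]; simpa using h
        rw [h4, hr'] at hs
        have := QuotientGroup.eq.1 (hinj hs)
        rw [← mul_inv_rev, inv_mem_iff] at this
        exact absurd this (mul_self_notMem hi hx)
      · rw [QuotientGroup.eq]
        simpa [mul_comm] using h

variable {G H C : Type} [CommGroup G] [CommGroup H] {c : G → C} {d : H → C}

theorem exists_hom_of_orderOf {n : ℕ} {g : G} (hg : orderOf g = n) :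
    ∃ φ : ZMod n →+ Additive G, Function.Injective φ ∧ φ 1 = Additive.ofMul g := by
  have h0 : zmultiplesHom (Additive G) (Additive.ofMul g) n = 0 := by
    rw [zmultiplesHom_apply, natCast_zsmul, ← ofMul_pow, ← hg, pow_orderOf_eq_one, ofMul_one]
  refine ⟨ZMod.lift n ⟨_, h0⟩, (ZMod.lift_injective _).2 fun m hm => ?_, ?_⟩
  · simp only [zmultiplesHom_apply] at hm
    rw [ZMod.intCast_zmod_eq_zero_iff_dvd, ← hg, orderOf_dvd_iff_zpow_eq_one]
    exact Additive.ofMul.injective hm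
  · have := ZMod.lift_coe n ⟨_, h0⟩ (1 : ℤ)
    simpa using this

theorem exists_hom_extend {A : Type} [AddCommGroup A] (φ : A →+ Additive G)
    (hφ : Function.Injective φ) {g : G} (hg : g ^ 3 = 1) (hgφ : ∀ a, φ a ≠ Additive.ofMul g) :
    ∃ ψ : A × ZMod 3 →+ Additive G, Function.Injective ψ ∧ (∀ a, ψ (a, 0) = φ a) ∧
      ψ (0, 1) = Additive.ofMul g := by
  have h1 : g ≠ 1 := fun h => hgφ 0 (by rw [h, map_zero, ofMul_one])
  obtain ⟨θ, hθ, hθ1⟩ := exists_hom_of_orderOf (orderOf_eq_prime (p := 3) hg h1)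
  refine ⟨φ.coprod θ, (injective_iff_map_eq_zero _).2 ?_, fun a => by simp, by simpa using hθ1⟩
  rintro ⟨a, k⟩ h
  rw [AddMonoidHom.coprod_apply] at h
  have hk : k = 0 := by
    by_contra hk
    have hk' : k = 1 ∨ k = -1 := by clear h; revert k; decide
    rcases hk' with rfl | rfl
    · rw [hθ1] at h
      exact hgφ (-a) (by rw [map_neg, neg_eq_iff_add_eq_zero, h])
    · rw [map_neg, hθ1, add_neg_eq_zero] at h
      exact hgφ a h
  subst hk
  rw [map_zero, add_zero] at h
  have ha : a = 0 := hφ (h.trans (map_zero φ).symm)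
  rw [ha]; rfl

/-- Elementary abelian groups of order nine: any basis can be moved to any other. -/
theorem exists_hom_of_card_nine [Finite G] (hG : Nat.card G = 9) (h3 : ∀ g : G, g ^ 3 = 1)
    {a b : G} (ha : a ≠ 1) (hb : ∀ n : ℤ, b ≠ a ^ n) : ∃ e : ZMod 3 × ZMod 3 ≃+ Additive G,
      e (1, 0) = Additive.ofMul a ∧ e (0, 1) = Additive.ofMul b := by
  obtain ⟨φ, hφ, hφ1⟩ := exists_hom_of_orderOf (orderOf_eq_prime (p := 3) (h3 a) ha)
  obtain ⟨ψ, hψ, h1, h2⟩ := exists_hom_extend φ hφ (h3 b) (fun k hk => by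
    obtain ⟨n, rfl⟩ := ZMod.intCast_surjective k
    rw [← zsmul_one, map_zsmul, hφ1, ← ofMul_zpow] at hk
    exact hb n (Additive.ofMul.injective hk).symm)
  have hbij : Function.Bijective ψ := by
    have := Fintype.ofFinite G
    have : Fintype (Additive G) := inferInstance
    rw [Fintype.bijective_iff_injective_and_card]
    refine ⟨hψ, ?_⟩
    have : Fintype.card (Additive G) = 9 := by rw [← Nat.card_eq_fintype_card]; exact hG
    rw [this]; rfl
  exact ⟨AddEquiv.ofBijective ψ hbij, by simpa [hφ1] using h1 1, h2⟩

/-- Two mutually inverse classes cannot cover `G \ {1}` when `|G| ≡ 1 mod 4`. -/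
theorem Joint.eq_of_two_classes [Finite G] (J : Joint c c) (hG : Nat.card G % 4 = 1) {x : G}
    (hx : x ≠ 1) (h : ∀ g, g ≠ 1 → c g = c x ∨ c g = c x⁻¹) {g : G} (hg : g ≠ 1) :
    c g = c x := by
  classical
  have := Fintype.ofFinite G
  by_contra hne
  have hxx : c x⁻¹ ≠ c x := fun e => by rcases h g hg with h | h <;> simp_all
  have hinv : ∀ g, c g⁻¹ = c x⁻¹ ↔ c g = c x := fun g =>
    ⟨fun e => by simpa using J.inv e, fun e => J.inv e⟩
  set k := ∑ w, if c w = c x then 1 else 0 with hk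
  have hk' : (∑ w, if c w = c x⁻¹ then 1 else 0) = k := by
    rw [hk, ← Equiv.sum_comp (Equiv.inv G)]
    exact Finset.sum_congr rfl fun w _ => by simp only [Equiv.inv_apply, hinv]
  have hn : Nat.card G = 1 + 2 * k := by
    have : (∑ w : G, 1) = ∑ w : G, ((if w = 1 then 1 else 0) + ((if c w = c x then 1 else 0) +
        if c w = c x⁻¹ then 1 else 0)) := Finset.sum_congr rfl fun w _ => by
      by_cases hw : w = 1
      · have h1 : ∀ y : G, y ≠ 1 → c w ≠ c y := fun y hy e => hy ((J.one_iff e).1 hw)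
        rw [if_pos hw, if_neg (h1 x hx), if_neg (h1 x⁻¹ (inv_ne_one.2 hx))]
      · rcases h w hw with e | e
        · simp [hw, e, hxx.symm]
        · simp [hw, e, hxx]
    rw [Finset.sum_add_distrib, Finset.sum_add_distrib, hk', ← hk] at this
    simp at this
    rw [Nat.card_eq_fintype_card, this]; ring
  let N := fun z => ∑ w, if c w = c x ∧ c (w⁻¹ * z) = c x⁻¹ then 1 else 0
  have hN : ∀ z z', c z = c z' → N z = N z' := fun z z' e => J.sum_eq e
    (Φ := fun w v => if c w = c x ∧ c v = c x⁻¹ then 1 else 0)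
    (Ψ := fun w v => if c w = c x ∧ c v = c x⁻¹ then 1 else 0)
    (fun w v w' v' hw hv => by simp only [hw, hv])
  have hN1 : N 1 = k := Finset.sum_congr rfl fun w _ => by
    simp only [mul_one, hinv, and_self]
  have hNi : N x⁻¹ = N x := by
    simp only [N]
    symm
    rw [← Equiv.sum_comp (Equiv.mulRight x)]
    refine Finset.sum_congr rfl fun w _ => ?_
    have e : c (w⁻¹ * x⁻¹) = c x⁻¹ ↔ c (w * x) = c x := by
      rw [← hinv, mul_inv_rev, mul_comm]
    have e2 : (w * x)⁻¹ * x = w⁻¹ := by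
      rw [mul_inv_rev, mul_comm, mul_inv_cancel_left]
    simp only [Equiv.coe_mulRight, e, e2, hinv, and_comm (a := c (w * x) = c x)]
  have hsum : ∑ z, N z = k * k := by
    simp only [N]
    rw [Finset.sum_comm, hk, Finset.sum_mul]
    refine Finset.sum_congr rfl fun w _ => ?_
    by_cases hw : c w = c x
    · simp only [hw, true_and, if_true, one_mul, ← hk, ← hk']
      exact Equiv.sum_comp (Equiv.mulLeft w⁻¹) (fun v => if c v = c x⁻¹ then 1 else 0)
    · simp [hw]
  have hsum' : ∑ z, N z = k + (Nat.card G - 1) * N x := by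
    rw [← Finset.add_sum_erase _ _ (Finset.mem_univ (1 : G)), hN1]
    congr 1
    rw [Finset.sum_congr rfl (g := fun _ => N x)]
    · simp [Finset.card_erase_of_mem, Nat.card_eq_fintype_card]
    · intro z hz
      rcases h z (Finset.ne_of_mem_erase hz) with e | e
      · exact hN _ _ e
      · rw [hN _ _ e, hNi]
  have hkpos : 0 < k := Finset.sum_pos' (fun _ _ => Nat.zero_le _) ⟨x, Finset.mem_univ _, by simp⟩
  rw [hn] at hsum' hG
  have h1 : k * k = k * (1 + 2 * N x) := by
    rw [← hsum, hsum', Nat.add_sub_cancel_left]; ring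
  have h2 := Nat.eq_of_mul_eq_mul_left hkpos h1
  omega

variable {G H C : Type} [CommGroup G] [CommGroup H] {c : G → C} {d : H → C}

theorem Joint.const_of_orderOf_nine [Finite G] (J : Joint c c) (hG : Nat.card G = 9)
    (hno : ∀ L : Subgroup G, Nat.card L = 3 → ¬ JS c c (L : Set G) L) {x : G}
    (hx : orderOf x = 9) : ∃ y : G, y ≠ 1 ∧ ∀ g, g ≠ 1 → c g = c y := by
  obtain ⟨φ, hφ, hφ1⟩ := exists_hom_of_orderOf hx
  have hsurj : Function.Surjective φ := by
    have := Fintype.ofFinite G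
    have : Fintype (Additive G) := inferInstance
    refine ((Fintype.bijective_iff_injective_and_card _).2 ⟨hφ, ?_⟩).2
    have : Fintype.card (Additive G) = 9 := by rw [← Nat.card_eq_fintype_card]; exact hG
    rw [this, ZMod.card]
  let e : ZMod 9 → G := fun k => (φ k).toMul
  have es : ∀ g, ∃ k, e k = g := hsurj
  have e0 : e 0 = 1 := by simp [e]
  have en : ∀ k, e (-k) = (e k)⁻¹ := fun k => by simp [e]
  have em : ∀ (m : ℕ) k, e (m * k) = e k ^ m := fun m k => by
    simp only [e]; rw [← nsmul_eq_mul, map_nsmul, toMul_nsmul]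
  have einj : ∀ k, e k = 1 → k = 0 := fun k h => hφ (h.trans e0.symm)
  have hpow : ∀ m : ℕ, m < 9 → Nat.Coprime 3 m → ∀ k l, c (e k) = c (e l) →
      c (e (m * k)) = c (e (m * l)) := fun m hm hm3 k l h => by
    rw [em, em]
    refine J.pow ?_ h
    rw [hG]
    exact Nat.Coprime.pow_left 2 hm3
  have hmem : ∀ k, e k ∈ Subgroup.zpowers (x ^ 3) ↔ k = 0 ∨ k = 3 ∨ k = 6 := by
    intro k
    have hx3 : x ^ 3 = e 3 := by
      have := em 3 1
      rw [mul_one] at this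
      rw [show ((3 : ℕ) : ZMod 9) = 3 from rfl] at this
      rw [this]; simp [e, hφ1]
    rw [Subgroup.mem_zpowers_iff, hx3]
    have ez : ∀ n : ℤ, e 3 ^ n = e (n * 3) := fun n => by
      simp only [e]; rw [← zsmul_eq_mul, map_zsmul, toMul_zsmul]
    constructor
    · rintro ⟨n, hn⟩
      rw [ez] at hn
      have := hφ hn
      rw [← this]
      generalize (n : ZMod 9) = n
      revert n; decide
    · rintro (rfl | rfl | rfl)
      · exact ⟨0, by simp [e0]⟩
      · exact ⟨1, by simp⟩
      · exact ⟨2, by rw [ez]; rfl⟩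
  have hcard : Nat.card (Subgroup.zpowers (x ^ 3)) = 3 := by
    rw [Nat.card_zpowers, orderOf_pow, hx]; rfl
  obtain ⟨k, l, hkl, hk, hl⟩ : ∃ k l, c (e k) = c (e l) ∧ (k = 0 ∨ k = 3 ∨ k = 6) ∧
      ¬ (l = 0 ∨ l = 3 ∨ l = 6) := by
    by_contra hcon
    push Not at hcon
    refine hno _ hcard fun g h hgh => ?_
    obtain ⟨k, rfl⟩ := es g
    obtain ⟨l, rfl⟩ := es h
    rw [SetLike.mem_coe, SetLike.mem_coe, hmem, hmem]
    have h1 := hcon k l hgh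
    have h2 := hcon l k hgh.symm
    tauto
  have hl0 : e l ≠ 1 := fun h => hl (Or.inl (einj l h))
  have hk0 : k ≠ 0 := fun h => hl0 ((J.one_iff hkl).1 (by rw [h, e0]))
  have hcov : ∀ k l s : ZMod 9, (k = 3 ∨ k = 6) → ¬ (l = 0 ∨ l = 3 ∨ l = 6) → s ≠ 0 →
      ∃ m ∈ Finset.range 9, Nat.Coprime 3 m ∧ (s = m * l ∨ s = m * k) := by decide
  have hfix : ∀ k : ZMod 9, (k = 3 ∨ k = 6) → ∀ m ∈ Finset.range 9, Nat.Coprime 3 m →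
      (m * k = k ∨ m * k = -k) := by decide
  have hk' : k = 3 ∨ k = 6 := by tauto
  refine ⟨e l, hl0, fun g hg => J.eq_of_two_classes (by rw [hG]) hl0 (fun g hg => ?_) hg⟩
  obtain ⟨s, rfl⟩ := es g
  obtain ⟨m, hm, hm3, h⟩ := hcov k l s hk' hl (fun h => hg (by rw [h, e0]))
  have h1 := hpow m (Finset.mem_range.1 hm) hm3 k l hkl
  have h2 : c (e s) = c (e (m * k)) := by rcases h with rfl | rfl; exacts [h1.symm, rfl]
  rw [h2]
  rcases hfix k hk' m hm hm3 with h | h <;> rw [h]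
  · left; exact hkl
  · right; rw [en]; exact J.inv hkl

/-- The structure of a primitive colouring of an elementary abelian group of order nine. -/
theorem Joint.const_or_paley [Finite G] (J : Joint c c) (hG : Nat.card G = 9)
    (hno : ∀ L : Subgroup G, Nat.card L = 3 → ¬ JS c c (L : Set G) L) (h3 : ∀ g : G, g ^ 3 = 1)
    {a : G} (ha : a ≠ 1) : (∀ g, g ≠ 1 → c g = c a) ∨ ∃ b, (∀ n : ℤ, b ≠ a ^ n) ∧
      ∀ g, g ≠ 1 → (c g = c a ↔ g = a ∨ g = a⁻¹ ∨ g = b ∨ g = b⁻¹) ∧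
        (c g ≠ c a → c g = c (a * b)) := by
  have hz : ∀ (g : G) (n : ℤ), g ^ n = 1 ∨ g ^ n = g ∨ g ^ n = g⁻¹ := fun g n => by
    have h3' : g ^ (3 : ℤ) = 1 := by exact_mod_cast h3 g
    rw [← Int.mul_ediv_add_emod n 3, zpow_add, zpow_mul, h3', one_zpow, one_mul]
    have h1 := Int.emod_nonneg n (show (3 : ℤ) ≠ 0 by norm_num)
    have h2 := Int.emod_lt_of_pos n (show (0 : ℤ) < 3 by norm_num)
    interval_cases n % 3
    · left; simp
    · right; left; simp
    · right; right
      rw [eq_inv_iff_mul_eq_one, ← zpow_add_one]; exact h3'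
  have hrel : ∀ g : G, g ≠ 1 → ∃ h, h ≠ 1 ∧ h ≠ g ∧ h ≠ g⁻¹ ∧ c h = c g := by
    intro g hg
    by_contra hcon
    push Not at hcon
    refine hno (Subgroup.zpowers g) (by rw [Nat.card_zpowers, orderOf_eq_prime (h3 g) hg]) ?_
    have hmem : ∀ x, x ∈ Subgroup.zpowers g ↔ x = 1 ∨ x = g ∨ x = g⁻¹ := fun x => by
      rw [Subgroup.mem_zpowers_iff]
      constructor
      · rintro ⟨n, rfl⟩; exact hz g n
      · rintro (rfl | rfl | rfl)
        exacts [⟨0, by simp⟩, ⟨1, by simp⟩, ⟨-1, by simp⟩]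
    have h1 : ∀ x y, c x = c y → x ∈ Subgroup.zpowers g → y ∈ Subgroup.zpowers g := by
      intro x y e hx
      rw [hmem] at hx ⊢
      rcases hx with rfl | rfl | rfl
      · exact Or.inl ((J.one_iff e).1 rfl)
      · by_contra hy
        push Not at hy
        exact hcon y hy.1 hy.2.1 hy.2.2 e.symm
      · by_contra hy
        push Not at hy
        refine hcon y⁻¹ (inv_ne_one.2 hy.1) (fun h => hy.2.2 (by rw [← h, inv_inv]))
          (fun h => hy.2.1 (inv_injective h)) ?_
        simpa using (J.inv e).symm
    exact fun x y e => ⟨h1 x y e, h1 y x e.symm⟩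
  obtain ⟨b, hb1, hba, hba', hcb⟩ := hrel a ha
  have hb : ∀ n : ℤ, b ≠ a ^ n := fun n h => by
    rcases hz a n with h' | h' | h' <;> rw [h'] at h <;> contradiction
  obtain ⟨e, ea, eb⟩ := exists_hom_of_card_nine hG h3 ha hb
  have hall : ∀ g : G, g = 1 ∨ (g = a ∨ g = a⁻¹) ∨ (g = b ∨ g = b⁻¹) ∨
      (g = a * b ∨ g = (a * b)⁻¹) ∨ (g = a * b⁻¹ ∨ g = (a * b⁻¹)⁻¹) := by
    have hE : ∀ g : G, ∃ k, e k = Additive.ofMul g := fun g => e.surjective _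
    have e1 : e 0 = Additive.ofMul 1 := by simp
    have key : ∀ k : ZMod 3 × ZMod 3, k = 0 ∨ (k = (1, 0) ∨ k = -(1, 0)) ∨
        (k = (0, 1) ∨ k = -(0, 1)) ∨ (k = (1, 0) + (0, 1) ∨ k = -((1, 0) + (0, 1))) ∨
        (k = (1, 0) + -(0, 1) ∨ k = -((1, 0) + -(0, 1))) := by decide
    intro g
    obtain ⟨k, hk⟩ := hE g
    have := key k
    simpa only [← e.injective.eq_iff, hk, map_neg, map_add, ea, eb, e1, ← ofMul_inv, ← ofMul_mul,
      Additive.ofMul.injective.eq_iff] using this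
  have hsymm : ∀ a b : G, a ≠ b → c b = c a →
      (∀ g, c g = c a → g = a ∨ g = a⁻¹ ∨ g = b ∨ g = b⁻¹) → c a⁻¹ = c a := by
    intro a b hab hcb hX
    by_contra hne
    have hX' : ∀ g, c g = c a → g = a ∨ g = b := fun g hg => by
      have hb' : c b⁻¹ ≠ c a := fun h => hne ((J.inv hcb).symm.trans h)
      rcases hX g hg with h | h | h | h <;> subst h
      exacts [Or.inl rfl, absurd hg hne, Or.inr rfl, absurd hg hb']
    obtain ⟨g, hg1, h1, h2, hg⟩ := hrel (a * b⁻¹) (fun h => hab (mul_inv_eq_one.1 h))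
    obtain ⟨u, v, hu, hv, rfl⟩ := J.exists_mul hg.symm
    have hv' := J.inv hv
    rw [inv_inv] at hv'
    rcases hX' u hu.symm with h | h <;> rcases hX' v⁻¹ (hv'.symm.trans hcb) with h' | h' <;>
      rw [inv_eq_iff_eq_inv] at h' <;> rw [h, h'] at hg1 h1 h2
    · exact hg1 (mul_inv_cancel _)
    · exact h1 rfl
    · exact h2 (by rw [mul_inv_rev, inv_inv])
    · exact hg1 (mul_inv_cancel _)
  have hR : ∀ g, (g = a ∨ g = a⁻¹) ∨ (g = b ∨ g = b⁻¹) → c g = c a ∨ c g = c a⁻¹ := by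
    rintro g ((rfl | rfl) | (rfl | rfl))
    exacts [Or.inl rfl, Or.inr rfl, Or.inl hcb, Or.inr (J.inv hcb)]
  have hRi : ∀ g, c g = c a ∨ c g = c a⁻¹ → c g⁻¹ = c a ∨ c g⁻¹ = c a⁻¹ := by
    rintro g (h | h)
    · exact Or.inr (J.inv h)
    · left; simpa using J.inv h
  have hab : a ≠ b := fun h => hba h.symm
  have hab' : a * b ≠ 1 := fun h => hba' (eq_inv_of_mul_eq_one_right h)
  have hab'' : a * b⁻¹ ≠ 1 := fun h => hab (mul_inv_eq_one.1 h)
  have hRpq : ∀ p q : G, (∀ g : G, g = 1 ∨ (g = a ∨ g = a⁻¹) ∨ (g = b ∨ g = b⁻¹) ∨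
      (g = p ∨ g = p⁻¹) ∨ (g = q ∨ g = q⁻¹)) → q ≠ 1 → (c p = c a ∨ c p = c a⁻¹) →
      ∀ g, g ≠ 1 → c g = c a := by
    intro p q hall hq1 hp g hg
    refine J.eq_of_two_classes (by rw [hG]) ha (fun g hg => ?_) hg
    have hq : c q = c a ∨ c q = c a⁻¹ := by
      obtain ⟨h, h1, h2, h3, h4⟩ := hrel q hq1
      rw [← h4]
      rcases hall h with h' | h' | h' | (rfl | rfl) | h' | h'
      exacts [absurd h' h1, hR _ (Or.inl h'), hR _ (Or.inr h'), hp, hRi _ hp, absurd h' h2,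
        absurd h' h3]
    rcases hall g with h | h | h | (rfl | rfl) | (rfl | rfl)
    exacts [absurd h hg, hR _ (Or.inl h), hR _ (Or.inr h), hp, hRi _ hp, hq, hRi _ hq]
  by_cases hp : c (a * b) = c a ∨ c (a * b) = c a⁻¹
  · exact Or.inl (hRpq _ _ hall hab'' hp)
  by_cases hq : c (a * b⁻¹) = c a ∨ c (a * b⁻¹) = c a⁻¹
  · exact Or.inl (hRpq _ _ (fun g => by have := hall g; tauto) hab' hq)
  right
  obtain ⟨q, hqq, hpq⟩ : ∃ q, (q = a * b⁻¹ ∨ q = (a * b⁻¹)⁻¹) ∧ c q = c (a * b) := by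
    obtain ⟨h, h1, h2, h3, h4⟩ := hrel _ hab'
    rcases hall h with h' | h' | h' | h' | h'
    · exact absurd h' h1
    · exact absurd (h4 ▸ hR _ (Or.inl h')) hp
    · exact absurd (h4 ▸ hR _ (Or.inr h')) hp
    · rcases h' with h' | h'
      exacts [absurd h' h2, absurd h' h3]
    · exact ⟨h, h', h4⟩
  have hnq : ∀ g, g = q ∨ g = q⁻¹ → ¬ (c g = c a ∨ c g = c a⁻¹) := by
    have hq' : ¬ (c (a * b⁻¹)⁻¹ = c a ∨ c (a * b⁻¹)⁻¹ = c a⁻¹) := fun h => hq (by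
      have := hRi _ h
      rwa [inv_inv] at this)
    rcases hqq with rfl | rfl <;> rintro g (rfl | rfl)
    · exact hq
    · exact hq'
    · exact hq'
    · rwa [inv_inv]
  have hnp : ∀ g, g = a * b ∨ g = (a * b)⁻¹ → ¬ (c g = c a ∨ c g = c a⁻¹) := by
    rintro g (rfl | rfl)
    · exact hp
    · exact fun h => hp (by
        have := hRi _ h
        rwa [inv_inv] at this)
  have hall' : ∀ g : G, g = 1 ∨ (g = a ∨ g = a⁻¹) ∨ (g = b ∨ g = b⁻¹) ∨
      (g = a * b ∨ g = (a * b)⁻¹) ∨ (g = q ∨ g = q⁻¹) := fun g => by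
    rcases hqq with rfl | rfl
    · exact hall g
    · rw [inv_inv, or_comm (a := g = (a * b⁻¹)⁻¹)]; exact hall g
  have hai : c a⁻¹ = c a := hsymm a b hab hcb fun g hg => by
    rcases hall' g with h | h | h | h | h
    · exact absurd ((J.one_iff hg).1 h) ha
    · tauto
    · tauto
    · exact absurd (Or.inl hg) (hnp g h)
    · exact absurd (Or.inl hg) (hnq g h)
  have hpi : c (a * b)⁻¹ = c (a * b) := hsymm (a * b) q (fun h => hb1 (by
      rcases hqq with rfl | rfl
      · have := mul_left_cancel h
        have h2 : b ^ 3 = b := by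
          rw [pow_succ, pow_two]; nth_rw 1 [this]; simp
        rw [← h2, h3]
      · rw [mul_inv_rev, inv_inv, mul_comm b] at h
        exact absurd (mul_right_cancel h) (fun h => ha (by
          have h2 : a ^ 3 = a := by
            rw [pow_succ, pow_two]; nth_rw 1 [h]; simp
          rw [← h2, h3])))) hpq fun g hg => by
    rcases hall' g with h | h | h | h | h
    · exact absurd ((J.one_iff hg).1 h) hab'
    · exact absurd (hg ▸ hR g (Or.inl h)) hp
    · exact absurd (hg ▸ hR g (Or.inr h)) hp
    · tauto
    · tauto
  refine ⟨b, hb, fun g hg => ⟨⟨fun h => ?_, fun h => ?_⟩, fun h => ?_⟩⟩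
  · rcases hall' g with h' | h' | h' | h' | h'
    · exact absurd h' hg
    · tauto
    · tauto
    · exact absurd (Or.inl h) (hnp g h')
    · exact absurd (Or.inl h) (hnq g h')
  · have := hR g (by tauto)
    rwa [hai, or_self] at this
  · rcases hall' g with h' | h' | h' | (rfl | rfl) | (rfl | rfl)
    · exact absurd h' hg
    · have := hR g (Or.inl h'); rw [hai, or_self] at this; contradiction
    · have := hR g (Or.inr h'); rw [hai, or_self] at this; contradiction
    · rfl
    · exact hpi
    · exact hpq
    · rw [J.inv hpq, hpi]

theorem sep_nine : Sep 9 := by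
  intro G H C _ _ _ _ c d hG J
  have hH : Nat.card H = 9 := J.card_eq.symm.trans hG
  by_cases hno : ∀ L : Subgroup G, Nat.card L = 3 → ¬ JS c c (L : Set G) L
  swap
  · push Not at hno
    obtain ⟨L, hcL, hL⟩ := hno
    obtain ⟨L', hL'⟩ := J.exists_subgroup L hL
    have hq : Nat.card (G ⧸ L) = 3 := by
      have := L.card_eq_card_quotient_mul_card_subgroup
      rw [hcL, hG] at this; omega
    obtain ⟨g, hg, hg1⟩ := sep_three.exists (J.quotient hL') hq
    obtain ⟨f, hf, -⟩ := J.lift_of_card_nine hL' hG hcL hg hg1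
    exact ⟨f, hf⟩
  have hno' : ∀ L : Subgroup H, Nat.card L = 3 → ¬ JS d d (L : Set H) L := fun L' hcL hL' => by
    obtain ⟨L, hL⟩ := J.symm.exists_subgroup L' hL'
    exact hno L ((J.symm.card_set_eq hL).symm.trans hcL) (hL.symm.left J)
  by_cases hrk : ∃ y : G, y ≠ 1 ∧ ∀ g, g ≠ 1 → c g = c y
  · obtain ⟨y, -, hy⟩ := hrk
    exact J.exists_ji_of_rank_two hy
  have hrk' : ¬ ∃ y : H, y ≠ 1 ∧ ∀ g, g ≠ 1 → d g = d y := by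
    rintro ⟨y, hy1, hy⟩
    obtain ⟨x, hx⟩ := J.exists_left y
    refine hrk ⟨x, fun h => hy1 ((J.one_iff hx).1 h), fun g hg => ?_⟩
    obtain ⟨h, hh⟩ := J.exists_right g
    rw [hh, hx, hy h fun h => hg ((J.one_iff hh).2 h)]
  have hexp : ∀ {K : Type} [CommGroup K] [Finite K] {k : K → C}, Joint k k → Nat.card K = 9 →
      (∀ L : Subgroup K, Nat.card L = 3 → ¬ JS k k (L : Set K) L) →
      (¬ ∃ y : K, y ≠ 1 ∧ ∀ g, g ≠ 1 → k g = k y) → ∀ g : K, g ^ 3 = 1 := by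
    intro K _ _ k J hK hno hrk g
    have h1 : orderOf g ∣ 3 ^ 2 := by
      have := orderOf_dvd_natCard g
      rwa [hK] at this
    obtain ⟨i, hi, h2⟩ := (Nat.dvd_prime_pow Nat.prime_three).1 h1
    interval_cases i
    · have : g = 1 := orderOf_eq_one_iff.1 (by simpa using h2)
      rw [this, one_pow]
    · rw [pow_one] at h2
      rw [← h2, pow_orderOf_eq_one]
    · exact absurd (J.const_of_orderOf_nine hK hno h2) hrk
  have h3 := hexp J.left hG hno hrk
  have h3' := hexp J.right hH hno' hrk'
  have : Nontrivial G := Finite.one_lt_card_iff_nontrivial.1 (by rw [hG]; norm_num)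
  obtain ⟨a, ha⟩ := exists_ne (1 : G)
  obtain ⟨a', haa'⟩ := J.exists_right a
  have ha' : a' ≠ 1 := fun h => ha ((J.one_iff haa').2 h)
  obtain ⟨b, hb, hab⟩ := (J.left.const_or_paley hG hno h3 ha).resolve_left
    fun h => hrk ⟨a, ha, h⟩
  obtain ⟨b', hb', hab'⟩ := (J.right.const_or_paley hH hno' h3' ha').resolve_left
    fun h => hrk' ⟨a', ha', h⟩
  obtain ⟨e, ea, eb⟩ := exists_hom_of_card_nine hG h3 ha hb
  obtain ⟨e', ea', eb'⟩ := exists_hom_of_card_nine hH h3' ha' hb'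
  let f : G ≃* H := AddEquiv.toMultiplicative (e.symm.trans e')
  have fa : f a = a' := by
    have h : e'  (e.symm (Additive.ofMul a)) = Additive.ofMul a' := by
      rw [← ea, e.symm_apply_apply, ea']
    exact h
  have fb : f b = b' := by
    have h : e'  (e.symm (Additive.ofMul b)) = Additive.ofMul b' := by
      rw [← eb, e.symm_apply_apply, eb']
    exact h
  refine ⟨f, ji_of_hom (f : G →* H) fun g => ?_⟩
  change c g = d (f g)
  by_cases hg : g = 1
  · rw [hg, map_one, J.map_one]
  have hfg : f g ≠ 1 := fun h => hg (by simpa using h)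
  have hiff : c g = c a ↔ d (f g) = d a' := by
    rw [(hab g hg).1, (hab' _ hfg).1, ← fa, ← fb, ← map_inv, ← map_inv]
    simp only [f.injective.eq_iff]
  by_cases h : c g = c a
  · rw [h, haa', hiff.1 h]
  · obtain ⟨x, hx⟩ := J.exists_left (f g)
    have hx1 : x ≠ 1 := fun h => hfg ((J.one_iff hx).1 h)
    have hxa : c x ≠ c a := fun e => h (hiff.2 (by rw [← hx, e, haa']))
    rw [(hab g hg).2 h, ← hx, (hab x hx1).2 hxa]

/-- A function on an affine plane vanishing on the axes is determined by its sums along the lines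
that neither pass through the origin nor are parallel to an axis. -/
theorem eq_zero_of_line_sums {K : Type*} [Field K] [Fintype K] [DecidableEq K]
    (h2 : Fintype.card K ≠ 2) (D : K → K → ℤ) (h0 : ∀ v, D 0 v = 0) (h0' : ∀ u, D u 0 = 0)
    (h : ∀ μ ν : K, μ ≠ 0 → ν ≠ 0 → ∑ s, D (μ * s) (ν * (1 - s)) = 0) (u v : K) : D u v = 0 := by
  let T : ℤ := ∑ u, ∑ v, D u v
  let line : K → K → ℤ := fun m k => ∑ t, D t (m * t + k)
  have hline : ∀ m k, m ≠ 0 → k ≠ 0 → line m k = 0 := fun m k hm hk => by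
    rw [← h (-k / m) k (div_ne_zero (neg_ne_zero.2 hk) hm) hk]
    refine (Fintype.sum_equiv (Equiv.mulLeft₀ (-k / m) (div_ne_zero (neg_ne_zero.2 hk) hm)) _ _
      fun s => ?_).symm
    change _ = D (-k / m * s) (m * (-k / m * s) + k)
    congr 1
    field_simp
    ring
  have hpt : ∀ u v, ∑ m, line m (v - m * u) =
      Fintype.card K * D u v + T - ∑ v, D u v := fun u v => by
    have h1 : ∀ t, ∑ m, D t (m * t + (v - m * u)) =
        (if t = u then Fintype.card K * D u v - ∑ v, D u v else 0) + ∑ v, D t v := fun t => by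
      by_cases ht : t = u
      · subst ht
        simp [Finset.card_univ]
      · rw [if_neg ht, zero_add]
        refine Fintype.sum_equiv ((Equiv.mulLeft₀ (t - u) (sub_ne_zero.2 ht)).trans
          (Equiv.addRight v)) _ _ fun m => ?_
        change _ = D t ((t - u) * m + v)
        congr 1
        ring
    simp only [line]
    rw [Finset.sum_comm]
    simp only [h1, Finset.sum_add_distrib, Finset.sum_ite_eq',
      Finset.mem_univ, if_true, T]
    ring
  have hpar : ∀ m, ∑ k, line m k = T := fun m => by
    simp only [line, T]
    rw [Finset.sum_comm]
    exact Finset.sum_congr rfl fun t _ => Fintype.sum_equiv (Equiv.addLeft (m * t)) _ _ fun k => rfl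
  have hrow : ∀ k, k ≠ 0 → line 0 k = T := fun k hk => by
    have := hpt 0 k
    simp only [mul_zero, sub_zero, h0, Finset.sum_const_zero, zero_add] at this
    rw [← this, Finset.sum_eq_single 0 (fun m _ hm => hline m k hm hk) (by simp)]
  have hray : ∀ m, m ≠ 0 → line m 0 = T := fun m hm => by
    rw [← hpar m, Finset.sum_eq_single 0 (fun k _ hk => hline m k hm hk) (by simp)]
  have h00 : line 0 0 = 0 := by simp [line, h0']
  have hT : T = 0 := by
    have h1 := hpar 0
    rw [← Finset.add_sum_erase _ _ (Finset.mem_univ (0 : K)), h00,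
      Finset.sum_congr rfl fun k hk => hrow k (Finset.ne_of_mem_erase hk), Finset.sum_const,
      Finset.card_erase_of_mem (Finset.mem_univ _), Finset.card_univ, zero_add, nsmul_eq_mul] at h1
    have h3 : ((Fintype.card K - 1 : ℕ) : ℤ) ≠ 1 := by
      have := Fintype.card_pos (α := K); omega
    by_contra hT
    exact h3 (mul_right_cancel₀ hT (h1.trans (one_mul T).symm))
  have hall : ∀ m k, line m k = 0 := fun m k => by
    by_cases hm : m = 0 <;> by_cases hk : k = 0
    · rw [hm, hk, h00]
    · rw [hm, hrow k hk, hT]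
    · rw [hk, hray m hm, hT]
    · exact hline m k hm hk
  have hcol : ∑ v, D u v = 0 := by
    have := hpt u 0
    simp only [hall, Finset.sum_const_zero, h0', hT] at this
    linarith
  have := hpt u v
  simp only [hall, Finset.sum_const_zero, hT, hcol] at this
  have hc : (Fintype.card K : ℤ) ≠ 0 := by
    have := Fintype.card_pos (α := K); omega
  have h4 : (Fintype.card K : ℤ) * D u v = 0 := by linarith
  exact (mul_eq_zero.1 h4).resolve_left hc

variable {G H C : Type} [CommGroup G] [CommGroup H] {c : G → C} {d : H → C}

/-- A direct complement of prime order, parametrised by `ZMod p`. -/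
structure Split (Q : Subgroup G) (p : ℕ) where
  /-- the parametrisation of the complement -/
  ρ : ZMod p → G
  map_add : ∀ s t, ρ (s + t) = ρ s * ρ t
  bij : Function.Bijective fun w : Q × ZMod p => (w.1 : G) * ρ w.2

namespace Split

variable {Q : Subgroup G} {p : ℕ} (S : Split Q p)

theorem map_zero : S.ρ 0 = 1 := by
  have := S.map_add 0 0
  rw [add_zero] at this
  exact (mul_eq_left.1 this.symm)

theorem map_neg (s : ZMod p) : S.ρ (-s) = (S.ρ s)⁻¹ := by
  rw [eq_inv_iff_mul_eq_one, ← S.map_add, neg_add_cancel, S.map_zero]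

theorem map_pow (s : ZMod p) (m : ℕ) : S.ρ s ^ m = S.ρ (m * s) := by
  induction m with
  | zero => simp [S.map_zero]
  | succ m ih => rw [pow_succ, ih, ← S.map_add]; push_cast; congr 1; ring

theorem exists_eq (g : G) : ∃ u ∈ Q, ∃ s, g = u * S.ρ s := by
  obtain ⟨⟨u, s⟩, h⟩ := S.bij.2 g
  exact ⟨u, u.2, s, h.symm⟩

theorem eq_iff {u v : G} (hu : u ∈ Q) (hv : v ∈ Q) {s t : ZMod p} :
    u * S.ρ s = v * S.ρ t ↔ u = v ∧ s = t := by
  refine ⟨fun h => ?_, fun h => by rw [h.1, h.2]⟩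
  have := @S.bij.1 (⟨u, hu⟩, s) (⟨v, hv⟩, t) h
  simpa using this

theorem mem_iff {u : G} (hu : u ∈ Q) {s : ZMod p} : u * S.ρ s ∈ Q ↔ s = 0 := by
  refine ⟨fun h => ?_, fun h => by rw [h, S.map_zero, mul_one]; exact hu⟩
  have : u * S.ρ s = (u * S.ρ s) * S.ρ 0 := by rw [S.map_zero, mul_one]
  exact ((S.eq_iff hu h).1 this).2

theorem ρ_eq_one {s : ZMod p} : S.ρ s = 1 ↔ s = 0 := by
  have := S.eq_iff Q.one_mem Q.one_mem (s := s) (t := 0)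
  rw [S.map_zero, mul_one, one_mul] at this
  tauto

/-- Rescaling of the parametrisation. -/
def scale [Fact p.Prime] (k : ZMod p) (hk : k ≠ 0) : Split Q p where
  ρ s := S.ρ (k * s)
  map_add s t := by rw [mul_add, S.map_add]
  bij := S.bij.comp ((Equiv.prodCongr (Equiv.refl Q) (Equiv.mulLeft₀ k hk)).bijective)

theorem sum_eq [Fintype G] [Fintype Q] [NeZero p] (f : G → ℤ) :
    ∑ g, f g = ∑ s, ∑ w : Q, f (w * S.ρ s) := by
  rw [← Fintype.sum_prod_type_right', ← (Equiv.ofBijective _ S.bij).sum_comp]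
  rfl

end Split

theorem exists_split [Finite G] {Q : Subgroup G} {n p : ℕ} (hp : p.Prime) (hn : n.Coprime p)
    (hQ : Nat.card Q = n) (hG : Nat.card G = n * p) : Nonempty (Split Q p) := by
  have := Fact.mk hp
  obtain ⟨x, hx⟩ := exists_prime_orderOf_dvd_card' (G := G) p (hG ▸ dvd_mul_left p n)
  obtain ⟨φ, hφ, -⟩ := exists_hom_of_orderOf hx
  refine ⟨⟨fun s => (φ s).toMul, fun s t => by rw [map_add]; rfl, ?_⟩⟩
  refine Function.Injective.bijective_of_nat_card_le ?_ (by
    rw [hG, Nat.card_prod, hQ, Nat.card_zmod])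
  rintro ⟨u, s⟩ ⟨v, t⟩ h
  have h1 : (φ (s - t)).toMul ∈ Q := by
    have : (φ (s - t)).toMul = (v : G) * (u : G)⁻¹ := by
      rw [map_sub]
      change (φ s).toMul / (φ t).toMul = _
      rw [← div_eq_mul_inv, div_eq_div_iff_mul_eq_mul, mul_comm]
      simpa [mul_comm] using h
    rw [this]
    exact Q.mul_mem v.2 (Q.inv_mem u.2)
  have h2 : (φ (s - t)).toMul ^ n = 1 := by
    have := pow_card_eq_one' (G := Q) (x := ⟨_, h1⟩)
    rw [hQ] at this
    exact congrArg Subtype.val this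
  have h3 : (φ (s - t)).toMul ^ p = 1 := by
    have : p • φ (s - t) = 0 := by rw [← map_nsmul]; simp
    exact this
  have h4 : (φ (s - t)).toMul = 1 := by
    rw [← pow_one ((φ (s - t)).toMul), ← hn.gcd_eq_one]
    exact pow_gcd_eq_one.2 ⟨h2, h3⟩
  have h5 : s - t = 0 := hφ (by rw [map_zero]; exact h4)
  have h6 : s = t := sub_eq_zero.1 h5
  subst h6
  simpa using h

section Mult

variable {Q : Subgroup G} {Q' : Subgroup H} {n p : ℕ} (S : Split Q p) (S' : Split Q' p)

theorem Split.exists_pow [Finite G] [Finite H] (hn : n.Coprime p)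
    (hQ : Nat.card Q = n) (hQ' : Nat.card Q' = n) (hp : p.Prime) (k : ZMod p) (hk : k ≠ 0) :
    ∃ m : ℕ, (n * p).Coprime m ∧ (∀ u ∈ Q, ∀ s, (u * S.ρ s) ^ m = u * S.ρ (k * s)) ∧
      (∀ u ∈ Q', ∀ s, (u * S'.ρ s) ^ m = u * S'.ρ (k * s)) := by
  have := Fact.mk hp
  obtain ⟨m, h1, h2⟩ := Nat.chineseRemainder hn 1 k.val
  have h3 : (m : ZMod p) = k := by
    have := (ZMod.natCast_eq_natCast_iff _ _ _).2 h2
    rwa [ZMod.natCast_zmod_val] at this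
  have h4 : ∀ {K : Type} [CommGroup K] [Finite K] (R : Subgroup K), Nat.card R = n →
      ∀ u ∈ R, u ^ m = u := fun R hR u hu => by
    have h5 : orderOf u ∣ n := by
      rw [← hR, ← Subgroup.orderOf_mk u hu]; exact orderOf_dvd_natCard _
    have : u ^ m = u ^ 1 := pow_eq_pow_iff_modEq.2 (h1.of_dvd h5)
    rwa [pow_one] at this
  refine ⟨m, Nat.Coprime.mul_left ?_ ?_, fun u hu s => ?_, fun u hu s => ?_⟩
  · have := h1.gcd_eq
    rw [Nat.gcd_one_left] at this
    exact Nat.coprime_comm.1 this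
  · refine (hp.coprime_iff_not_dvd).2 fun h => hk ?_
    rw [← h3]; exact (ZMod.natCast_eq_zero_iff _ _).2 h
  · rw [mul_pow, h4 Q hQ u hu, S.map_pow, h3]
  · rw [mul_pow, h4 Q' hQ' u hu, S'.map_pow, h3]

theorem Joint.mult [Finite G] [Finite H] (J : Joint c d) (hn : n.Coprime p)
    (hQ : Nat.card Q = n) (hQ' : Nat.card Q' = n) (hp : p.Prime) (hG : Nat.card G = n * p)
    {k : ZMod p} (hk : k ≠ 0) {u : G} (hu : u ∈ Q) {u' : H} (hu' : u' ∈ Q') {s s' : ZMod p}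
    (h : c (u * S.ρ s) = d (u' * S'.ρ s')) :
    c (u * S.ρ (k * s)) = d (u' * S'.ρ (k * s')) := by
  obtain ⟨m, hm, h1, h2⟩ := S.exists_pow S' hn hQ hQ' hp k hk
  rw [← h1 u hu, ← h2 u' hu']
  exact J.pow (hG ▸ hm) h

end Mult

variable {G H C : Type} [CommGroup G] [CommGroup H] {c : G → C} {d : H → C}
  {Q : Subgroup G} {Q' : Subgroup H} {n p : ℕ}

theorem Split.sum_conv [Fintype G] [Fintype Q] [NeZero p] (S : Split Q p) (Φ : G → G → ℤ) (z : G)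
    (t : ZMod p) : ∑ x, Φ x (x⁻¹ * (z * S.ρ t)) =
      ∑ s, ∑ w : Q, Φ (w * S.ρ s) (((w : G)⁻¹ * z) * S.ρ (t - s)) := by
  rw [S.sum_eq]
  refine Finset.sum_congr rfl fun s _ => Finset.sum_congr rfl fun w _ => ?_
  congr 1
  rw [sub_eq_add_neg, S.map_add, S.map_neg]
  apply Additive.ofMul.injective; simp only [ofMul_mul, ofMul_inv]; abel

theorem Joint.sum_conv_eq [Fintype G] [Fintype H] [Fintype Q] [Fintype Q'] [NeZero p]
    (J : Joint c d) (S : Split Q p) (S' : Split Q' p) (Φ : G → G → ℤ) (Ψ : H → H → ℤ)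
    (hΦ : ∀ x y x' y', c x = d x' → c y = d y' → Φ x y = Ψ x' y')
    {z : G} {z' : H} {t : ZMod p} (h : c (z * S.ρ t) = d (z' * S'.ρ t)) :
    ∑ s, ∑ w : Q, Φ (w * S.ρ s) (((w : G)⁻¹ * z) * S.ρ (t - s)) =
      ∑ s, ∑ w : Q', Ψ (w * S'.ρ s) (((w : H)⁻¹ * z') * S'.ρ (t - s)) := by
  rw [← S.sum_conv, ← S'.sum_conv]
  exact J.sum_eq h hΦ

theorem sum_sum_eq_single {ι κ : Type} [Fintype ι] [Fintype κ] (t : ι) (F : ι → κ → ℤ)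
    (h : ∀ s, s ≠ t → ∀ w, F s w = 0) : ∑ s, ∑ w, F s w = ∑ w, F t w :=
  Finset.sum_eq_single_of_mem t (Finset.mem_univ _) fun s _ hs =>
    Finset.sum_eq_zero fun w _ => h s hs w

theorem Joint.sum_fiber_left [Fintype G] [Fintype H] [Fintype Q] [Fintype Q'] [NeZero p]
    [DecidableEq C]
    (J : Joint c d) (hJQ : JS c d (Q : Set G) Q') (S : Split Q p) (S' : Split Q' p)
    {z : G} {z' : H} {t : ZMod p} (h : c (z * S.ρ t) = d (z' * S'.ρ t)) (i j : C) :
    (∑ w : Q, if c (w * S.ρ 0) = i ∧ c ((w : G)⁻¹ * z * S.ρ t) = j then (1 : ℤ) else 0) =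
      ∑ w : Q', if d (w * S'.ρ 0) = i ∧ d ((w : H)⁻¹ * z' * S'.ρ t) = j then 1 else 0 := by
  classical
  have := J.sum_conv_eq S S' (fun x y => if x ∈ Q ∧ c x = i ∧ c y = j then (1 : ℤ) else 0)
    (fun x y => if x ∈ Q' ∧ d x = i ∧ d y = j then (1 : ℤ) else 0)
    (fun x y x' y' hx hy => by
      have := hJQ hx
      simp only [SetLike.mem_coe] at this
      simp only [hx, hy, this]) h
  rw [sum_sum_eq_single 0 _ fun s hs w => if_neg fun h => hs ((S.mem_iff w.2).1 h.1),
    sum_sum_eq_single 0 _ fun s hs w => if_neg fun h => hs ((S'.mem_iff w.2).1 h.1)] at this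
  simpa only [S.map_zero, S'.map_zero, mul_one, sub_zero, SetLike.coe_mem, true_and] using this

theorem Joint.sum_fiber_right [Fintype G] [Fintype H] [Fintype Q] [Fintype Q'] [NeZero p]
    (J : Joint c d) (hJQ : JS c d (Q : Set G) Q') (S : Split Q p) (S' : Split Q' p)
    {z : G} {z' : H} (hz : z ∈ Q) (hz' : z' ∈ Q') {t : ZMod p}
    (h : c (z * S.ρ t) = d (z' * S'.ρ t)) {i : C}
    {Φ : G → Prop} {Ψ : H → Prop} [DecidableEq C] [DecidablePred Φ] [DecidablePred Ψ]
    (hΦ : ∀ u ∈ Q, ∀ v ∈ Q', c u = d v → (Φ u ↔ Ψ v)) :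
    (∑ w : Q, if c (w * S.ρ t) = i ∧ Φ ((w : G)⁻¹ * z) then (1 : ℤ) else 0) =
      ∑ w : Q', if d (w * S'.ρ t) = i ∧ Ψ ((w : H)⁻¹ * z') then 1 else 0 := by
  classical
  have := J.sum_conv_eq S S' (fun x y => if y ∈ Q ∧ c x = i ∧ Φ y then (1 : ℤ) else 0)
    (fun x y => if y ∈ Q' ∧ d x = i ∧ Ψ y then (1 : ℤ) else 0)
    (fun x y x' y' hx hy => by
      have h1 := hJQ hy
      simp only [SetLike.mem_coe] at h1
      have h2 : y ∈ Q → (Φ y ↔ Ψ y') := fun h => hΦ y h y' (h1.1 h) hy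
      by_cases h : y ∈ Q
      · simp only [hx, h2 h, h1]
      · simp only [hx, h, h1.not.1 h, false_and, if_false]) h
  rw [sum_sum_eq_single t _ fun s hs w => if_neg fun h => hs
      (sub_eq_zero.1 ((S.mem_iff (Q.mul_mem (Q.inv_mem w.2) hz)).1 h.1)).symm,
    sum_sum_eq_single t _ fun s hs w => if_neg fun h => hs
      (sub_eq_zero.1 ((S'.mem_iff (Q'.mul_mem (Q'.inv_mem w.2) hz')).1 h.1)).symm] at this
  have h1 : ∀ w : Q, (w : G)⁻¹ * z ∈ Q := fun w => Q.mul_mem (Q.inv_mem w.2) hz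
  have h2 : ∀ w : Q', (w : H)⁻¹ * z' ∈ Q' := fun w => Q'.mul_mem (Q'.inv_mem w.2) hz'
  simpa only [S.map_zero, S'.map_zero, mul_one, sub_self, h1, h2, true_and] using this

/-- For `p = 2` the colours of the nontrivial coset of `Q` are determined by those of `Q`. -/
theorem Joint.shift_of_two [Finite G] [Finite H] (J : Joint c d) (hn : n.Coprime 2)
    (hQ : Nat.card Q = n) (hJQ : JS c d (Q : Set G) Q') (S : Split Q 2) (S' : Split Q' 2)
    {v : G} {v' : H} (hv : v ∈ Q) (hv' : v' ∈ Q') (h : c v = d v') :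
    c (v * S.ρ 1) = d (v' * S'.ρ 1) := by
  classical
  have h10 : ¬ (1 : ZMod 2) = 0 := by decide
  have h01 : ∀ s : ZMod 2, s = 0 ∨ s = 1 := by decide
  have := Fintype.ofFinite G
  have := Fintype.ofFinite H
  have hf : Fact (Nat.Prime 2) := ⟨Nat.prime_two⟩
  have h2 : c (v ^ 2) = d (v' ^ 2) :=
    (J.restrict hJQ).pow (m := 2) (by rwa [hQ]) (g := ⟨v, hv⟩) (h := ⟨v', hv'⟩) h
  have hQ' : Nat.card Q' = n := (J.card_set_eq hJQ).symm.trans hQ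
  have key : ∀ {K : Type} [CommGroup K] [Fintype K] {R : Subgroup K} (T : Split R 2) (k : K → C),
      Nat.card R = n → ∀ w ∈ R, ∀ j : C,
      (∑ x, if x ^ 2 = w ^ 2 then (if k x = j then (1 : ZMod 2) else 0) else 0) =
        (if k w = j then 1 else 0) + (if k (w * T.ρ 1) = j then 1 else 0) := by
    intro K _ _ R T k hR w hw j
    have hρ : T.ρ 1 * T.ρ 1 = 1 := by
      rw [← T.map_add, show (1 + 1 : ZMod 2) = 0 from rfl, T.map_zero]
    have hne : w ≠ w * T.ρ 1 := fun h => by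
      have := T.ρ_eq_one.1 (mul_eq_left.1 h.symm)
      exact h10 this
    rw [← Finset.sum_filter]
    have : Finset.univ.filter (fun x => x ^ 2 = w ^ 2) = {w, w * T.ρ 1} := by
      ext x
      simp only [Finset.mem_filter, Finset.mem_univ, true_and, Finset.mem_insert,
        Finset.mem_singleton]
      constructor
      · intro hx
        obtain ⟨u, hu, s, rfl⟩ := T.exists_eq x
        have hs := h01 s
        have hu2 : u ^ 2 = w ^ 2 := by
          rcases hs with rfl | rfl
          · rwa [T.map_zero, mul_one] at hx
          · rwa [mul_pow, pow_two (T.ρ 1), hρ, mul_one] at hx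
        have : u = w := by
          have h1 : (⟨u, hu⟩ : R) = ⟨w, hw⟩ :=
            (powCoprime (G := R) (n := 2) (by rwa [hR])).injective (Subtype.ext hu2)
          exact congrArg Subtype.val h1
        subst this
        rcases hs with rfl | rfl
        · left; rw [T.map_zero, mul_one]
        · right; rfl
      · rintro (rfl | rfl)
        · rfl
        · rw [mul_pow, pow_two (T.ρ 1), hρ, mul_one]
    rw [this, Finset.sum_pair hne]
  by_contra hne
  have := J.frobenius 2 (a := fun x => if c x = c (v * S.ρ 1) then 1 else 0)
    (b := fun x => if d x = c (v * S.ρ 1) then 1 else 0) (fun g h e => by simp only [e]) h2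
  rw [key S c hQ v hv, key S' d hQ' v' hv', h] at this
  have := add_left_cancel this
  rw [if_pos rfl, if_neg (Ne.symm hne)] at this
  exact h10 this

/-- The colouring of a coset of a Hall `A`-subgroup behaves like an S-ring. -/
theorem Joint.exists_fiber_equiv [Finite G] [Finite H] (J : Joint c d) (hp : p.Prime)
    (hn : n.Coprime p) (hG : Nat.card G = n * p)
    (hQ : Nat.card Q = n) (hJQ : JS c d (Q : Set G) Q') (S : Split Q p) (S' : Split Q' p)
    {z : G} {z' : H} (hz : z ∈ Q) (hz' : z' ∈ Q') (h : c (z * S.ρ 1) = d (z' * S'.ρ 1)) :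
    ∃ e : Q ≃ Q', ∀ w : Q, c (w * S.ρ 1) = d (e w * S'.ρ 1) ∧
      c ((w : G)⁻¹ * z * S.ρ (-1)) = d ((e w : H)⁻¹ * z' * S'.ρ (-1)) := by
  classical
  have := Fintype.ofFinite G
  have := Fintype.ofFinite H
  have := Fact.mk hp
  have hQ' : Nat.card Q' = n := (J.card_set_eq hJQ).symm.trans hQ
  suffices hF : ∀ i j : C, (∑ w : Q, if c (w * S.ρ 1) = i ∧ c ((w : G)⁻¹ * z * S.ρ (-1)) = j
      then (1 : ℤ) else 0) = ∑ w : Q', if d (w * S'.ρ 1) = i ∧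
        d ((w : H)⁻¹ * z' * S'.ρ (-1)) = j then 1 else 0 by
    obtain ⟨e, he⟩ := exists_equiv_of_card_fiber
      (fun w : Q => (c (w * S.ρ 1), c ((w : G)⁻¹ * z * S.ρ (-1))))
      (fun w : Q' => (d (w * S'.ρ 1), d ((w : H)⁻¹ * z' * S'.ρ (-1)))) fun k => by
        obtain ⟨i, j⟩ := k
        have := hF i j
        simp only [Finset.sum_boole, Nat.cast_inj] at this
        simp only [Prod.mk.injEq, Nat.card_eq_fintype_card, Fintype.card_subtype]
        exact this
    exact ⟨e, fun w => by simpa using he w⟩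
  intro i j
  by_cases h2 : p = 2
  · subst h2
    have hJ := J.sum_fiber_right hJQ S S' hz hz' h (i := i)
      (Φ := fun u => c (u * S.ρ 1) = j) (Ψ := fun u => d (u * S'.ρ 1) = j)
      fun u hu v hv e => by rw [J.shift_of_two hn hQ hJQ S S' hu hv e]
    exact hJ
  have hmul : ∀ {k : ZMod p}, k ≠ 0 → c (z * S.ρ k) = d (z' * S'.ρ k) := fun {k} hk => by
    have := J.mult S S' hn hQ hQ' hp hG hk hz hz' h
    rwa [mul_one] at this
  let E : ZMod p → ZMod p → ℤ := fun a b =>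
    (∑ w : Q, if c (w * S.ρ a) = i ∧ c ((w : G)⁻¹ * z * S.ρ b) = j then (1 : ℤ) else 0) -
      ∑ w : Q', if d (w * S'.ρ a) = i ∧ d ((w : H)⁻¹ * z' * S'.ρ b) = j then 1 else 0
  have hE0 : ∀ b, b ≠ 0 → E 0 b = 0 := fun b hb =>
    sub_eq_zero.2 (J.sum_fiber_left hJQ S S' (hmul hb) i j)
  have hE0' : ∀ a, a ≠ 0 → E a 0 = 0 := fun a ha => by
    refine sub_eq_zero.2 (J.sum_fiber_right hJQ S S' hz hz' (hmul ha)
      (Φ := fun u => c (u * S.ρ 0) = j) (Ψ := fun u => d (u * S'.ρ 0) = j) fun u _ v _ e => ?_)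
    rw [S.map_zero, S'.map_zero, mul_one, mul_one, e]
  have hE : ∀ μ ν : ZMod p, μ ≠ 0 → ν ≠ 0 → ∑ s, E (μ * s) (ν * (1 - s)) = 0 := by
    intro μ ν hμ hν
    obtain ⟨m, hm, hm1, hm2⟩ := S.exists_pow S' hn hQ hQ' hp μ hμ
    obtain ⟨l, hl, hl1, hl2⟩ := S.exists_pow S' hn hQ hQ' hp ν hν
    have := J.sum_conv_eq S S'
      (fun x y => if c (x ^ m) = i ∧ c (y ^ l) = j then (1 : ℤ) else 0)
      (fun x y => if d (x ^ m) = i ∧ d (y ^ l) = j then (1 : ℤ) else 0)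
      (fun x y x' y' hx hy => by rw [J.pow (hG ▸ hm) hx, J.pow (hG ▸ hl) hy]) h
    simp only [E]
    rw [Finset.sum_sub_distrib, sub_eq_zero]
    refine (Finset.sum_congr rfl fun s _ => Finset.sum_congr rfl fun w _ => ?_).trans
      (this.trans (Finset.sum_congr rfl fun s _ => Finset.sum_congr rfl fun w _ => ?_))
    · rw [hm1 _ w.2, hl1 _ (Q.mul_mem (Q.inv_mem w.2) hz)]
    · rw [hm2 _ w.2, hl2 _ (Q'.mul_mem (Q'.inv_mem w.2) hz')]
  have key := eq_zero_of_line_sums (K := ZMod p) (by rwa [ZMod.card])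
    (fun a b => if a = 0 ∨ b = 0 then 0 else E a b) (fun v => if_pos (Or.inl rfl))
    (fun u => if_pos (Or.inr rfl)) (fun μ ν hμ hν => by
      refine (Finset.sum_congr rfl fun s _ => ?_).trans (hE μ ν hμ hν)
      by_cases hs : s = 0
      · subst hs
        rw [mul_zero, if_pos (Or.inl rfl), hE0 _ (by simpa using hν)]
      by_cases hs1 : s = 1
      · subst hs1
        rw [sub_self, mul_zero, if_pos (Or.inr rfl), hE0' _ (by simpa using hμ)]
      · rw [if_neg]
        simp [hμ, hν, hs, sub_eq_zero, Ne.symm hs1]) 1 (-1)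
  simp only [one_ne_zero, neg_eq_zero, or_self, if_false] at key
  exact sub_eq_zero.1 key

variable {G H C : Type} [CommGroup G] [CommGroup H] {c : G → C} {d : H → C}

theorem qcol_restrict {L U : Subgroup G} (hLU : L ≤ U) (u : U) :
    qcol (fun u : U => c u) (L.subgroupOf U) (u : U ⧸ L.subgroupOf U) =
      qcol c L ((u : G) : G ⧸ L) := by
  ext k
  rw [mem_qcol, mem_qcol]
  constructor
  · rintro ⟨l, hl, h⟩
    exact ⟨l, Subgroup.mem_subgroupOf.1 hl, h⟩
  · rintro ⟨l, hl, h⟩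
    exact ⟨⟨l, hLU hl⟩, Subgroup.mem_subgroupOf.2 hl, h⟩

theorem JI.qcol_eq {L : Subgroup G} {L' : Subgroup H} {g : G ⧸ L → H ⧸ L'}
    (hg : JI (qcol c L) (qcol d L') g) (hg1 : g 1 = 1) (q : G ⧸ L) :
    qcol c L q = qcol d L' (g q) := by
  simpa [hg1] using hg 1 q

theorem mk_subgroupOf_eq {L U : Subgroup G} {u v : U} :
    (u : U ⧸ L.subgroupOf U) = v ↔ ((u : G) : G ⧸ L) = (v : G) := by
  rw [QuotientGroup.eq, QuotientGroup.eq, Subgroup.mem_subgroupOf]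
  simp

/-- Lifting along a generalised wreath product whose inner group has order `9`. -/
theorem Joint.exists_ji_of_wedge_nine [Finite G] [Finite H] (J : Joint c d) {L U : Subgroup G}
    {L' U' : Subgroup H} (hL : JS c d (L : Set G) (L' : Set H))
    (hU : JS c d (U : Set G) (U' : Set H)) (hLU : L ≤ U) (hcL : Nat.card L = 3)
    (hcU : Nat.card U = 9) (hr : ∀ x ∉ U, ∀ l ∈ L, c (x * l) = c x)
    (h₂ : ∃ f₂ : G ⧸ L → H ⧸ L', JI (qcol c L) (qcol d L') f₂) : ∃ f : G → H, JI c d f := by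
  obtain ⟨f₂, h₂⟩ := h₂
  suffices h : ∀ t : G, ∃ f₁ : U → U', JI (fun u : U => c u) (fun u : U' => d u) f₁ ∧
      ∀ u : U, (((f₁ u : U') : H) : H ⧸ L') = (f₂ (t : G ⧸ L))⁻¹ * f₂ ((t * u : G) : G ⧸ L) by
    obtain ⟨f, hf, -⟩ := J.exists_ji_of_wedge hL hU hr f₂ h₂ h
    exact ⟨f, hf⟩
  intro t
  have hLU' : L' ≤ U' := fun l hl => by
    obtain ⟨x, hx⟩ := J.exists_left l
    exact (hU hx).1 (hLU ((hL hx).2 hl))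
  let g0 : G ⧸ L → H ⧸ L' := fun q => f₂ ((t : G ⧸ L) * q) * (f₂ (t : G ⧸ L))⁻¹
  have hg0 : JI (qcol c L) (qcol d L') g0 := (h₂.comp_mul (t : G ⧸ L)).mul_const _
  have hg01 : g0 1 = 1 := by simp [g0]
  have hF : ∀ u : U, ∃ v : U', ((v : H) : H ⧸ L') = g0 ((u : G) : G ⧸ L) := by
    intro u
    obtain ⟨h, hh⟩ := QuotientGroup.mk_surjective (g0 ((u : G) : G ⧸ L))
    have h1 := hg0.qcol_eq hg01 ((u : G) : G ⧸ L)
    rw [← hh] at h1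
    obtain ⟨l, hl, h2⟩ := exists_mul_of_qcol_eq h1
    exact ⟨⟨h, (U'.mul_mem_cancel_right (hLU' hl)).1 ((hU h2).1 u.2)⟩, hh⟩
  choose F hF using hF
  let g : U ⧸ L.subgroupOf U → U' ⧸ L'.subgroupOf U' := fun q => (F q.out : U' ⧸ L'.subgroupOf U')
  have hgF : ∀ u : U, g (u : U ⧸ L.subgroupOf U) = (F u : U' ⧸ L'.subgroupOf U') := fun u => by
    refine mk_subgroupOf_eq.2 ?_
    rw [hF, hF, mk_subgroupOf_eq.1 (QuotientGroup.out_eq' (u : U ⧸ L.subgroupOf U))]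
  have hg : JI (qcol (fun u : U => c u) (L.subgroupOf U))
      (qcol (fun u : U' => d u) (L'.subgroupOf U')) g := by
    intro x y
    induction x using QuotientGroup.induction_on with | _ x
    induction y using QuotientGroup.induction_on with | _ y
    rw [hgF, hgF, ← QuotientGroup.mk_inv, ← QuotientGroup.mk_inv, ← QuotientGroup.mk_mul,
      ← QuotientGroup.mk_mul, qcol_restrict hLU, qcol_restrict hLU']
    have := hg0 ((x : G) : G ⧸ L) ((y : G) : G ⧸ L)
    rw [← hF, ← hF] at this
    exact this
  have hLr : JS (fun u : U => c u) (fun u : U' => d u) (L.subgroupOf U : Set U)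
      (L'.subgroupOf U' : Set U') := fun u v e => by
    simp only [SetLike.mem_coe, Subgroup.mem_subgroupOf]
    exact hL e
  have hg1 : g 1 = 1 := by
    rw [← QuotientGroup.mk_one, hgF, ← QuotientGroup.mk_one, mk_subgroupOf_eq, hF]
    simpa using hg01
  obtain ⟨f, hf, -, hfg⟩ := (J.restrict hU).lift_of_card_nine hLr hcU (by
    rw [Nat.card_congr (Subgroup.subgroupOfEquivOfLe hLU).toEquiv, hcL]) hg hg1
  refine ⟨f, hf, fun u => ?_⟩
  have := hfg u
  rw [hgF, mk_subgroupOf_eq, hF] at this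
  rw [this, mul_comm]
  rfl

variable {G H C : Type} [CommGroup G] [CommGroup H] {c : G → C} {d : H → C}

/-- The stabiliser of the colouring of a union of classes. -/
theorem Joint.exists_radical [Finite G] (J : Joint c c) {X : Set G} (hX : JS c c X X) :
    ∃ R : Subgroup G, JS c c (R : Set G) R ∧ ∀ g, g ∈ R ↔ ∀ y ∈ X, c (y * g) = c y := by
  have hmul : ∀ g h, (∀ y ∈ X, c (y * g) = c y) → (∀ y ∈ X, c (y * h) = c y) →
      ∀ y ∈ X, c (y * (g * h)) = c y := fun g h hg hh y hy => by
    rw [← mul_assoc, hh _ ((hX (hg y hy)).2 hy), hg y hy]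
  refine ⟨{ carrier := {g | ∀ y ∈ X, c (y * g) = c y}
            one_mem' := fun y _ => by rw [mul_one]
            mul_mem' := fun {g h} hg hh => hmul g h hg hh
            inv_mem' := fun {g} hg => ?_ }, ?_, fun g => Iff.rfl⟩
  · have : ∀ m : ℕ, ∀ y ∈ X, c (y * g ^ m) = c y := fun m => by
      induction m with
      | zero => intro y _; rw [pow_zero, mul_one]
      | succ m ih => rw [pow_succ]; exact hmul _ _ ih hg
    have h1 : g⁻¹ = g ^ (orderOf g - 1) := by
      rw [inv_eq_iff_mul_eq_one, ← pow_succ', Nat.sub_add_cancel (orderOf_pos g),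
        pow_orderOf_eq_one]
    intro y hy
    rw [h1]
    exact this _ y hy
  · have key : ∀ g h, c g = c h → (∀ y ∈ X, c (y * g) = c y) → ∀ y ∈ X, c (y * h) = c y := by
      intro g h e hg y hy
      obtain ⟨E, hE⟩ := J.exists_equiv e
      have h1 := hE (E.symm y⁻¹)
      rw [E.apply_symm_apply, inv_inv] at h1
      have h2 : c (E.symm y⁻¹)⁻¹ = c y := by rw [J.inv h1.1, inv_inv]
      rw [← h1.2, hg _ ((hX h2).2 hy), h2]
    exact fun g h e => ⟨key g h e, key h g e.symm⟩

section Hall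

variable {Q : Subgroup G} {Q' : Subgroup H} {n p : ℕ}

theorem Joint.exists_fiber_equiv' [Finite G] [Finite H] (J : Joint c d) (hp : p.Prime)
    (hn : n.Coprime p) (hG : Nat.card G = n * p)
    (hQ : Nat.card Q = n) (hJQ : JS c d (Q : Set G) Q') (S : Split Q p) (S' : Split Q' p)
    {z : G} {z' : H} (hz : z ∈ Q) (hz' : z' ∈ Q') (h : c (z * S.ρ 1) = d (z' * S'.ρ 1)) :
    ∃ e : Q ≃ Q', ∀ w : Q, c (w * S.ρ 1) = d (e w * S'.ρ 1) ∧
      c ((w : G) * z⁻¹ * S.ρ 1) = d ((e w : H) * z'⁻¹ * S'.ρ 1) := by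
  obtain ⟨e, he⟩ := J.exists_fiber_equiv hp hn hG hQ hJQ S S' hz hz' h
  refine ⟨e, fun w => ⟨(he w).1, ?_⟩⟩
  have := J.inv (he w).2
  rw [S.map_neg, S'.map_neg] at this
  simpa only [mul_inv_rev, inv_inv, mul_comm] using this

theorem Joint.exists_split_right [Finite G] [Finite H] (J : Joint c d) (hp : p.Prime)
    (hn : n.Coprime p) (hG : Nat.card G = n * p)
    (hQ : Nat.card Q = n) (hJQ : JS c d (Q : Set G) Q') (S : Split Q p) :
    ∃ S' : Split Q' p, c (S.ρ 1) = d (S'.ρ 1) := by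
  have := Fact.mk hp
  have hQ' : Nat.card Q' = n := (J.card_set_eq hJQ).symm.trans hQ
  obtain ⟨S₀⟩ := exists_split hp hn hQ' (J.card_eq.symm.trans hG)
  obtain ⟨h, hh⟩ := J.exists_right (S.ρ 1)
  obtain ⟨z, hz, k, rfl⟩ := S₀.exists_eq h
  have hk : k ≠ 0 := by
    rintro rfl
    have h1 : S.ρ 1 ∈ Q := (hJQ hh).2 (by rw [S₀.map_zero, mul_one]; exact hz)
    have h2 := (S.mem_iff (s := 1) Q.one_mem).1 (by rwa [one_mul])
    exact one_ne_zero h2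
  have hρ : (S₀.scale k hk).ρ 1 = S₀.ρ k := by simp [Split.scale]
  rw [← hρ] at hh
  obtain ⟨e, he⟩ := J.exists_fiber_equiv' hp hn hG hQ hJQ S (S₀.scale k hk) Q.one_mem hz
    (by rwa [one_mul])
  refine ⟨S₀.scale k hk, ?_⟩
  have h1 := he (e.symm ⟨z, hz⟩)
  rw [e.apply_symm_apply, inv_one, mul_one, mul_inv_cancel, one_mul] at h1
  rw [hh, ← h1.1, h1.2]

theorem Joint.exists_ji_of_faithful [Finite G] [Finite H] (J : Joint c d) (hp : p.Prime)
    (hn : n.Coprime p) (hsep : Sep n) (hG : Nat.card G = n * p)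
    (hQ : Nat.card Q = n) (hJQ : JS c d (Q : Set G) Q') (S : Split Q p)
    (hL : ∀ u ∈ Q, c (u * S.ρ 1) = c (S.ρ 1) → u = 1) : ∃ f : G → H, JI c d f := by
  have := Fact.mk hp
  have hQ' : Nat.card Q' = n := (J.card_set_eq hJQ).symm.trans hQ
  obtain ⟨S', h1⟩ := J.exists_split_right hp hn hG hQ hJQ S
  have hone : ∀ {g : G} {h : H}, g ∈ Q → h ∈ Q' → c (g * S.ρ 1) = d (h * S'.ρ 1) →
      (g = 1 ↔ h = 1) := by
    intro g h hg hh e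
    constructor
    · rintro rfl
      obtain ⟨E, hE⟩ := J.exists_fiber_equiv' hp hn hG hQ hJQ S S' Q.one_mem Q'.one_mem
        (by rwa [one_mul, one_mul])
      have key : ∀ v : Q', d (v * S'.ρ 1) = d (S'.ρ 1) → E.symm v = 1 := fun v hv => by
        have h2 := (hE (E.symm v)).1
        rw [E.apply_symm_apply, hv, ← h1] at h2
        exact Subtype.ext (hL _ (E.symm v).2 h2)
      have h3 := key 1 (by rw [OneMemClass.coe_one, one_mul])
      have h4 := key ⟨h, hh⟩ (by rw [← e, one_mul, h1])
      have h5 := E.symm.injective (h4.trans h3.symm)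
      exact congrArg Subtype.val h5
    · rintro rfl
      exact hL g hg (by rw [e, one_mul, h1])
  have hinv : ∀ {g : G} {h : H}, g ∈ Q → h ∈ Q' → c (g * S.ρ 1) = d (h * S'.ρ 1) →
      c (g⁻¹ * S.ρ 1) = d (h⁻¹ * S'.ρ 1) := by
    intro g h hg hh e
    obtain ⟨E, hE⟩ := J.exists_fiber_equiv' hp hn hG hQ hJQ S S' hg hh e
    have h2 := hE 1
    have h3 := (hone Q.one_mem (E 1).2 h2.1).1 rfl
    simp only [h3, OneMemClass.coe_one, one_mul] at h2
    exact h2.2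
  have K : Joint (fun u : Q => c (u * S.ρ 1)) (fun u : Q' => d (u * S'.ρ 1)) :=
    { map_one := by simpa using h1
      one_iff := fun {g h} e => by simpa using hone g.2 h.2 e
      inv := fun {g h} e => hinv g.2 h.2 e
      exists_equiv := fun {z z'} e => by
        obtain ⟨E, hE⟩ := J.exists_fiber_equiv' hp hn hG hQ hJQ S S' z.2 z'.2 e
        refine ⟨E, fun x => ⟨(hE x).1, ?_⟩⟩
        have := hinv (Q.mul_mem x.2 (Q.inv_mem z.2)) (Q'.mul_mem (E x).2 (Q'.inv_mem z'.2)) (hE x).2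
        simpa only [mul_inv_rev, inv_inv, mul_comm, Subgroup.coe_mul, Subgroup.coe_inv] using this }
  have href : ∀ z ∈ Q, ∀ z' ∈ Q', c (z * S.ρ 1) = d (z' * S'.ρ 1) → c z = d z' := by
    intro z hz z' hz' e
    obtain ⟨E, hE⟩ := J.exists_equiv e
    have h2 := hE z
    have h3 : E z ∈ Q' := (hJQ h2.1).1 hz
    rw [← mul_assoc, ← mul_assoc, inv_mul_cancel] at h2
    have h4 := (hone Q.one_mem (Q'.mul_mem (Q'.inv_mem h3) hz') h2.2).1 rfl
    rw [h2.1, inv_mul_eq_one.1 h4]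
  obtain ⟨f, hf⟩ := hsep Q Q' C _ _ hQ K
  let E := Equiv.ofBijective _ S.bij
  have hE : ∀ w, E w = (w.1 : G) * S.ρ w.2 := fun w => rfl
  refine ⟨fun g => f (E.symm g).1 * S'.ρ (E.symm g).2, fun g h => ?_⟩
  obtain ⟨⟨u, s⟩, rfl⟩ := E.surjective g
  obtain ⟨⟨v, t⟩, rfl⟩ := E.surjective h
  simp only [E.symm_apply_apply]
  rw [hE, hE]
  have e1 : (v : G) * S.ρ t * (u * S.ρ s)⁻¹ = ((v * u⁻¹ : Q) : G) * S.ρ (t - s) := by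
    rw [sub_eq_add_neg, S.map_add, S.map_neg]
    simp only [Subgroup.coe_mul, Subgroup.coe_inv]
    apply Additive.ofMul.injective; simp only [ofMul_mul, ofMul_inv]; abel
  have e2 : (f v : H) * S'.ρ t * (f u * S'.ρ s)⁻¹ =
      ((f v * (f u)⁻¹ : Q') : H) * S'.ρ (t - s) := by
    rw [sub_eq_add_neg, S'.map_add, S'.map_neg]
    simp only [Subgroup.coe_mul, Subgroup.coe_inv]
    apply Additive.ofMul.injective; simp only [ofMul_mul, ofMul_inv]; abel
  rw [e1, e2]
  have h2 := hf u v
  by_cases hts : t - s = 0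
  · rw [hts, S.map_zero, S'.map_zero, mul_one, mul_one]
    exact href _ (v * u⁻¹ : Q).2 _ (f v * (f u)⁻¹ : Q').2 h2
  · have := J.mult S S' hn hQ hQ' hp hG hts (v * u⁻¹ : Q).2 (f v * (f u)⁻¹ : Q').2 h2
    rwa [mul_one] at this

theorem sep_prime (hp : p.Prime) : Sep p := by
  intro G H C _ _ _ _ c d hG J
  have h1 : JS c d ((⊥ : Subgroup G) : Set G) ((⊥ : Subgroup H) : Set H) := fun g h e => by
    simpa using J.one_iff e
  obtain ⟨S⟩ := exists_split (Q := (⊥ : Subgroup G)) (n := 1) hp (Nat.coprime_one_left p)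
    (by simp) (by rw [hG, one_mul])
  exact J.exists_ji_of_faithful hp (Nat.coprime_one_left p) sep_one (by rw [hG, one_mul])
    (by simp) h1 S fun u hu _ => Subgroup.mem_bot.1 hu

theorem Joint.exists_ji_of_hall_of [Finite G] [Finite H] (J : Joint c d) (hp : p.Prime)
    (hn : n.Coprime p) (hsep : Sep n) (hG : Nat.card G = n * p)
    (hQ : Nat.card Q = n) (hJQ : JS c d (Q : Set G) Q')
    (hmid : ∀ L ≤ Q, L ≠ ⊥ → L ≠ Q → JS c c (L : Set G) L →
      (∀ x ∉ Q, ∀ l ∈ L, c (x * l) = c x) → ∃ f : G → H, JI c d f) :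
    ∃ f : G → H, JI c d f := by
  have := Fact.mk hp
  have hQQ : JS c c (Q : Set G) Q := hJQ.left J
  obtain ⟨S⟩ := exists_split hp hn hQ hG
  obtain ⟨R, hR, hRm⟩ := J.left.exists_radical hQQ.compl
  have hr : ∀ x ∉ Q, ∀ l ∈ R ⊓ Q, c (x * l) = c x := fun x hx l hl =>
    (hRm l).1 (Subgroup.mem_inf.1 hl).1 x hx
  by_cases h1 : R ⊓ Q = ⊥
  · refine J.exists_ji_of_faithful hp hn hsep hG hQ hJQ S fun u hu e => ?_
    rw [← Subgroup.mem_bot, ← h1, Subgroup.mem_inf]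
    refine ⟨(hRm u).2 fun y hy => ?_, hu⟩
    obtain ⟨w, hw, s, rfl⟩ := S.exists_eq y
    have hs : s ≠ 0 := fun h => hy ((S.mem_iff hw).2 h)
    obtain ⟨E, hE⟩ := J.left.exists_fiber_equiv' hp hn hG hQ hQQ S S hu Q.one_mem
      (by rw [e, one_mul])
    have key : ∀ w : Q, c (w * u⁻¹ * S.ρ 1) = c (w * S.ρ 1) := fun w => by
      rw [(hE w).2, (hE w).1, inv_one, mul_one]
    have h2 := key (⟨w, hw⟩ * ⟨u, hu⟩)
    simp only [Subgroup.coe_mul, mul_inv_cancel_right] at h2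
    have h3 := J.left.mult S S hn hQ hQ hp hG hs (Q.mul_mem hw hu) hw h2.symm
    rw [mul_one] at h3
    rw [mul_right_comm, h3]
  by_cases h2 : R ⊓ Q = Q
  · rw [h2] at hr
    have hc : Nat.card (G ⧸ Q) = p := by
      have := Q.card_eq_card_quotient_mul_card_subgroup
      rw [hG, hQ, mul_comm] at this
      exact (Nat.eq_of_mul_eq_mul_right (by rw [← hQ]; exact Nat.card_pos) this).symm
    obtain ⟨f₂, h₂⟩ := sep_prime hp _ _ _ _ _ hc (J.quotient hJQ)
    obtain ⟨f, hf, -⟩ := J.exists_ji_of_wreath hJQ hr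
      (hsep Q Q' C _ _ hQ (J.restrict hJQ)) f₂ h₂
    exact ⟨f, hf⟩
  · refine hmid _ inf_le_right h1 h2 ?_ hr
    have := hR.inter hQQ
    rwa [← Subgroup.coe_inf] at this

theorem Joint.map_subgroup (J : Joint c d) {L U : Subgroup G} {L' U' : Subgroup H}
    (hL : JS c d (L : Set G) (L' : Set H)) (hU : JS c d (U : Set G) (U' : Set H)) (hLU : L ≤ U) :
    JS (qcol c L) (qcol d L') (U.map (QuotientGroup.mk' L) : Set (G ⧸ L))
      (U'.map (QuotientGroup.mk' L') : Set (H ⧸ L')) := by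
  have hLU' : L' ≤ U' := fun l hl => by
    obtain ⟨x, hx⟩ := J.exists_left l
    exact (hU hx).1 (hLU ((hL hx).2 hl))
  have key : ∀ {K : Type} [CommGroup K] {M V : Subgroup K}, M ≤ V → ∀ g : K,
      ((g : K ⧸ M) ∈ V.map (QuotientGroup.mk' M) ↔ g ∈ V) := by
    intro K _ M V hMV g
    rw [Subgroup.mem_map]
    constructor
    · rintro ⟨x, hx, e⟩
      have h1 := QuotientGroup.eq.1 e
      have := V.mul_mem hx (hMV h1)
      rwa [mul_inv_cancel_left] at this
    · exact fun hg => ⟨g, hg, rfl⟩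
  intro x y e
  induction x using QuotientGroup.induction_on with | _ g
  induction y using QuotientGroup.induction_on with | _ h
  rw [SetLike.mem_coe, SetLike.mem_coe, key hLU, key hLU']
  obtain ⟨l, hl, h'⟩ := exists_mul_of_qcol_eq e
  rw [← U'.mul_mem_cancel_right (hLU' hl)]
  exact hU h'

theorem card_map_mk [Finite G] {L U : Subgroup G} (hLU : L ≤ U) :
    Nat.card (U.map (QuotientGroup.mk' L)) * Nat.card L = Nat.card U := by
  rw [← Subgroup.relIndex_ker, QuotientGroup.ker_mk', mul_comm, ← Subgroup.relIndex_bot_left,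
    ← Subgroup.relIndex_bot_left]
  exact Subgroup.relIndex_mul_relIndex ⊥ L U bot_le hLU

theorem Joint.exists_ji_of_hall_three [Finite G] [Finite H] (J : Joint c d) (hp : p.Prime)
    (hn : Nat.Coprime 3 p) (hG : Nat.card G = 3 * p)
    (hQ : Nat.card Q = 3) (hJQ : JS c d (Q : Set G) Q') : ∃ f : G → H, JI c d f := by
  refine J.exists_ji_of_hall_of hp hn sep_three hG hQ hJQ fun L hL h1 h2 _ _ => ?_
  have h3 := Subgroup.card_dvd_of_le hL
  rw [hQ, Nat.dvd_prime Nat.prime_three] at h3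
  rcases h3 with h3 | h3
  · exact absurd (Subgroup.card_eq_one.1 h3) h1
  · exact absurd (Subgroup.eq_of_le_of_card_ge hL (by rw [hQ, h3])) h2

theorem Joint.exists_ji_of_hall_nine [Finite G] [Finite H] (J : Joint c d) (hp : p.Prime)
    (hn : Nat.Coprime 9 p) (hG : Nat.card G = 9 * p)
    (hQ : Nat.card Q = 9) (hJQ : JS c d (Q : Set G) Q') : ∃ f : G → H, JI c d f := by
  refine J.exists_ji_of_hall_of hp hn sep_nine hG hQ hJQ fun L hL h1 h2 hLL hr => ?_
  have h3 := Subgroup.card_dvd_of_le hL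
  rw [hQ, show 9 = 3 ^ 2 by norm_num, Nat.dvd_prime_pow Nat.prime_three] at h3
  have hcL : Nat.card L = 3 := by
    obtain ⟨k, hk, h3⟩ := h3
    interval_cases k
    · exact absurd (Subgroup.card_eq_one.1 h3) h1
    · simpa using h3
    · exact absurd (Subgroup.eq_of_le_of_card_ge hL (by rw [hQ, h3]; norm_num)) h2
  obtain ⟨L', hL'⟩ := J.exists_subgroup L hLL
  refine J.exists_ji_of_wedge_nine hL' hJQ hL hcL hQ hr ?_
  have hc1 := card_map_mk hL
  rw [hcL, hQ] at hc1
  have hc2 := L.card_eq_card_quotient_mul_card_subgroup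
  rw [hG, hcL] at hc2
  exact (J.quotient hL').exists_ji_of_hall_three hp (Nat.Coprime.coprime_dvd_left (by norm_num) hn)
    (by omega) (by omega) (J.map_subgroup hL' hJQ hL)

end Hall

variable {G H C : Type} [CommGroup G] [CommGroup H] {c : G → C} {d : H → C}

theorem sep_of_dvd_nine {n : ℕ} (hn : n ∣ 9) : Sep n := by
  have : n = 1 ∨ n = 3 ∨ n = 9 := by
    have h1 := Nat.le_of_dvd (by norm_num) hn
    interval_cases n <;> revert hn <;> decide
  rcases this with rfl | rfl | rfl
  exacts [sep_one, sep_three, sep_nine]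

theorem Joint.exists_stab [Finite G] {D : Type} (J : Joint c c) {φ : G → D}
    (hφ : ∀ g h, c g = c h → φ g = φ h) :
    ∃ R : Subgroup G, JS c c (R : Set G) R ∧ ∀ g, g ∈ R ↔ ∀ y, φ (y * g) = φ y := by
  refine ⟨{ carrier := {g | ∀ y, φ (y * g) = φ y}
            one_mem' := fun y => by rw [mul_one]
            mul_mem' := fun {g h} hg hh y => by rw [← mul_assoc, hh, hg]
            inv_mem' := fun {g} hg y => by rw [← hg, inv_mul_cancel_right] }, ?_, fun g => Iff.rfl⟩
  have key : ∀ g h, c g = c h → (∀ y, φ (y * g) = φ y) → ∀ y, φ (y * h) = φ y := by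
    intro g h e hg y
    obtain ⟨E, hE⟩ := J.exists_equiv e
    have h1 := hE (E.symm y⁻¹)
    rw [E.apply_symm_apply, inv_inv] at h1
    have h3 : φ (E.symm y⁻¹)⁻¹ = φ y := by simpa using hφ _ _ (J.inv h1.1)
    rw [← hφ _ _ h1.2, hg, h3]
  exact fun g h e => ⟨key g h e, key h g e.symm⟩

/-- The largest subgroup inside a union `U` of classes, stabilising `U` and the colours of its
complement, is a union of classes. -/
theorem Joint.exists_core [Finite G] (J : Joint c c) {U : Set G} (hU : JS c c U U)
    (h1 : (1 : G) ∈ U) : ∃ R : Subgroup G, JS c c (R : Set G) R ∧ (R : Set G) ⊆ U ∧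
      (∀ y ∉ U, ∀ l ∈ R, c (y * l) = c y) ∧
      ∀ g, (∀ y ∈ U, y * g ∈ U) → (∀ y ∉ U, c (y * g) = c y) → g ∈ R := by
  classical
  obtain ⟨R, hR, hRm⟩ := J.exists_stab (φ := fun y => if y ∈ U then none else some (c y))
    fun g h e => by simp only [hU e, e]
  refine ⟨R, hR, fun g hg => ?_, fun y hy l hl => ?_, fun g h2 h3 => (hRm g).2 fun y => ?_⟩
  · have := (hRm g).1 hg 1
    by_contra h
    simp [h, h1] at this
  · have := (hRm l).1 hl y
    simp only [hy, if_false] at this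
    split_ifs at this
    exact Option.some.inj this
  · by_cases hy : y ∈ U
    · simp [hy, h2 y hy]
    · have h4 := h3 y hy
      have h5 : y * g ∉ U := fun h => hy ((hU h4).1 h)
      simp [hy, h5, h4]

theorem Joint.exists_ji_of_wreath_nine [Finite G] [Finite H] (J : Joint c d) {U : Subgroup G}
    {U' : Subgroup H} (hU : JS c d (U : Set G) (U' : Set H))
    (hr : ∀ x ∉ U, ∀ l ∈ U, c (x * l) = c x)
    (h₁ : ∃ f : U → U', JI (fun u : U => c u) (fun u : U' => d u) f)
    (hc : Nat.card (G ⧸ U) ∣ 9) : ∃ f : G → H, JI c d f := by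
  obtain ⟨f₂, h₂⟩ := sep_of_dvd_nine hc _ _ _ _ _ rfl (J.quotient hU)
  obtain ⟨f, hf, -⟩ := J.exists_ji_of_wreath hU hr h₁ f₂ h₂
  exact ⟨f, hf⟩

/-- Induced bijections of a product of two `A`-subgroups. -/
theorem exists_ji_of_prod {K L : Subgroup G} {K' L' : Subgroup H}
    (hprod : ∀ g, ∃ k ∈ K, ∃ l ∈ L, g = k * l)
    (hcomb : ∀ k ∈ K, ∀ l ∈ L, ∀ k' ∈ K', ∀ l' ∈ L', c k = d k' → c l = d l' →
      c (k * l) = d (k' * l'))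
    (h₁ : ∃ f : K → K', JI (fun u : K => c u) (fun u : K' => d u) f)
    (h₂ : ∃ f : L → L', JI (fun u : L => c u) (fun u : L' => d u) f) :
    ∃ f : G → H, JI c d f := by
  obtain ⟨f₁, h₁⟩ := h₁
  obtain ⟨f₂, h₂⟩ := h₂
  have hprod' : ∀ g, ∃ w : K × L, g = (w.1 : G) * (w.2 : G) := fun g => by
    obtain ⟨k, hk, l, hl, e⟩ := hprod g
    exact ⟨(⟨k, hk⟩, ⟨l, hl⟩), e⟩
  choose w hw using hprod'
  refine ⟨fun g => f₁ (w g).1 * f₂ (w g).2, fun g h => ?_⟩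
  have e1 : h * g⁻¹ = (((w h).1 * (w g).1⁻¹ : K) : G) * (((w h).2 * (w g).2⁻¹ : L) : G) := by
    conv_lhs => rw [hw g, hw h]
    simp only [Subgroup.coe_mul, Subgroup.coe_inv]
    apply Additive.ofMul.injective; simp only [ofMul_mul, ofMul_inv]; abel
  have e2 : ((f₁ (w h).1 : H) * f₂ (w h).2) * ((f₁ (w g).1 : H) * f₂ (w g).2)⁻¹ =
      ((f₁ (w h).1 * (f₁ (w g).1)⁻¹ : K') : H) * ((f₂ (w h).2 * (f₂ (w g).2)⁻¹ : L') : H) := by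
    simp only [Subgroup.coe_mul, Subgroup.coe_inv]
    apply Additive.ofMul.injective; simp only [ofMul_mul, ofMul_inv]; abel
  rw [e1, e2]
  exact hcomb _ (SetLike.coe_mem _) _ (SetLike.coe_mem _) _ (SetLike.coe_mem _) _
    (SetLike.coe_mem _) (h₁ _ _) (h₂ _ _)

section Split

variable {Q : Subgroup G} {n p : ℕ}

/-- The complement given by a splitting. -/
def Split.compl (S : Split Q p) : Subgroup G where
  carrier := Set.range S.ρ
  one_mem' := ⟨0, S.map_zero⟩
  mul_mem' := by
    rintro _ _ ⟨s, rfl⟩ ⟨t, rfl⟩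
    exact ⟨s + t, S.map_add s t⟩
  inv_mem' := by
    rintro _ ⟨s, rfl⟩
    exact ⟨-s, S.map_neg s⟩

theorem Split.card_compl (S : Split Q p) : Nat.card S.compl = p := by
  have : Function.Injective S.ρ := fun s t h =>
    ((S.eq_iff Q.one_mem Q.one_mem).1 (congrArg (1 * ·) h)).2
  have h := Nat.card_congr (Equiv.ofInjective _ this)
  rw [Nat.card_zmod] at h
  exact h.symm

theorem Split.card_quotient_dvd [Finite G] [Fact p.Prime] (S : Split Q p) (hG : Nat.card G = n * p)
    {R : Subgroup G} (h : S.compl ≤ R) : Nat.card (G ⧸ R) ∣ n := by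
  have h1 := Subgroup.card_dvd_of_le h
  rw [S.card_compl] at h1
  obtain ⟨m, hm⟩ := h1
  have h2 := R.card_eq_card_quotient_mul_card_subgroup
  rw [hG, hm] at h2
  refine ⟨m, Nat.eq_of_mul_eq_mul_right (Fact.out : p.Prime).pos ?_⟩
  rw [h2]; ring

theorem Split.pow_mem (S : Split Q p) (x : G) : x ^ p ∈ Q := by
  obtain ⟨u, hu, s, rfl⟩ := S.exists_eq x
  rw [mul_pow, S.map_pow, ZMod.natCast_self, zero_mul, S.map_zero, mul_one]
  exact Q.pow_mem hu p

theorem Split.sum_pow [Fintype G] [DecidableEq G] [Fact p.Prime] (S : Split Q p)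
    (hn : n.Coprime p) (hQ : Nat.card Q = n) (a : G → ZMod p) {q : G} (hq : q ∈ Q) :
    ∑ x, (if x ^ p = q ^ p then a x else 0) = ∑ s, a (q * S.ρ s) := by
  have hinj : Function.Injective fun s => q * S.ρ s := fun s t h => ((S.eq_iff hq hq).1 h).2
  rw [← Finset.sum_filter, ← Finset.sum_image (f := a) (g := fun s => q * S.ρ s)
    (s := Finset.univ) hinj.injOn]
  refine Finset.sum_congr ?_ fun _ _ => rfl
  ext x
  simp only [Finset.mem_filter, Finset.mem_univ, true_and, Finset.mem_image]
  constructor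
  · intro hx
    obtain ⟨u, hu, s, rfl⟩ := S.exists_eq x
    rw [mul_pow, S.map_pow, ZMod.natCast_self, zero_mul, S.map_zero, mul_one] at hx
    have h1 : (⟨u, hu⟩ : Q) = ⟨q, hq⟩ :=
      (powCoprime (G := Q) (n := p) (by rwa [hQ])).injective (Subtype.ext hx)
    have h2 : u = q := congrArg Subtype.val h1
    exact ⟨s, by rw [h2]⟩
  · rintro ⟨s, rfl⟩
    rw [mul_pow, S.map_pow, ZMod.natCast_self, zero_mul, S.map_zero, mul_one]

theorem Joint.const_on_coset [Finite G] [Fact p.Prime] (J : Joint c c) (S : Split Q p)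
    (hn : n.Coprime p) (hQ : Nat.card Q = n) {q h : G} (hq : q ∈ Q) (hh : h ∉ Q)
    (e : c h = c (q ^ p)) (s : ZMod p) : c (q * S.ρ s) = c q := by
  classical
  have := Fintype.ofFinite G
  have h1 := J.frobenius p (a := fun x => if c x = c q then 1 else 0)
    (b := fun x => if c x = c q then 1 else 0) (fun g h e => by simp only [e]) e
  rw [S.sum_pow hn hQ _ hq, Finset.sum_eq_zero fun x _ => if_neg fun hx : x ^ p = h => hh (hx ▸ S.pow_mem x),
    Finset.sum_boole, eq_comm, ZMod.natCast_eq_zero_iff] at h1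
  have h2 : 0 < (Finset.univ.filter fun s => c (q * S.ρ s) = c q).card :=
    Finset.card_pos.2 ⟨0, by simp [S.map_zero]⟩
  have h3 := Finset.card_le_univ (Finset.univ.filter fun s => c (q * S.ρ s) = c q)
  have h4 := Nat.le_of_dvd h2 h1
  have h5 := Finset.eq_univ_of_card _ (le_antisymm h3 (by rwa [ZMod.card]))
  have := Finset.mem_univ s
  rw [← h5] at this
  exact (Finset.mem_filter.1 this).2

end Split

variable {G H C : Type} [CommGroup G] [CommGroup H] {c : G → C} {d : H → C}

theorem zpow_cases_three {a : G} (ha : a ^ 3 = 1) (m : ℤ) :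
    (a ^ m = 1 ∧ m % 3 = 0) ∨ (a ^ m = a ∧ m % 3 = 1) ∨ (a ^ m = a⁻¹ ∧ m % 3 = 2) := by
  have h1 : a ^ m = a ^ (m % 3) := by
    conv_lhs => rw [← Int.emod_add_mul_ediv m 3, zpow_add, zpow_mul]
    norm_cast
    rw [ha, one_zpow, mul_one]
  rw [h1]
  have h2 : m % 3 = 0 ∨ m % 3 = 1 ∨ m % 3 = 2 := by omega
  rcases h2 with h2 | h2 | h2 <;> rw [h2]
  · simp
  · simp
  · right; right
    refine ⟨?_, rfl⟩
    rw [eq_inv_iff_mul_eq_one]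
    norm_cast
    rw [← pow_succ, ha]

theorem mem_of_pow_eq_one {L : Subgroup G} {g : G} {m : ℕ} (hg : g ^ m = 1)
    (hm : (Nat.card (G ⧸ L)).Coprime m) : g ∈ L := by
  rw [← QuotientGroup.eq_one_iff]
  have h1 : (g : G ⧸ L) ^ m = 1 := by rw [← QuotientGroup.mk_pow, hg, QuotientGroup.mk_one]
  have h2 : (g : G ⧸ L) ^ Nat.card (G ⧸ L) = 1 := pow_card_eq_one'
  exact orderOf_eq_one_iff.1 (Nat.eq_one_of_dvd_coprimes hm (orderOf_dvd_of_pow_eq_one h2)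
    (orderOf_dvd_of_pow_eq_one h1))

theorem card_quotient_of_card [Finite G] {L : Subgroup G} {n p : ℕ} (hp : 0 < p)
    (hG : Nat.card G = n * p) (hL : Nat.card L = p) : Nat.card (G ⧸ L) = n := by
  have := L.card_eq_card_quotient_mul_card_subgroup
  rw [hG, hL] at this
  exact (Nat.eq_of_mul_eq_mul_right hp this).symm

theorem Split.compl_eq [Finite G] {Q : Subgroup G} {n p : ℕ} (S : Split Q p) (hp : p.Prime)
    (hn : n.Coprime p) (hG : Nat.card G = n * p) {L : Subgroup G} (hL : Nat.card L = p) :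
    S.compl = L := by
  refine Subgroup.eq_of_le_of_card_ge ?_ (by rw [S.card_compl, hL])
  rintro _ ⟨s, rfl⟩
  refine mem_of_pow_eq_one (m := p) ?_ (by rwa [card_quotient_of_card hp.pos hG hL])
  rw [S.map_pow, CharP.cast_eq_zero, zero_mul, S.map_zero]

/-- On a product of an `A`-subgroup of order `3` and one of prime order `p`, matching colours of
generators extend to an isomorphism. -/
theorem Joint.exists_ji_of_thin_product [Finite G] [Finite H] {p : ℕ} {Q : Subgroup G}
    {Q' : Subgroup H} (J : Joint c d) (hp : p.Prime)
    (hn : Nat.Coprime 3 p) (hG : Nat.card G = 3 * p) (hQ : Nat.card Q = 3)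
    (hJQ : JS c d (Q : Set G) Q') {L : Subgroup G} {L' : Subgroup H} (hL : Nat.card L = p)
    (hJL : JS c d (L : Set G) L') {h : G} {h' : H} (hh : h ∈ Q) (h1 : h ≠ 1) (e : c h = d h') :
    ∃ f : G → H, JI c d f ∧ ∀ g, ∃ m : ℤ, ∃ x ∈ L, ∃ x' ∈ L', g = h ^ m * x ∧ f g = h' ^ m * x' := by
  have := Fact.mk hp
  have hQ' : Nat.card Q' = 3 := (J.card_set_eq hJQ).symm.trans hQ
  have hL' : Nat.card L' = p := (J.card_set_eq hJL).symm.trans hL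
  have hh' : h' ∈ Q' := (hJQ e).1 hh
  obtain ⟨S⟩ := exists_split hp hn hQ hG
  obtain ⟨S', -⟩ := J.exists_split_right hp hn hG hQ hJQ S
  have hSL := S.compl_eq hp hn hG hL
  have hSL' := S'.compl_eq hp hn (J.card_eq.symm.trans hG) hL'
  have h3 : h ^ 3 = 1 := pow_three_of_card_three hQ hh
  have h3' : h' ^ 3 = 1 := pow_three_of_card_three hQ' hh'
  obtain ⟨x', hx', e1⟩ := J.exists_mul_mem hJL e (l := S.ρ 1) (hSL ▸ ⟨1, rfl⟩)
  rw [← hSL'] at hx'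
  obtain ⟨k, rfl⟩ := hx'
  have e2 : c (S.ρ 1) = d (S'.ρ k) := by
    obtain ⟨a, b, ha, hb, hab⟩ := J.exists_mul e1
    have ha' := (hJQ ha).1 hh
    have hb' := (hJL hb).1 (hSL ▸ ⟨1, rfl⟩)
    rw [← hSL'] at hb'
    obtain ⟨k', rfl⟩ := hb'
    rw [hb, ((S'.eq_iff ha' hh').1 hab).2]
  have key1 : ∀ s, s ≠ 0 → c (h * S.ρ s) = d (h' * S'.ρ (k * s)) := fun s hs => by
    have := J.mult S S' hn hQ hQ' hp hG hs hh hh' e1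
    rwa [mul_one, mul_comm s k] at this
  have key : ∀ (m : ℤ) s, c (h ^ m * S.ρ s) = d (h' ^ m * S'.ρ (k * s)) := by
    intro m s
    by_cases hs : s = 0
    · rw [hs, mul_zero, S.map_zero, S'.map_zero, mul_one, mul_one]
      rcases zpow_cases_three h3 m with ⟨a, ha⟩ | ⟨a, ha⟩ | ⟨a, ha⟩ <;>
      rcases zpow_cases_three h3' m with ⟨b, hb⟩ | ⟨b, hb⟩ | ⟨b, hb⟩ <;>
      first | omega | rw [a, b]
      exacts [J.map_one, e, J.inv e]
    · rcases zpow_cases_three h3 m with ⟨a, ha⟩ | ⟨a, ha⟩ | ⟨a, ha⟩ <;>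
      rcases zpow_cases_three h3' m with ⟨b, hb⟩ | ⟨b, hb⟩ | ⟨b, hb⟩ <;>
      first | omega | rw [a, b]
      · have := J.mult S S' hn hQ hQ' hp hG hs Q.one_mem Q'.one_mem (s := 1) (s' := k)
          (by rw [one_mul, one_mul]; exact e2)
        rwa [mul_one, mul_comm s k] at this
      · exact key1 s hs
      · have := J.inv (key1 (-s) (neg_ne_zero.2 hs))
        rwa [mul_inv, mul_inv, ← S.map_neg, ← S'.map_neg, neg_neg, mul_neg, neg_neg] at this
  have hdec : ∀ g, ∃ w : ℤ × ZMod p, g = h ^ w.1 * S.ρ w.2 := by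
    intro g
    obtain ⟨u, hu, s, rfl⟩ := S.exists_eq g
    rcases mem_of_card_three hQ hh h1 hu with rfl | rfl | rfl
    exacts [⟨(0, s), by simp⟩, ⟨(1, s), by simp⟩, ⟨(-1, s), by simp⟩]
  choose w hw using hdec
  refine ⟨fun g => h' ^ (w g).1 * S'.ρ (k * (w g).2), fun g₁ g₂ => ?_, fun g => ⟨(w g).1,
    S.ρ (w g).2, hSL ▸ ⟨_, rfl⟩, S'.ρ (k * (w g).2), hSL' ▸ ⟨_, rfl⟩, hw g, rfl⟩⟩
  have e3 : g₂ * g₁⁻¹ = h ^ ((w g₂).1 - (w g₁).1) * S.ρ ((w g₂).2 - (w g₁).2) := by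
    conv_lhs => rw [hw g₁, hw g₂]
    rw [sub_eq_add_neg (w g₂).2, S.map_add, S.map_neg, zpow_sub]
    apply Additive.ofMul.injective; simp only [ofMul_mul, ofMul_inv]; abel
  have e4 : h' ^ (w g₂).1 * S'.ρ (k * (w g₂).2) * (h' ^ (w g₁).1 * S'.ρ (k * (w g₁).2))⁻¹ =
      h' ^ ((w g₂).1 - (w g₁).1) * S'.ρ (k * ((w g₂).2 - (w g₁).2)) := by
    rw [mul_sub, sub_eq_add_neg (k * _), S'.map_add, S'.map_neg, zpow_sub]
    apply Additive.ofMul.injective; simp only [ofMul_mul, ofMul_inv]; abel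
  rw [e3, e4, key]

theorem Joint.exists_ji_of_wedge_thin [Finite G] [Finite H] {p : ℕ} (J : Joint c d) (hp : p.Prime)
    (hn : Nat.Coprime 3 p) (hG : Nat.card G = 9 * p) {K L U : Subgroup G} {K' L' U' : Subgroup H}
    (hK : Nat.card K = 3) (hJK : JS c d (K : Set G) K') (hL : Nat.card L = p)
    (hJL : JS c d (L : Set G) L') (hJU : JS c d (U : Set G) U') (hKU : K ≤ U) (hLU : L ≤ U)
    (hKU' : K' ≤ U') (hLU' : L' ≤ U') (hcU : Nat.card U = 3 * p)
    (hr : ∀ x ∉ U, ∀ l ∈ L, c (x * l) = c x) : ∃ f : G → H, JI c d f := by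
  have hK' : Nat.card K' = 3 := (J.card_set_eq hJK).symm.trans hK
  have hL' : Nat.card L' = p := (J.card_set_eq hJL).symm.trans hL
  have hdisj : ∀ x ∈ K, x ∈ L → x = 1 := fun x hx hx' => by
    have := (Subgroup.disjoint_of_coprime_natCard (H := K) (K := L) (by rwa [hK, hL])).eq_bot
    exact Subgroup.mem_bot.1 (this ▸ Subgroup.mem_inf.2 ⟨hx, hx'⟩)
  obtain ⟨h, hh, h1⟩ : ∃ h ∈ K, h ≠ 1 := by
    by_contra! hcon
    rw [(Subgroup.eq_bot_iff_forall K).2 hcon] at hK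
    simp at hK
  have J2 := J.quotient hJL
  obtain ⟨f₂, h₂⟩ := sep_nine _ _ _ _ _ (card_quotient_of_card hp.pos hG hL) J2
  refine Exists.imp (fun _ => And.left) (J.exists_ji_of_wedge hJL hJU hr f₂ h₂ fun t => ?_)
  have hg0 : JI (qcol c L) (qcol d L') fun u => (f₂ t)⁻¹ * f₂ (t * u) := by
    have := (h₂.comp_mul t).mul_const (f₂ t)⁻¹
    simpa only [mul_comm] using this
  set g0 : G ⧸ L → H ⧸ L' := fun u => (f₂ t)⁻¹ * f₂ (t * u) with hg0d
  have hg01 : g0 1 = 1 := by simp [hg0d]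
  have hlift : ∀ k ∈ K, ∃ k' ∈ K', c k = d k' ∧ (k' : H ⧸ L') = g0 (k : G ⧸ L) := by
    intro k hk
    obtain ⟨y, hy⟩ := QuotientGroup.mk_surjective (g0 (k : G ⧸ L))
    have e := hg0 1 (k : G ⧸ L)
    rw [inv_one, mul_one, hg01, inv_one, mul_one, ← hy] at e
    obtain ⟨l', hl', e'⟩ := exists_mul_of_qcol_eq e
    refine ⟨y * l', (hJK e').1 hk, e', ?_⟩
    rw [QuotientGroup.mk_mul, (QuotientGroup.eq_one_iff l').2 hl', mul_one, hy]
  obtain ⟨h', hh', e, hq⟩ := hlift h hh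
  have hqi : ((h'⁻¹ : H) : H ⧸ L') = g0 ((h⁻¹ : G) : G ⧸ L) := by
    obtain ⟨k', hk', e', hq'⟩ := hlift h⁻¹ (K.inv_mem hh)
    have h1' : h' ≠ 1 := fun hc => h1 ((J.one_iff e).2 hc)
    have hinj := JI.injective J2 hg0
    rcases mem_of_card_three hK' hh' h1' hk' with rfl | rfl | rfl
    · exact absurd ((J.one_iff e').2 rfl) (inv_ne_one.2 h1)
    · have h2 := QuotientGroup.eq.1 (hinj (hq.symm.trans hq'))
      have h3 := hdisj _ (K.mul_mem (K.inv_mem hh) (K.inv_mem hh)) h2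
      rw [mul_self_of_card_three hK (K.inv_mem hh), inv_inv] at h3
      exact absurd h3 h1
    · exact hq'
  obtain ⟨f₁, hf₁, hf₁d⟩ := (J.restrict hJU).exists_ji_of_thin_product (Q := K.subgroupOf U)
    (Q' := K'.subgroupOf U') (L := L.subgroupOf U) (L' := L'.subgroupOf U') hp hn hcU
    (by rw [Nat.card_congr (Subgroup.subgroupOfEquivOfLe hKU).toEquiv, hK])
    (fun g h e => hJK e)
    (by rw [Nat.card_congr (Subgroup.subgroupOfEquivOfLe hLU).toEquiv, hL])
    (fun g h e => hJL e) (h := ⟨h, hKU hh⟩) (h' := ⟨h', hKU' hh'⟩) hh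
    (fun hc => h1 (congrArg Subtype.val hc)) e
  refine ⟨f₁, hf₁, fun u => ?_⟩
  obtain ⟨m, x, hx, x', hx', hu, hu'⟩ := hf₁d u
  have hgu : ((u : G) : G ⧸ L) = (h : G ⧸ L) ^ m := by
    rw [hu]
    push_cast
    rw [QuotientGroup.mk_mul, (QuotientGroup.eq_one_iff (x : G)).2 hx, mul_one]; rfl
  have hfu : ((f₁ u : H) : H ⧸ L') = (h' : H ⧸ L') ^ m := by
    rw [hu']
    push_cast
    rw [QuotientGroup.mk_mul, (QuotientGroup.eq_one_iff (x' : H)).2 hx', mul_one]; rfl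
  have : (f₂ (t : G ⧸ L))⁻¹ * f₂ ((t * u : G) : G ⧸ L) = g0 ((h : G ⧸ L) ^ m) := by
    rw [← hgu]; rfl
  rw [this, hfu]
  have h3 : (h : G ⧸ L) ^ 3 = 1 := by
    rw [← QuotientGroup.mk_pow, pow_three_of_card_three hK hh]; rfl
  have h3' : (h' : H ⧸ L') ^ 3 = 1 := by
    rw [← QuotientGroup.mk_pow, pow_three_of_card_three hK' hh']; rfl
  rcases zpow_cases_three h3 m with ⟨a, ha⟩ | ⟨a, ha⟩ | ⟨a, ha⟩ <;>
  rcases zpow_cases_three h3' m with ⟨b, hb⟩ | ⟨b, hb⟩ | ⟨b, hb⟩ <;>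
  first | omega | rw [a, b]
  exacts [hg01.symm, hq, hqi]

variable {G H C : Type} [CommGroup G] [CommGroup H] {c : G → C} {d : H → C}

/-- The largest union of classes inside a subgroup is a subgroup. -/
theorem Joint.exists_interior (J : Joint c c) (Q : Subgroup G) :
    ∃ K : Subgroup G, K ≤ Q ∧ JS c c (K : Set G) K ∧ ∀ q, q ∈ K ↔ ∀ h, c h = c q → h ∈ Q := by
  refine ⟨{ carrier := {q | ∀ h, c h = c q → h ∈ Q}
            one_mem' := fun h e => by rw [(J.one_iff e).2 rfl]; exact Q.one_mem
            mul_mem' := fun {a b} ha hb h e => ?_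
            inv_mem' := fun {a} ha h e => ?_ }, fun q hq => hq q rfl, fun g h e => ?_, fun q => Iff.rfl⟩
  · obtain ⟨x, y, hx, hy, rfl⟩ := J.exists_mul e.symm
    exact Q.mul_mem (ha x hx.symm) (hb y hy.symm)
  · have := ha h⁻¹ (by rw [J.inv e, inv_inv])
    exact inv_inv h ▸ Q.inv_mem this
  · exact ⟨fun hg k ek => hg k (ek.trans e.symm), fun hg k ek => hg k (ek.trans e)⟩

theorem JS.le (J : Joint c d) {K U : Subgroup G} {K' U' : Subgroup H}
    (hK : JS c d (K : Set G) K') (hU : JS c d (U : Set G) U') (h : K ≤ U) : K' ≤ U' := by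
  intro y hy
  obtain ⟨g, hg⟩ := J.exists_left y
  exact (hU hg).1 (h ((hK hg).2 hy))

theorem card_sup_of_disjoint {K L : Subgroup G} (h : Disjoint K L) :
    Nat.card (K ⊔ L : Subgroup G) = Nat.card K * Nat.card L := by
  have h1 := Subgroup.relIndex_mul_relIndex ⊥ K (K ⊔ L) bot_le le_sup_left
  rw [Subgroup.relIndex_bot_left, Subgroup.relIndex_bot_left, Subgroup.relIndex_sup_left,
    ← Subgroup.inf_relIndex_right, h.eq_bot, Subgroup.relIndex_bot_left] at h1
  exact h1.symm

section

variable {Q K : Subgroup G} {p : ℕ}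

theorem Joint.const_on_coset_of_not_mem [Finite G] [Fact p.Prime] (J : Joint c c) (S : Split Q p)
    (hn : Nat.Coprime 9 p) (hQ : Nat.card Q = 9)
    (hKm : ∀ q, q ∈ K ↔ ∀ h, c h = c q → h ∈ Q) {q : G} (hq : q ∈ Q) (hqK : q ∉ K) (s : ZMod p) :
    c (q * S.ρ s) = c q := by
  have h1 : q ^ p ∉ K := by
    intro h
    refine hqK ?_
    have h2 : orderOf q ∣ 9 := by
      rw [← hQ]; exact Subgroup.orderOf_dvd_natCard Q hq
    obtain ⟨m, hm⟩ := exists_pow_eq_self_of_coprime (x := q) (n := p)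
      (Nat.Coprime.coprime_dvd_right h2 hn.symm)
    rw [← hm]
    exact K.pow_mem h m
  rw [hKm] at h1
  push Not at h1
  obtain ⟨h, e, hh⟩ := h1
  exact J.const_on_coset S hn hQ hq hh e s

theorem Joint.exists_ji_of_no_link [Finite G] [Finite H] (J : Joint c d) (hp : p.Prime)
    (hn : Nat.Coprime 9 p) (hG : Nat.card G = 9 * p) (hQ : Nat.card Q = 9) (S : Split Q p)
    (hKQ : K ≤ Q) (hK : JS c c (K : Set G) K)
    (hKc : Nat.card K = 1 ∨ Nat.card K = 3)
    (hP : ∀ q ∈ Q, q ∉ K → ∀ s, c (q * S.ρ s) = c q)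
    (hA : ¬∃ q ∈ Q, q ∉ K ∧ c (S.ρ 1) = c q) : ∃ f : G → H, JI c d f := by
  have := Fact.mk hp
  have hn3 : Nat.Coprime 3 p := Nat.Coprime.coprime_dvd_left (by norm_num) hn
  have Jc := J.left
  set U := K ⊔ S.compl with hUd
  have hKU : K ≤ U := le_sup_left
  have hSU : S.compl ≤ U := le_sup_right
  have hUm : ∀ q ∈ Q, ∀ s, q * S.ρ s ∈ U → q ∈ K := by
    intro q hq s h
    obtain ⟨k, hk, _, ⟨t, rfl⟩, e⟩ := Subgroup.mem_sup.1 h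
    exact ((S.eq_iff (hKQ hk) hq).1 e).1 ▸ hk
  have hUc : ∀ u y, c u = c y → u ∈ U → y ∈ U := by
    intro u y e hu
    obtain ⟨k, hk, _, ⟨t, rfl⟩, rfl⟩ := Subgroup.mem_sup.1 hu
    obtain ⟨q, hq, s, rfl⟩ := S.exists_eq y
    by_cases hqK : q ∈ K
    · exact U.mul_mem (hKU hqK) (hSU ⟨s, rfl⟩)
    rw [hP q hq hqK] at e
    by_cases ht : t = 0
    · rw [ht, S.map_zero, mul_one] at e
      exact absurd ((hK e).1 hk) hqK
    obtain ⟨l, hl, e'⟩ := Jc.exists_mul_mem hK e (K.inv_mem hk)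
    rw [mul_right_comm, mul_inv_cancel] at e'
    have hql : q * l ∉ K := fun h => hqK ((K.mul_mem_cancel_right hl).1 h)
    have hqQ := Q.mul_mem hq (hKQ hl)
    have := Jc.mult S S hn hQ hQ hp hG (inv_ne_zero ht) Q.one_mem hqQ (s := t) (s' := 0)
      (by rw [S.map_zero, mul_one, e'])
    rw [mul_zero, S.map_zero, mul_one, inv_mul_cancel₀ ht, one_mul] at this
    exact absurd ⟨_, hqQ, hql, this⟩ hA
  have hU : JS c c (U : Set G) U := fun g h e => ⟨hUc g h e, hUc h g e.symm⟩
  have hrP : ∀ y ∉ U, ∀ s, c (y * S.ρ s) = c y := by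
    intro y hy s
    obtain ⟨q, hq, t, rfl⟩ := S.exists_eq y
    have hqK : q ∉ K := fun h => hy (U.mul_mem (hKU h) (hSU ⟨t, rfl⟩))
    rw [mul_assoc, ← S.map_add, hP q hq hqK, hP q hq hqK]
  obtain ⟨U', hU'⟩ := J.exists_subgroup U hU
  obtain ⟨R, hR, hRU, hRr, hRm⟩ := Jc.exists_core hU U.one_mem
  have hSR : S.compl ≤ R := by
    rintro _ ⟨s, rfl⟩
    exact hRm _ (fun y hy => U.mul_mem hy (hSU ⟨s, rfl⟩)) fun y hy => hrP y hy s
  have hcU : Nat.card U = Nat.card K * p := by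
    have hdisj : Disjoint K S.compl := by
      rw [Subgroup.disjoint_def]
      rintro _ hx ⟨s, rfl⟩
      have := (S.mem_iff Q.one_mem (s := s)).1 (by rw [one_mul]; exact hKQ hx)
      rw [this, S.map_zero]
    rw [card_sup_of_disjoint hdisj, S.card_compl]
  by_cases hRU' : U ≤ R
  · have hRe : R = U := le_antisymm hRU hRU'
    refine J.exists_ji_of_wreath_nine hU' (by rw [← hRe]; exact fun y hy => hRr y (hRe ▸ hy)) ?_
      (S.card_quotient_dvd hG hSU)
    rcases hKc with hKc | hKc
    · rw [hKc, one_mul] at hcU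
      exact sep_prime hp _ _ _ _ _ hcU (J.restrict hU')
    · rw [hKc] at hcU
      obtain ⟨K', hK'⟩ := J.exists_subgroup K hK
      exact (J.restrict hU').exists_ji_of_hall_three hp hn3 hcU (Q := K.subgroupOf U)
        (Q' := K'.subgroupOf U')
        (by rw [Nat.card_congr (Subgroup.subgroupOfEquivOfLe hKU).toEquiv, hKc])
        (fun g h e => hK' e)
  · have hRc : R = S.compl ∧ Nat.card K = 3 := by
      obtain ⟨m, hm⟩ := S.card_compl ▸ Subgroup.card_dvd_of_le hSR
      have h1 := Subgroup.card_dvd_of_le hRU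
      rw [hcU, hm, mul_comm] at h1
      have h2 := Nat.dvd_of_mul_dvd_mul_right hp.pos (mul_comm p m ▸ mul_comm p _ ▸ h1)
      have h3 : m ≠ Nat.card K := fun h => hRU' (Subgroup.eq_of_le_of_card_ge hRU
        (by rw [hcU, hm, h, mul_comm])).ge
      have h4 : m = 1 ∧ Nat.card K = 3 := by
        rcases hKc with hKc | hKc <;> rw [hKc] at h2 h3 ⊢
        · exact absurd (Nat.dvd_one.1 h2) h3
        · exact ⟨((Nat.dvd_prime Nat.prime_three).1 h2).resolve_right h3, rfl⟩
      exact ⟨(Subgroup.eq_of_le_of_card_ge hSR (by rw [hm, h4.1, S.card_compl, mul_one])).symm, h4.2⟩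
    rw [hRc.1] at hR
    obtain ⟨L', hL'⟩ := J.exists_subgroup _ hR
    obtain ⟨K', hK'⟩ := J.exists_subgroup K hK
    exact J.exists_ji_of_wedge_thin hp hn3 hG hRc.2 hK' S.card_compl hL' hU' hKU hSU
      (hK'.le J hU' hKU) (hL'.le J hU' hSU) (by rw [hcU, hRc.2]) fun x hx l hl =>
      hRr x hx l (hSR hl)

theorem Joint.exists_ji_of_link [Finite G] [Finite H] (J : Joint c d) (hp : p.Prime)
    (hn : Nat.Coprime 9 p) (hG : Nat.card G = 9 * p) (hQ : Nat.card Q = 9) (S : Split Q p)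
    (hKQ : K ≤ Q) (hK : JS c c (K : Set G) K)
    (hKc : Nat.card K = 1 ∨ Nat.card K = 3)
    (hP : ∀ q ∈ Q, q ∉ K → ∀ s, c (q * S.ρ s) = c q)
    {q : G} (hq : q ∈ Q) (hqK : q ∉ K) (e : c (S.ρ 1) = c q) : ∃ f : G → H, JI c d f := by
  classical
  have := Fact.mk hp
  have Jc := J.left
  have hcs : ∀ s, s ≠ 0 → c (S.ρ s) = c q := fun s hs => by
    have := Jc.mult S S hn hQ hQ hp hG hs Q.one_mem hq (s := 1) (s' := 0)
      (by rw [S.map_zero, mul_one, one_mul, e])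
    rwa [mul_zero, S.map_zero, mul_one, mul_one, one_mul] at this
  have h10 : (1 : G) ∈ {y | y = 1 ∨ c y = c q} := Or.inl rfl
  have hYS : JS c c {y | y = 1 ∨ c y = c q} {y | y = 1 ∨ c y = c q} := fun g h eg => by
    simp only [Set.mem_ofPred_eq, eg, Jc.one_iff eg]
  have hρY : ∀ s, S.ρ s ∈ {y | y = 1 ∨ c y = c q} := fun s => by
    by_cases hs : s = 0
    · left; rw [hs, S.map_zero]
    · right; exact hcs s hs
  -- a subgroup containing the complement and contained in the class of `q` has rank two
  have hrank : ∀ {R : Subgroup G} {R' : Subgroup H}, JS c d (R : Set G) R' →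
      (R : Set G) ⊆ {y | y = 1 ∨ c y = c q} →
      S.compl ≤ R → ∃ f : R → R', JI (fun u : R => c u) (fun u : R' => d u) f := by
    intro R R' hR hRY hSR
    have h1 := hSR ⟨1, rfl⟩
    refine (J.restrict hR).exists_ji_of_rank_two (x := ⟨S.ρ 1, h1⟩) fun g hg => ?_
    have := (hRY g.2).resolve_left fun h => hg (Subtype.ext h)
    exact this.trans e.symm
  rcases hKc with hKc | hKc
  · have hK1 : K = ⊥ := Subgroup.card_eq_one.1 hKc
    obtain ⟨R, hR, hRY, hRr, hRm⟩ := Jc.exists_core hYS h10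
    have hSR : S.compl ≤ R := by
      rintro _ ⟨s, rfl⟩
      refine hRm _ (fun y hy => ?_) fun y hy => ?_
      all_goals
        obtain ⟨u, hu, t, rfl⟩ := S.exists_eq y
        rw [mul_assoc, ← S.map_add]
        by_cases huK : u ∈ K
        · rw [hK1, Subgroup.mem_bot] at huK
          subst huK
          rw [one_mul] at hy ⊢
          first
          | exact hρY _
          | exact absurd (hρY _) hy
      · rw [Set.mem_ofPred_eq] at hy ⊢
        rw [hP u hu huK] at hy ⊢
        refine hy.imp_left fun h => ?_
        have := S.mem_iff hu (s := t)
        rw [h] at this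
        have := this.1 Q.one_mem
        rw [this, S.map_zero, mul_one] at h
        exact absurd (h ▸ K.one_mem) huK
      · rw [hP u hu huK, hP u hu huK]
    have hYR : ∀ y, (y = 1 ∨ c y = c q) → y ∈ R := by
      rintro y (rfl | h)
      · exact R.one_mem
      · exact (hR (h.trans e.symm)).2 (hSR ⟨1, rfl⟩)
    obtain ⟨R', hR'⟩ := J.exists_subgroup R hR
    refine J.exists_ji_of_wreath_nine hR' (fun y hy => hRr y fun h => hy (hYR y h))
      (hrank hR' hRY hSR) (S.card_quotient_dvd hG hSR)
  have hx1 : S.ρ 1 ∉ K := fun h => hqK ((hK e).1 h)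
  have hidx : (K.subgroupOf Q).index = 3 := by
    have := Subgroup.card_mul_index (K.subgroupOf Q)
    rw [Nat.card_congr (Subgroup.subgroupOfEquivOfLe hKQ).toEquiv, hKc, hQ] at this
    omega
  have hQdec : ∀ u ∈ Q, u ∈ K ∨ u * q⁻¹ ∈ K ∨ u * q ∈ K := fun u hu =>
    mem_or_of_index_three hidx (x := ⟨q, hq⟩) hqK ⟨u, hu⟩
  have eqi : c q⁻¹ = c q := by
    rw [← hcs (-1) (neg_ne_zero.2 one_ne_zero), S.map_neg]
    exact Jc.inv e.symm
  by_cases hT : ∀ h ∈ K, c (S.ρ 1 * h) = c q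
  · have hall : ∀ g ∉ K, c g = c q := by
      have hshift : ∀ v, c v = c q → ∀ k ∈ K, c (v * k) = c q := by
        intro v hv k hk
        obtain ⟨l, hl, h1⟩ := Jc.exists_mul_mem hK (hv.trans e.symm) hk
        rw [h1, hT l hl]
      intro g hg
      obtain ⟨u, hu, s, rfl⟩ := S.exists_eq g
      by_cases huK : u ∈ K
      · have hs : s ≠ 0 := by
          rintro rfl
          rw [S.map_zero, mul_one] at hg
          exact hg huK
        rw [mul_comm, hshift _ (hcs s hs) u huK]
      · rw [hP u hu huK]
        rcases hQdec u hu with h | h | h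
        · exact absurd h huK
        · have := hshift q rfl _ h
          rwa [mul_comm, inv_mul_cancel_right] at this
        · have := hshift q⁻¹ eqi _ h
          rwa [mul_comm, mul_inv_cancel_right] at this
    obtain ⟨K', hK'⟩ := J.exists_subgroup K hK
    have h2 : ∃ f, JI (qcol c K) (qcol d K') f := by
      refine (J.quotient hK').exists_ji_of_rank_two (x := (q : G ⧸ K)) fun g hg => ?_
      induction g using QuotientGroup.induction_on with | _ g
      have hg' : g ∉ K := fun h => hg ((QuotientGroup.eq_one_iff g).2 h)
      ext k
      rw [mem_qcol, mem_qcol]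
      refine exists_congr fun l => and_congr_right fun hl => ?_
      rw [hall _ fun h => hg' ((K.mul_mem_cancel_right hl).1 h),
        hall _ fun h => hqK ((K.mul_mem_cancel_right hl).1 h)]
    obtain ⟨f₂, h₂⟩ := h2
    exact Exists.imp (fun _ => And.left) (J.exists_ji_of_wreath hK' (fun y hy l hl =>
      (hall _ fun h => hy ((K.mul_mem_cancel_right hl).1 h)).trans (hall y hy).symm)
      (sep_three _ _ _ _ _ hKc (J.restrict hK')) f₂ h₂)
  have hT1 : ∀ h ∈ K, h ≠ 1 → c (S.ρ 1 * h) ≠ c q := by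
    intro h hh h1 hc
    refine hT fun k hk => ?_
    rcases mem_of_card_three hKc hh h1 hk with rfl | rfl | rfl
    · rw [mul_one, e]
    · exact hc
    · have h3 := Jc.mult S S hn hQ hQ hp hG (neg_ne_zero.2 one_ne_zero) (hKQ hh) hq (s := 1)
        (s' := 0) (by rw [S.map_zero, mul_one, mul_comm, hc])
      have h4 := Jc.inv h3
      rw [mul_inv, mul_zero, S.map_zero, mul_one, ← S.map_neg, mul_one, neg_neg, mul_comm] at h4
      rw [h4, eqi]
  have hneq : ∀ h ∈ K, h ≠ 1 → ∀ t, c (h * S.ρ t) ≠ c q := by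
    intro h hh h1 t hc
    have ht : t ≠ 0 := by
      rintro rfl
      rw [S.map_zero, mul_one] at hc
      exact hqK ((hK hc).1 hh)
    have := Jc.mult S S hn hQ hQ hp hG (inv_ne_zero ht) (hKQ hh) hq (s := t) (s' := 0)
      (by rw [S.map_zero, mul_one, hc])
    rw [inv_mul_cancel₀ ht, mul_zero, S.map_zero, mul_one, mul_comm] at this
    exact hT1 h hh h1 this
  obtain ⟨R, hR, hRm⟩ := Jc.exists_stab (φ := fun y => (y ∈ {y | y = 1 ∨ c y = c q} : Prop))
    fun g h eg => propext (hYS eg)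
  have hRY : (R : Set G) ⊆ {y | y = 1 ∨ c y = c q} := fun g hg => by
    have := (hRm g).1 hg 1
    rw [one_mul] at this
    exact this ▸ h10
  have hSR : S.compl ≤ R := by
    rintro _ ⟨s, rfl⟩
    refine (hRm _).2 fun y => ?_
    obtain ⟨u, hu, t, rfl⟩ := S.exists_eq y
    rw [mul_assoc, ← S.map_add]
    have h1 : ∀ s t, u * S.ρ t ∈ {y | y = 1 ∨ c y = c q} →
        u * S.ρ s ∈ {y | y = 1 ∨ c y = c q} := by
      intro s t hy
      by_cases hu1 : u = 1
      · subst hu1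
        rw [one_mul]
        exact hρY _
      · right
        rcases hy with hy | hy
        · exact absurd ((S.eq_iff hu Q.one_mem (t := 0)).1
            (by rw [hy, S.map_zero, mul_one])).1 hu1
        · have huK : u ∉ K := fun h => hneq u h hu1 t hy
          rw [hP u hu huK] at hy ⊢
          exact hy
    exact propext ⟨h1 _ _, h1 _ _⟩
  have hcR : ∀ y, c y = c q → y ∈ R := fun y hy => (hR (hy.trans e.symm)).2 (hSR ⟨1, rfl⟩)
  have hdisj : ∀ g ∈ R, g ∈ K → g = 1 := fun g hg hgK =>
    (hRY hg).resolve_right fun h => hqK ((hK h).1 hgK)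
  have hRq : ∀ g ∈ R, g ≠ 1 → c g = c q := fun g hg h1 => (hRY hg).resolve_left h1
  obtain ⟨R', hR'⟩ := J.exists_subgroup R hR
  obtain ⟨K', hK'⟩ := J.exists_subgroup K hK
  refine exists_ji_of_prod (K := R) (L := K) (K' := R') (L' := K') (fun g => ?_) ?_
    (hrank hR' hRY hSR) (sep_three _ _ _ _ _ hKc (J.restrict hK'))
  · obtain ⟨u, hu, s, rfl⟩ := S.exists_eq g
    have hs := hSR ⟨s, rfl⟩
    have hqR := hcR q rfl
    rcases hQdec u hu with h | h | h
    · exact ⟨_, hs, u, h, mul_comm _ _⟩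
    · refine ⟨_, R.mul_mem hqR hs, _, h, ?_⟩
      apply Additive.ofMul.injective; simp only [ofMul_mul, ofMul_inv]; abel
    · refine ⟨_, R.mul_mem (R.inv_mem hqR) hs, _, h, ?_⟩
      apply Additive.ofMul.injective; simp only [ofMul_mul, ofMul_inv]; abel
  intro k hk l hl k' hk' l' hl' ek el
  by_cases hl1 : l = 1
  · rw [hl1, (J.one_iff el).1 hl1, mul_one, mul_one, ek]
  by_cases hk1 : k = 1
  · rw [hk1, (J.one_iff ek).1 hk1, one_mul, one_mul, el]
  by_cases hthin : c l = c l⁻¹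
  swap
  · refine J.mul_thin el (fun g hg => ?_) ek
    rcases mem_of_card_three hKc hl hl1 ((hK hg).2 hl) with rfl | rfl | rfl
    exacts [absurd ((Jc.one_iff hg).1 rfl) hl1, rfl, absurd hg.symm hthin]
  have hKcol : ∀ m ∈ K, m ≠ 1 → c m = c l := fun m hm h1 => by
    rcases mem_of_card_three hKc hl hl1 hm with rfl | rfl | rfl
    exacts [absurd rfl h1, rfl, hthin.symm]
  have hnR : ∀ v ∈ R, ∀ m ∈ K, m ≠ 1 → v * m ∉ R := fun v hv m hm h1 h =>
    h1 (hdisj m ((R.mul_mem_cancel_left hv).1 h) hm)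
  have hx : c (S.ρ 1 * l) = c (S.ρ 1 * l⁻¹) := by
    by_contra hne
    have := Fintype.ofFinite G
    have hm : ∀ m ∈ K, ∀ s, s ≠ 0 → c (m * S.ρ s) = c (S.ρ 1 * m) := by
      intro m hm s hs
      obtain ⟨n, hn', h1⟩ := Jc.exists_mul_mem hK e hm
      have := Jc.mult S S hn hQ hQ hp hG hs (hKQ hm) (Q.mul_mem hq (hKQ hn')) (s := 1)
        (s' := 0) (by rw [S.map_zero, mul_one, mul_comm, h1])
      rw [h1]
      rwa [mul_one, mul_zero, S.map_zero, mul_one] at this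
    have hK1 : ∀ m ∈ K, c m ≠ c (S.ρ 1 * l) := fun m hm h =>
      hx1 ((K.mul_mem_cancel_right hl).1 ((hK h).1 hm))
    have hlp : c (l ^ p) = c (l⁻¹ ^ p) := by
      have h3 := mem_of_card_three hKc hl hl1 (K.pow_mem hl p)
      rw [inv_pow]
      rcases h3 with h3 | h3 | h3 <;> rw [h3]
      · rw [inv_one]
      · exact hthin
      · rw [inv_inv]; exact hthin.symm
    have h1 := Jc.frobenius p (a := fun y => if c y = c (S.ρ 1 * l) then 1 else 0)
      (b := fun y => if c y = c (S.ρ 1 * l) then 1 else 0) (fun g h e => by simp only [e]) hlp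
    have h2 : ∀ s, (if c (l * S.ρ s) = c (S.ρ 1 * l) then (1 : ZMod p) else 0) =
        1 - if s = 0 then 1 else 0 := by
      intro s
      by_cases hs : s = 0
      · rw [if_neg, if_pos hs, sub_self]
        rw [hs, S.map_zero, mul_one]
        exact hK1 l hl
      · rw [if_pos (hm l hl s hs), if_neg hs, sub_zero]
    have h3 : ∀ s, (if c (l⁻¹ * S.ρ s) = c (S.ρ 1 * l) then (1 : ZMod p) else 0) = 0 := by
      intro s
      rw [if_neg]
      by_cases hs : s = 0
      · rw [hs, S.map_zero, mul_one]
        exact hK1 _ (K.inv_mem hl)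
      · rw [hm _ (K.inv_mem hl) s hs]
        exact Ne.symm hne
    rw [S.sum_pow hn hQ _ (hKQ hl), S.sum_pow hn hQ _ (Q.inv_mem (hKQ hl)),
      Finset.sum_congr rfl fun s _ => h2 s, Finset.sum_congr rfl fun s _ => h3 s] at h1
    simp at h1
  have hconst : ∀ v ∈ R, v ≠ 1 → ∀ m ∈ K, m ≠ 1 → c (v * m) = c (S.ρ 1 * l) := by
    intro v hv hv1 m hm hm1
    obtain ⟨n, hn, h1⟩ := Jc.exists_mul_mem hK ((hRq v hv hv1).trans e.symm) hm
    rw [h1]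
    rcases mem_of_card_three hKc hl hl1 hn with rfl | rfl | rfl
    · rw [mul_one] at h1
      exact absurd ((hR h1).2 (hSR ⟨1, rfl⟩)) (hnR v hv m hm hm1)
    · rfl
    · exact hx.symm
  obtain ⟨g, hg⟩ := J.exists_left (k' * l')
  obtain ⟨k₁, l₁, h1, h2, h3⟩ := J.symm.exists_mul hg.symm
  rw [hconst k hk hk1 l hl hl1, ← hg, ← h3, hconst k₁ ((hR' h1.symm).2 hk') _ l₁
    ((hK' h2.symm).2 hl')]
  · rintro rfl
    exact hl1 ((J.one_iff el).2 ((J.one_iff h2.symm).1 rfl))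
  · rintro rfl
    exact hk1 ((J.one_iff ek).2 ((J.one_iff h1.symm).1 rfl))

theorem Joint.exists_ji_of_hall_not [Finite G] [Finite H] {Q : Subgroup G} (J : Joint c d)
    (hp : p.Prime) (hn : Nat.Coprime 9 p) (hG : Nat.card G = 9 * p) (hQ : Nat.card Q = 9)
    (hJQ : ¬ JS c c (Q : Set G) Q) : ∃ f : G → H, JI c d f := by
  classical
  have := Fact.mk hp
  obtain ⟨S⟩ := exists_split hp hn hQ hG
  have Jc := J.left
  obtain ⟨K, hKQ, hK, hKm⟩ := Jc.exists_interior Q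
  have hP : ∀ q ∈ Q, q ∉ K → ∀ s, c (q * S.ρ s) = c q := fun q hq hqK =>
    Jc.const_on_coset_of_not_mem S hn hQ hKm hq hqK
  have hKc : Nat.card K = 1 ∨ Nat.card K = 3 := by
    have h1 := Subgroup.card_dvd_of_le hKQ
    have h2 : Nat.card K ≠ 9 := fun h => hJQ (Subgroup.eq_of_le_of_card_ge hKQ (by rw [hQ, h]) ▸ hK)
    rw [hQ, show 9 = 3 ^ 2 by norm_num, Nat.dvd_prime_pow Nat.prime_three] at h1
    obtain ⟨i, hi, h1⟩ := h1
    interval_cases i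
    · left; simpa using h1
    · right; simpa using h1
    · exact absurd (h1.trans (by norm_num)) h2
  by_cases hA : ∃ q ∈ Q, q ∉ K ∧ c (S.ρ 1) = c q
  · obtain ⟨q, hq, hqK, e⟩ := hA
    exact J.exists_ji_of_link hp hn hG hQ S hKQ hK hKc hP hq hqK e
  · exact J.exists_ji_of_no_link hp hn hG hQ S hKQ hK hKc hP hA

theorem sep_nine_mul (hp : p.Prime) (h3 : p ≠ 3) : Sep (9 * p) := by
  intro G H C _ _ _ _ c d hG J
  have := Fact.mk Nat.prime_three
  have hn : Nat.Coprime 9 p := by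
    rw [show 9 = 3 ^ 2 by norm_num]
    exact Nat.Coprime.pow_left 2 ((Nat.coprime_primes Nat.prime_three hp).2 h3.symm)
  obtain ⟨Q, hQ⟩ := Sylow.exists_subgroup_card_pow_prime (G := G) 3 (n := 2)
    (by rw [hG]; exact dvd_mul_right 9 p)
  by_cases hJQ : JS c c (Q : Set G) Q
  · obtain ⟨Q', hQ'⟩ := J.exists_subgroup Q hJQ
    exact J.exists_ji_of_hall_nine hp hn hG hQ hQ'
  · exact J.exists_ji_of_hall_not hp hn hG hQ hJQ

end

section

/-- The number of ways to write `g` as a product of two members of `l`. -/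
def conv {K : Type} [CommGroup K] [DecidableEq K] (l : List K) (g : K) : ℕ :=
  l.countP fun u => decide (g * u⁻¹ ∈ l)

/-- The number of elements with as many representations as `g`. -/
def level {K : Type} [CommGroup K] [DecidableEq K] [Fintype K] (l : List K) (g : K) : ℕ :=
  (Finset.univ.filter fun h => conv l h = conv l g).card

variable {K K' : Type} [CommGroup K] [DecidableEq K] [CommGroup K'] [DecidableEq K']

theorem conv_map (e : K ≃* K') (l : List K) (g : K) : conv (l.map e) (e g) = conv l g := by
  rw [conv, conv, List.countP_map]
  refine List.countP_congr fun u _ => ?_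
  simp [← map_inv, ← map_mul]

theorem level_map [Fintype K] [Fintype K'] (e : K ≃* K') (l : List K) (g : K) :
    level (l.map e) (e g) = level l g := by
  rw [level, level]
  symm
  refine Finset.card_equiv e.toEquiv fun h => ?_
  simp [conv_map]

theorem level_map' [Fintype K] [Fintype K'] (e : K ≃* K') (l : List K) (g : K') :
    level (l.map e) g = level l (e.symm g) := by
  rw [← level_map e, e.apply_symm_apply]

set_option synthInstance.maxHeartbeats 400000 in
set_option synthInstance.maxSize 1000 in
theorem cyclic_two : ∀ a : Multiplicative (ZMod 9), a ≠ 1 → ∃ g, level [1, a] g < 2 := by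
  decide +kernel

set_option synthInstance.maxHeartbeats 400000 in
set_option synthInstance.maxSize 1000 in
theorem elementary_two : ∀ a : Multiplicative (ZMod 3 × ZMod 3), a ≠ 1 →
    ∃ g, level [1, a] g < 2 := by
  decide +kernel

set_option synthInstance.maxHeartbeats 400000 in
set_option synthInstance.maxSize 1000 in
theorem cyclic_three : ∀ a b : Multiplicative (ZMod 9), a ≠ 1 → b ≠ 1 → a ≠ b →
    (∃ g, level [1, a, b] g < 3) ∨ (a * b = 1 ∧ a ^ 3 = 1) ∨
      (a * b ≠ 1 ∧ ∀ g, level [1, a, b] g = 3) := by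
  decide +kernel

set_option synthInstance.maxHeartbeats 400000 in
set_option synthInstance.maxSize 1000 in
theorem elementary_three : ∀ a b : Multiplicative (ZMod 3 × ZMod 3), a ≠ 1 → b ≠ 1 → a ≠ b →
    (∃ g, level [1, a, b] g < 3) ∨ (a * b = 1 ∧ a ^ 3 = 1) ∨
      (a * b ≠ 1 ∧ ∀ g, level [1, a, b] g = 3) := by
  decide +kernel

set_option synthInstance.maxHeartbeats 400000 in
set_option synthInstance.maxSize 1000 in
theorem cyclic_trace : ∀ a b : Multiplicative (ZMod 9), a ≠ 1 → b ≠ 1 → a ≠ b → a * b ≠ 1 →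
    (∀ g, level [1, a, b] g = 3) → ¬ (a ^ 4 ∈ [1, a, b] ∧ b ^ 4 ∈ [1, a, b]) ∧
      ∀ w : Multiplicative (ZMod 9), w ≠ 1 → w ^ 3 = 1 →
        ¬ (∀ u ∈ [1, a, b], w * u ∈ [1, a, b]) ∧ ∃ u ∈ [1, a, b], w * u ∈ [1, a, b] := by
  decide +kernel

set_option synthInstance.maxHeartbeats 400000 in
set_option synthInstance.maxSize 1000 in
theorem cyclic_four : ∀ a b f : Multiplicative (ZMod 9), [1, a, b, f].Nodup →
    ∃ g, level [1, a, b, f] g < 4 := by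
  decide +kernel

set_option synthInstance.maxHeartbeats 400000 in
set_option synthInstance.maxSize 1000 in
theorem elementary_four : ∀ a b f : Multiplicative (ZMod 3 × ZMod 3), [1, a, b, f].Nodup →
    ∃ g, level [1, a, b, f] g < 4 := by
  decide +kernel

theorem equiv_of_card_nine [Finite K] (hK : Nat.card K = 9) :
    Nonempty (K ≃* Multiplicative (ZMod 9)) ∨
      (∀ g : K, g ^ 3 = 1) ∧ Nonempty (K ≃* Multiplicative (ZMod 3 × ZMod 3)) := by
  by_cases h : ∃ g : K, orderOf g = 9
  · left
    obtain ⟨g, hg⟩ := h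
    obtain ⟨φ, hφ, -⟩ := exists_hom_of_orderOf hg
    have : Function.Bijective φ := by
      have := Fintype.ofFinite K
      have : Fintype (Additive K) := inferInstance
      rw [Fintype.bijective_iff_injective_and_card]
      refine ⟨hφ, ?_⟩
      rw [ZMod.card, ← Nat.card_eq_fintype_card, ← hK]
      exact Nat.card_congr Additive.ofMul
    exact ⟨(AddEquiv.toMultiplicative (AddEquiv.ofBijective φ this).symm)⟩
  · right
    have h3 : ∀ g : K, g ^ 3 = 1 := by
      intro g
      have h1 : orderOf g ∣ 3 ^ 2 := by
        have := orderOf_dvd_natCard g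
        rwa [hK] at this
      obtain ⟨i, hi, h1⟩ := (Nat.dvd_prime_pow Nat.prime_three).1 h1
      interval_cases i
      · exact orderOf_dvd_iff_pow_eq_one.1 (h1 ▸ by norm_num)
      · exact orderOf_dvd_iff_pow_eq_one.1 (h1 ▸ by norm_num)
      · exact absurd ⟨g, h1⟩ h
    refine ⟨h3, ?_⟩
    have : Nontrivial K := Finite.one_lt_card_iff_nontrivial.1 (by rw [hK]; norm_num)
    obtain ⟨a, ha⟩ := exists_ne (1 : K)
    have hb : ∃ b : K, b ∉ Subgroup.zpowers a := by
      by_contra hb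
      push Not at hb
      have h1 : Nat.card (Subgroup.zpowers a) = 9 := by
        rw [(Subgroup.eq_top_iff' _).2 hb, Subgroup.card_top, hK]
      rw [Nat.card_zpowers] at h1
      exact h ⟨a, h1⟩
    obtain ⟨b, hb⟩ := hb
    obtain ⟨e, -, -⟩ := exists_hom_of_card_nine hK h3 ha
      (fun n hn => hb (Subgroup.mem_zpowers_iff.2 ⟨n, hn.symm⟩))
    exact ⟨AddEquiv.toMultiplicative e.symm⟩

theorem level_two [Fintype K] (hK : Nat.card K = 9) {a : K} (ha : a ≠ 1) :
    ∃ g, level [1, a] g < 2 := by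
  rcases equiv_of_card_nine hK with ⟨⟨e⟩⟩ | ⟨-, ⟨e⟩⟩
  · obtain ⟨g, hg⟩ := cyclic_two (e a) (by simpa using ha)
    refine ⟨e.symm g, ?_⟩
    rw [← level_map' e]
    simpa using hg
  · obtain ⟨g, hg⟩ := elementary_two (e a) (by simpa using ha)
    refine ⟨e.symm g, ?_⟩
    rw [← level_map' e]
    simpa using hg

theorem level_three [Fintype K] (hK : Nat.card K = 9) {a b : K} (ha : a ≠ 1) (hb : b ≠ 1)
    (hab : a ≠ b) (hl : ∀ g, 3 ≤ level [1, a, b] g) :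
    (a * b = 1 ∧ a ^ 3 = 1) ∨ (a * b ≠ 1 ∧ ∀ g, level [1, a, b] g = 3) := by
  have h : ∀ {A : Type} [CommGroup A] [DecidableEq A] [Fintype A] (e : K ≃* A),
      ((∃ g, level [1, e a, e b] g < 3) ∨ (e a * e b = 1 ∧ e a ^ 3 = 1) ∨
        (e a * e b ≠ 1 ∧ ∀ g, level [1, e a, e b] g = 3)) →
      (a * b = 1 ∧ a ^ 3 = 1) ∨ (a * b ≠ 1 ∧ ∀ g, level [1, a, b] g = 3) := by
    intro A _ _ _ e h
    have h0 : [1, e a, e b] = [1, a, b].map e := by simp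
    rw [h0] at h
    rcases h with ⟨g, hg⟩ | h | h
    · rw [level_map'] at hg
      exact absurd (hl _) hg.not_ge
    · left
      simpa [← map_mul, ← map_pow] using h
    · right
      refine ⟨by simpa [← map_mul] using h.1, fun g => ?_⟩
      rw [← level_map e]
      exact h.2 _
  rcases equiv_of_card_nine hK with ⟨⟨e⟩⟩ | ⟨-, ⟨e⟩⟩
  · exact h e (cyclic_three _ _ (by simpa using ha) (by simpa using hb) (by simpa using hab))
  · exact h e (elementary_three _ _ (by simpa using ha) (by simpa using hb) (by simpa using hab))

theorem level_four [Fintype K] (hK : Nat.card K = 9) {a b f : K} (hn : [1, a, b, f].Nodup) :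
    ∃ g, level [1, a, b, f] g < 4 := by
  have h : ∀ {A : Type} [CommGroup A] [DecidableEq A] [Fintype A] (e : K ≃* A),
      ([1, e a, e b, e f].Nodup → ∃ g, level [1, e a, e b, e f] g < 4) →
      ∃ g, level [1, a, b, f] g < 4 := by
    intro A _ _ _ e h
    have h0 : [1, e a, e b, e f] = [1, a, b, f].map e := by simp
    rw [h0] at h
    obtain ⟨g, hg⟩ := h (hn.map e.injective)
    rw [level_map'] at hg
    exact ⟨_, hg⟩
  rcases equiv_of_card_nine hK with ⟨⟨e⟩⟩ | ⟨-, ⟨e⟩⟩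
  · exact h e (cyclic_four _ _ _)
  · exact h e (elementary_four _ _ _)

/-- A triple in a cyclic group all of whose levels have size three. -/
theorem exists_pow_three_ne [Fintype K] (hK : Nat.card K = 9) (h3 : ∃ g : K, g ^ 3 ≠ 1) {a b : K}
    (ha : a ≠ 1) (hb : b ≠ 1) (hab : a ≠ b) (hab1 : a * b ≠ 1)
    (hl : ∀ g, level [1, a, b] g = 3) : ¬ (a ^ 4 ∈ [1, a, b] ∧ b ^ 4 ∈ [1, a, b]) ∧
      ∀ w : K, w ≠ 1 → w ^ 3 = 1 →
        ¬ (∀ u ∈ [1, a, b], w * u ∈ [1, a, b]) ∧ ∃ u ∈ [1, a, b], w * u ∈ [1, a, b] := by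
  rcases equiv_of_card_nine hK with ⟨⟨e⟩⟩ | ⟨h, -⟩
  · have h0 : [1, e a, e b] = [1, a, b].map e := by simp
    have h1 : ∀ g, e g ∈ [1, e a, e b] ↔ g ∈ [1, a, b] := fun g => by
      rw [h0, List.mem_map_of_injective e.injective]
    have h2 := cyclic_trace (e a) (e b) (by simpa using ha) (by simpa using hb)
      (by simpa using hab) (by simpa [← map_mul] using hab1)
      (fun g => by rw [h0, level_map']; exact hl _)
    rw [← map_pow, ← map_pow, h1, h1] at h2
    refine ⟨h2.1, fun w hw hw3 => ?_⟩
    have h4 := h2.2 (e w) (by simpa using hw) (by rw [← map_pow, hw3, map_one])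
    constructor
    · intro h5
      refine h4.1 fun u hu => ?_
      obtain ⟨u, rfl⟩ := e.surjective u
      rw [← map_mul, h1]
      exact h5 u ((h1 u).1 hu)
    · obtain ⟨u, hu, h5⟩ := h4.2
      obtain ⟨u, rfl⟩ := e.surjective u
      rw [← map_mul, h1] at h5
      exact ⟨u, (h1 u).1 hu, h5⟩
  · obtain ⟨g, hg⟩ := h3
    exact absurd (h g) hg

end

section

variable {G H C : Type} [CommGroup G] [CommGroup H] {c : G → C} {d : H → C} {U : Subgroup G}
  {U' : Subgroup H}

/-- The members of the class of `x` in the coset `xU`, as elements of `U`. -/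
def trace (c : G → C) (U : Subgroup G) (x : G) : Set U := {u | c (x * u) = c x}

theorem mem_trace {x : G} {u : U} : u ∈ trace c U x ↔ c (x * u) = c x := Iff.rfl

theorem one_mem_trace {x : G} : (1 : U) ∈ trace c U x := by
  rw [mem_trace, U.coe_one, mul_one]

theorem countP_eq_card {K : Type} (l : List K) (hn : l.Nodup) (p : K → Prop) [DecidablePred p] :
    l.countP (fun u => decide (p u)) = Nat.card {u // u ∈ l ∧ p u} := by
  classical
  rw [List.countP_eq_length_filter, ← List.toFinset_card_of_nodup (hn.filter _),
    ← Nat.card_eq_finsetCard]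
  refine Nat.card_congr (Equiv.subtypeEquivRight fun u => ?_)
  simp

theorem conv_eq_card [DecidableEq U] (hU : JS c c (U : Set G) U) (hi : U.index = 3) {x : G}
    (hx : x ∉ U) {l : List U} (hl : ∀ u, u ∈ l ↔ u ∈ trace c U x) (hn : l.Nodup) (g : U) :
    conv l g = Nat.card {y // c y = c x ∧ c (y⁻¹ * (x * x * g)) = c x} := by
  rw [conv, countP_eq_card l hn]
  simp only [hl, mem_trace]
  have h1 : ∀ u : U, (x * u)⁻¹ * (x * x * g) = x * ((g * u⁻¹ : U) : G) := fun u => by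
    push_cast
    apply Additive.ofMul.injective; simp only [ofMul_mul, ofMul_inv]; abel
  refine Nat.card_eq_of_bijective (fun u => ⟨x * u.1, u.2.1, by rw [h1]; exact u.2.2⟩)
    ⟨fun u v h => ?_, fun y => ?_⟩
  · simp only [Subtype.mk.injEq, mul_right_inj] at h
    exact Subtype.ext (Subtype.ext h)
  · obtain ⟨y, hy, hy'⟩ := y
    have hyx : y * x⁻¹ ∈ U := by
      rcases mem_or_of_index_three hi hx y with h | h | h
      · exact absurd ((hU hy).1 h) hx
      · exact h
      · refine absurd ((hU hy').1 ?_) hx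
        have : y⁻¹ * (x * x * g) = (y * x)⁻¹ * x ^ 3 * g := by
          apply Additive.ofMul.injective; simp only [ofMul_mul, ofMul_inv, ofMul_pow]; abel
        rw [this]
        exact U.mul_mem (U.mul_mem (U.inv_mem h) (pow_three_mem hi x)) g.2
    have h2 : x * (y * x⁻¹) = y := by
      rw [mul_comm, inv_mul_cancel_right]
    refine ⟨⟨⟨_, hyx⟩, by simpa only [h2], ?_⟩, Subtype.ext h2⟩
    rw [← h1]
    simpa only [h2]

theorem Joint.conv_eq [DecidableEq U] [DecidableEq U'] (J : Joint c d)
    (hU : JS c d (U : Set G) U') (hi : U.index = 3) (hi' : U'.index = 3) {x : G} {x' : H}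
    (hx : x ∉ U) (e : c x = d x') {l : List U} (hl : ∀ u, u ∈ l ↔ u ∈ trace c U x)
    (hn : l.Nodup) {l' : List U'} (hl' : ∀ u, u ∈ l' ↔ u ∈ trace d U' x') (hn' : l'.Nodup)
    {g : U} {h : U'} (egh : c (x * x * g) = d (x' * x' * h)) : conv l g = conv l' h := by
  rw [conv_eq_card (hU.left J) hi hx hl hn,
    conv_eq_card (hU.symm.left J.symm) hi' (fun h => hx ((hU e).2 h)) hl' hn']
  exact J.card_conv_eq egh (Φ := fun y w => c y = c x ∧ c w = c x)
    (Ψ := fun y w => d y = d x' ∧ d w = d x') fun y w y' w' h1 h2 => by rw [h1, h2, e]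

theorem Joint.card_trace_le [Finite G] [DecidableEq U] [Fintype U] (J : Joint c c)
    (hU : JS c c (U : Set G) U) (hi : U.index = 3) {x : G} (hx : x ∉ U)
    {l : List U} (hl : ∀ u, u ∈ l ↔ u ∈ trace c U x) (hn : l.Nodup) (g : U) :
    Nat.card (trace c U (x * x * g)) ≤ level l g := by
  rw [level, ← Nat.card_eq_finsetCard]
  refine Nat.card_le_card_of_injective
    (β := {h // h ∈ Finset.univ.filter fun h => conv l h = conv l g}) (fun u => ⟨g * u.1, ?_⟩) ?_
  · rw [Finset.mem_filter]
    refine ⟨Finset.mem_univ _, J.conv_eq hU hi hi hx rfl hl hn hl hn ?_⟩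
    rw [U.coe_mul, ← mul_assoc]
    exact u.2
  · intro u v h
    exact Subtype.ext (by simpa using h)

theorem Joint.card_trace_eq (J : Joint c d) (hU : JS c d (U : Set G) U') {x : G} {x' : H}
    (e : c x = d x') : Nat.card (trace c U x) = Nat.card (trace d U' x') := by
  have h : ∀ {G : Type} [CommGroup G] {c : G → C} {U : Subgroup G} (J : Joint c c) {x : G},
      Nat.card (trace c U x) = Nat.card {y // c y = c x ∧ y⁻¹ * x ∈ U} := by
    intro G _ c U _ x
    refine Nat.card_eq_of_bijective (fun u => ⟨x * u.1, u.2, by simp⟩) ⟨fun u v h => ?_, ?_⟩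
    · simp only [Subtype.mk.injEq, mul_right_inj] at h
      exact Subtype.ext (Subtype.ext h)
    · rintro ⟨y, hy, hy'⟩
      have h2 : x * (x⁻¹ * y) = y := mul_inv_cancel_left _ _
      refine ⟨⟨⟨x⁻¹ * y, by simpa using U.inv_mem hy'⟩, ?_⟩, Subtype.ext h2⟩
      rw [mem_trace]
      simpa only [h2]
  rw [h J.left, h J.right]
  exact J.card_conv_eq e (Φ := fun y w => c y = c x ∧ w ∈ U) (Ψ := fun y w => d y = d x' ∧ w ∈ U')
    fun y w y' w' h1 h2 => by rw [h1, e]; exact and_congr_right fun _ => hU h2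

theorem Joint.mem_trace_inv (J : Joint c c) {x : G} {u : U} :
    u ∈ trace c U x⁻¹ ↔ u⁻¹ ∈ trace c U x := by
  rw [mem_trace, mem_trace]
  constructor
  · intro h
    have := J.inv h
    rwa [mul_inv, inv_inv] at this
  · intro h
    have := J.inv h
    rwa [mul_inv, U.coe_inv, inv_inv] at this

theorem Joint.card_trace_inv (J : Joint c c) {x : G} :
    Nat.card (trace c U x⁻¹) = Nat.card (trace c U x) := by
  refine Nat.card_congr ((Equiv.inv U).subtypeEquiv fun u => ?_)
  exact J.mem_trace_inv

theorem exists_of_card_two {K : Type} [CommGroup K] {S : Set K} (h1 : 1 ∈ S)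
    (h : Nat.card S = 2) : ∃ a, a ≠ 1 ∧ ∀ u, u ∈ [1, a] ↔ u ∈ S := by
  obtain ⟨x, y, hxy, rfl⟩ := Set.ncard_eq_two.1 h
  rcases h1 with h1 | h1
  · exact ⟨y, by rw [h1]; exact hxy.symm, by simp [h1]⟩
  · exact ⟨x, by rw [h1]; exact hxy, by simp [← Set.mem_singleton_iff.1 h1, or_comm]⟩

theorem exists_of_card_three {K : Type} [CommGroup K] {S : Set K} (h1 : 1 ∈ S)
    (h : Nat.card S = 3) : ∃ a b, a ≠ 1 ∧ b ≠ 1 ∧ a ≠ b ∧ ∀ u, u ∈ [1, a, b] ↔ u ∈ S := by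
  classical
  have hf : S.Finite := Set.finite_of_ncard_ne_zero (by rw [← Nat.card_coe_set_eq, h]; norm_num)
  have h2 : (S \ {1}).ncard = 2 := by
    rw [Set.ncard_sdiff_singleton_of_mem h1, ← Nat.card_coe_set_eq, h]
  obtain ⟨x, y, hxy, hS⟩ := Set.ncard_eq_two.1 h2
  have hx : x ∈ S \ {1} := by rw [hS]; simp
  have hy : y ∈ S \ {1} := by rw [hS]; simp
  refine ⟨x, y, hx.2, hy.2, hxy, fun u => ?_⟩
  have := Set.ext_iff.1 hS u
  simp only [Set.mem_sdiff, Set.mem_singleton_iff, Set.mem_insert_iff] at this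
  simp only [List.mem_cons, List.not_mem_nil, or_false]
  by_cases hu : u = 1
  · simp [hu, h1]
  · rw [← this]; simp [hu]

theorem exists_of_card_four {K : Type} [CommGroup K] {S : Set K} (h1 : 1 ∈ S)
    (h : Nat.card S = 4) : ∃ a b f, [1, a, b, f].Nodup ∧ ∀ u, u ∈ [1, a, b, f] ↔ u ∈ S := by
  classical
  have h2 : (S \ {1}).ncard = 3 := by
    rw [Set.ncard_sdiff_singleton_of_mem h1, ← Nat.card_coe_set_eq, h]
  obtain ⟨x, y, z, hxy, hxz, hyz, hS⟩ := Set.ncard_eq_three.1 h2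
  have hx : x ∈ S \ {1} := by rw [hS]; simp
  have hy : y ∈ S \ {1} := by rw [hS]; simp
  have hz : z ∈ S \ {1} := by rw [hS]; simp
  refine ⟨x, y, z, ?_, fun u => ?_⟩
  · have := hx.2; have := hy.2; have := hz.2
    simp_all [eq_comm]
  have := Set.ext_iff.1 hS u
  simp only [Set.mem_sdiff, Set.mem_singleton_iff, Set.mem_insert_iff] at this
  simp only [List.mem_cons, List.not_mem_nil, or_false]
  by_cases hu : u = 1
  · simp [hu, h1]
  · rw [← this]; simp [hu]

end

section

variable {G H C : Type} [CommGroup G] [CommGroup H] {c : G → C} {d : H → C} {U : Subgroup G}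
  {U' : Subgroup H}

theorem Joint.eq_of_mul_thin (J : Joint c c) {x y : G} (hx : ∀ g, c g = c x → g = x)
    (hy : ∀ g, c g = c y → g = y) : ∀ g, c g = c (x * y) → g = x * y := fun g hg => by
  obtain ⟨a, b, ha, hb, rfl⟩ := J.exists_mul hg.symm
  rw [hx a ha.symm, hy b hb.symm]

theorem card_trace_pos [Finite G] {x : G} : 0 < Nat.card (trace c U x) :=
  Nat.card_pos_iff.2 ⟨⟨1, one_mem_trace⟩, inferInstance⟩

theorem Joint.exists_pair [Finite G] (J : Joint c c) (hU : JS c c (U : Set G) U)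
    (hi : U.index = 3) (hcU : Nat.card U = 9) {x : G} (hx : x ∉ U)
    (h1 : Nat.card (trace c U x) = 1) : ∃ z ∉ U, ∀ g, c g = c z → g = z ∨ g = z⁻¹ := by
  have huniq : ∀ y, c y = c x → ∀ u ∈ U, c (y * u) = c x → u = 1 := by
    intro y hy u hu h
    have h2 : Nat.card (trace c U y) = 1 := by rw [J.card_trace_eq hU hy, h1]
    have h3 := (Nat.card_eq_one_iff_unique.1 h2).1
    have h4 := @Subsingleton.elim _ h3 ⟨⟨u, hu⟩, h.trans hy.symm⟩ ⟨1, one_mem_trace⟩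
    simpa using congrArg (fun w => (w.1 : G)) h4
  by_cases h : ∃ y, c y = c x ∧ y ≠ x ∧ y ≠ x⁻¹
  swap
  · push Not at h
    exact ⟨x, hx, fun g hg => or_iff_not_imp_left.2 (h g hg)⟩
  obtain ⟨y, hy, hyx, -⟩ := h
  have hyU : y ∉ U := fun h => hx ((hU hy).1 h)
  have hxy : y * x ∈ U := by
    rcases mem_or_of_index_three hi hx y with h | h | h
    · exact absurd h hyU
    · have := huniq x rfl _ h (by rw [mul_comm x, inv_mul_cancel_right, hy])
      exact absurd (mul_inv_eq_one.1 this) hyx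
    · exact h
  have hcls : ∀ g, c g = c x → g = x ∨ g = y := by
    intro g hg
    rcases mem_or_of_index_three hi hx g with h | h | h
    · exact absurd ((hU hg).1 h) hx
    · left
      have := huniq x rfl _ h (by rw [mul_comm x, inv_mul_cancel_right, hg])
      exact mul_inv_eq_one.1 this
    · right
      have := huniq y hy (g * y⁻¹) (by
        have := U.mul_mem h (U.inv_mem hxy)
        rwa [mul_inv, ← mul_assoc, mul_right_comm, mul_inv_cancel_right] at this) (by
        rw [mul_comm y, inv_mul_cancel_right, hg])
      exact mul_inv_eq_one.1 this
  have hthin : ∀ g, c g = c (y * x) → g = y * x := by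
    intro g hg
    have hgU : g ∈ U := (hU hg).2 hxy
    obtain ⟨a, b, ha, hb, rfl⟩ := J.exists_mul hg.symm
    rcases hcls a (ha.symm.trans hy) with rfl | rfl <;> rcases hcls b hb.symm with rfl | rfl
    · exact absurd hgU (mul_self_notMem hi hx)
    · exact mul_comm _ _
    · rfl
    · exact absurd hgU (mul_self_notMem hi hyU)
  have h2 := J.eq_of_mul_thin hthin hthin
  have h4 := J.eq_of_mul_thin h2 h2
  have h9 : (y * x) ^ 9 = 1 := by
    have : (⟨y * x, hxy⟩ : U) ^ 9 = 1 := by rw [← hcU]; exact pow_card_eq_one'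
    simpa [Subtype.ext_iff] using this
  refine ⟨y * x * (y * x) * (y * x * (y * x)) * x, fun h => hx ?_, fun g hg => ?_⟩
  · exact (U.mul_mem_cancel_left (U.mul_mem (U.mul_mem hxy hxy) (U.mul_mem hxy hxy))).1 h
  · obtain ⟨a, b, ha, hb, rfl⟩ := J.exists_mul hg.symm
    rw [h4 a ha.symm]
    rcases hcls b hb.symm with rfl | rfl
    · left; rfl
    · right
      rw [eq_inv_iff_mul_eq_one, ← h9]
      apply Additive.ofMul.injective; simp only [ofMul_mul, ofMul_pow]; abel

theorem Joint.exists_pair_or [Finite G] (J : Joint c c) (hU : JS c c (U : Set G) U)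
    (hi : U.index = 3) (hcU : Nat.card U = 9) :
    (∃ z ∉ U, ∀ g, c g = c z → g = z ∨ g = z⁻¹) ∨ ∀ x ∉ U, 3 ≤ Nat.card (trace c U x) := by
  classical
  have := Fintype.ofFinite G
  by_contra! h
  obtain ⟨h1, x, hx, h3⟩ := h
  have hone : ∀ x ∉ U, Nat.card (trace c U x) ≠ 1 := fun x hx h => by
    obtain ⟨z, hz, hz'⟩ := J.exists_pair hU hi hcU hx h
    obtain ⟨g, hg, h1⟩ := h1 z hz
    rcases hz' g hg with rfl | rfl
    exacts [h1.1 rfl, h1.2 rfl]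
  have h2 : Nat.card (trace c U x) = 2 := by
    have := hone x hx
    have := card_trace_pos (c := c) (U := U) (x := x)
    omega
  obtain ⟨a, ha, hl⟩ := exists_of_card_two one_mem_trace h2
  obtain ⟨g, hg⟩ := level_two hcU ha
  have h4 := J.card_trace_le hU hi hx hl (by simpa using ha.symm) g
  have h5 : x * x * g ∉ U := fun h => mul_self_notMem hi hx ((U.mul_mem_cancel_right g.2).1 h)
  have := hone _ h5
  have := card_trace_pos (c := c) (U := U) (x := x * x * g)
  omega

/-- The traces meeting a coset cannot all have at least four elements unless the trace is the whole
coset. -/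
theorem Joint.exists_trace_three [Finite G] (J : Joint c c) (hU : JS c c (U : Set G) U)
    (hi : U.index = 3) (hcU : Nat.card U = 9) (h3 : ∀ x ∉ U, 3 ≤ Nat.card (trace c U x))
    {x : G} (hx : x ∉ U) (h9 : ∃ u ∈ U, c (x * u) ≠ c x) :
    ∃ y ∉ U, Nat.card (trace c U y) = 3 := by
  classical
  have := Fintype.ofFinite G
  by_contra! h
  have h4 : ∀ x ∉ U, 4 ≤ Nat.card (trace c U x) := fun x hx =>
    lt_of_le_of_ne (h3 x hx) (h x hx).symm
  have hne4 : ∀ x ∉ U, Nat.card (trace c U x) ≠ 4 := by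
    intro x hx h
    obtain ⟨a, b, f, hn, hl⟩ := exists_of_card_four one_mem_trace h
    obtain ⟨g, hg⟩ := level_four hcU hn
    have h5 := J.card_trace_le hU hi hx hl hn g
    have := h4 (x * x * g) fun h => mul_self_notMem hi hx ((U.mul_mem_cancel_right g.2).1 h)
    omega
  obtain ⟨u, hu, hxu⟩ := h9
  have hxuU : x * u ∉ U := fun h => hx ((U.mul_mem_cancel_right hu).1 h)
  have h5 : Nat.card (trace c U (x * u)) ≤ Nat.card ((trace c U x)ᶜ : Set U) := by
    refine Nat.card_le_card_of_injective (fun v => ⟨⟨u, hu⟩ * v.1, fun h => hxu ?_⟩)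
      fun v w h => Subtype.ext (by simpa using h)
    rw [mem_trace, U.coe_mul, ← mul_assoc] at h
    rw [← h]
    exact v.2.symm
  have h6 : Nat.card (trace c U x) + Nat.card ((trace c U x)ᶜ : Set U) = 9 := by
    rw [Nat.card_coe_set_eq, Nat.card_coe_set_eq, Set.ncard_add_ncard_compl, hcU]
  have := h4 x hx
  have := h4 _ hxuU
  have := hne4 x hx
  have := hne4 _ hxuU
  omega

end

section

variable {G H C : Type} [CommGroup G] [CommGroup H] {c : G → C} {d : H → C} {U : Subgroup G}
  {U' : Subgroup H}

theorem conv_eq_length {K : Type} [CommGroup K] [DecidableEq K] {l : List K} {g : K} :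
    conv l g = l.length ↔ ∀ u ∈ l, g * u⁻¹ ∈ l := by
  rw [conv, List.countP_eq_length]
  simp only [decide_eq_true_eq]

theorem mem_zpowers_of_pow_three {a : G} (ha : a ^ 3 = 1) (ha1 : a ≠ 1) {g : G} :
    g ∈ Subgroup.zpowers a ↔ g = 1 ∨ g = a ∨ g = a⁻¹ := by
  have hc : Nat.card (Subgroup.zpowers a) = 3 := by
    rw [Nat.card_zpowers, orderOf_eq_prime ha ha1]
  constructor
  · exact fun h => mem_of_card_three hc (Subgroup.mem_zpowers a) ha1 h
  · rintro (rfl | rfl | rfl)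
    exacts [Subgroup.one_mem _, Subgroup.mem_zpowers _, Subgroup.inv_mem _ (Subgroup.mem_zpowers _)]

theorem ne_inv_of_card_nine {K : Type} [CommGroup K] (hK : Nat.card K = 9) {a : K} (ha : a ≠ 1) :
    a⁻¹ ≠ a := by
  intro h
  have h2 : a ^ 2 = 1 := by rw [pow_two]; nth_rewrite 1 [← h]; exact inv_mul_cancel a
  have h9 : a ^ 9 = 1 := by rw [← hK]; exact pow_card_eq_one'
  rw [show 9 = 2 * 4 + 1 by norm_num, pow_succ, pow_mul, h2, one_pow, one_mul] at h9
  exact ha h9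

theorem Joint.mul_mem_cls_of_coset_trace [Finite G] (J : Joint c c) (hU : JS c c (U : Set G) U)
    (hi : U.index = 3) (hcU : Nat.card U = 9) (hG : Nat.card G = 27)
    (h3 : ∀ x ∉ U, 3 ≤ Nat.card (trace c U x))
    {x : G} (hx : x ∉ U) {D : Subgroup G} (hDU : D ≤ U) (hcD : Nat.card D = 3)
    (hD : ∀ u ∈ U, c (x * u) = c x ↔ u ∈ D) :
    ∀ y, c y = c x → ∀ d ∈ D, c (y * d) = c x := by
  classical
  have := Fintype.ofFinite G
  intro y hy d hd
  have hyU : y ∉ U := fun h => hx ((hU hy).1 h)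
  rcases mem_or_of_index_three hi hx y with h | h | h
  · exact absurd h hyU
  · have h1 : x * (y * x⁻¹) = y := by rw [mul_comm x, inv_mul_cancel_right]
    rw [← h1, mul_assoc]
    refine (hD _ (U.mul_mem h (hDU hd))).2 (D.mul_mem ((hD _ h).1 ?_) hd)
    rw [h1, hy]
  have hDcard : Nat.card (trace c U x) = 3 := by
    rw [← hcD]
    refine Nat.card_eq_of_bijective (fun u => (⟨u.1, (hD _ u.1.2).1 u.2⟩ : D))
      ⟨fun u v h => ?_, fun e => ⟨⟨⟨e.1, hDU e.2⟩, (hD _ (hDU e.2)).2 e.2⟩, rfl⟩⟩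
    have h' : ((u.1 : U) : G) = (v.1 : U) := congrArg (fun w : D => (w : G)) h
    exact Subtype.ext (Subtype.ext h')
  obtain ⟨a, b, ha, hb, hab, hl⟩ := exists_of_card_three one_mem_trace hDcard
  have hDc : Nat.card (trace c U y) = 3 := by rw [J.card_trace_eq hU hy, hDcard]
  obtain ⟨a', b', ha', hb', hab', hl'⟩ := exists_of_card_three one_mem_trace hDc
  have hn : [1, a, b].Nodup := by simp [ha.symm, hb.symm, hab]
  have hn' : [1, a', b'].Nodup := by simp [ha'.symm, hb'.symm, hab']
  have hlD : ∀ u, u ∈ [1, a, b] ↔ (u : G) ∈ D := fun u => (hl u).trans (hD _ u.2)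
  have hsq : c (y * y * (1 : U)) = c (x * x * (1 : U)) := by
    have := J.pow (m := 2) (by rw [hG]; norm_num) hy
    rwa [U.coe_one, mul_one, mul_one, ← pow_two, ← pow_two]
  have hconv : conv [1, a', b'] 1 = conv [1, a, b] 1 := J.conv_eq hU hi hi hyU hy hl' hn' hl hn hsq
  have hconv' : conv [1, a, b] 1 = [1, a, b].length := by
    rw [conv_eq_length]
    intro u hu
    rw [hlD, one_mul]
    exact D.inv_mem ((hlD u).1 hu)
  have hab1 : a' * b' = 1 := by
    rw [hconv', show [1, a, b].length = [1, a', b'].length from rfl,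
      conv_eq_length] at hconv
    have h1 := hconv a' (by simp)
    rw [one_mul] at h1
    simp only [List.mem_cons, List.not_mem_nil, or_false, inv_eq_one] at h1
    rcases h1 with h1 | h1 | h1
    · exact absurd h1 ha'
    · exact absurd h1 (ne_inv_of_card_nine hcU ha')
    · rw [← h1, mul_inv_cancel]
  have ha3 : a' ^ 3 = 1 := by
    rcases level_three hcU ha' hb' hab' fun g =>
      (h3 (y * y * g) fun h => mul_self_notMem hi hyU ((U.mul_mem_cancel_right g.2).1 h)).trans
        (J.card_trace_le hU hi hyU hl' hn' g) with h1 | h1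
    · exact h1.2
    · exact absurd hab1 h1.1
  have hD' : ∀ u ∈ U, c (y * u) = c y ↔ u ∈ Subgroup.zpowers (a' : G) := by
    intro u hu
    have h1 := hl' ⟨u, hu⟩
    rw [mem_trace] at h1
    rw [← h1, mem_zpowers_of_pow_three (by exact_mod_cast ha3) (by exact_mod_cast ha'),
      eq_inv_of_mul_eq_one_right hab1]
    simp [Subtype.ext_iff]
  have hcD' : Nat.card (Subgroup.zpowers (a' : G)) = 3 := by
    rw [Nat.card_zpowers, orderOf_eq_prime (by exact_mod_cast ha3) (by exact_mod_cast ha')]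
  have hD'U : Subgroup.zpowers (a' : G) ≤ U := by
    rw [Subgroup.zpowers_le]; exact a'.2
  have haD : (a' : G) ∈ D := by
    by_contra haD
    have hdisj : Disjoint D (Subgroup.zpowers (a' : G)) := by
      rw [Subgroup.disjoint_def]
      intro m hm hm'
      by_contra hm1
      rcases mem_of_card_three hcD' hm' hm1 (Subgroup.mem_zpowers _) with h1 | h1 | h1
      · exact ha' (by exact_mod_cast h1)
      · exact haD (h1 ▸ hm)
      · exact haD (h1 ▸ D.inv_mem hm)
    have hsup : D ⊔ Subgroup.zpowers (a' : G) = U :=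
      Subgroup.eq_of_le_of_card_ge (sup_le hDU hD'U) (by
        rw [card_sup_of_disjoint hdisj, hcD, hcD', hcU])
    rw [← hsup] at h
    obtain ⟨e, he, e', he', h⟩ := Subgroup.mem_sup.1 h
    have h1 : ∀ m ∈ Subgroup.zpowers (a' : G), c (x * (e⁻¹ * m)) = c x⁻¹ := by
      intro m hm
      have h2 : x * (e⁻¹ * m) = (y * (e'⁻¹ * m⁻¹))⁻¹ := by
        have h4 : y = e * e' * x⁻¹ := by rw [h, mul_inv_cancel_right]
        rw [h4]
        apply Additive.ofMul.injective; simp only [ofMul_mul, ofMul_inv]; abel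
      rw [h2]
      refine J.inv (((hD' _ ?_).2 ?_).trans hy)
      · exact hD'U (Subgroup.mul_mem _ (Subgroup.inv_mem _ he') (Subgroup.inv_mem _ hm))
      · exact Subgroup.mul_mem _ (Subgroup.inv_mem _ he') (Subgroup.inv_mem _ hm)
    have h2 := h1 1 (Subgroup.one_mem _)
    rw [mul_one, (hD _ (U.inv_mem (hDU he))).2 (D.inv_mem he)] at h2
    have h4 := h1 a' (Subgroup.mem_zpowers _)
    rw [← h2, hD _ (U.mul_mem (U.inv_mem (hDU he)) a'.2), D.mul_mem_cancel_left (D.inv_mem he)]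
      at h4
    exact haD h4
  refine ((hD' _ (hDU hd)).2 ?_).trans hy
  rw [mem_zpowers_of_pow_three (by exact_mod_cast ha3) (by exact_mod_cast ha')]
  exact mem_of_card_three hcD haD (by exact_mod_cast ha') hd

theorem Joint.isASet_of_coset_trace [Finite G] (J : Joint c c) (hU : JS c c (U : Set G) U)
    (hi : U.index = 3) {x : G} (hx : x ∉ U) {D : Subgroup G}
    (hD : ∀ u ∈ U, c (x * u) = c x ↔ u ∈ D)
    (h : ∀ y, c y = c x → ∀ d ∈ D, c (y * d) = c x) : JS c c (D : Set G) D := by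
  obtain ⟨R, hR, hR'⟩ := J.exists_stab (φ := fun y => c y = c x) fun g h e => by rw [e]
  have hle : ∀ r ∈ R, c (x * r) = c x := fun r hr => ((hR' r).1 hr x).symm ▸ rfl
  have : R = D := by
    ext r
    constructor
    · intro hr
      have hrU : r ∈ U := by
        by_contra hrU
        rcases mem_or_of_index_three hi hrU x with h | h | h
        · exact hx h
        · exact hx ((hU (hle _ (R.inv_mem hr))).1 h)
        · exact hx ((hU (hle _ hr)).1 h)
      exact (hD r hrU).1 (hle r hr)
    · intro hr
      rw [hR']
      intro y
      refine propext ⟨fun hy => ?_, fun hy => h y hy r hr⟩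
      have := h _ hy r⁻¹ (D.inv_mem hr)
      rwa [mul_inv_cancel_right] at this
  rwa [this] at hR

theorem Joint.const_of_coset_trace [Finite G] (J : Joint c c) (hU : JS c c (U : Set G) U)
    (hi : U.index = 3) (hcU : Nat.card U = 9)
    (h3 : ∀ x ∉ U, 3 ≤ Nat.card (trace c U x))
    {x : G} (hx : x ∉ U) {D : Subgroup G} (hDU : D ≤ U) (hcD : Nat.card D = 3)
    (hD : ∀ u ∈ U, c (x * u) = c x ↔ u ∈ D) (hJD : JS c c (D : Set G) D)
    (hxD : ∀ y, c y = c x → ∀ d ∈ D, c (y * d) = c x) :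
    ∀ y ∉ U, ∀ d ∈ D, c (y * d) = c y := by
  have := Fintype.ofFinite G
  have hpart : ∀ y, y * x⁻¹ ∈ U → ∃ d ∈ D, d ≠ 1 ∧ c (y * d) = c y := by
    intro y hyx
    have hyU : y ∉ U := fun h => hx (by simpa using (U.mul_mem_cancel_left h).1 hyx)
    by_cases hy : c y = c x
    · have : Nontrivial D := Finite.one_lt_card_iff_nontrivial.1 (by omega)
      obtain ⟨d, hd⟩ := exists_ne (1 : D)
      exact ⟨d, d.2, by simpa using hd, by rw [hxD y hy d d.2, hy]⟩
    obtain ⟨u, v, hne, hmem⟩ : ∃ u v : trace c U y, u ≠ v ∧ ((u : U) : G)⁻¹ * ((v : U) : G) ∈ D := by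
      by_contra! hno
      let F : trace c U y → U ⧸ D.subgroupOf U := fun u => ((u : U) : U ⧸ D.subgroupOf U)
      have hinj : Function.Injective F := by
        intro u v huv
        by_contra hne
        exact hno u v hne (by simpa [Subgroup.mem_subgroupOf] using QuotientGroup.eq.1 huv)
      have hcq : Nat.card (U ⧸ D.subgroupOf U) = 3 := by
        have h1 := (D.subgroupOf U).card_mul_index
        have h2 : Nat.card (D.subgroupOf U) = 3 := by
          rw [← hcD]; exact Nat.card_congr (Subgroup.subgroupOfEquivOfLe hDU).toEquiv
        rw [h2, hcU] at h1
        exact Nat.eq_of_mul_eq_mul_left (by norm_num : 0 < 3) (h1.trans (by norm_num))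
      have hbij : Function.Bijective F := hinj.bijective_of_nat_card_le (by rw [hcq]; exact h3 y hyU)
      have hyx' : y⁻¹ * x ∈ U := by
        have := U.inv_mem hyx
        rwa [mul_inv, inv_inv] at this
      obtain ⟨u, hu⟩ := hbij.2 ((⟨y⁻¹ * x, hyx'⟩ : U) : U ⧸ D.subgroupOf U)
      have h1 : ((u : U) : G)⁻¹ * (y⁻¹ * x) ∈ D := by
        simpa [Subgroup.mem_subgroupOf] using QuotientGroup.eq.1 hu
      have h2 := hxD x rfl _ (D.inv_mem h1)
      have h4 : x * (((u : U) : G)⁻¹ * (y⁻¹ * x))⁻¹ = y * (u : U) := by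
        apply Additive.ofMul.injective; simp only [ofMul_mul, ofMul_inv]; abel
      rw [h4, u.2] at h2
      exact hy h2
    have h1 : c (y * (v : U) * (((u : U) : G)⁻¹ * ((v : U) : G))⁻¹) = c y := by
      rw [← show c (y * (u : U)) = c y from u.2]
      congr 1
      apply Additive.ofMul.injective; simp only [ofMul_mul, ofMul_inv]; abel
    obtain ⟨p, q, hp, hq, rfl⟩ := J.exists_mul h1
    refine ⟨q⁻¹, D.inv_mem ((hJD hq).1 (D.inv_mem hmem)), fun h => hne ?_, ?_⟩
    · rw [inv_eq_one] at h
      have := (J.one_iff hq).2 h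
      rw [inv_eq_one, inv_mul_eq_one] at this
      exact Subtype.ext (Subtype.ext this)
    · rw [mul_inv_cancel_right, ← hp]
      exact v.2
  have hconst : ∀ y, y * x⁻¹ ∈ U → ∀ d ∈ D, c (y * d) = c y := by
    intro y hyx d hd
    obtain ⟨e, he, he1, h1⟩ := hpart y hyx
    have h2 : c (y * e⁻¹) = c y := by
      have h4 : y * e⁻¹ * x⁻¹ ∈ U := by
        rw [mul_right_comm]; exact U.mul_mem hyx (U.inv_mem (hDU he))
      obtain ⟨f, hf, hf1, h5⟩ := hpart (y * e⁻¹) h4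
      rcases mem_of_card_three hcD he he1 hf with rfl | rfl | rfl
      · exact absurd rfl hf1
      · rw [inv_mul_cancel_right] at h5
        exact h5.symm
      · rw [← h5, mul_assoc, ← mul_inv, mul_self_of_card_three hcD he, inv_inv, h1]
    rcases mem_of_card_three hcD he he1 hd with rfl | rfl | rfl
    · rw [mul_one]
    · exact h1
    · exact h2
  intro y hyU d hd
  rcases mem_or_of_index_three hi hx y with h | h | h
  · exact absurd h hyU
  · exact hconst y h d hd
  · have h1 := hconst y⁻¹ (by rw [← mul_inv]; exact U.inv_mem h) d⁻¹ (D.inv_mem hd)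
    have := J.inv h1
    rwa [← mul_inv, inv_inv, inv_inv] at this

theorem Joint.exists_ji_of_coset_trace [Finite G] [Finite H] (J : Joint c d)
    (hU : JS c d (U : Set G) U')
    (hi : U.index = 3) (hcU : Nat.card U = 9) (hG : Nat.card G = 27)
    (h3 : ∀ x ∉ U, 3 ≤ Nat.card (trace c U x))
    {x : G} (hx : x ∉ U) {D : Subgroup G} (hDU : D ≤ U) (hcD : Nat.card D = 3)
    (hD : ∀ u ∈ U, c (x * u) = c x ↔ u ∈ D) : ∃ f : G → H, JI c d f := by
  have hUc := hU.left J
  have h1 := J.left.mul_mem_cls_of_coset_trace hUc hi hcU hG h3 hx hDU hcD hD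
  have h2 := J.left.isASet_of_coset_trace hUc hi hx hD h1
  have h4 := J.left.const_of_coset_trace hUc hi hcU h3 hx hDU hcD hD h2 h1
  obtain ⟨D', hD'⟩ := J.exists_subgroup D h2
  refine J.exists_ji_of_wedge_nine hD' hU hDU hcD hcU h4 ?_
  exact sep_nine _ _ _ _ _ (card_quotient_of_card (by norm_num) (n := 9) (p := 3) hG hcD)
    (J.quotient hD')

end

section

variable {G H C : Type} [CommGroup G] [CommGroup H] {c : G → C} {d : H → C} {U : Subgroup G}
  {U' : Subgroup H}

/-- The trace at `x` is `{1, a, b}`, and its square has three values, each taken three times. -/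
structure IsTriple [DecidableEq U] [Fintype U] (c : G → C) (x : G) (a b : U) : Prop where
  left : a ≠ 1
  right : b ≠ 1
  ne : a ≠ b
  mul : a * b ≠ 1
  mem : ∀ u, u ∈ [1, a, b] ↔ u ∈ trace c U x
  level : ∀ g, level [1, a, b] g = 3

theorem IsTriple.nodup [DecidableEq U] [Fintype U] {x : G} {a b : U} (h : IsTriple c x a b) :
    [1, a, b].Nodup := by
  simp [h.left.symm, h.right.symm, h.ne]

theorem Joint.forall_isTriple [DecidableEq U] [Fintype U] [Finite G] (J : Joint c c)
    (hU : JS c c (U : Set G) U) (hi : U.index = 3) (hcU : Nat.card U = 9)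
    (h3 : ∀ x ∉ U, 3 ≤ Nat.card (trace c U x))
    (hno : ¬ ∃ x ∉ U, ∃ D : Subgroup G, D ≤ U ∧ Nat.card D = 3 ∧
      ∀ u ∈ U, c (x * u) = c x ↔ u ∈ D)
    {x : G} (hx : x ∉ U) (hx3 : Nat.card (trace c U x) = 3) :
    ∀ y ∉ U, ∃ a b : U, IsTriple c y a b := by
  have key : ∀ y ∉ U, Nat.card (trace c U y) = 3 → ∃ a b : U, IsTriple c y a b := by
    intro y hy hy3
    obtain ⟨a, b, ha, hb, hab, hl⟩ := exists_of_card_three one_mem_trace hy3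
    have hn : [1, a, b].Nodup := by simp [ha.symm, hb.symm, hab]
    rcases level_three hcU ha hb hab fun g =>
      (h3 (y * y * g) fun h => mul_self_notMem hi hy ((U.mul_mem_cancel_right g.2).1 h)).trans
        (J.card_trace_le hU hi hy hl hn g) with h1 | h1
    · refine absurd ⟨y, hy, Subgroup.zpowers (a : G), ?_, ?_, fun u hu => ?_⟩ hno
      · rw [Subgroup.zpowers_le]; exact a.2
      · rw [Nat.card_zpowers, orderOf_eq_prime (by exact_mod_cast h1.2) (by exact_mod_cast ha)]
      · have h2 := hl ⟨u, hu⟩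
        rw [mem_trace] at h2
        rw [← h2, mem_zpowers_of_pow_three (by exact_mod_cast h1.2) (by exact_mod_cast ha),
          eq_inv_of_mul_eq_one_right h1.1]
        simp [Subtype.ext_iff]
    · exact ⟨a, b, ha, hb, hab, h1.1, hl, h1.2⟩
  obtain ⟨a, b, T⟩ := key x hx hx3
  have h4 : ∀ y, y * x ∈ U → Nat.card (trace c U y) = 3 := by
    intro y hyx
    have hyU : y ∉ U := fun h => hx ((U.mul_mem_cancel_left h).1 hyx)
    refine le_antisymm ?_ (h3 y hyU)
    have h5 : y * (x * x)⁻¹ ∈ U := by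
      have : y * (x * x)⁻¹ = y * x * (x ^ 3)⁻¹ := by
        apply Additive.ofMul.injective; simp only [ofMul_mul, ofMul_inv, ofMul_pow]; abel
      rw [this]
      exact U.mul_mem hyx (U.inv_mem (pow_three_mem hi x))
    have h6 := J.card_trace_le hU hi hx T.mem T.nodup ⟨_, h5⟩
    rwa [T.level, mul_comm (x * x), inv_mul_cancel_right] at h6
  intro y hy
  refine key y hy ?_
  rcases mem_or_of_index_three hi hx y with h | h | h
  · exact absurd h hy
  · rw [← J.card_trace_inv]
    refine h4 _ ?_
    have := U.inv_mem h
    rwa [mul_inv, inv_inv] at this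
  · exact h4 y h

theorem exists_pow_three_eq {K : Type} [CommGroup K] [Finite K] (hK : Nat.card K = 9)
    (h3 : ∃ g : K, g ^ 3 ≠ 1) {m : K} (hm : m ^ 3 = 1) : ∃ v : K, v ^ 3 = m := by
  classical
  rcases equiv_of_card_nine hK with ⟨⟨e⟩⟩ | ⟨h, -⟩
  · have h1 : ∀ m : Multiplicative (ZMod 9), m ^ 3 = 1 → ∃ v : Multiplicative (ZMod 9),
      v ^ 3 = m := by decide +kernel
    obtain ⟨v, hv⟩ := h1 (e m) (by rw [← map_pow, hm, map_one])
    exact ⟨e.symm v, by rw [← map_pow, hv, e.symm_apply_apply]⟩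
  · obtain ⟨g, hg⟩ := h3
    exact absurd (h g) hg

theorem Joint.pow_three_eq_one [DecidableEq U] [Fintype U] [Finite G] (J : Joint c c)
    (hi : U.index = 3) (hcU : Nat.card U = 9) (hG : Nat.card G = 27)
    (hT : ∀ y ∉ U, ∃ a b : U, IsTriple c y a b) (u : U) : u ^ 3 = 1 := by
  by_contra hu
  have h27 : ∀ g : G, g ^ 27 = 1 := fun g => by rw [← hG]; exact pow_card_eq_one'
  have hU9 : ∀ u : U, (u : G) ^ 9 = 1 := fun u => by
    have : u ^ 9 = 1 := by rw [← hcU]; exact pow_card_eq_one'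
    exact_mod_cast this
  have hcube : ∀ x ∉ U, x ^ 3 ≠ 1 := by
    intro x hx hx3
    obtain ⟨a, b, T⟩ := hT x hx
    refine (exists_pow_three_ne hcU ⟨u, hu⟩ T.left T.right T.ne T.mul T.level).1 ?_
    have h1 : ∀ v ∈ [1, a, b], v ^ 4 ∈ [1, a, b] := by
      intro v hv
      rw [T.mem, mem_trace] at hv ⊢
      have h4 := J.pow (m := 4) (by rw [hG]; norm_num) hv
      rwa [mul_pow, show x ^ 4 = x by rw [pow_succ, hx3, one_mul]] at h4
    exact ⟨h1 a (by simp), h1 b (by simp)⟩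
  have hU' : ∃ x, x ∉ U := by
    by_contra! h
    rw [(Subgroup.eq_top_iff' U).2 h, Subgroup.index_top] at hi
    norm_num at hi
  obtain ⟨x, hx⟩ := hU'
  have hx9 : x ^ 9 ≠ 1 := by
    intro hx9
    obtain ⟨v, hv⟩ := exists_pow_three_eq hcU ⟨u, hu⟩ (m := ⟨x ^ 3, pow_three_mem hi x⟩)
      (by rw [Subtype.ext_iff]; simp [← pow_mul, hx9])
    refine hcube (x * (v : G)⁻¹) (fun h => hx ((U.mul_mem_cancel_right (U.inv_mem v.2)).1 h)) ?_
    rw [mul_pow, inv_pow, mul_inv_eq_one]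
    exact (congrArg (fun w : U => (w : G)) hv).symm
  obtain ⟨a, b, T⟩ := hT x hx
  have hw : x ^ 9 ∈ U := by
    rw [show 9 = 3 * 3 by norm_num, pow_mul]
    exact U.pow_mem (pow_three_mem hi x) 3
  obtain ⟨h1, v, hv, hwv⟩ :=
    (exists_pow_three_ne hcU ⟨u, hu⟩ T.left T.right T.ne T.mul T.level).2 ⟨x ^ 9, hw⟩
    (by simpa [Subtype.ext_iff] using hx9) (by simp [Subtype.ext_iff, ← pow_mul, h27])
  have h2 : ∀ v ∈ [1, a, b], c (x * (x ^ 9 * v)) = c (x * x ^ 9) := by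
    intro v hv
    rw [T.mem, mem_trace] at hv
    have h4 := J.pow (m := 10) (by rw [hG]; norm_num) hv
    rwa [mul_pow, show (v : G) ^ 10 = v by rw [pow_succ, hU9, one_mul],
      show x ^ 10 = x * x ^ 9 by rw [← pow_succ'], mul_assoc] at h4
  refine h1 fun v' hv' => ?_
  rw [T.mem, mem_trace] at hwv ⊢
  rw [U.coe_mul] at hwv ⊢
  rw [← hwv, h2 v hv, h2 v' hv']

theorem Joint.exists_isTriple_match [DecidableEq U] [Fintype U] [DecidableEq U'] [Fintype U']
    (J : Joint c d) (hU : JS c d (U : Set G) U') {x : G} {x' : H} (hxx : c x = d x')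
    {a b : U} (T : IsTriple c x a b) {a₀ b₀ : U'} (T₀ : IsTriple d x' a₀ b₀) :
    ∃ a' b' : U', IsTriple d x' a' b' ∧ c a = d a' ∧ c b = d b' ∧
      c ((b⁻¹ * a : U) : G) = d ((b'⁻¹ * a' : U') : H) := by
  have key : ∀ {z : G} {z' : H} (e : G ≃ H)
      (he : ∀ y, c y = d (e y) ∧ c (y⁻¹ * z) = d ((e y)⁻¹ * z')), z * x⁻¹ ∈ U → z' * x'⁻¹ ∈ U' →
      ∀ u ∈ [1, a, b], ∃ u' ∈ [1, a₀, b₀], e (x * u) = x' * u' := by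
    intro z z' e he hz hz' u hu
    obtain ⟨h1, h2⟩ := he (x * u)
    have h3 : (e (x * u))⁻¹ * z' ∈ U' := by
      refine (hU h2).1 ?_
      have : (x * u)⁻¹ * z = z * x⁻¹ * (u : G)⁻¹ := by
        apply Additive.ofMul.injective; simp only [ofMul_mul, ofMul_inv]; abel
      rw [this]
      exact U.mul_mem hz (U.inv_mem u.2)
    have h4 : x'⁻¹ * e (x * u) ∈ U' := by
      have := U'.mul_mem (U'.inv_mem h3) hz'
      have h5 : ((e (x * u))⁻¹ * z')⁻¹ * (z' * x'⁻¹) = x'⁻¹ * e (x * u) := by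
        apply Additive.ofMul.injective; simp only [ofMul_mul, ofMul_inv]; abel
      rwa [h5] at this
    refine ⟨⟨_, h4⟩, ?_, (mul_inv_cancel_left _ _).symm⟩
    rw [T.mem, mem_trace] at hu
    rw [T₀.mem, mem_trace]
    simp only [mul_inv_cancel_left]
    rw [← h1, hu, hxx]
  have hinj : ∀ (e : G ≃ H) {u v : U} {u' v' : U'}, e (x * u) = x' * u' → e (x * v) = x' * v' →
      u' = v' → u = v := by
    rintro e u v u' v' h1 h2 rfl
    rw [← h2] at h1
    exact Subtype.ext (mul_left_cancel (e.injective h1))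
  obtain ⟨e, he⟩ := J.exists_equiv hxx
  have k := key e he (by rw [mul_inv_cancel]; exact U.one_mem)
    (by rw [mul_inv_cancel]; exact U'.one_mem)
  have hval : ∀ {u : U} {u' : U'}, e (x * u) = x' * u' → c u = d u' := by
    intro u u' h
    have h1 := J.inv (he (x * u)).2
    rw [h] at h1
    simpa using h1
  obtain ⟨a', ha', hea⟩ := k a (by simp)
  obtain ⟨b', hb', heb⟩ := k b (by simp)
  have ha1 : a' ≠ 1 := fun h => T.left (by
    have := (J.one_iff (hval hea)).2 (by rw [h]; rfl)
    exact_mod_cast this)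
  have hb1 : b' ≠ 1 := fun h => T.right (by
    have := (J.one_iff (hval heb)).2 (by rw [h]; rfl)
    exact_mod_cast this)
  have hab : a' ≠ b' := fun h => T.ne (hinj e hea heb h)
  have T' : IsTriple d x' a' b' := by
    have hsw : IsTriple d x' b₀ a₀ := by
      have hperm : ∀ u, u ∈ [1, b₀, a₀] ↔ u ∈ [1, a₀, b₀] := fun u => by simp [or_comm]
      refine ⟨T₀.right, T₀.left, T₀.ne.symm, by rw [mul_comm]; exact T₀.mul,
        fun u => (hperm u).trans (T₀.mem u), fun g => ?_⟩
      rw [← T₀.level g]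
      have hc : ∀ g, conv [1, b₀, a₀] g = conv [1, a₀, b₀] g := fun g => by
        have hp : List.Perm [1, b₀, a₀] [1, a₀, b₀] := (List.Perm.swap _ _ _).cons _
        rw [conv, conv, hp.countP_eq]
        exact List.countP_congr fun u _ => by simp only [hperm]
      simp only [SchurSep.level, hc]
    have h1 : a' = a₀ ∨ a' = b₀ := by simpa [ha1] using ha'
    have h2 : b' = a₀ ∨ b' = b₀ := by simpa [hb1] using hb'
    rcases h1 with rfl | rfl <;> rcases h2 with rfl | rfl
    exacts [absurd rfl hab, T₀, hsw, absurd rfl hab]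
  refine ⟨a', b', T', hval hea, hval heb, ?_⟩
  have hxa : c (x * a) = d (x' * a') := by rw [(he _).1, hea]
  obtain ⟨e₂, he₂⟩ := J.exists_equiv hxa
  have k₂ := key e₂ he₂ (by rw [mul_comm x, mul_inv_cancel_right]; exact a.2)
    (by rw [mul_comm x', mul_inv_cancel_right]; exact a'.2)
  have hval₂ : ∀ {u : U} {u' : U'}, e₂ (x * u) = x' * u' →
      c ((u⁻¹ * a : U) : G) = d ((u'⁻¹ * a' : U') : H) := by
    intro u u' h
    have h1 := (he₂ (x * u)).2
    rw [h] at h1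
    have h2 : (x * u)⁻¹ * (x * a) = ((u⁻¹ * a : U) : G) := by
      push_cast; apply Additive.ofMul.injective; simp only [ofMul_mul, ofMul_inv]; abel
    have h3 : (x' * u')⁻¹ * (x' * a') = ((u'⁻¹ * a' : U') : H) := by
      push_cast; apply Additive.ofMul.injective; simp only [ofMul_mul, ofMul_inv]; abel
    rwa [h2, h3] at h1
  have hmem' : ∀ v : U', v ∈ [1, a₀, b₀] → v = 1 ∨ v = a' ∨ v = b' := fun v hv => by
    have := (T'.mem v).2 ((T₀.mem v).1 hv)
    simpa using this
  obtain ⟨v, hv, hev⟩ := k₂ 1 (by simp)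
  obtain ⟨w, hw, hew⟩ := k₂ b (by simp)
  have hva : v ≠ a' := fun h => T.left (by
    have := (J.one_iff (hval₂ hev)).2 (by rw [h, inv_mul_cancel]; rfl)
    simpa using this)
  have hwa : w ≠ a' := fun h => T.ne (by
    have := (J.one_iff (hval₂ hew)).2 (by rw [h, inv_mul_cancel]; rfl)
    have h1 : b⁻¹ * a = 1 := by exact_mod_cast this
    exact (inv_mul_eq_one.1 h1).symm)
  have hvw : v ≠ w := fun h => T.right (hinj e₂ hev hew h).symm
  have h1 := hval₂ hev
  have h2 := hval₂ hew
  rcases hmem' v hv with rfl | rfl | rfl <;> rcases hmem' w hw with rfl | rfl | rfl <;>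
    first | contradiction | skip
  · exact h2
  · rw [inv_one, one_mul] at h1 h2
    rw [h2, ← h1, hval hea]

end

section

variable {G H C : Type} [CommGroup G] [CommGroup H] {c : G → C} {d : H → C} {U : Subgroup G}
  {U' : Subgroup H}

/-- The set `{1, α, β}` for the standard generators of an elementary abelian group of order 9. -/
def simplex : List (Multiplicative (ZMod 3 × ZMod 3)) :=
  [1, Multiplicative.ofAdd (1, 0), Multiplicative.ofAdd (0, 1)]

/-- The product of the standard generators. -/
def diag : Multiplicative (ZMod 3 × ZMod 3) := Multiplicative.ofAdd (1, 1)

theorem simplex_nodup : simplex.Nodup := by decide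

theorem level_simplex : ∀ g, level simplex g = 3 := by decide +kernel

theorem simplex_mul_diag : ∀ u ∈ simplex, u * diag ∉ simplex ∧ u * diag⁻¹ ∉ simplex := by
  decide +kernel

theorem conv_mul_diag : ∀ v, conv simplex (v * diag) ≠ conv simplex v ∧
    conv simplex (v * diag⁻¹) ≠ conv simplex v := by
  decide +kernel

theorem exists_simplex : ∀ s, s ≠ 1 → s ≠ diag → s ≠ diag⁻¹ → ∃ u ∈ simplex, u * s ∈ simplex := by
  decide +kernel

theorem eq_of_conv_simplex : ∀ w, (∀ u ∈ simplex, conv simplex (w * u⁻¹) = conv simplex w) →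
    w = 1 ∨ w = diag ∨ w = diag⁻¹ := by
  decide +kernel

theorem conv_diag : conv simplex 1 = 1 ∧ conv simplex diag = 2 ∧ conv simplex diag⁻¹ = 0 := by
  decide +kernel

/-- A coordinate system on `U` taking the trace at `x` to `simplex`. -/
structure Frame (c : G → C) (U : Subgroup G) (x : G)
    (E : U ≃* Multiplicative (ZMod 3 × ZMod 3)) : Prop where
  joint : Joint c c
  js : JS c c (U : Set G) U
  index : U.index = 3
  notMem : x ∉ U
  mem : ∀ u, E u ∈ simplex ↔ c (x * u) = c x
  three : ∀ y ∉ U, Nat.card (trace c U y) = 3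

variable {x : G} {x' : H} {E : U ≃* Multiplicative (ZMod 3 × ZMod 3)}
  {E' : U' ≃* Multiplicative (ZMod 3 × ZMod 3)}

theorem Frame.mem_map (F : Frame c U x E) (u : U) :
    u ∈ simplex.map E.symm ↔ u ∈ trace c U x := by
  rw [mem_trace, ← F.mem, List.mem_map]
  constructor
  · rintro ⟨v, hv, rfl⟩
    rwa [E.apply_symm_apply]
  · exact fun h => ⟨_, h, E.symm_apply_apply u⟩

theorem Frame.nodup : (simplex.map E.symm).Nodup :=
  simplex_nodup.map E.symm.injective

theorem Frame.conv_eq (F : Frame c U x E) (F' : Frame d U' x' E') (J : Joint c d)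
    (hU : JS c d (U : Set G) U') (hxx : c x = d x') {g : U} {h : U'}
    (e : c (x * x * g) = d (x' * x' * h)) : conv simplex (E g) = conv simplex (E' h) := by
  classical
  have := J.conv_eq hU F.index F'.index F.notMem hxx F.mem_map Frame.nodup F'.mem_map Frame.nodup e
  rwa [← E.symm_apply_apply g, ← E'.symm_apply_apply h, conv_map, conv_map] at this

theorem Frame.sq_mul_notMem (F : Frame c U x E) (g : U) : x * x * g ∉ U := fun h =>
  mul_self_notMem F.index F.notMem ((U.mul_mem_cancel_right g.2).1 h)

theorem Frame.conv_eq_iff (F : Frame c U x E) {g h : U} :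
    conv simplex (E g) = conv simplex (E h) ↔ c (x * x * g) = c (x * x * h) := by
  refine ⟨fun e => ?_, F.conv_eq F F.joint F.js rfl⟩
  have h1 := F.three _ (F.sq_mul_notMem h)
  have h2 := level_simplex (E h)
  rw [level] at h2
  let S : Set (Multiplicative (ZMod 3 × ZMod 3)) :=
    {k | conv simplex k = conv simplex (E h)}
  let φ : trace c U (x * x * h) → S := fun u => ⟨E (h * u.1), F.conv_eq F F.joint F.js rfl (by
    rw [U.coe_mul, ← mul_assoc]
    exact u.2)⟩
  have hφ : Function.Injective φ := fun u v huv =>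
    Subtype.ext (mul_left_cancel (E.injective (congrArg Subtype.val huv)))
  have hc : Nat.card S = 3 := by
    rw [Nat.card_eq_fintype_card, Fintype.card_subtype]
    exact h2
  have hb := (Nat.bijective_iff_injective_and_card φ).2 ⟨hφ, by rw [h1, hc]⟩
  obtain ⟨u, hu⟩ := hb.2 ⟨E g, e⟩
  have h3 : h * u.1 = g := E.injective (congrArg Subtype.val hu)
  have h4 := u.2
  rw [mem_trace, mul_assoc, ← U.coe_mul, h3] at h4
  exact h4

theorem Frame.diag_iff (F : Frame c U x E) (g : U) :
    (E g = diag ∨ E g = diag⁻¹) ↔ g ≠ 1 ∧ ¬ ∃ y, c y = c x ∧ c (y * g) = c x := by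
  constructor
  · intro hg
    refine ⟨?_, ?_⟩
    · rintro rfl
      rw [map_one] at hg
      revert hg
      decide
    · rintro ⟨y, hy, hyg⟩
      rcases mem_or_of_index_three F.index F.notMem y with h | h | h
      · exact F.notMem ((F.js hy).1 h)
      · let u : U := ⟨_, h⟩
        have hu : x * (u : G) = y := by rw [mul_comm, inv_mul_cancel_right]
        have h1 : E u ∈ simplex := (F.mem u).2 (by rw [hu, hy])
        have h2 : E (u * g) ∈ simplex := (F.mem _).2 (by rw [U.coe_mul, ← mul_assoc, hu, hyg])
        rw [map_mul] at h2
        rcases hg with hg | hg <;> rw [hg] at h2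
        exacts [(simplex_mul_diag _ h1).1 h2, (simplex_mul_diag _ h1).2 h2]
      · have h0 : y * (x * x)⁻¹ ∈ U := by
          have : y * (x * x)⁻¹ = y * x * (x ^ 3)⁻¹ := by
            apply Additive.ofMul.injective; simp only [ofMul_mul, ofMul_inv, ofMul_pow]; abel
          rw [this]
          exact U.mul_mem h (U.inv_mem (pow_three_mem F.index x))
        let v : U := ⟨_, h0⟩
        have hv : x * x * (v : G) = y := by rw [mul_comm, inv_mul_cancel_right]
        have h1 := F.conv_eq_iff (g := v * g) (h := v)
        rw [U.coe_mul, ← mul_assoc, hv, hyg, hy, map_mul] at h1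
        have h2 := h1.2 rfl
        rcases hg with hg | hg <;> rw [hg] at h2
        exacts [(conv_mul_diag _).1 h2, (conv_mul_diag _).2 h2]
  · rintro ⟨hg, hno⟩
    by_contra! h
    obtain ⟨u, hu, hus⟩ := exists_simplex (E g) (by simpa using hg) h.1 h.2
    refine hno ⟨x * E.symm u, (F.mem _).1 (by rwa [E.apply_symm_apply]), ?_⟩
    have := (F.mem (E.symm u * g)).1 (by rwa [map_mul, E.apply_symm_apply])
    rwa [U.coe_mul, ← mul_assoc] at this

theorem Frame.diag_of_diag (F : Frame c U x E) (F' : Frame d U' x' E') (J : Joint c d)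
    (hxx : c x = d x') {g : U} {h : U'} (e : c g = d h) (hg : E g = diag ∨ E g = diag⁻¹) :
    E' h = diag ∨ E' h = diag⁻¹ := by
  rw [F'.diag_iff]
  rw [F.diag_iff] at hg
  refine ⟨fun h1 => hg.1 ?_, ?_⟩
  · have := (J.one_iff e).2 (by rw [h1]; rfl)
    exact_mod_cast this
  · rintro ⟨y, hy, hyh⟩
    obtain ⟨φ, hφ⟩ := J.symm.exists_equiv e.symm
    have h1 := hφ y⁻¹
    refine hg.2 ⟨(φ y⁻¹)⁻¹, ?_, ?_⟩
    · have h2 := J.inv h1.1.symm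
      rw [inv_inv] at h2
      rw [h2, hy, hxx]
    · rw [← h1.2, inv_inv, hyh, hxx]

theorem forall_of_generators {P : Multiplicative (ZMod 3 × ZMod 3) → Prop} (h1 : P 1)
    (hinv : ∀ v, P v → P v⁻¹) (ha : P (Multiplicative.ofAdd (1, 0)))
    (hb : P (Multiplicative.ofAdd (0, 1))) (hd : P diag)
    (hba : P ((Multiplicative.ofAdd (0, 1))⁻¹ * Multiplicative.ofAdd (1, 0))) : ∀ v, P v := by
  intro v
  have key : ∀ v : Multiplicative (ZMod 3 × ZMod 3), v = 1 ∨ v = Multiplicative.ofAdd (1, 0) ∨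
      v = (Multiplicative.ofAdd (1, 0))⁻¹ ∨ v = Multiplicative.ofAdd (0, 1) ∨
      v = (Multiplicative.ofAdd (0, 1))⁻¹ ∨ v = diag ∨ v = diag⁻¹ ∨
      v = (Multiplicative.ofAdd (0, 1))⁻¹ * Multiplicative.ofAdd (1, 0) ∨
      v = ((Multiplicative.ofAdd (0, 1))⁻¹ * Multiplicative.ofAdd (1, 0))⁻¹ := by decide
  rcases key v with rfl | rfl | rfl | rfl | rfl | rfl | rfl | rfl | rfl
  exacts [h1, ha, hinv _ ha, hb, hinv _ hb, hd, hinv _ hd, hba, hinv _ hba]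

theorem Frame.coe_eq (F : Frame c U x E) (F' : Frame d U' x' E') (J : Joint c d)
    (hU : JS c d (U : Set G) U') (hxx : c x = d x')
    (ha : c (E.symm (Multiplicative.ofAdd (1, 0))) = d (E'.symm (Multiplicative.ofAdd (1, 0))))
    (hb : c (E.symm (Multiplicative.ofAdd (0, 1))) = d (E'.symm (Multiplicative.ofAdd (0, 1))))
    (hba : c (E.symm ((Multiplicative.ofAdd (0, 1))⁻¹ * Multiplicative.ofAdd (1, 0))) =
      d (E'.symm ((Multiplicative.ofAdd (0, 1))⁻¹ * Multiplicative.ofAdd (1, 0))))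
    (h2 : c (x * x) = d (x' * x')) : ∀ v, c (E.symm v) = d (E'.symm v) := by
  refine forall_of_generators ?_ ?_ ha hb ?_ hba
  · simpa using J.map_one
  · intro v hv
    simpa using J.inv hv
  · have h3 : c (x * x * (E.symm diag⁻¹ : U) * (E.symm diag : U)) = d (x' * x') := by
      rw [← h2, map_inv, U.coe_inv, inv_mul_cancel_right]
    obtain ⟨y, q, hy, hq, hyq⟩ := J.exists_mul h3
    have hqU : q ∈ U' := (hU hq).1 (E.symm diag).2
    obtain rfl : y = x' * x' * q⁻¹ := eq_mul_inv_of_mul_eq hyq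
    have h4 := F.conv_eq F' J hU hxx (g := E.symm diag⁻¹) (h := ⟨q, hqU⟩⁻¹) hy
    rw [E.apply_symm_apply, conv_diag.2.2, map_inv] at h4
    have h5 := F.diag_of_diag F' J hxx (h := ⟨q, hqU⟩) hq (by simp)
    rcases h5 with h5 | h5
    · have h6 : E'.symm diag = ⟨q, hqU⟩ := by rw [← h5, E'.symm_apply_apply]
      rw [h6]
      exact hq
    · rw [h5, inv_inv, conv_diag.2.1] at h4
      norm_num at h4

theorem Frame.sq_mul_eq (F : Frame c U x E) (F' : Frame d U' x' E') (J : Joint c d)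
    (hU : JS c d (U : Set G) U') (hxx : c x = d x') (h2 : c (x * x) = d (x' * x')) (g : U) :
    c (x * x * g) = d (x' * x' * (E'.symm (E g) : U')) := by
  obtain ⟨l, hl, e⟩ := J.exists_mul_mem hU h2 g.2
  have h3 := F.conv_eq F' J hU hxx (g := g) (h := ⟨l, hl⟩) e
  rw [e]
  refine (F'.conv_eq_iff (g := ⟨l, hl⟩) (h := E'.symm (E g))).1 ?_
  rw [← h3, E'.apply_symm_apply]

theorem Frame.cube_mem (F : Frame c U x E) : (x ^ 3)⁻¹ ∈ U :=
  U.inv_mem (pow_three_mem F.index x)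

theorem Frame.sq_mul_cube (F : Frame c U x E) (u : U) :
    x * x * ((⟨_, F.cube_mem⟩ * u : U) : G) = x⁻¹ * u := by
  push_cast
  apply Additive.ofMul.injective; simp only [ofMul_mul, ofMul_inv, ofMul_pow]; abel

theorem Frame.cube_eq (F : Frame c U x E) :
    E ⟨_, F.cube_mem⟩ = 1 ∨ E ⟨_, F.cube_mem⟩ = diag ∨ E ⟨_, F.cube_mem⟩ = diag⁻¹ := by
  refine eq_of_conv_simplex _ fun u hu => ?_
  have h1 : E.symm u⁻¹ = (E.symm u)⁻¹ := map_inv _ _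
  have h2 := F.conv_eq_iff (g := ⟨_, F.cube_mem⟩ * E.symm u⁻¹) (h := ⟨_, F.cube_mem⟩ * 1)
  rw [F.sq_mul_cube, F.sq_mul_cube, map_mul, E.apply_symm_apply, mul_one] at h2
  refine h2.2 ?_
  have h3 := (F.mem (E.symm u)).1 (by rwa [E.apply_symm_apply])
  have h4 := F.joint.inv h3
  rw [mul_inv] at h4
  rw [h1, U.coe_inv, U.coe_one, mul_one, h4]

theorem Frame.cube_eq_cube (F : Frame c U x E) (F' : Frame d U' x' E') (J : Joint c d)
    (hU : JS c d (U : Set G) U') (hxx : c x = d x') :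
    E ⟨_, F.cube_mem⟩ = E' ⟨_, F'.cube_mem⟩ := by
  have h1 : conv simplex (E ⟨_, F.cube_mem⟩) = conv simplex (E' ⟨_, F'.cube_mem⟩) := by
    refine F.conv_eq F' J hU hxx ?_
    have h2 := F.sq_mul_cube 1
    have h3 := F'.sq_mul_cube 1
    rw [mul_one] at h2 h3
    rw [h2, h3]
    simpa using J.inv hxx
  obtain ⟨k1, k2, k3⟩ := conv_diag
  rcases F.cube_eq with h | h | h <;> rcases F'.cube_eq with h' | h' | h' <;>
    rw [h, h'] at h1 ⊢ <;> simp [k1, k2, k3] at h1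

theorem Frame.zpow_mul_eq (F : Frame c U x E) (F' : Frame d U' x' E') (J : Joint c d)
    (hU : JS c d (U : Set G) U') (hxx : c x = d x') (h2 : c (x * x) = d (x' * x'))
    (h0 : ∀ u : U, c u = d (E'.symm (E u))) (n : ℤ) (u : U) :
    c (x ^ n * u) = d (x' ^ n * (E'.symm (E u) : U')) := by
  have hw : E'.symm (E ⟨_, F.cube_mem⟩) = ⟨_, F'.cube_mem⟩ := by
    rw [F.cube_eq_cube F' J hU hxx, E'.symm_apply_apply]
  have hsub : ∀ u : U, c (x ^ (-1 : ℤ) * u) = d (x' ^ (-1 : ℤ) * (E'.symm (E u) : U')) := by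
    intro u
    have h3 := F.sq_mul_eq F' J hU hxx h2 (⟨_, F.cube_mem⟩ * u)
    rw [map_mul, map_mul, hw, F.sq_mul_cube, F'.sq_mul_cube] at h3
    rwa [zpow_neg_one, zpow_neg_one]
  have hred : ∀ (m r : ℤ), (∀ u : U, c (x ^ r * u) = d (x' ^ r * (E'.symm (E u) : U'))) →
      ∀ u : U, c (x ^ (3 * m + r) * u) = d (x' ^ (3 * m + r) * (E'.symm (E u) : U')) := by
    intro m r hr u
    have h3 := hr ((⟨_, F.cube_mem⟩ : U) ^ (-m) * u)
    rw [map_mul, map_mul, map_zpow, map_zpow, hw] at h3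
    have key : ∀ {K : Type} [CommGroup K] (x v : K), x ^ r * ((x ^ 3)⁻¹ ^ (-m) * v) =
        x ^ (3 * m + r) * v := by
      intro K _ x v
      have : (x ^ 3)⁻¹ ^ (-m) = x ^ (3 * m) := by
        rw [inv_zpow', neg_neg, zpow_mul]; norm_cast
      rw [this, ← mul_assoc, ← zpow_add, add_comm]
    push_cast at h3
    rwa [key, key] at h3
  have h3 : ∀ k : ℤ, k % 3 = 0 ∨ k % 3 = 1 ∨ k % 3 = 2 := fun k => by omega
  rcases h3 n with h | h | h
  · obtain ⟨m, rfl⟩ : ∃ m, n = 3 * m + 0 := ⟨n / 3, by omega⟩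
    exact hred m 0 (fun u => by simpa using h0 u) u
  · obtain ⟨m, rfl⟩ : ∃ m, n = 3 * m + 1 := ⟨n / 3, by omega⟩
    refine hred m 1 (fun u => ?_) u
    have h4 := J.inv (hsub u⁻¹)
    simpa [mul_comm] using h4
  · obtain ⟨m, rfl⟩ : ∃ m, n = 3 * m + (-1) := ⟨(n + 1) / 3, by omega⟩
    exact hred m (-1) hsub u

theorem exists_zpow_mul (hi : U.index = 3) (hx : x ∉ U) (g : G) :
    ∃ (n : ℤ) (u : U), x ^ n * (u : G) = g := by
  rcases mem_or_of_index_three hi hx g with h | h | h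
  · exact ⟨0, ⟨g, h⟩, by simp⟩
  · exact ⟨1, ⟨_, h⟩, by simp [mul_comm]⟩
  · exact ⟨-1, ⟨_, h⟩, by simp [mul_comm]⟩

theorem Frame.exists_ji (F : Frame c U x E) (F' : Frame d U' x' E') (J : Joint c d)
    (hU : JS c d (U : Set G) U') (hxx : c x = d x') (h2 : c (x * x) = d (x' * x'))
    (h0 : ∀ u : U, c u = d (E'.symm (E u))) : ∃ f : G → H, JI c d f := by
  choose n u hnu using exists_zpow_mul F.index F.notMem
  refine ⟨fun g => x' ^ n g * (E'.symm (E (u g)) : U'), fun g h => ?_⟩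
  have h3 := F.zpow_mul_eq F' J hU hxx h2 h0 (n h - n g) (u h * (u g)⁻¹)
  have key : ∀ {K : Type} [CommGroup K] (x v w : K), x ^ (n h - n g) * (v * w⁻¹) =
        x ^ n h * v * (x ^ n g * w)⁻¹ := by
    intro K _ x v w
    rw [zpow_sub]
    apply Additive.ofMul.injective; simp only [ofMul_mul, ofMul_inv]; abel
  simp only [map_mul, map_inv] at h3
  push_cast at h3
  rw [key, key, hnu, hnu] at h3
  exact h3

end

section

variable {G H C : Type} [CommGroup G] [CommGroup H] {c : G → C} {d : H → C} {U : Subgroup G}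
  {U' : Subgroup H}

theorem IsTriple.exists_equiv [DecidableEq U] [Fintype U] (hcU : Nat.card U = 9)
    (h3 : ∀ u : U, u ^ 3 = 1) {x : G} {a b : U} (T : IsTriple c x a b) :
    ∃ E : U ≃* Multiplicative (ZMod 3 × ZMod 3),
      E.symm (Multiplicative.ofAdd (1, 0)) = a ∧ E.symm (Multiplicative.ofAdd (0, 1)) = b ∧
      ∀ u, E u ∈ simplex ↔ c (x * u) = c x := by
  obtain ⟨e, he1, he2⟩ := exists_hom_of_card_nine hcU h3 T.left (b := b) (by
    intro n hn
    have : b ∈ Subgroup.zpowers a := ⟨n, hn.symm⟩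
    rcases (mem_zpowers_of_pow_three (h3 a) T.left).1 this with h | h | h
    · exact T.right h
    · exact T.ne h.symm
    · exact T.mul (by rw [h, mul_inv_cancel]))
  let E : U ≃* Multiplicative (ZMod 3 × ZMod 3) := (AddEquiv.toMultiplicativeLeft e).symm
  have h1 : E.symm (Multiplicative.ofAdd (1, 0)) = a := he1
  have h2 : E.symm (Multiplicative.ofAdd (0, 1)) = b := he2
  refine ⟨E, h1, h2, fun u => ?_⟩
  rw [← mem_trace, ← T.mem, simplex, ← h1, ← h2]
  simp [MulEquiv.eq_symm_apply]

theorem JI.exists_symm [Finite G] [Finite H] (J : Joint c d) (h : ∃ f, JI d c f) :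
    ∃ f, JI c d f := by
  obtain ⟨f, hf⟩ := h
  have hb := (Nat.bijective_iff_injective_and_card f).2 ⟨hf.injective J.symm, J.card_eq.symm⟩
  obtain ⟨g, hg⟩ := hb.2.hasRightInverse
  exact ⟨g, fun a b => by rw [hf, hg, hg]⟩

/-- A finite S-ring over an abelian group of order 27 with an invariant subgroup of order 9. -/
theorem Joint.exists_ji_of_subgroup [Finite G] [Finite H] (J : Joint c d)
    (hU : JS c d (U : Set G) U') (hG : Nat.card G = 27) (hcU : Nat.card U = 9) :
    ∃ f : G → H, JI c d f := by
  classical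
  have := Fintype.ofFinite G
  have := Fintype.ofFinite H
  have hi : U.index = 3 := by
    have := U.card_mul_index
    rw [hcU, hG] at this
    omega
  have hi' : U'.index = 3 := by rw [← J.index_eq hU, hi]
  have hcH : Nat.card H = 27 := by rw [← J.card_eq, hG]
  have hcU' : Nat.card U' = 9 := by rw [← (J.restrict hU).card_eq, hcU]
  have hUc := hU.left J
  have hUd := hU.symm.left J.symm
  rcases J.left.exists_pair_or hUc hi hcU with ⟨z, hz, hz'⟩ | h3
  · obtain ⟨z', hzz⟩ := J.exists_right z
    obtain ⟨f, hf, -⟩ := J.exists_ji_of_small_class (by rw [hG]; norm_num) hU hi hz hzz hz'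
      (by rw [hcU]; exact sep_nine)
    exact ⟨f, hf⟩
  by_cases hfull : ∃ x ∉ U, ∀ u ∈ U, c (x * u) = c x
  · obtain ⟨x, hx, hxu⟩ := hfull
    refine J.exists_ji_of_wreath_nine hU (fun y hy l hl => ?_) (sep_nine _ _ _ _ _ hcU (J.restrict hU))
      (by rw [card_quotient_of_card (n := 3) (p := 9) (by norm_num) hG hcU]; norm_num)
    rcases mem_or_of_index_three hi hx y with h | h | h
    · exact absurd h hy
    · have h1 := hxu _ h
      have h2 := hxu _ (U.mul_mem h hl)
      rw [mul_comm, inv_mul_cancel_right] at h1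
      rw [mul_comm x, mul_right_comm, inv_mul_cancel_right] at h2
      rw [h1, h2]
    · have h1 := J.left.inv (hxu _ (U.inv_mem h))
      have h2 := J.left.inv (hxu _ (U.inv_mem (U.mul_mem h hl)))
      have k1 : (x * (y * x)⁻¹)⁻¹ = y := by
        apply Additive.ofMul.injective; simp only [ofMul_mul, ofMul_inv]; abel
      have k2 : (x * (y * x * l)⁻¹)⁻¹ = y * l := by
        apply Additive.ofMul.injective; simp only [ofMul_mul, ofMul_inv]; abel
      rw [k1] at h1
      rw [k2] at h2
      rw [h1, h2]
  push Not at hfull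
  have hex : ∃ x, x ∉ U := by
    by_contra! h
    rw [(Subgroup.eq_top_iff' U).2 h, Subgroup.index_top] at hi
    norm_num at hi
  obtain ⟨x₀, hx₀⟩ := hex
  obtain ⟨x, hx, hx3⟩ := J.left.exists_trace_three hUc hi hcU h3 hx₀ (hfull x₀ hx₀)
  by_cases hP : ∃ x ∉ U, ∃ D : Subgroup G, D ≤ U ∧ Nat.card D = 3 ∧
      ∀ u ∈ U, c (x * u) = c x ↔ u ∈ D
  · obtain ⟨y, hy, D, hDU, hcD, hD⟩ := hP
    exact J.exists_ji_of_coset_trace hU hi hcU hG h3 hy hDU hcD hD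
  have h3' : ∀ y ∉ U', 3 ≤ Nat.card (trace d U' y) := fun y hy => by
    obtain ⟨g, hg⟩ := J.exists_left y
    rw [← J.card_trace_eq hU hg]
    exact h3 g fun h => hy ((hU hg).1 h)
  by_cases hP' : ∃ x ∉ U', ∃ D : Subgroup H, D ≤ U' ∧ Nat.card D = 3 ∧
      ∀ u ∈ U', d (x * u) = d x ↔ u ∈ D
  · obtain ⟨y, hy, D, hDU, hcD, hD⟩ := hP'
    exact JI.exists_symm J
      (J.symm.exists_ji_of_coset_trace hU.symm hi' hcU' hcH h3' hy hDU hcD hD)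
  have hT := J.left.forall_isTriple hUc hi hcU h3 hP hx hx3
  obtain ⟨x', hxx⟩ := J.exists_right x
  have hx' : x' ∉ U' := fun h => hx ((hU hxx).2 h)
  have hx3' : Nat.card (trace d U' x') = 3 := by rw [← J.card_trace_eq hU hxx, hx3]
  have hT' := J.right.forall_isTriple hUd hi' hcU' h3' hP' hx' hx3'
  have ht : ∀ {G : Type} [CommGroup G] {c : G → C} {U : Subgroup G} [DecidableEq U] [Fintype U],
      (∀ y ∉ U, ∃ a b : U, IsTriple c y a b) → ∀ y ∉ U, Nat.card (trace c U y) = 3 := by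
    intro G _ c U _ _ h y hy
    obtain ⟨a, b, T⟩ := h y hy
    have h1 : trace c U y = ([1, a, b].toFinset : Set U) := by
      ext u
      rw [← T.mem]
      simp
    rw [h1, Nat.card_eq_card_toFinset, Finset.toFinset_coe, List.toFinset_card_of_nodup T.nodup]
    rfl
  obtain ⟨a, b, T⟩ := hT x hx
  obtain ⟨a₀, b₀, T₀⟩ := hT' x' hx'
  obtain ⟨a', b', T', ha, hb, hba⟩ := J.exists_isTriple_match hU hxx T T₀
  obtain ⟨E, ha1, hb1, hE⟩ := T.exists_equiv hcU (J.left.pow_three_eq_one hi hcU hG hT)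
  obtain ⟨E', ha1', hb1', hE'⟩ := T'.exists_equiv hcU' (J.right.pow_three_eq_one hi' hcU' hcH hT')
  have F : Frame c U x E := ⟨J.left, hUc, hi, hx, hE, ht hT⟩
  have F' : Frame d U' x' E' := ⟨J.right, hUd, hi', hx', hE', ht hT'⟩
  have h2 : c (x * x) = d (x' * x') := by
    rw [← sq, ← sq]
    exact J.pow (by rw [hG]; norm_num) hxx
  have h0 := F.coe_eq F' J hU hxx (by rw [ha1, ha1', ha]) (by rw [hb1, hb1', hb])
    (by rw [map_mul, map_mul, map_inv, map_inv, ha1, ha1', hb1, hb1', hba]) h2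
  refine F.exists_ji F' J hU hxx h2 fun u => ?_
  rw [← h0, E.symm_apply_apply]

end

section

variable {G H C : Type} [CommGroup G] [CommGroup H] {c : G → C} {d : H → C} {L : Subgroup G}

/-- No subgroup of order nine is a union of classes. -/
def NoNine (c : G → C) : Prop := ∀ U : Subgroup G, Nat.card U = 9 → ¬ JS c c (U : Set G) U

/-- No subgroup of order three is a union of classes. -/
def NoThree (c : G → C) : Prop := ∀ U : Subgroup G, Nat.card U = 3 → ¬ JS c c (U : Set G) U

theorem NoNine.transfer (hno : NoNine c) (J : Joint c d) : NoNine d := fun U hU h => by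
  obtain ⟨V, hV⟩ := J.symm.exists_subgroup U h
  exact hno V ((J.symm.card_set_eq hV).symm.trans hU) (hV.symm.left J)

theorem NoThree.transfer (hno : NoThree c) (J : Joint c d) : NoThree d := fun U hU h => by
  obtain ⟨V, hV⟩ := J.symm.exists_subgroup U h
  exact hno V ((J.symm.card_set_eq hV).symm.trans hU) (hV.symm.left J)

theorem Joint.closure (J : Joint c c) {X : Set G} (hX : JS c c X X) :
    JS c c (Subgroup.closure X : Set G) (Subgroup.closure X) := by
  have key : ∀ g ∈ Subgroup.closure X, ∀ h, c g = c h → h ∈ Subgroup.closure X := by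
    intro g hg
    induction hg using Subgroup.closure_induction with
    | mem x hx => exact fun h e => Subgroup.subset_closure ((hX e).1 hx)
    | one => exact fun h e => by rw [(J.one_iff e).1 rfl]; exact one_mem _
    | mul x y _ _ hx hy =>
      intro h e
      obtain ⟨x', y', ex, ey, rfl⟩ := J.exists_mul e
      exact mul_mem (hx _ ex) (hy _ ey)
    | inv x _ hx =>
      intro h e
      have := hx h⁻¹ (by simpa using J.inv e)
      simpa using this
  exact fun g h e => ⟨fun hg => key g hg h e, fun hh => key h hh g e.symm⟩

theorem Joint.closure_card_dvd [Finite G] (J : Joint c c) (hno : NoNine c) {X : Set G}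
    (hX : JS c c X X) {K : Subgroup G} (hK : Nat.card K = 9) (hXK : X ⊆ K) :
    Nat.card (Subgroup.closure X) ∣ 3 := by
  have h1 : Nat.card (Subgroup.closure X) ∣ 3 ^ 2 := by
    have := Subgroup.card_dvd_of_le ((Subgroup.closure_le K).2 hXK)
    rwa [hK] at this
  obtain ⟨i, hi, h2⟩ := (Nat.dvd_prime_pow Nat.prime_three).1 h1
  interval_cases i
  · rw [h2]; norm_num
  · rw [h2]; norm_num
  · exact absurd (J.closure hX) (hno _ h2)

/-- A union of classes in a group of order nine consists of the identity when no subgroup of order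
three or nine is a union of classes. -/
theorem Joint.eq_one_of_subset [Finite G] (J : Joint c c) (hno : NoNine c) (hno3 : NoThree c)
    {X : Set G} (hX : JS c c X X) {K : Subgroup G} (hK : Nat.card K = 9) (hXK : X ⊆ K) {x : G}
    (hx : x ∈ X) : x = 1 := by
  have h := J.closure_card_dvd hno hX hK hXK
  rcases (Nat.dvd_prime Nat.prime_three).1 h with h | h
  · have h2 := Subgroup.card_eq_one.1 h
    have : x ∈ Subgroup.closure X := Subgroup.subset_closure hx
    rwa [h2, Subgroup.mem_bot] at this
  · exact absurd (J.closure hX) (hno3 _ h)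

theorem NoNine.quotient [Finite G] (hno : NoNine c) (J : Joint c c)
    (hL : JS c c (L : Set G) L) (hcL : Nat.card L = 3) : NoThree (qcol c L) := by
  intro M hM hJ
  refine hno (M.comap (QuotientGroup.mk' L)) ?_ fun g h e => hJ (J.qcol_eq hL e)
  have := card_quotient_fiber L (fun q => q ∈ M)
  rw [hcL] at this
  exact this.trans (by rw [show Nat.card {q // q ∈ M} = 3 from hM])

/-- The class of `x` is constant along `L`. -/
def Full (c : G → C) (L : Subgroup G) (x : G) : Prop := ∀ l ∈ L, c (x * l) = c x

theorem Full.congr (J : Joint c c) (hL : JS c c (L : Set G) L) {x y : G} (hx : Full c L x)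
    (e : c y = c x) : Full c L y := fun l hl => by
  obtain ⟨l', hl', h⟩ := J.exists_mul_mem hL e hl
  rw [h, hx l' hl', e]

theorem Full.mul {x l : G} (hx : Full c L x) (hl : l ∈ L) : Full c L (x * l) := fun k hk => by
  rw [mul_assoc, hx _ (L.mul_mem hl hk), hx l hl]

theorem Full.inv (J : Joint c c) {x : G} (hx : Full c L x) : Full c L x⁻¹ := fun l hl => by
  have := J.inv (hx l⁻¹ (L.inv_mem hl))
  rwa [mul_inv, inv_inv] at this

theorem full_of_pow (hcL : Nat.card L = 3) {x l : G} (hl : l ∈ L) (h1 : l ≠ 1)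
    (e1 : c (x * l) = c x) (e2 : c (x * (l * l)) = c x) : Full c L x := fun k hk => by
  rcases mem_of_card_three hcL hl h1 hk with rfl | rfl | rfl
  · rw [mul_one]
  · exact e1
  · rw [← mul_self_of_card_three hcL hl]; exact e2

/-- The quotient by `L` has rank two. -/
def Flat (c : G → C) (L : Subgroup G) : Prop := ∀ x ∉ L, ∀ y ∉ L, ∃ l ∈ L, c y = c (x * l)

theorem flat_of_rank_two {q : G ⧸ L} (h : ∀ r, r ≠ 1 → qcol c L r = qcol c L q) :
    Flat c L := fun x hx y hy =>
  exists_mul_of_qcol_eq ((h _ fun e => hy ((QuotientGroup.eq_one_iff y).1 e)).trans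
    (h _ fun e => hx ((QuotientGroup.eq_one_iff x).1 e)).symm)

theorem Flat.full (J : Joint c c) (hL : JS c c (L : Set G) L) (hf : Flat c L) {x : G} (hx : x ∉ L)
    (hx' : Full c L x) : ∀ y ∉ L, Full c L y := fun y hy => by
  obtain ⟨l, hl, e⟩ := hf x hx y hy
  exact hx'.congr J hL (e.trans (hx' l hl))

theorem Joint.exists_ji_of_full [Finite G] [Finite H] (J : Joint c d) (hG : Nat.card G = 27)
    (hL : JS c c (L : Set G) L) (hcL : Nat.card L = 3) (h : ∀ x ∉ L, Full c L x) :
    ∃ f : G → H, JI c d f := by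
  obtain ⟨L', hL'⟩ := J.exists_subgroup L hL
  refine J.exists_ji_of_wreath_nine hL' h (sep_three _ _ _ _ _ hcL (J.restrict hL')) ?_
  rw [card_quotient_of_card (n := 9) (p := 3) (by norm_num) (by rw [hG]) hcL]

/-- The class of `x` meets the coset of `x` only in `x`. -/
def Triv (c : G → C) (L : Subgroup G) (x : G) : Prop := ∀ l ∈ L, c (x * l) = c x → l = 1

theorem Triv.congr (J : Joint c c) (hL : JS c c (L : Set G) L) {x y : G} (hx : Triv c L x)
    (e : c y = c x) : Triv c L y := fun l hl h => by
  have h1 : c (y * l * l⁻¹) = c x := by rwa [mul_inv_cancel_right]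
  obtain ⟨y', m, e1, e2, rfl⟩ := J.exists_mul h1
  have hm : m ∈ L := (hL e2).1 (L.inv_mem hl)
  have h2 := hx m⁻¹ (L.inv_mem hm) (by rw [mul_inv_cancel_right, ← e1, h, e])
  rw [inv_eq_one] at h2
  exact inv_eq_one.1 ((J.one_iff e2).2 h2)

theorem Triv.inv (J : Joint c c) {x : G} (hx : Triv c L x) : Triv c L x⁻¹ := fun l hl h => by
  have := J.inv h
  rw [mul_inv, inv_inv] at this
  exact inv_eq_one.1 (hx _ (L.inv_mem hl) this)

theorem exists_triv (hcL : Nat.card L = 3) {x : G} (hx : ¬ Full c L x) :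
    ∃ l ∈ L, Triv c L (x * l) := by
  by_cases h : Triv c L x
  · exact ⟨1, L.one_mem, by rwa [mul_one]⟩
  unfold Triv at h
  push Not at h
  obtain ⟨l, hl, e, h1⟩ := h
  refine ⟨l⁻¹, L.inv_mem hl, fun k hk e' => ?_⟩
  by_contra hk1
  apply hx
  have h3 := mul_self_of_card_three hcL hl
  refine full_of_pow hcL hl h1 e ?_
  rw [h3]
  rcases mem_of_card_three hcL hl h1 hk with rfl | rfl | rfl
  · exact absurd rfl hk1
  · rw [← e', inv_mul_cancel_right]
  · rw [← e', mul_assoc, ← mul_inv, h3, inv_inv, e]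

/-- If the class of `x` does not have full trace, there is a symmetric class with trivial traces
meeting the same coset. -/
theorem Joint.exists_symmetric (J : Joint c c) (hL : JS c c (L : Set G) L)
    (hcL : Nat.card L = 3) {x : G} (hx2 : ∃ l ∈ L, c x⁻¹ = c (x * l))
    (hxf : ¬ Full c L x) :
    ∃ l ∈ L, c (x * l)⁻¹ = c (x * l) ∧ Triv c L (x * l) := by
  obtain ⟨l, hl, ht⟩ := exists_triv hcL hxf
  obtain ⟨m, hm, e⟩ : ∃ m ∈ L, c (x * l)⁻¹ = c (x * l * m) := by
    obtain ⟨k, hk, e⟩ := hx2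
    obtain ⟨k', hk', e'⟩ := J.exists_mul_mem hL e (L.inv_mem hl)
    exact ⟨l⁻¹ * (k * k'), L.mul_mem (L.inv_mem hl) (L.mul_mem hk hk'), by
      rw [mul_inv, e']; congr 1; group⟩
  by_cases hm1 : m = 1
  · exact ⟨l, hl, by rw [e, hm1, mul_one], ht⟩
  have ht' : Triv c L (x * l * m) := (ht.inv J).congr J hL e.symm
  have h3 := mul_self_of_card_three hcL hm
  have n1 : c (x * l * m⁻¹) ≠ c (x * l) := fun h => hm1 (inv_eq_one.1 (ht _ (L.inv_mem hm) h))
  have n2 : c (x * l * m⁻¹) ≠ c (x * l * m) := fun h => hm1 (ht' m hm (by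
    rw [mul_assoc, h3, h]))
  obtain ⟨k, hk, e'⟩ : ∃ k ∈ L, c (x * l * m⁻¹)⁻¹ = c (x * l * k) := by
    obtain ⟨k', hk', e'⟩ := J.exists_mul_mem hL e hm
    exact ⟨m * k', L.mul_mem hm hk', by rw [mul_inv, inv_inv, e']; congr 1; group⟩
  refine ⟨l * m⁻¹, L.mul_mem hl (L.inv_mem hm), ?_, ?_⟩
  · rw [← mul_assoc, e']
    rcases mem_of_card_three hcL hm hm1 hk with rfl | rfl | rfl
    · have := J.inv e'
      rw [inv_inv, mul_one] at this
      exact absurd (this.trans e) n2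
    · have := J.inv (e'.trans e.symm)
      rw [inv_inv, inv_inv] at this
      exact absurd this n1
    · rfl
  · rw [← mul_assoc]
    intro k hk h
    rcases mem_of_card_three hcL hm hm1 hk with rfl | rfl | rfl
    · rfl
    · rw [inv_mul_cancel_right] at h
      exact absurd h.symm n1
    · rw [mul_assoc, ← mul_inv, h3, inv_inv] at h
      exact absurd h.symm n2

end

section

variable {G H C : Type} [CommGroup G] [CommGroup H] {c : G → C} {d : H → C} {L : Subgroup G}

theorem eq_of_triv {z g : G} (hz : Triv c L z) (e : c g = c z) (h : (g : G ⧸ L) = z) : g = z := by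
  have h1 := hz (z⁻¹ * g) (QuotientGroup.eq.1 h.symm) (by rwa [mul_inv_cancel_left])
  rw [inv_mul_eq_one] at h1
  exact h1.symm

/-- The quotient by `L` has rank two or is a Paley scheme. -/
theorem Joint.flat_or_paley [Finite G] (J : Joint c c) (hno : NoNine c) (hG : Nat.card G = 27)
    (hL : JS c c (L : Set G) L) (hcL : Nat.card L = 3) (h3 : ∀ g : G, g ^ 3 ∈ L) {z : G}
    (hz : z ∉ L) : Flat c L ∨ ∃ v, (∀ n : ℤ, z ^ n * v ∉ L) ∧ c v = c z ∧
      (∀ g, c g = c z → (g : G ⧸ L) = z ∨ (g : G ⧸ L) = (z⁻¹ : G) ∨ (g : G ⧸ L) = v ∨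
        (g : G ⧸ L) = (v⁻¹ : G)) ∧
      (∀ g ∉ L, (∃ l ∈ L, c g = c (z * l)) ∨ ∃ l ∈ L, c g = c (z * v * l)) ∧
      (∀ l ∈ L, c (z * v) ≠ c (z * l)) := by
  have hQ : Nat.card (G ⧸ L) = 9 :=
    card_quotient_of_card (n := 9) (p := 3) (by norm_num) (by rw [hG]) hcL
  have hq3 : ∀ q : G ⧸ L, q ^ 3 = 1 := fun q => by
    induction q using QuotientGroup.induction_on with | _ g
    rw [← QuotientGroup.mk_pow, QuotientGroup.eq_one_iff]
    exact h3 g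
  have hz1 : ((z : G) : G ⧸ L) ≠ 1 := fun h => hz ((QuotientGroup.eq_one_iff z).1 h)
  rcases (J.quotient hL).const_or_paley hQ (hno.quotient J hL hcL) hq3 hz1 with h | ⟨b, hb, hg⟩
  · exact Or.inl (flat_of_rank_two h)
  right
  have hb1 : b ≠ 1 := fun h => hb 0 (by simpa using h)
  have hbz := (hg b hb1).1.2 (by simp)
  obtain ⟨v, rfl⟩ := QuotientGroup.mk_surjective b
  obtain ⟨l, hl, e⟩ := exists_mul_of_qcol_eq hbz.symm
  have hvl : ((v * l : G) : G ⧸ L) = v := by rw [QuotientGroup.eq]; simpa using hl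
  have hzv : ((z * (v * l) : G) : G ⧸ L) = (z : G ⧸ L) * v := by
    rw [QuotientGroup.mk_mul, hvl]
  have hne1 : (z : G ⧸ L) * v ≠ 1 := fun h => hb (-1) (by
    rw [zpow_neg, zpow_one]; exact (mul_eq_one_iff_eq_inv.1 (by rwa [mul_comm] at h)))
  have hnc : qcol c L ((z : G ⧸ L) * v) ≠ qcol c L z := by
    intro h
    rcases (hg _ hne1).1.1 h with h | h | h | h
    · exact hb1 (by simpa using h)
    · refine hb (-2) ?_
      rw [zpow_neg, eq_inv_iff_mul_eq_one, zpow_ofNat, pow_two]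
      rw [eq_inv_iff_mul_eq_one] at h
      rw [← h]
      apply Additive.ofMul.injective; simp only [ofMul_mul]; abel
    · exact hz1 (by simpa using h)
    · have h4 : (z : G ⧸ L) * (v * v) = 1 := by
        rw [← mul_assoc]; exact eq_inv_iff_mul_eq_one.1 h
      have h5 := hq3 v
      have h6 : (z : G ⧸ L) = v := by
        calc (z : G ⧸ L) = z * (v ^ 3) := by rw [h5, mul_one]
          _ = (z * (v * v)) * v := by
            apply Additive.ofMul.injective; simp only [ofMul_mul, ofMul_pow]; abel
          _ = v := by rw [h4, one_mul]
      exact hb 1 (by rw [zpow_one, h6])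
  refine ⟨v * l, fun n hn => ?_, e.symm, fun g hgz => ?_, fun g hgL => ?_, fun l' hl' h => ?_⟩
  · refine hb (-n) ?_
    rw [← hvl, ← QuotientGroup.mk_zpow, QuotientGroup.eq, zpow_neg, ← mul_inv, mul_comm]
    exact L.inv_mem hn
  · have h1 : (g : G ⧸ L) ≠ 1 := fun h =>
      hz ((hL hgz).1 ((QuotientGroup.eq_one_iff g).1 h))
    have h2 := (hg _ h1).1.1 (J.qcol_eq hL hgz)
    rw [QuotientGroup.mk_inv, QuotientGroup.mk_inv, hvl]
    exact h2
  · have h1 : (g : G ⧸ L) ≠ 1 := fun h => hgL ((QuotientGroup.eq_one_iff g).1 h)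
    by_cases h : qcol c L (g : G ⧸ L) = qcol c L z
    · exact Or.inl (exists_mul_of_qcol_eq h)
    · right
      have h2 := (hg _ h1).2 h
      rw [← hzv] at h2
      exact exists_mul_of_qcol_eq h2
  · have h1 := J.qcol_eq hL h
    have h2 : ((z * l' : G) : G ⧸ L) = z := by rw [QuotientGroup.eq]; simpa using hl'
    rw [h2, hzv] at h1
    exact hnc h1

theorem Joint.flat_of_orderOf [Finite G] (J : Joint c c) (hno : NoNine c) (hG : Nat.card G = 27)
    (hL : JS c c (L : Set G) L) (hcL : Nat.card L = 3) {y : G} (hy : orderOf (y : G ⧸ L) = 9) :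
    Flat c L := by
  have hQ : Nat.card (G ⧸ L) = 9 :=
    card_quotient_of_card (n := 9) (p := 3) (by norm_num) (by rw [hG]) hcL
  obtain ⟨q, -, h⟩ := (J.quotient hL).const_of_orderOf_nine hQ (hno.quotient J hL hcL) hy
  exact flat_of_rank_two h

/-- In the Paley case, a class `{z, z⁻¹, v, v⁻¹}` does not let `z * v` have full trace. -/
theorem Joint.not_full_paley (J : Joint c c) (hcL : Nat.card L = 3)
    (h3 : ∀ g : G, g ^ 3 ∈ L) {z v : G} (hv : ∀ n : ℤ, z ^ n * v ∉ L) (hz : z ∉ L)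
    (hvz : c v = c z) (he : ∀ g, c g = c z → g = z ∨ g = z⁻¹ ∨ g = v ∨ g = v⁻¹)
    (hf : Full c L (z * v)) : False := by
  have h0 : v ∉ L := by simpa using hv 0
  have h1 : z * v ∉ L := by simpa using hv 1
  have h2 : z⁻¹ * v ∉ L := by simpa using hv (-1)
  have : Nontrivial L := by
    have : Finite L := Nat.finite_of_card_ne_zero (by rw [hcL]; norm_num)
    exact Finite.one_lt_card_iff_nontrivial.1 (by rw [hcL]; norm_num)
  obtain ⟨⟨l, hl⟩, hl1⟩ := exists_ne (1 : L)
  have hl1' : l ≠ 1 := fun h => hl1 (Subtype.ext h)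
  obtain ⟨x, y, ex, ey, h⟩ := J.exists_mul (hf l hl).symm
  have h' : l = x * y * (z * v)⁻¹ := by rw [h, mul_assoc, mul_comm l, mul_inv_cancel_left]
  have hz3 := h3 z
  have hv3 := h3 v
  have key : ∀ x y, (x = z ∨ x = z⁻¹ ∨ x = v ∨ x = v⁻¹) → (y = z ∨ y = z⁻¹ ∨ y = v ∨ y = v⁻¹) →
      x * y * (z * v)⁻¹ = 1 ∨ x * y * (z * v)⁻¹ ∉ L := by
    have e : ∀ {a b : G}, b ∉ L → (a ∈ L → b ∈ L) → a ∉ L := fun hb h ha => hb (h ha)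
    have kz : ∀ {a} b, z * (z * z) * a = b → (a ∈ L → b ∈ L) := fun b h ha => by
      rw [← h]; rw [pow_succ, pow_two, mul_assoc] at hz3; exact L.mul_mem hz3 ha
    have kv : ∀ {a} b, v * (v * v) * a = b → (a ∈ L → b ∈ L) := fun b h ha => by
      rw [← h]; rw [pow_succ, pow_two, mul_assoc] at hv3; exact L.mul_mem hv3 ha
    have ki : ∀ {a} b, a⁻¹ = b → (a ∈ L → b ∈ L) := fun b h ha => by
      rw [← h]; exact L.inv_mem ha
    have kzv : ∀ {a} b, z * (z * z) * (v * (v * v)) * a = b → (a ∈ L → b ∈ L) := fun b h ha => by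
      rw [← h]; rw [pow_succ, pow_two, mul_assoc] at hv3 hz3
      exact L.mul_mem (L.mul_mem hz3 hv3) ha
    rintro x y (rfl | rfl | rfl | rfl) (rfl | rfl | rfl | rfl)
    all_goals first
      | (right; refine e h2 (fun ha => ?_); convert ha using 1; apply Additive.ofMul.injective
         simp only [ofMul_mul, ofMul_inv]; abel; done)
      | (left; apply Additive.ofMul.injective; simp only [ofMul_mul, ofMul_inv, ofMul_one]; abel; done)
      | (right; refine e h2 (ki _ ?_); apply Additive.ofMul.injective
         simp only [ofMul_mul, ofMul_inv]; abel; done)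
      | (right; refine e h1 (ki _ ?_); apply Additive.ofMul.injective
         simp only [ofMul_mul, ofMul_inv]; abel; done)
      | (right; refine e h0 (kv _ ?_); apply Additive.ofMul.injective
         simp only [ofMul_mul, ofMul_inv]; abel; done)
      | (right; refine e hz (kz _ ?_); apply Additive.ofMul.injective
         simp only [ofMul_mul, ofMul_inv]; abel; done)
      | (right; refine e h1 (kzv _ ?_); apply Additive.ofMul.injective
         simp only [ofMul_mul, ofMul_inv]; abel; done)
      | (right; refine e (fun h => h0 (L.inv_mem_iff.1 h)) (kz _ ?_); apply Additive.ofMul.injective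
         simp only [ofMul_mul, ofMul_inv]; abel; done)
      | (right; refine e (fun h => hz (L.inv_mem_iff.1 h)) (kv _ ?_); apply Additive.ofMul.injective
         simp only [ofMul_mul, ofMul_inv]; abel; done)
  rcases key x y (he x ex.symm) (he y (ey.symm.trans hvz)) with h4 | h4
  · exact hl1' (h'.trans h4)
  · exact h4 (h' ▸ hl)

end

section

variable {G H C : Type} [CommGroup G] [CommGroup H] {c : G → C} {d : H → C} {L : Subgroup G}
variable {V W : Type} [AddCommGroup V] [Fintype V] [DecidableEq V] [AddCommGroup W] [Fintype W]
  [DecidableEq W]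

/-- The number of ways to write `z` as a sum of an element of `p` and one of `q`. -/
def cnt (p q : V → Bool) (z : V) : ℕ := (Finset.univ.filter fun u => p u && q (z - u)).card

theorem cnt_eq_card (e : V ≃+ Additive G) {X Y : Set G} {p q : V → Bool}
    (hp : ∀ v, p v ↔ (e v).toMul ∈ X) (hq : ∀ v, q v ↔ (e v).toMul ∈ Y) (z : V) :
    cnt p q z = Nat.card {u : G // u ∈ X ∧ u⁻¹ * (e z).toMul ∈ Y} := by
  have h1 : cnt p q z = Nat.card {u : V // p u && q (z - u)} := by
    rw [Nat.card_eq_fintype_card, Fintype.card_subtype, cnt]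
  rw [h1]
  refine Nat.card_congr ((e.toEquiv.trans Additive.toMul).subtypeEquiv fun u => ?_)
  rw [Bool.and_eq_true]
  refine and_congr (hp u) ((hq _).trans ?_)
  rw [map_sub, sub_eq_neg_add]
  rfl

theorem Joint.cnt_eq (J : Joint c d) (e : V ≃+ Additive G) (e' : W ≃+ Additive H) {X Y : Set G}
    {X' Y' : Set H} (hX : JS c d X X') (hY : JS c d Y Y') {p q : V → Bool} {p' q' : W → Bool}
    (hp : ∀ v, p v ↔ (e v).toMul ∈ X) (hq : ∀ v, q v ↔ (e v).toMul ∈ Y)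
    (hp' : ∀ v, p' v ↔ (e' v).toMul ∈ X') (hq' : ∀ v, q' v ↔ (e' v).toMul ∈ Y') {z : V} {z' : W}
    (h : c (e z).toMul = d (e' z').toMul) : cnt p q z = cnt p' q' z' := by
  rw [cnt_eq_card e hp hq, cnt_eq_card e' hp' hq']
  exact J.card_conv_eq h (Φ := fun x y => x ∈ X ∧ y ∈ Y) (Ψ := fun x y => x ∈ X' ∧ y ∈ Y')
    fun x y x' y' h1 h2 => and_congr (hX h1) (hY h2)

/-- Level sets of convolutions are unions of classes. -/
theorem Joint.js_cnt (J : Joint c c) (e : V ≃+ Additive G) {X Y : Set G}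
    (hX : JS c c X X) (hY : JS c c Y Y) {p q : V → Bool}
    (hp : ∀ v, p v ↔ (e v).toMul ∈ X) (hq : ∀ v, q v ↔ (e v).toMul ∈ Y) (n : ℕ) :
    JS c c {g | cnt p q (e.symm (Additive.ofMul g)) = n}
      {g | cnt p q (e.symm (Additive.ofMul g)) = n} := by
  intro g h heq
  have := J.cnt_eq e e hX hY hp hq hp hq (z := e.symm (Additive.ofMul g))
    (z' := e.symm (Additive.ofMul h)) (by simpa using heq)
  simp only [Set.mem_ofPred_eq, this]

theorem exists_pred {V : Type} [AddCommGroup V] (e : V ≃+ Additive G) (X : Set G) :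
    ∃ p : V → Bool, ∀ v, p v ↔ (e v).toMul ∈ X := by
  classical
  exact ⟨fun v => decide ((e v).toMul ∈ X), fun v => by simp⟩

theorem exists_equiv_of_injective [Finite G] (φ : V →+ Additive G) (hφ : Function.Injective φ)
    (h : Nat.card V = Nat.card G) : ∃ e : V ≃+ Additive G, ∀ v, e v = φ v := by
  have hb : Function.Bijective φ := by
    have := Fintype.ofFinite G
    have : Fintype (Additive G) := inferInstance
    rw [Fintype.bijective_iff_injective_and_card]
    refine ⟨hφ, ?_⟩
    have h' : Nat.card V = Nat.card (Additive G) := h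
    rwa [Nat.card_eq_fintype_card, Nat.card_eq_fintype_card] at h'
  exact ⟨AddEquiv.ofBijective φ hb, fun v => rfl⟩

theorem orderOf_mk_of_card_nine (hcL : Nat.card L = 3) {y : G}
    (hQ : Nat.card (G ⧸ L) = 9) (h : y ^ 3 ∉ L) : orderOf (y : G ⧸ L) = 9 := by
  have : orderOf (y : G ⧸ L) ∣ 3 ^ 2 := by
    have := orderOf_dvd_natCard (y : G ⧸ L)
    rwa [hQ] at this
  obtain ⟨i, hi, h2⟩ := (Nat.dvd_prime_pow Nat.prime_three).1 this
  have h3 : (y : G ⧸ L) ^ 3 ≠ 1 := by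
    rwa [← QuotientGroup.mk_pow, Ne, QuotientGroup.eq_one_iff]
  rw [Ne, ← orderOf_dvd_iff_pow_eq_one, h2] at h3
  interval_cases i
  · simp at h3
  · simp at h3
  · exact h2

/-- A class containing `w` and fixed by the multiplier `m`, where `w ^ m = w * l`, `l ∈ L`. -/
theorem Joint.full_of_mult [Finite G] (J : Joint c c) (hL : JS c c (L : Set G) L) (hcL : Nat.card L = 3)
    {m : ℕ} (hm : (Nat.card G).Coprime m) {x w l : G} (hx : x ^ m = x) (hw : c w = c x)
    (hl : l ∈ L) (hl1 : l ≠ 1) (h1 : w ^ m = w * l) (h2 : l ^ m = l) : Full c L x := by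
  have e1 := J.pow hm hw
  rw [hx, h1] at e1
  have e2 := J.pow hm e1
  rw [hx, mul_pow, h1, h2, mul_assoc] at e2
  exact (full_of_pow hcL hl hl1 (e1.trans hw.symm) (e2.trans hw.symm)).congr J hL hw.symm

/-- A wreath decomposition of cyclic groups of order 27. -/
theorem Joint.full_cyclic [Finite G] (J : Joint c c) (hno : NoNine c) (hG : Nat.card G = 27)
    (hL : JS c c (L : Set G) L) (hcL : Nat.card L = 3) {y : G} (hy : orderOf y = 27) :
    ∀ x ∉ L, Full c L x := by
  have hQ : Nat.card (G ⧸ L) = 9 :=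
    card_quotient_of_card (n := 9) (p := 3) (by norm_num) (by rw [hG]) hcL
  have hy9 : y ^ 9 ≠ 1 := fun h => by
    have := orderOf_dvd_of_pow_eq_one h
    rw [hy] at this; norm_num at this
  have hy27 : y ^ 27 = 1 := by rw [← hy, pow_orderOf_eq_one]
  have hy9L : y ^ 9 ∈ L := by
    rw [← QuotientGroup.eq_one_iff, QuotientGroup.mk_pow, ← hQ]; exact pow_card_eq_one'
  have hy3 : y ^ 3 ∉ L := fun h => hy9 (by
    have := pow_three_of_card_three hcL h
    rwa [← pow_mul] at this)
  have hf := J.flat_of_orderOf hno hG hL hcL (orderOf_mk_of_card_nine hcL hQ hy3)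
  have hyL : y ∉ L := fun h => hy3 (L.pow_mem h 3)
  obtain ⟨l, hl, e⟩ := hf y hyL _ hy3
  have hl3 := pow_three_of_card_three hcL hl
  refine hf.full J hL hy3 (J.full_of_mult hL hcL (m := 10) (by rw [hG]; norm_num)
    (w := y * l) (l := y ^ 9) ?_ e.symm hy9L hy9 ?_ ?_)
  · rw [← pow_mul, show 3 * 10 = 27 + 3 by norm_num, pow_add, hy27, one_mul]
  · rw [mul_pow, show l ^ 10 = l by rw [show 10 = 3 * 3 + 1 by norm_num, pow_add, pow_mul, hl3,
      one_pow, one_mul, pow_one], pow_succ, mul_assoc, mul_comm]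
  · rw [← pow_mul, show 9 * 10 = 27 * 3 + 9 by norm_num, pow_add, pow_mul, hy27, one_pow, one_mul]

end

section

variable {G H C : Type} [CommGroup G] [CommGroup H] {c : G → C} {d : H → C} {L : Subgroup G}

/-- The two candidates for half of the nonzero elements of a cyclic group. -/
def cycHalf (s t : Bool) (v : ZMod 27) : Bool :=
  if v.val % 3 = 0 then if v.val % 9 = 0 then if v = 0 then false else (v.val = 9) == t
    else (v.val % 9 = 3) == s else v.val % 3 = 1

set_option synthInstance.maxHeartbeats 400000 in
set_option synthInstance.maxSize 1000 in
theorem cycHalf_cnt : ∀ s t, ∃ z, cycHalf s t z = true ∧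
    cnt (cycHalf s t) (cycHalf s t) z ≠ cnt (cycHalf s t) (cycHalf s t) 1 := by
  decide +kernel

set_option synthInstance.maxHeartbeats 400000 in
set_option synthInstance.maxSize 1000 in
theorem cyc_orbit : ∀ v : ZMod 27, v = 0 ∨ ∃ j : Fin 9,
    (v = 4 ^ j.val * 1 ∨ v = -(4 ^ j.val * 1)) ∨ (v = 4 ^ j.val * 3 ∨ v = -(4 ^ j.val * 3)) ∨
    (v = 4 ^ j.val * 9 ∨ v = -(4 ^ j.val * 9)) := by
  decide +kernel

set_option synthInstance.maxHeartbeats 400000 in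
set_option synthInstance.maxSize 1000 in
theorem cycHalf_eq : ∀ s t : Bool, ∀ j : Fin 9,
    cycHalf s t (4 ^ j.val * 1) = true ∧ cycHalf s t (-(4 ^ j.val * 1)) = false ∧
    cycHalf s t (4 ^ j.val * 3) = s ∧ cycHalf s t (-(4 ^ j.val * 3)) = !s ∧
    cycHalf s t (4 ^ j.val * 9) = t ∧ cycHalf s t (-(4 ^ j.val * 9)) = !t := by
  decide +kernel

theorem toMul_ne_one {V : Type} [AddCommGroup V] (e : V ≃+ Additive G) {v : V} :
    (e v).toMul ≠ 1 ↔ v ≠ 0 := by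
  rw [not_iff_not]
  exact (Additive.ofMul.injective.eq_iff (a := (e v).toMul) (b := 1)).symm.trans
    (e.map_eq_zero_iff (x := v))

theorem toMul_nsmul {V : Type} [AddCommGroup V] (e : V ≃+ Additive G) (n : ℕ) (v : V) :
    (e (n • v)).toMul = (e v).toMul ^ n := by rw [map_nsmul]; rfl

theorem toMul_neg {V : Type} [AddCommGroup V] (e : V ≃+ Additive G) (v : V) :
    (e (-v)).toMul = (e v).toMul⁻¹ := by rw [map_neg]; rfl

theorem toMul_add {V : Type} [AddCommGroup V] (e : V ≃+ Additive G) (v w : V) :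
    (e (v + w)).toMul = (e v).toMul * (e w).toMul := by rw [map_add]; rfl

theorem pow_eq_self_of_mod {k n m : ℕ} {x : G} (hx : x ^ k = 1) (h : n % k = m % k) :
    x ^ n = x ^ m := by
  rw [← Nat.div_add_mod n k, ← Nat.div_add_mod m k, pow_add, pow_add, pow_mul, pow_mul, hx, h,
    one_pow, one_pow]

/-- Half of the nonzero elements: the class of `x` in an antisymmetric colouring of rank three. -/
theorem Joint.exists_half {V : Type} [AddCommGroup V] (J : Joint c c) (e : V ≃+ Additive G) {x : G}
    (h : ∀ g, g ≠ 1 → c g = c x ∨ c g = c x⁻¹) (hx : c x⁻¹ ≠ c x) :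
    ∃ p : V → Bool, (∀ v, p v ↔ (e v).toMul ∈ cls c x) ∧ ∀ v, v ≠ 0 → p (-v) = !p v := by
  obtain ⟨p, hp⟩ := exists_pred e (cls c x)
  refine ⟨p, hp, fun v hv => ?_⟩
  have h1 := hp (-v)
  rw [toMul_neg, mem_cls] at h1
  have h2 := hp v
  rw [mem_cls] at h2
  rcases h _ ((toMul_ne_one e).2 hv) with h3 | h3
  · rw [h2.2 h3, Bool.not_true, Bool.eq_false_iff, Ne, h1]
    exact fun h4 => hx ((J.inv h3).symm.trans h4)
  · have h4 := J.inv h3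
    rw [inv_inv] at h4
    rw [h1.2 h4, eq_comm, Bool.not_eq_true', Bool.eq_false_iff, Ne, h2]
    exact fun h5 => hx (h3.symm.trans h5)

theorem Joint.half_nsmul [Finite G] {V : Type} [AddCommGroup V] (J : Joint c c)
    {e : V ≃+ Additive G} {x : G} (hx1 : x ≠ 1) {p : V → Bool} (hp : ∀ v, p v ↔ (e v).toMul ∈ cls c x)
    (hpn : ∀ v, v ≠ 0 → p (-v) = !p v) {m : ℕ} (hm : (Nat.card G).Coprime m)
    (hx : c (x ^ m) = c x) {v : V} (hv : v ≠ 0) : p (m • v) = p v := by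
  have h1 : ∀ v, p v → p (m • v) := fun v h => by
    rw [hp, mem_cls] at h ⊢
    rw [toMul_nsmul]
    exact (J.pow hm h).trans hx
  by_cases hpv : p v
  · rw [hpv, h1 v hpv]
  · have h2 := h1 (-v) (by rw [hpn v hv]; simpa using hpv)
    have h3 : m • v ≠ 0 := fun h => by
      rw [smul_neg, h, neg_zero, hp, mem_cls, map_zero] at h2
      exact hx1 ((J.one_iff h2).1 rfl)
    rw [smul_neg, hpn _ h3] at h2
    simp only [Bool.not_eq_true] at hpv
    rw [hpv]
    simpa using h2

/-- A primitive colouring of a cyclic group of order 27 has rank two. -/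
theorem Joint.rank_two_cyclic [Finite G] (J : Joint c c) (hno : NoNine c) (hno3 : NoThree c)
    (hG : Nat.card G = 27) {y : G} (hy : orderOf y = 27) : ∃ x, ∀ g, g ≠ 1 → c g = c x := by
  have hy27 : ∀ g : G, g ^ 27 = 1 := fun g => by rw [← hG]; exact pow_card_eq_one'
  have hy9 : y ^ 9 ≠ 1 := fun h => by
    have := orderOf_dvd_of_pow_eq_one h
    rw [hy] at this; norm_num at this
  -- every class contains a generator
  have key : ∀ y : G, orderOf y = 27 → ∀ g, g ≠ 1 → ∃ k : ℕ, k % 3 ≠ 0 ∧ c (y ^ k) = c g := by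
    intro y hy g hg
    by_contra hk
    push Not at hk
    have hZ : Nat.card (Subgroup.zpowers (y ^ 3)) = 9 := by
      rw [Nat.card_zpowers, orderOf_pow, hy]; norm_num
    refine hg (J.eq_one_of_subset hno hno3 (JS.cls rfl) hZ (fun h hh => ?_) (self_mem_cls (c := c)))
    have : h ∈ Submonoid.powers y := by
      have h1 : Subgroup.zpowers y = ⊤ := Subgroup.eq_top_of_card_eq _ (by
        rw [Nat.card_zpowers, hy, hG])
      rw [mem_powers_iff_mem_zpowers, h1]; trivial
    obtain ⟨k, rfl⟩ := this
    have h3 : k % 3 = 0 := by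
      by_contra h3
      exact hk k h3 hh
    obtain ⟨j, rfl⟩ := Nat.dvd_of_mod_eq_zero h3
    exact Subgroup.mem_zpowers_iff.2 ⟨j, by simp [pow_mul]⟩
  obtain ⟨k, hk, ek⟩ := key y hy _ hy9
  have hw : orderOf (y ^ k) = 27 := by
    rw [orderOf_pow, hy]
    have : Nat.gcd 27 k = 1 := by
      have : Nat.Coprime (3 ^ 3) k := Nat.Coprime.pow_left 3
        ((Nat.Prime.coprime_iff_not_dvd Nat.prime_three).2 (fun h => hk (Nat.mod_eq_zero_of_dvd h)))
      exact this
    rw [this]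
  set w := y ^ k with hwd
  have hmul : ∀ m : ℕ, m % 3 = 1 → c (w ^ m) = c w := fun m hm => by
    have hm' : (Nat.card G).Coprime m := by
      rw [hG]
      exact Nat.Coprime.pow_left 3 ((Nat.Prime.coprime_iff_not_dvd Nat.prime_three).2 (by omega))
    have := J.pow hm' ek
    rw [this, ek, ← pow_mul]
    rw [pow_eq_self_of_mod (hy27 y) (n := 9 * m) (m := 9) (by omega)]
  have hcov : ∀ g, g ≠ 1 → c g = c w ∨ c g = c w⁻¹ := fun g hg => by
    obtain ⟨i, hi, e⟩ := key w hw g hg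
    have : i % 3 = 1 ∨ i % 3 = 2 := by omega
    rcases this with h | h
    · exact Or.inl (e.symm.trans (hmul i h))
    · right
      have h1 := J.inv (hmul (26 * i) (by omega))
      rw [← e, ← h1]
      congr 1
      rw [eq_inv_iff_mul_eq_one, ← pow_add, pow_eq_self_of_mod (hy27 w) (m := 0) (by omega),
        pow_zero]
  by_cases hs : c w⁻¹ = c w
  · exact ⟨w, fun g hg => (hcov g hg).elim id fun h => h.trans hs⟩
  exfalso
  obtain ⟨φ, hφ, hφ1⟩ := exists_hom_of_orderOf hw
  obtain ⟨e, he⟩ := exists_equiv_of_injective φ hφ (by rw [hG, Nat.card_zmod])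
  have hw1 : w ≠ 1 := fun h => by rw [h, orderOf_one] at hw; norm_num at hw
  obtain ⟨p, hp, hpn⟩ := J.exists_half e hcov hs
  have h4 : ∀ v, v ≠ 0 → ∀ j : ℕ, p (4 ^ j * v) = p v := fun v hv j => by
    induction j with
    | zero => rw [pow_zero, one_mul]
    | succ j ih =>
      have h5 : ∀ u : ZMod 27, 4 * u = 0 → u = 0 := by decide
      have h6 : (4 : ZMod 27) ^ j * v ≠ 0 := by
        clear ih
        induction j with
        | zero => simpa using hv
        | succ j ih => rw [pow_succ', mul_assoc]; exact fun h => ih (h5 _ h)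
      rw [pow_succ', mul_assoc, ← ih, ← J.half_nsmul hw1 hp hpn (m := 4) (by rw [hG]; norm_num)
        (hmul 4 rfl) h6]
      congr 1
      simp
  have hp1 : p 1 = true := by rw [hp, he, hφ1]; rfl
  have hpe : p = cycHalf (p 3) (p 9) := by
    funext v
    rcases cyc_orbit v with rfl | ⟨j, h⟩
    · have : p 0 = false := by
        rw [Bool.eq_false_iff, Ne, hp, mem_cls, map_zero]
        exact fun h => hw1 ((J.one_iff h).1 rfl)
      rw [this]; rfl
    have hne : ∀ j : Fin 9, (4 : ZMod 27) ^ j.val * 1 ≠ 0 ∧ (4 : ZMod 27) ^ j.val * 3 ≠ 0 ∧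
      (4 : ZMod 27) ^ j.val * 9 ≠ 0 := by decide
    obtain ⟨n1, n3, n9⟩ := hne j
    obtain ⟨q1, q2, q3, q4, q5, q6⟩ := cycHalf_eq (p 3) (p 9) j
    rcases h with (rfl | rfl) | (rfl | rfl) | (rfl | rfl)
    · rw [q1, h4 1 (by decide), hp1]
    · rw [q2, hpn _ n1, h4 1 (by decide), hp1]; rfl
    · rw [q3, h4 3 (by decide)]
    · rw [q4, hpn _ n3, h4 3 (by decide)]
    · rw [q5, h4 9 (by decide)]
    · rw [q6, hpn _ n9, h4 9 (by decide)]
  obtain ⟨z, hz, hc⟩ := cycHalf_cnt (p 3) (p 9)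
  rw [← hpe] at hz hc
  rw [hp, mem_cls] at hz
  exact hc (J.cnt_eq e e (JS.cls rfl) (JS.cls rfl) hp hp hp hp
    (hz.trans (by rw [he, hφ1]; rfl)))

end

section

variable {G H C : Type} [CommGroup G] [CommGroup H] {c : G → C} {d : H → C} {L : Subgroup G}

theorem orderOf_eq_nine {y : G} (h9 : y ^ 9 = 1) (hy : y ^ 3 ≠ 1) : orderOf y = 9 := by
  have h1 : orderOf y ∣ 3 ^ 2 := orderOf_dvd_of_pow_eq_one h9
  obtain ⟨i, hi, h2⟩ := (Nat.dvd_prime_pow Nat.prime_three).1 h1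
  rw [Ne, ← orderOf_dvd_iff_pow_eq_one, h2] at hy
  interval_cases i
  · simp at hy
  · simp at hy
  · exact h2

theorem exists_equiv_nine_three_of [Finite G] (hG : Nat.card G = 27) {y u : G} (h9 : y ^ 9 = 1)
    (hy : y ^ 3 ≠ 1) (hu3 : u ^ 3 = 1) (hu : ∀ n : ℕ, u ≠ y ^ n) :
    ∃ e : ZMod 9 × ZMod 3 ≃+ Additive G, e (1, 0) = Additive.ofMul y ∧
      e (0, 1) = Additive.ofMul u := by
  obtain ⟨φ, hφ, hφ1⟩ := exists_hom_of_orderOf (orderOf_eq_nine h9 hy)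
  obtain ⟨ψ, hψ, h1, h2⟩ := exists_hom_extend φ hφ hu3 (fun k hk => by
    refine hu k.val (Additive.ofMul.injective (hk.symm.trans ?_))
    rw [ofMul_pow, ← hφ1, ← map_nsmul, nsmul_one, ZMod.natCast_zmod_val])
  obtain ⟨e, he⟩ := exists_equiv_of_injective ψ hψ
    (by rw [hG, Nat.card_prod, Nat.card_zmod, Nat.card_zmod])
  exact ⟨e, by rw [he, h1, hφ1], by rw [he, h2]⟩

theorem exists_equiv_nine_three [Finite G] (hG : Nat.card G = 27) (h9 : ∀ g : G, g ^ 9 = 1) {y : G}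
    (hy : y ^ 3 ≠ 1) : ∃ e : ZMod 9 × ZMod 3 ≃+ Additive G, e (1, 0) = Additive.ofMul y := by
  obtain ⟨u, hu3, hu⟩ : ∃ u : G, u ^ 3 = 1 ∧ ∀ n : ℕ, u ≠ y ^ n := by
    have hc : Nat.card (Subgroup.zpowers y) = 9 := by
      rw [Nat.card_zpowers, orderOf_eq_nine (h9 y) hy]
    have hi : (Subgroup.zpowers y).index = 3 := by
      have := (Subgroup.zpowers y).card_mul_index
      rw [hc, hG] at this; omega
    obtain ⟨g, hg⟩ : ∃ g, g ∉ Subgroup.zpowers y := by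
      by_contra h
      push Not at h
      have h2 := (Subgroup.eq_top_iff' _).2 h
      rw [h2, Subgroup.card_top, hG] at hc; norm_num at hc
    have h3 := pow_three_mem hi g
    rw [← mem_powers_iff_mem_zpowers] at h3
    obtain ⟨k, hk⟩ := h3
    have hk' : y ^ k = g ^ 3 := hk
    have h4 : y ^ (k * 3) = 1 := by rw [pow_mul, hk', ← pow_mul, h9]
    rw [← orderOf_dvd_iff_pow_eq_one, orderOf_eq_nine (h9 y) hy] at h4
    obtain ⟨i, rfl⟩ : 3 ∣ k := by omega
    refine ⟨g * (y ^ i)⁻¹, ?_, fun n hn => hg ?_⟩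
    · rw [mul_pow, ← hk', inv_pow, ← pow_mul, mul_comm 3 i, mul_inv_cancel]
    · rw [mul_inv_eq_iff_eq_mul] at hn
      rw [hn]
      exact Subgroup.mul_mem _ (Subgroup.npow_mem_zpowers y n) (Subgroup.npow_mem_zpowers y i)
  obtain ⟨e, h, -⟩ := exists_equiv_nine_three_of hG (h9 y) hy hu3 hu
  exact ⟨e, h⟩

/-- One outer union of cosets forces all outer classes to be unions of cosets. -/
theorem Joint.full_of_full [Finite G] (J : Joint c c) (hno : NoNine c) (hG : Nat.card G = 27)
    (hL : JS c c (L : Set G) L) (hcL : Nat.card L = 3) (h3 : ∀ g : G, g ^ 3 ∈ L) {x : G}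
    (hx : x ∉ L) (hf : Full c L x) : ∀ y ∉ L, Full c L y := by
  rcases J.flat_or_paley hno hG hL hcL h3 hx with h | ⟨v, -, -, -, hd, -⟩
  · exact h.full J hL hx hf
  intro y hy
  by_contra hyf
  have hxv : ¬ Full c L (x * v) := fun h => by
    rcases hd y hy with ⟨l, hl, e⟩ | ⟨l, hl, e⟩
    · exact hyf ((hf.mul hl).congr J hL e)
    · exact hyf ((h.mul hl).congr J hL e)
  have hxvL : x * v ∉ L := fun h => by
    rcases hd y hy with ⟨l, hl, e⟩ | ⟨l, hl, e⟩
    · exact hyf ((hf.mul hl).congr J hL e)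
    · exact hy ((hL e).2 (L.mul_mem h hl))
  obtain ⟨l, hl, es, ht⟩ := J.exists_symmetric hL hcL (x := x * v) (by
    rcases hd (x * v)⁻¹ (by rwa [inv_mem_iff]) with ⟨l, hl, e⟩ | h
    · have := ((hf.mul hl).congr J hL e).inv J
      rw [inv_inv] at this
      exact absurd this hxv
    · exact h) hxv
  have hzL : x * v * l ∉ L := fun h => hxvL ((L.mul_mem_cancel_right hl).1 h)
  have hzf : ¬ Full c L (x * v * l) := fun h => hxv (by
    have := h.mul (L.inv_mem hl)
    rwa [mul_inv_cancel_right] at this)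
  have hzf' : ∀ m ∈ L, c x ≠ c (x * v * l * m) := fun m hm e => hzf (by
    have := (hf.congr J hL e.symm).mul (L.inv_mem hm)
    rwa [mul_inv_cancel_right] at this)
  rcases J.flat_or_paley hno hG hL hcL h3 hzL with h | ⟨w, h1, h2, h4, h5, h6⟩
  · obtain ⟨m, hm, e⟩ := h _ hzL x hx
    exact hzf' m hm e
  · refine J.not_full_paley hcL h3 h1 hzL h2 (fun g hg => ?_) ?_
    · have htw : Triv c L w := ht.congr J hL h2
      rcases h4 g hg with h | h | h | h
      · exact Or.inl (eq_of_triv ht hg h)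
      · exact Or.inr (Or.inl (eq_of_triv (ht.inv J) (hg.trans es.symm) h))
      · exact Or.inr (Or.inr (Or.inl (eq_of_triv htw (hg.trans h2.symm) h)))
      · exact Or.inr (Or.inr (Or.inr (eq_of_triv (htw.inv J)
          (hg.trans ((J.inv h2).trans es).symm) h)))
    · rcases h5 x hx with ⟨m, hm, e⟩ | ⟨m, hm, e⟩
      · exact absurd e (hzf' m hm)
      · have := (hf.congr J hL e.symm).mul (L.inv_mem hm)
        rwa [mul_inv_cancel_right] at this

/-- A transversal of the subgroup `0 × ZMod 3`. -/
def transv (a : ZMod 3) (v : ZMod 9 × ZMod 3) : Bool :=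
  if v.1 = 0 then false else if v.1 = 3 then v.2 = a else if v.1 = 6 then v.2 = -a else v.2 = 0

set_option synthInstance.maxHeartbeats 400000 in
set_option synthInstance.maxSize 1000 in
theorem transv_cnt : ∀ a : ZMod 3, a ≠ 0 →
    cnt (transv a) (transv a) (1, 0) ≠ cnt (transv a) (transv a) (3, a) := by
  decide +kernel

theorem Joint.full_nine_three [Finite G] (J : Joint c c) (hno : NoNine c) (hG : Nat.card G = 27)
    (h9 : ∀ g : G, g ^ 9 = 1) (hL : JS c c (L : Set G) L) (hcL : Nat.card L = 3) {y : G}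
    (hy : y ^ 3 ≠ 1) : ∀ x ∉ L, Full c L x := by
  have hQ : Nat.card (G ⧸ L) = 9 :=
    card_quotient_of_card (n := 9) (p := 3) (by norm_num) (by rw [hG]) hcL
  by_cases h3 : ∀ g : G, g ^ 3 ∈ L
  · obtain ⟨e, he⟩ := exists_equiv_nine_three hG h9 hy
    have hL3 : ∀ a : ZMod 9 × ZMod 3, 3 • a.1 = 0 → (e a).toMul ∈ L → a.2 = 0 := fun a h1 ha => by
      have hy3 : y ^ 3 = (e (3, 0)).toMul := by
        have : ((3, 0) : ZMod 9 × ZMod 3) = 3 • (1, 0) := by decide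
        rw [this, toMul_nsmul, he]; rfl
      rcases mem_of_card_three hcL (h3 y) hy ha with h | h | h
      · have : a = 0 := by
          by_contra h0; exact (toMul_ne_one e).2 h0 h
        rw [this]; rfl
      · rw [hy3] at h
        have := e.injective (Additive.toMul.injective h)
        rw [this]
      · rw [hy3, ← toMul_neg] at h
        have := e.injective (Additive.toMul.injective h)
        rw [this]; rfl
    set x := (e (0, 1)).toMul with hx
    have hxL : x ∉ L := fun h => by
      have := hL3 (0, 1) rfl h
      revert this; decide
    have hx3 : x ^ 3 = 1 := by
      rw [hx, ← toMul_nsmul]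
      have : 3 • ((0, 1) : ZMod 9 × ZMod 3) = 0 := by decide
      rw [this, map_zero]; rfl
    have hyL : y ∉ L := fun h => hy (pow_three_of_card_three hcL h)
    have hm : (Nat.card G).Coprime 4 := by rw [hG]; norm_num
    rcases J.flat_or_paley hno hG hL hcL h3 hxL with h | ⟨v, hv, hvx, -⟩
    · obtain ⟨l, hl, e1⟩ := h x hxL y hyL
      refine h.full J hL (x := x * l) (fun h => hxL ((L.mul_mem_cancel_right hl).1 h))
        (J.full_of_mult hL hcL hm ?_ e1 (h3 y) hy (by rw [pow_succ']) ?_)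
      · rw [pow_succ, mul_pow, hx3, pow_three_of_card_three hcL hl]; simp
      · rw [pow_succ, pow_three_of_card_three hcL (h3 y), one_mul]
    · have hv3 : v ^ 3 ≠ 1 := fun h => by
        obtain ⟨⟨a, b⟩, hab⟩ := e.surjective (Additive.ofMul v)
        have hab' : v = (e (a, b)).toMul := by rw [hab]; rfl
        have h0 : 3 • ((a, b) : ZMod 9 × ZMod 3) = 0 := by
          by_contra h0
          apply (toMul_ne_one e).2 h0
          rw [toMul_nsmul, ← hab', h]
        have ha : 3 • a = 0 := congrArg Prod.fst h0
        obtain ⟨k, hk⟩ : ∃ k : ZMod 9, a = 3 * k := by clear hab hab' h0; revert a; decide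
        apply hv (-(b.val : ℤ))
        have h1 : x ^ (-(b.val : ℤ)) * v = (e (a, 0)).toMul := by
          rw [zpow_neg, zpow_natCast, hx, ← toMul_nsmul, ← toMul_neg, hab', ← toMul_add]
          congr 2
          ext
          · simp
          · simp
        have h2 : (e (a, 0)).toMul = ((e (k, 0)).toMul) ^ 3 := by
          rw [← toMul_nsmul]
          congr 2
          ext
          · simp [hk]
          · simp
        rw [h1, h2]
        exact h3 _
      refine J.full_of_full hno hG hL hcL h3 hxL (J.full_of_mult hL hcL hm ?_ hvx (h3 v) hv3
        (by rw [pow_succ']) ?_)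
      · rw [pow_succ, hx3, one_mul]
      · rw [pow_succ, pow_three_of_card_three hcL (h3 v), one_mul]
  clear hy y
  push Not at h3
  obtain ⟨y, hy⟩ := h3
  have hf := J.flat_of_orderOf hno hG hL hcL (orderOf_mk_of_card_nine hcL hQ hy)
  have hyL : y ∉ L := fun h => hy (L.pow_mem h 3)
  by_contra hc
  push Not at hc
  obtain ⟨x, hx, hxf⟩ := hc
  have hyf : ¬ Full c L y := fun h => hxf (hf.full J hL hyL h x hx)
  obtain ⟨m, hm, hzs, hzt⟩ := J.exists_symmetric hL hcL
    (hf y hyL y⁻¹ (by rwa [inv_mem_iff])) hyf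
  set z := y * m with hz
  have hz3 : z ^ 3 = y ^ 3 := by rw [hz, mul_pow, pow_three_of_card_three hcL hm, mul_one]
  rw [← hz3] at hy
  have hzL : z ∉ L := fun h => hy (L.pow_mem h 3)
  obtain ⟨l', hl', e1⟩ := hf z hzL _ hy
  obtain ⟨k, hk, e2⟩ := J.exists_mul_mem hL e1.symm (L.inv_mem hl')
  rw [mul_inv_cancel_right] at e2
  have hl0 : ∃ l ∈ L, l ≠ 1 := by
    have : Finite L := Nat.finite_of_card_ne_zero (by rw [hcL]; norm_num)
    have : Nontrivial L := (Finite.one_lt_card_iff_nontrivial (α := L)).1 (by rw [hcL]; norm_num)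
    obtain ⟨l, h⟩ := exists_ne (1 : L)
    exact ⟨l, l.2, fun h' => h (Subtype.ext h')⟩
  obtain ⟨l, hl, hl1⟩ := hl0
  have hz31 : z ^ 3 ≠ 1 := fun h => hy (by rw [h]; exact L.one_mem)
  obtain ⟨e, he1, he2⟩ := exists_equiv_nine_three_of hG (h9 z) hz31 (pow_three_of_card_three hcL hl)
    (fun n hn => by
      have h1 : z ^ (n * 3) = 1 := by rw [pow_mul, ← hn, pow_three_of_card_three hcL hl]
      have h2 := orderOf_dvd_of_pow_eq_one h1
      rw [orderOf_eq_nine (h9 z) hz31] at h2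
      obtain ⟨j, rfl⟩ : 3 ∣ n := by omega
      have h3 : ¬ (3 ∣ j) := by
        rintro ⟨i, rfl⟩
        apply hl1
        rw [hn, show 3 * (3 * i) = 9 * i by ring, pow_mul, h9, one_pow]
      rw [pow_mul] at hn
      apply hy
      have h4 : z ^ 3 = l ^ j := by
        rw [hn, ← pow_mul, ← pow_mul]
        refine pow_eq_self_of_mod (h9 z) ?_
        have : j % 3 = 1 ∨ j % 3 = 2 := by omega
        rcases this with h | h
        · obtain ⟨q, rfl⟩ : ∃ q, j = 3 * q + 1 := ⟨j / 3, by omega⟩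
          ring_nf; omega
        · obtain ⟨q, rfl⟩ : ∃ q, j = 3 * q + 2 := ⟨j / 3, by omega⟩
          ring_nf; omega
      rw [h4]
      exact L.pow_mem hl j)
  obtain ⟨p, hp⟩ := exists_pred e (cls c z)
  have heL : ∀ b, (e (0, b)).toMul ∈ L := fun b => by
    have : ((0, b) : ZMod 9 × ZMod 3) = b.val • (0, 1) := by ext <;> simp
    rw [this, toMul_nsmul, he2]
    exact L.pow_mem hl _
  have hpL : ∀ b, p (0, b) = false := fun b => by
    rw [Bool.eq_false_iff, Ne, hp, mem_cls]
    exact fun h => hzL ((hL h).1 (heL b))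
  have huniq : ∀ i b b', p (i, b) → p (i, b') → b = b' := fun i b b' h h' => by
    rw [hp, mem_cls] at h h'
    have ht := hzt.congr J hL h'
    have := eq_of_triv ht (h.trans h'.symm) (by
      rw [eq_comm, QuotientGroup.eq, ← toMul_neg, ← toMul_add]
      have : -(i, b') + (i, b) = (0, b - b') := by ext <;> simp [sub_eq_neg_add]
      rw [this]; exact heL _)
    exact congrArg Prod.snd (e.injective (Additive.toMul.injective this))
  have hneg : ∀ v, p v → p (-v) := fun v h => by
    rw [hp, mem_cls] at h ⊢
    rw [toMul_neg, J.inv h, hzs]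
  have hu4 : (z ^ 3 * k) ^ 4 = z ^ 3 * k := by
    rw [pow_succ, mul_pow, pow_three_of_card_three hcL hk, ← pow_mul, h9]; simp
  have h4 : ∀ v, p v → p (4 • v) := fun v h => by
    rw [hp, mem_cls] at h ⊢
    have := J.pow (m := 4) (by rw [hG]; norm_num) (h.trans e2)
    rw [toMul_nsmul, this, hu4, ← e2]
  have p1 : p (1, 0) := by rw [hp, he1]; rfl
  obtain ⟨a, ha⟩ : ∃ a, p (3, a) := by
    obtain ⟨⟨i, a⟩, hia⟩ := e.surjective (Additive.ofMul k)
    have hkk : k = (e (i, a)).toMul := by rw [hia]; rfl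
    have hz30 : z ^ 3 = (e (3, 0)).toMul := by
      have : ((3, 0) : ZMod 9 × ZMod 3) = 3 • (1, 0) := by decide
      rw [this, toMul_nsmul, he1]; rfl
    have : ∃ b, k = (e (0, b)).toMul := by
      rcases mem_of_card_three hcL hl hl1 hk with h | h | h
      · exact ⟨0, by rw [h]; exact (congrArg Additive.toMul (map_zero e)).symm⟩
      · exact ⟨1, by rw [h, he2]; rfl⟩
      · refine ⟨-1, ?_⟩
        have : ((0, -1) : ZMod 9 × ZMod 3) = -(0, 1) := by decide
        rw [h, this, toMul_neg, he2]; rfl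
    obtain ⟨b, hb⟩ := this
    refine ⟨b, ?_⟩
    rw [hp, mem_cls, e2, hz30, hb, ← toMul_add]
    simp
  have p4 : p (4, 0) := by simpa using h4 _ p1
  have p7 : p (7, 0) := h4 _ p4
  have p8 : p (8, 0) := hneg _ p1
  have p5 : p (5, 0) := hneg _ p4
  have p2 : p (2, 0) := hneg _ p7
  have p6 : p (6, -a) := hneg _ ha
  have hpe : p = transv a := by
    funext ⟨i, b⟩
    have h0 : ∀ i b b', p (i, b') → p (i, b) = decide (b = b') := fun i b b' h => by
      by_cases hb : b = b'
      · rw [hb, h]; simp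
      · rw [decide_eq_false hb, Bool.eq_false_iff]
        exact fun h' => hb (huniq i b b' h' h)
    have hi : ∀ i : ZMod 9, i = 0 ∨ i = 1 ∨ i = 2 ∨ i = 3 ∨ i = 4 ∨ i = 5 ∨ i = 6 ∨ i = 7 ∨ i = 8 := by
      decide
    rcases hi i with rfl | rfl | rfl | rfl | rfl | rfl | rfl | rfl | rfl
    · exact hpL b
    · exact h0 _ b _ p1
    · exact h0 _ b _ p2
    · exact h0 _ b _ ha
    · exact h0 _ b _ p4
    · exact h0 _ b _ p5
    · exact h0 _ b _ p6
    · exact h0 _ b _ p7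
    · exact h0 _ b _ p8
  by_cases ha0 : a = 0
  · subst ha0
    have hZ : Nat.card (Subgroup.zpowers z) = 9 := by
      rw [Nat.card_zpowers, orderOf_eq_nine (h9 z) hz31]
    have := J.closure_card_dvd hno (JS.cls (c := c) (x := z) rfl) hZ (fun g hg => by
      obtain ⟨⟨i, b⟩, hib⟩ := e.surjective (Additive.ofMul g)
      have hgg : g = (e (i, b)).toMul := by rw [hib]; rfl
      rw [hgg, ← hp, hpe] at hg
      have hb : b = 0 := by clear hib hgg; revert i b; decide
      have : ((i, b) : ZMod 9 × ZMod 3) = i.val • (1, 0) := by ext <;> simp [hb]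
      rw [hgg, this, toMul_nsmul, he1]
      exact Subgroup.npow_mem_zpowers z _)
    have h1 : orderOf z ∣ 3 := by
      refine dvd_trans ?_ this
      rw [← Nat.card_zpowers]
      exact Subgroup.card_dvd_of_le (by
        rw [Subgroup.zpowers_le]; exact Subgroup.subset_closure self_mem_cls)
    rw [orderOf_eq_nine (h9 z) hz31] at h1
    norm_num at h1
  · have h1 := transv_cnt a ha0
    rw [← hpe] at h1
    refine h1 (J.cnt_eq e e (JS.cls rfl) (JS.cls rfl) hp hp hp hp ?_)
    rw [hp, mem_cls] at p1 ha
    exact p1.trans ha.symm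

end

section

variable {G H C : Type} [CommGroup G] [CommGroup H] {c : G → C} {d : H → C} {L : Subgroup G}

/-- The rational subset of `ZMod 9 × ZMod 3` with given values on representatives. -/
def ratSet (b : Fin 128) (v : ZMod 9 × ZMod 3) : Bool :=
  if v.1.val % 3 = 0 then
    if v.1 = 0 then if v.2 = 0 then false else b.val.testBit 0
    else if v.2 = 0 then b.val.testBit 1
    else if (v.1 = 3) == (v.2 = 1) then b.val.testBit 2 else b.val.testBit 3
  else if v.2 = 0 then b.val.testBit 4
  else if (v.1.val % 3 = 1) == (v.2 = 1) then b.val.testBit 5 else b.val.testBit 6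

/-- Representatives of the rational classes of `ZMod 9 × ZMod 3`. -/
def ratRep (i : Fin 7) : ZMod 9 × ZMod 3 :=
  match i with
  | 0 => (0, 1) | 1 => (3, 0) | 2 => (3, 1) | 3 => (3, 2) | 4 => (1, 0) | 5 => (1, 1) | 6 => (1, 2)

/-- The subset of `ZMod 9 × ZMod 3` containing exactly one of `v` and `-v` for each `v ≠ 0`,
with given values on representatives. -/
def ratHalf (b : Fin 128) (v : ZMod 9 × ZMod 3) : Bool :=
  ratSet b v != if v.1 = 0 then v.2 = 2 else if v.1.val % 3 = 0 then v.1 = 6 else v.1.val % 3 = 2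

/-- Kernels of the linear functionals on `ZMod 9 × ZMod 3`. -/
def ratFun (k : Fin 4) (v : ZMod 9 × ZMod 3) : Bool :=
  match k with
  | 0 => v.1.val % 3 = 0
  | 1 => v.2.val = 0
  | 2 => (v.1.val + v.2.val) % 3 = 0
  | 3 => (v.1.val + 2 * v.2.val) % 3 = 0

set_option synthInstance.maxHeartbeats 400000 in
set_option synthInstance.maxSize 1000 in
set_option maxRecDepth 10000 in
theorem ratSet_cnt : ∀ b : Fin 128, (b.val.testBit 0 || b.val.testBit 1 || b.val.testBit 2 ||
      b.val.testBit 3) = false ∨ b.val = 127 ∨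
    (∃ i j, ratSet b (ratRep i) = true ∧ ratSet b (ratRep j) = true ∧
      cnt (ratSet b) (ratSet b) (ratRep i) ≠ cnt (ratSet b) (ratSet b) (ratRep j)) ∨
    (∃ k i, ∀ v, (ratSet b v = ratSet b (ratRep i) ∧
      cnt (ratSet b) (ratSet b) v = cnt (ratSet b) (ratSet b) (ratRep i)) → v ≠ 0 →
      ratFun k v = true) := by
  decide +kernel

set_option synthInstance.maxHeartbeats 400000 in
set_option synthInstance.maxSize 1000 in
set_option maxRecDepth 10000 in
theorem ratHalf_cnt : ∀ b : Fin 128, ∃ v w, ratHalf b v = true ∧ ratHalf b w = true ∧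
      cnt (ratHalf b) (ratHalf b) v ≠ cnt (ratHalf b) (ratHalf b) w := by
  decide +kernel

theorem ratFun_closed : ∀ k, ratFun k 0 = true ∧ (∀ u v, ratFun k u = true → ratFun k v = true →
    ratFun k (u + v) = true) ∧ (∀ u, ratFun k u = true → ratFun k (-u) = true) ∧
    (Finset.univ.filter fun v => ratFun k v = true).card = 9 := by
  decide +kernel

theorem ratRep_orbit : ∀ v, v = 0 ∨ ∃ i : Fin 7, ∃ j : Fin 3, v = 4 ^ j.val • ratRep i ∨
    v = -(4 ^ j.val • ratRep i) := by
  decide +kernel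

set_option synthInstance.maxHeartbeats 400000 in
theorem ratSet_eq : ∀ (b : Fin 128) (i : Fin 7) (j : Fin 3),
    ratSet b (4 ^ j.val • ratRep i) = b.val.testBit i ∧
    ratSet b (-(4 ^ j.val • ratRep i)) = b.val.testBit i ∧
    ratHalf b (4 ^ j.val • ratRep i) = b.val.testBit i ∧
    ratHalf b (-(4 ^ j.val • ratRep i)) = !b.val.testBit i := by
  decide +kernel

theorem ratRep_ne : ∀ (i : Fin 7) (j : ℕ), 4 ^ j • ratRep i ≠ 0 := fun i j => by
  have h : ∀ v : ZMod 9 × ZMod 3, v ≠ 0 → 4 • v ≠ 0 := by decide +kernel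
  have h0 : ∀ i, ratRep i ≠ 0 := by decide
  induction j with
  | zero => rw [pow_zero, one_smul]; exact h0 i
  | succ j ih => rw [pow_succ', mul_smul]; exact h _ ih

theorem exists_testBit (n : ℕ) (q : Fin n → Bool) : ∃ b : Fin (2 ^ n), ∀ i : Fin n,
    b.val.testBit i = q i :=
  ⟨⟨Nat.ofBits q, Nat.ofBits_lt_two_pow q⟩, fun i => Nat.testBit_ofBits_lt q i.val i.isLt⟩

theorem apply_four_pow {p : ZMod 9 × ZMod 3 → Bool} (h4 : ∀ v, v ≠ 0 → p (4 • v) = p v)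
    (i : Fin 7) (j : ℕ) : p (4 ^ j • ratRep i) = p (ratRep i) := by
  induction j with
  | zero => rw [pow_zero, one_smul]
  | succ j ih => rw [pow_succ', mul_smul, h4 _ (ratRep_ne i j), ih]

theorem exists_ratSet {p : ZMod 9 × ZMod 3 → Bool} (h0 : p 0 = false)
    (h4 : ∀ v, v ≠ 0 → p (4 • v) = p v) (hn : ∀ v, p (-v) = p v) : ∃ b, p = ratSet b := by
  obtain ⟨b, hb⟩ := exists_testBit 7 fun i => p (ratRep i)
  refine ⟨b, funext fun v => ?_⟩
  rcases ratRep_orbit v with rfl | ⟨i, j, rfl | rfl⟩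
  · rw [h0]; rfl
  · rw [(ratSet_eq b i j).1, hb, apply_four_pow h4]
  · rw [(ratSet_eq b i j).2.1, hb, hn, apply_four_pow h4]

theorem exists_ratHalf {p : ZMod 9 × ZMod 3 → Bool} (h0 : p 0 = false)
    (h4 : ∀ v, v ≠ 0 → p (4 • v) = p v) (hn : ∀ v, v ≠ 0 → p (-v) = !p v) :
    ∃ b, p = ratHalf b := by
  obtain ⟨b, hb⟩ := exists_testBit 7 fun i => p (ratRep i)
  refine ⟨b, funext fun v => ?_⟩
  rcases ratRep_orbit v with rfl | ⟨i, j, rfl | rfl⟩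
  · rw [h0]; rfl
  · rw [(ratSet_eq b i j).2.2.1, hb, apply_four_pow h4]
  · rw [(ratSet_eq b i j).2.2.2, hb, hn _ (ratRep_ne i j), apply_four_pow h4]

theorem exists_subgroup_of_pred {V : Type} [AddCommGroup V] [Fintype V] (e : V ≃+ Additive G)
    {f : V → Bool} (h : f 0 = true ∧ (∀ u v, f u = true → f v = true → f (u + v) = true) ∧
      (∀ u, f u = true → f (-u) = true) ∧ (Finset.univ.filter fun v => f v = true).card = 9) :
    ∃ K : Subgroup G, Nat.card K = 9 ∧ ∀ v, (e v).toMul ∈ K ↔ f v = true := by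
  let K : Subgroup G :=
    { carrier := {g | f (e.symm (Additive.ofMul g)) = true}
      one_mem' := by
        change f (e.symm 0) = true
        rw [map_zero]; exact h.1
      mul_mem' := fun {a b} ha hb => by
        change f (e.symm (Additive.ofMul a + Additive.ofMul b)) = true
        rw [map_add]; exact h.2.1 _ _ ha hb
      inv_mem' := fun {a} ha => by
        change f (e.symm (-Additive.ofMul a)) = true
        rw [map_neg]; exact h.2.2.1 _ ha }
  have hK : ∀ v, (e v).toMul ∈ K ↔ f v = true := fun v => by
    change f (e.symm (e v)) = true ↔ _
    rw [AddEquiv.symm_apply_apply]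
  refine ⟨K, ?_, hK⟩
  rw [← h.2.2.2, ← Fintype.card_subtype, ← Nat.card_eq_fintype_card]
  exact (Nat.card_congr ((e.toEquiv.trans Additive.toMul).subtypeEquiv fun v =>
    (hK v).symm)).symm

/-- The pairs of mutually inverse classes. -/
theorem Joint.exists_union {V : Type} [AddCommGroup V] (J : Joint c c) (e : V ≃+ Additive G)
    {x : G} (hx1 : x ≠ 1) :
    ∃ r : V → Bool, (∀ v, r v ↔ (e v).toMul ∈ cls c x ∪ cls c x⁻¹) ∧ (∀ v, r (-v) = r v) ∧
      r 0 = false := by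
  obtain ⟨r, hr⟩ := exists_pred e (cls c x ∪ cls c x⁻¹)
  have h1 : ∀ v, r v → r (-v) := fun v h => by
    rw [hr] at h ⊢
    rw [toMul_neg]
    rcases h with h | h
    · exact Or.inr (J.inv h)
    · left
      have := J.inv h
      rwa [inv_inv] at this
  refine ⟨r, hr, fun v => ?_, ?_⟩
  · rw [Bool.eq_iff_iff]
    exact ⟨fun h => by simpa using h1 _ h, h1 v⟩
  · rw [Bool.eq_false_iff, Ne, hr, map_zero]
    rintro (h | h)
    · exact hx1 ((J.one_iff h).1 rfl)
    · exact hx1 (inv_eq_one.1 ((J.one_iff h).1 rfl))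

theorem cnt_neg {V : Type} [AddCommGroup V] [Fintype V] [DecidableEq V] {r : V → Bool}
    (hrn : ∀ v, r (-v) = r v) (v : V) : cnt r r (-v) = cnt r r v := by
  unfold cnt
  refine Finset.card_bij' (fun u _ => -u) (fun u _ => -u) ?_ ?_ (by simp) (by simp)
  · intro u hu
    simp only [Finset.mem_filter, Finset.mem_univ, true_and, Bool.and_eq_true] at hu ⊢
    rw [hrn, ← hrn (v - -u)]
    exact ⟨hu.1, by convert hu.2 using 2; abel⟩
  · intro u hu
    simp only [Finset.mem_filter, Finset.mem_univ, true_and, Bool.and_eq_true] at hu ⊢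
    rw [hrn, ← hrn (-v - -u)]
    exact ⟨hu.1, by convert hu.2 using 2; abel⟩

theorem Joint.cnt_union_eq {V : Type} [AddCommGroup V] [Fintype V] [DecidableEq V] (J : Joint c c)
    (e : V ≃+ Additive G) {x : G} {r : V → Bool}
    (hr : ∀ v, r v ↔ (e v).toMul ∈ cls c x ∪ cls c x⁻¹) (hrn : ∀ v, r (-v) = r v) {v w : V}
    (hv : r v) (hw : r w) : cnt r r v = cnt r r w := by
  have hR : JS c c (cls c x ∪ cls c x⁻¹) (cls c x ∪ cls c x⁻¹) := (JS.cls rfl).union (JS.cls rfl)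
  have key : ∀ v, r v → cnt r r v = cnt r r (e.symm (Additive.ofMul x)) := by
    intro v hv
    have h6 : ∀ v, (e v).toMul ∈ cls c x → cnt r r v = cnt r r (e.symm (Additive.ofMul x)) :=
      fun v hv => J.cnt_eq e e hR hR hr hr hr hr (by
        rw [AddEquiv.apply_symm_apply]; exact hv)
    rw [hr] at hv
    rcases hv with hv | hv
    · exact h6 v hv
    · rw [← cnt_neg hrn]
      refine h6 _ ?_
      rw [toMul_neg, mem_cls, J.inv hv, inv_inv]
  rw [key _ hv, key _ hw]

/-- No nonempty level of a convolution square lies in a subgroup of order nine. -/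
theorem Joint.not_level_le [Finite G] {V : Type} [AddCommGroup V] [Fintype V] [DecidableEq V]
    (J : Joint c c) (hno : NoNine c) (hno3 : NoThree c) (e : V ≃+ Additive G) {R : Set G}
    (hR : JS c c R R) {r : V → Bool} (hr : ∀ v, r v ↔ (e v).toMul ∈ R) {w : V} (hw : w ≠ 0)
    {K : Subgroup G} (hK : Nat.card K = 9)
    (h : ∀ v, (r v = r w ∧ cnt r r v = cnt r r w) → v ≠ 0 → (e v).toMul ∈ K) : False := by
  have hX : JS c c {g : G | (g ∈ R ↔ (e w).toMul ∈ R) ∧ cnt r r (e.symm (Additive.ofMul g)) =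
      cnt r r w ∧ g ≠ 1} {g : G | (g ∈ R ↔ (e w).toMul ∈ R) ∧
      cnt r r (e.symm (Additive.ofMul g)) = cnt r r w ∧ g ≠ 1} := fun a b hab =>
    and_congr (iff_congr (hR hab) Iff.rfl) (and_congr (J.js_cnt e hR hR hr hr _ hab)
      (not_congr ⟨fun h => (J.one_iff hab).1 h, fun h => (J.one_iff hab).2 h⟩))
  refine (toMul_ne_one e).2 hw (J.eq_one_of_subset hno hno3 hX hK (fun g hg => ?_)
    (x := (e w).toMul) ⟨Iff.rfl, by simp, (toMul_ne_one e).2 hw⟩)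
  obtain ⟨h1, h2, h3⟩ := hg
  have h4 := h (e.symm (Additive.ofMul g)) ⟨by
    rw [Bool.eq_iff_iff, hr, hr]; simpa using h1, h2⟩ (by
    rw [← toMul_ne_one e]; simpa using h3)
  simpa using h4

theorem Joint.rank_two_nine_three [Finite G] (J : Joint c c) (hno : NoNine c) (hno3 : NoThree c)
    (hG : Nat.card G = 27) (h9 : ∀ g : G, g ^ 9 = 1) {y : G} (hy : y ^ 3 ≠ 1) :
    ∃ x, ∀ g, g ≠ 1 → c g = c x := by
  obtain ⟨e, -⟩ := exists_equiv_nine_three hG h9 hy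
  set x := (e (0, 1)).toMul with hx
  have hx3 : x ^ 3 = 1 := by
    rw [hx, ← toMul_nsmul]
    have : 3 • ((0, 1) : ZMod 9 × ZMod 3) = 0 := by decide
    rw [this, map_zero]; rfl
  have hx1 : x ≠ 1 := (toMul_ne_one e).2 (by decide)
  have hm : (Nat.card G).Coprime 4 := by rw [hG]; norm_num
  have hx4 : x ^ 4 = x := by rw [pow_succ, hx3, one_mul]
  obtain ⟨r, hr, hrn, hr0⟩ := J.exists_union e hx1
  have hR : JS c c (cls c x ∪ cls c x⁻¹) (cls c x ∪ cls c x⁻¹) := (JS.cls rfl).union (JS.cls rfl)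
  have h4 : ∀ v, r v → r (4 • v) := fun v h => by
    rw [hr] at h ⊢
    rw [toMul_nsmul]
    rcases h with h | h
    · left
      have := J.pow hm h
      rwa [hx4] at this
    · right
      have := J.pow hm h
      rwa [inv_pow, hx4] at this
  obtain ⟨b, rfl⟩ := exists_ratSet hr0 (fun v hv => by
    rw [Bool.eq_iff_iff]
    refine ⟨fun h => ?_, h4 v⟩
    have := h4 _ (h4 _ h)
    have h64 : ∀ v : ZMod 9 × ZMod 3, 4 • 4 • 4 • v = v := by decide +kernel
    rwa [h64] at this) hrn
  have hcov : ∀ g, g ≠ 1 → c g = c x ∨ c g = c x⁻¹ := by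
    rcases ratSet_cnt b with h | h | ⟨i, j, h1, h2, h3⟩ | ⟨k, i, h⟩
    · have h1 : ratSet b (0, 1) = true := by rw [hr]; left; rfl
      have h2 : ratSet b (0, 1) = b.val.testBit 0 := by
        clear h h1 h4 hr0 hr hrn; revert b; decide
      rw [← h2, h1] at h
      simp at h
    · have h2 : ∀ b : Fin 128, b.val = 127 → ∀ v, v ≠ 0 → ratSet b v = true := by decide +kernel
      intro g hg
      have h3 := h2 b h (e.symm (Additive.ofMul g)) (by
        rw [← toMul_ne_one e]; simpa using hg)
      rw [hr] at h3
      simp only [AddEquiv.apply_symm_apply, toMul_ofMul] at h3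
      exact h3
    · exact absurd (J.cnt_union_eq e hr hrn h1 h2) h3
    · obtain ⟨K, hK, hKf⟩ := exists_subgroup_of_pred e (ratFun_closed k)
      exact (J.not_level_le hno hno3 e hR hr (w := ratRep i)
        (by simpa using ratRep_ne i 0) hK fun v h1 h2 => (hKf v).2 (h v h1 h2)).elim
  by_cases hs : c x⁻¹ = c x
  · exact ⟨x, fun g hg => (hcov g hg).elim id fun h => h.trans hs⟩
  exfalso
  obtain ⟨p, hp, hpn⟩ := J.exists_half e hcov hs
  obtain ⟨b', rfl⟩ := exists_ratHalf (p := p) (by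
    rw [Bool.eq_false_iff, Ne, hp, mem_cls, map_zero]
    exact fun h => hx1 ((J.one_iff h).1 rfl))
    (fun v hv => J.half_nsmul hx1 hp hpn hm (by rw [hx4]) hv) hpn
  obtain ⟨v, w, h1, h2, h3⟩ := ratHalf_cnt b'
  rw [hp, mem_cls] at h1 h2
  exact h3 (J.cnt_eq e e (JS.cls rfl) (JS.cls rfl) hp hp hp hp (h1.trans h2.symm))

end

section

variable {G H C : Type} [CommGroup G] [CommGroup H] {c : G → C} {d : H → C} {L : Subgroup G}

theorem exists_equiv_cube [Finite G] (hG : Nat.card G = 27) (h3 : ∀ g : G, g ^ 3 = 1) {x y z : G}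
    (hx : x ≠ 1) (hy : ∀ n : ℤ, y ≠ x ^ n) (hz : ∀ m n : ℤ, z ≠ x ^ m * y ^ n) :
    ∃ e : (ZMod 3 × ZMod 3) × ZMod 3 ≃+ Additive G, (e ((1, 0), 0)).toMul = x ∧
      (e ((0, 1), 0)).toMul = y ∧ (e ((0, 0), 1)).toMul = z := by
  obtain ⟨φ, hφ, hφ1⟩ := exists_hom_of_orderOf (orderOf_eq_prime (p := 3) (h3 x) hx)
  have hφ2 : ∀ k, φ k = Additive.ofMul (x ^ (k.val : ℤ)) := fun k => by
    rw [ofMul_zpow, ← hφ1, ← map_zsmul, zsmul_one]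
    simp
  obtain ⟨ψ, hψ, h1, h2⟩ := exists_hom_extend φ hφ (h3 y) (fun k hk => by
    rw [hφ2] at hk
    exact hy _ (Additive.ofMul.injective hk).symm)
  have hψ2 : ∀ k, ψ (0, k) = Additive.ofMul (y ^ (k.val : ℤ)) := fun k => by
    rw [ofMul_zpow, ← h2, ← map_zsmul]
    simp
  obtain ⟨θ, hθ, h4, h5⟩ := exists_hom_extend ψ hψ (h3 z) (fun k hk => by
    have : k = (k.1, 0) + (0, k.2) := by simp
    rw [this, map_add, h1, hψ2, hφ2, ← ofMul_mul] at hk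
    exact hz _ _ (Additive.ofMul.injective hk).symm)
  obtain ⟨e, he⟩ := exists_equiv_of_injective θ hθ
    (by rw [hG, Nat.card_prod, Nat.card_prod, Nat.card_zmod])
  refine ⟨e, ?_, ?_, ?_⟩
  · rw [he, h4, h1, hφ1]; rfl
  · rw [he, h4, h2]; rfl
  · exact congrArg Additive.toMul ((he _).trans h5)

/-- The graph of an odd function. -/
def oddGraph (i j : ZMod 3) (v : (ZMod 3 × ZMod 3) × ZMod 3) : Bool :=
  if v.1.1 = 0 then if v.1.2 = 0 then false else v.2 = 0
  else if v.1.2 = 0 then v.2 = 0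
  else if v.1.1 = v.1.2 then v.2 = v.1.1 * i else v.2 = v.1.1 * j

set_option synthInstance.maxHeartbeats 400000 in
set_option synthInstance.maxSize 1000 in
theorem oddGraph_cnt : ∀ i j, (i = 0 ∧ j = 0) ∨ ∃ v w, oddGraph i j v = true ∧
    oddGraph i j w = true ∧
    cnt (oddGraph i j) (oddGraph i j) v ≠ cnt (oddGraph i j) (oddGraph i j) w := by
  decide +kernel

/-- The plane orthogonal to the last coordinate. -/
def plane (v : (ZMod 3 × ZMod 3) × ZMod 3) : Bool := v.2 = 0

theorem plane_closed : plane 0 = true ∧ (∀ u v, plane u = true → plane v = true →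
    plane (u + v) = true) ∧ (∀ u, plane u = true → plane (-u) = true) ∧
    (Finset.univ.filter fun v => plane v = true).card = 9 := by
  decide +kernel

theorem exists_equiv_cube_of_subgroup [Finite G] (hG : Nat.card G = 27) (h3 : ∀ g : G, g ^ 3 = 1)
    (hcL : Nat.card L = 3) {z v : G} (hzL : z ∉ L) (h1 : ∀ n : ℤ, z ^ n * v ∉ L) :
    ∃ e : (ZMod 3 × ZMod 3) × ZMod 3 ≃+ Additive G, (e ((1, 0), 0)).toMul = z ∧
      (e ((0, 1), 0)).toMul = v ∧ (∀ k, (e (0, k)).toMul ∈ L) ∧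
      ∀ l ∈ L, ∃ k, l = (e (0, k)).toMul := by
  have hz1 : z ≠ 1 := fun h => hzL (by rw [h]; exact L.one_mem)
  have hvz : ∀ n : ℤ, v ≠ z ^ n := fun n h => h1 (-n) (by
    rw [h, ← zpow_add, neg_add_cancel, zpow_zero]; exact L.one_mem)
  have : Finite L := Nat.finite_of_card_ne_zero (by rw [hcL]; norm_num)
  have : Nontrivial L := (Finite.one_lt_card_iff_nontrivial (α := L)).1 (by rw [hcL]; norm_num)
  obtain ⟨l, hl⟩ := exists_ne (1 : L)
  have hl' : (l : G) ≠ 1 := fun h => hl (Subtype.ext h)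
  obtain ⟨e, e1, e2, e3⟩ := exists_equiv_cube hG h3 hz1 hvz (z := l) (fun m n h => by
    have hl0 : z ^ m * v ^ n ∈ L := by rw [← h]; exact l.2
    have hv3 : v ^ (3 : ℤ) = 1 := by exact_mod_cast h3 v
    have hz3 : z ^ (3 : ℤ) = 1 := by exact_mod_cast h3 z
    rw [← Int.emod_add_mul_ediv n 3, zpow_add, zpow_mul, hv3, one_zpow, mul_one] at hl0 h
    have : n % 3 = 0 ∨ n % 3 = 1 ∨ n % 3 = 2 := by omega
    rcases this with h' | h' | h'
    · rw [h', zpow_zero, mul_one] at hl0 h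
      rw [← Int.emod_add_mul_ediv m 3, zpow_add, zpow_mul, hz3, one_zpow, mul_one] at hl0 h
      have : m % 3 = 0 ∨ m % 3 = 1 ∨ m % 3 = 2 := by omega
      rcases this with h' | h' | h'
      · rw [h', zpow_zero] at h
        exact hl' h
      · rw [h', zpow_one] at hl0; exact hzL hl0
      · rw [h'] at hl0
        have := L.mul_mem hl0 hl0
        rw [← zpow_add, show (2 + 2 : ℤ) = 3 + 1 by norm_num, zpow_add, hz3, one_mul,
          zpow_one] at this
        exact hzL this
    · rw [h', zpow_one] at hl0; exact h1 _ hl0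
    · rw [h'] at hl0
      refine h1 (m + m) ?_
      have := L.mul_mem hl0 hl0
      rwa [mul_mul_mul_comm, ← zpow_add, ← zpow_add, show (2 + 2 : ℤ) = 3 + 1 by norm_num,
        zpow_add v, hv3, one_mul, zpow_one] at this)
  refine ⟨e, e1, e2, fun k => ?_, fun k hk => ?_⟩
  · have : ((0, k) : (ZMod 3 × ZMod 3) × ZMod 3) = k.val • ((0, 0), 1) := by ext <;> simp
    rw [this, toMul_nsmul, e3]
    exact L.pow_mem l.2 _
  · rcases mem_of_card_three hcL l.2 hl' hk with h | h | h
    · exact ⟨0, by rw [h]; exact (congrArg Additive.toMul (map_zero e)).symm⟩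
    · exact ⟨1, by rw [h]; exact e3.symm⟩
    · refine ⟨-1, ?_⟩
      have : ((0, -1) : (ZMod 3 × ZMod 3) × ZMod 3) = -((0, 0), 1) := by decide
      rw [h, this, toMul_neg, e3]

/-- Two independent elements cannot lie in a class contained in a subgroup of order nine. -/
theorem Joint.false_of_le [Finite G] (J : Joint c c) (hno : NoNine c) (h3 : ∀ g : G, g ^ 3 = 1)
    {z v : G} (hz : z ≠ 1) (hvz : c v = c z) (hv : ∀ n : ℤ, v ≠ z ^ n) {K : Subgroup G}
    (hK : Nat.card K = 9) (h : cls c z ⊆ K) : False := by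
  have h1 := J.closure_card_dvd hno (JS.cls rfl) hK h
  have hzm : z ∈ Subgroup.closure (cls c z) := Subgroup.subset_closure self_mem_cls
  have hvm : v ∈ Subgroup.closure (cls c z) := Subgroup.subset_closure hvz
  have h2 : Subgroup.zpowers z = Subgroup.closure (cls c z) := by
    refine Subgroup.eq_of_le_of_card_ge (by rwa [Subgroup.zpowers_le]) ?_
    rw [Nat.card_zpowers, orderOf_eq_prime (p := 3) (h3 z) hz]
    exact Nat.le_of_dvd (by norm_num) h1
  rw [← h2] at hvm
  obtain ⟨n, hn⟩ := hvm
  exact hv n hn.symm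

theorem Joint.full_cube [Finite G] (J : Joint c c) (hno : NoNine c) (hG : Nat.card G = 27)
    (h3 : ∀ g : G, g ^ 3 = 1) (hL : JS c c (L : Set G) L) (hcL : Nat.card L = 3) :
    ∀ x ∉ L, Full c L x := by
  have hQ : Nat.card (G ⧸ L) = 9 :=
    card_quotient_of_card (n := 9) (p := 3) (by norm_num) (by rw [hG]) hcL
  have hL3 : ∀ g : G, g ^ 3 ∈ L := fun g => by rw [h3]; exact L.one_mem
  intro x hx
  by_contra hxf
  obtain ⟨m, hm, hzs, hzt⟩ := J.exists_symmetric hL hcL (x := x) (by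
    rcases J.flat_or_paley hno hG hL hcL hL3 hx with h | ⟨v, h1, h2, h4, h5, h6⟩
    · exact h x hx x⁻¹ (by rwa [inv_mem_iff])
    rcases h5 x⁻¹ (by rwa [inv_mem_iff]) with h | ⟨l, hl, e⟩
    · exact h
    exfalso
    have e1 := J.inv e
    rw [inv_inv] at e1
    have h7 := h4 _ e1.symm
    have key : ∀ g : G, ((x * v * l)⁻¹ : G) = (g : G ⧸ L) → x * v * g ∈ L := fun g h => by
      rw [QuotientGroup.eq, inv_inv] at h
      have := L.mul_mem h (L.inv_mem hl)
      rwa [show x * v * l * g * l⁻¹ = x * v * g by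
        rw [mul_right_comm (x * v), mul_inv_cancel_right]] at this
    rcases h7 with h | h | h | h
    · refine h1 2 ?_
      have := key _ h
      rwa [show x * v * x = x ^ (2 : ℤ) * v by rw [zpow_two, mul_right_comm]] at this
    · refine h1 0 ?_
      have := key _ h
      rwa [show x * v * x⁻¹ = x ^ (0 : ℤ) * v by rw [zpow_zero, one_mul, mul_inv_cancel_comm]] at this
    · refine h1 (-1) ?_
      have := L.inv_mem (key _ h)
      have hv3 : v * v = v⁻¹ := by
        rw [eq_inv_iff_mul_eq_one, ← pow_two, ← pow_succ, h3]
      rwa [mul_assoc, hv3, mul_inv, inv_inv, ← zpow_neg_one] at this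
    · have := key _ h
      rw [mul_inv_cancel_right] at this
      exact hx this) hxf
  set z := x * m with hz
  have hzL : z ∉ L := fun h => hx ((L.mul_mem_cancel_right hm).1 h)
  have hz1 : z ≠ 1 := fun h => hzL (by rw [h]; exact L.one_mem)
  rcases J.flat_or_paley hno hG hL hcL hL3 hzL with hf | ⟨v, h1, h2, h4, h5, h6⟩
  swap
  · have htv := hzt.congr J hL h2
    have hvz : ∀ n : ℤ, v ≠ z ^ n := fun n h => h1 (-n) (by
      rw [h, ← zpow_add, neg_add_cancel, zpow_zero]; exact L.one_mem)
    obtain ⟨e, e1, e2, -⟩ := exists_equiv_cube_of_subgroup hG h3 hcL hzL h1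
    obtain ⟨K, hK, hKf⟩ := exists_subgroup_of_pred e plane_closed
    have hzK : z ∈ K := by rw [← e1, hKf]; rfl
    have hvK : v ∈ K := by rw [← e2, hKf]; rfl
    refine J.false_of_le hno h3 hz1 h2 hvz hK fun g hg => ?_
    rcases h4 g hg with h | h | h | h
    · rw [eq_of_triv hzt hg h]; exact hzK
    · rw [eq_of_triv (hzt.inv J) (hg.trans hzs.symm) h]; exact K.inv_mem hzK
    · rw [eq_of_triv htv (hg.trans h2.symm) h]; exact hvK
    · rw [eq_of_triv (htv.inv J) (hg.trans ((J.inv h2).trans hzs).symm) h]; exact K.inv_mem hvK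
  obtain ⟨v, hvz, hvL⟩ : ∃ v, c v = c z ∧ ∀ n : ℤ, z ^ n * v ∉ L := by
    obtain ⟨g, hg⟩ : ∃ g : G, (g : G ⧸ L) ∉ Subgroup.zpowers (z : G ⧸ L) := by
      by_contra h
      push Not at h
      have h2 : Subgroup.zpowers (z : G ⧸ L) = ⊤ := (Subgroup.eq_top_iff' _).2 fun q => by
        obtain ⟨g, rfl⟩ := QuotientGroup.mk_surjective q
        exact h g
      have h4 := Nat.card_zpowers (z : G ⧸ L)
      rw [h2, Subgroup.card_top, hQ] at h4
      have : (z : G ⧸ L) ^ 3 = 1 := by rw [← QuotientGroup.mk_pow, h3]; rfl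
      have := orderOf_dvd_of_pow_eq_one this
      rw [← h4] at this
      norm_num at this
    have hgn : ∀ n : ℤ, z ^ n * g ∉ L := fun n h => hg (by
      rw [← QuotientGroup.eq_one_iff, QuotientGroup.mk_mul, QuotientGroup.mk_zpow] at h
      rw [← inv_mem_iff, ← eq_inv_of_mul_eq_one_left h]
      exact Subgroup.zpow_mem_zpowers _ n)
    have hgL : g ∉ L := fun h => hgn 0 (by simpa using h)
    obtain ⟨l, hl, e⟩ := hf g hgL z hzL
    refine ⟨g * l, e.symm, fun n h => hgn n ?_⟩
    rw [← mul_assoc] at h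
    exact (L.mul_mem_cancel_right hl).1 h
  have hvz' : ∀ n : ℤ, v ≠ z ^ n := fun n h => hvL (-n) (by
    rw [h, ← zpow_add, neg_add_cancel, zpow_zero]; exact L.one_mem)
  obtain ⟨e, e1, e2, heL, heL'⟩ := exists_equiv_cube_of_subgroup hG h3 hcL hzL hvL
  obtain ⟨p, hp⟩ := exists_pred e (cls c z)
  have hpL : ∀ b, p (0, b) = false := fun b => by
    rw [Bool.eq_false_iff, Ne, hp, mem_cls]
    exact fun h => hzL ((hL h).1 (heL b))
  have huniq : ∀ i b b', p (i, b) → p (i, b') → b = b' := fun i b b' h h' => by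
    rw [hp, mem_cls] at h h'
    have ht := hzt.congr J hL h'
    have := eq_of_triv ht (h.trans h'.symm) (by
      rw [eq_comm, QuotientGroup.eq, ← toMul_neg, ← toMul_add]
      have : -(i, b') + (i, b) = (0, b - b') := by ext <;> simp [sub_eq_neg_add]
      rw [this]; exact heL _)
    exact congrArg Prod.snd (e.injective (Additive.toMul.injective this))
  have hneg : ∀ v, p v → p (-v) := fun v h => by
    rw [hp, mem_cls] at h ⊢
    rw [toMul_neg, J.inv h, hzs]
  have hex : ∀ a, (e (a, 0)).toMul ∉ L → ∃ k, p (a, k) := fun a ha => by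
    obtain ⟨l, hl, h⟩ := hf _ ha z hzL
    obtain ⟨k, rfl⟩ := heL' l hl
    refine ⟨k, ?_⟩
    rw [hp, mem_cls, h, ← toMul_add]
    simp
  have p1 : p ((1, 0), 0) := by rw [hp, e1]; rfl
  have p2 : p ((0, 1), 0) := by rw [hp, e2]; exact hvz
  obtain ⟨i, hi⟩ := hex (1, 1) (by
    have : (((1, 1), 0) : (ZMod 3 × ZMod 3) × ZMod 3) = ((1, 0), 0) + ((0, 1), 0) := by decide
    rw [this, toMul_add, e1, e2]
    simpa using hvL 1)
  obtain ⟨j, hj⟩ := hex (1, 2) (by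
    have : (((1, 2), 0) : (ZMod 3 × ZMod 3) × ZMod 3) = -(2 • ((1, 0), 0) + ((0, 1), 0)) := by
      decide
    rw [this, toMul_neg, toMul_add, toMul_nsmul, e1, e2, inv_mem_iff]
    exact_mod_cast hvL 2)
  have n1 := hneg _ p1
  have n2 := hneg _ p2
  have ni := hneg _ hi
  have nj := hneg _ hj
  have hpe : p = oddGraph i j := by
    have h0 : ∀ i b b', p (i, b') → p (i, b) = decide (b = b') := fun i b b' h => by
      by_cases hb : b = b'
      · rw [hb, h]; simp
      · rw [decide_eq_false hb, Bool.eq_false_iff]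
        exact fun h' => hb (huniq i b b' h' h)
    funext ⟨a, b⟩
    have ha : ∀ a : ZMod 3 × ZMod 3, a = 0 ∨ a = (1, 0) ∨ a = (0, 1) ∨ a = (1, 1) ∨ a = (1, 2) ∨
      a = -(1, 0) ∨ a = -(0, 1) ∨ a = -(1, 1) ∨ a = -(1, 2) := by decide
    rcases ha a with rfl | rfl | rfl | rfl | rfl | rfl | rfl | rfl | rfl
    · exact hpL b
    · exact h0 _ b _ p1
    · exact h0 _ b _ p2
    · rw [h0 _ b _ hi]; clear hi hj ni nj; revert i j b; decide
    · rw [h0 _ b _ hj]; clear hi hj ni nj; revert i j b; decide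
    · exact h0 _ b _ n1
    · exact h0 _ b _ n2
    · rw [h0 _ b _ ni]; clear hi hj ni nj; revert i j b; decide
    · rw [h0 _ b _ nj]; clear hi hj ni nj; revert i j b; decide
  rcases oddGraph_cnt i j with ⟨rfl, rfl⟩ | ⟨u, w, h1, h2, h4⟩
  · obtain ⟨K, hK, hKf⟩ := exists_subgroup_of_pred e plane_closed
    refine J.false_of_le hno h3 hz1 hvz hvz' hK fun g hg => ?_
    obtain ⟨w, hw⟩ := e.surjective (Additive.ofMul g)
    have hgg : g = (e w).toMul := by rw [hw]; rfl
    rw [hgg] at hg ⊢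
    rw [← hp, hpe] at hg
    refine (hKf w).2 ?_
    have : ∀ w, oddGraph 0 0 w = true → plane w = true := by decide
    exact this w hg
  · rw [← hpe] at h1 h2 h4
    rw [hp, mem_cls] at h1 h2
    exact h4 (J.cnt_eq e e (JS.cls rfl) (JS.cls rfl) hp hp hp hp (h1.trans h2.symm))

end

/-- The elementary abelian group of order 27. -/
abbrev Cube := (ZMod 3 × ZMod 3) × ZMod 3

/-- Representatives of the nonzero elements of `Cube` up to sign; the last three form a basis. -/
def cubeRep (i : Fin 13) : Cube :=
  match i with
  | 0 => ((0, 1), 1) | 1 => ((0, 1), 2) | 2 => ((1, 0), 1) | 3 => ((1, 0), 2) | 4 => ((1, 1), 0)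
  | 5 => ((1, 1), 1) | 6 => ((1, 1), 2) | 7 => ((1, 2), 0) | 8 => ((1, 2), 1) | 9 => ((1, 2), 2)
  | 10 => ((1, 0), 0) | 11 => ((0, 1), 0) | 12 => ((0, 0), 1)

/-- The index of `v` or `-v` in the list of representatives, with `15` for `v = 0` and `14` for
the basis vectors. -/
def cubeIdx (v : Cube) : ℕ :=
  109377401829172899754286395748079 / 16 ^ (9 * v.1.1.val + 3 * v.1.2.val + v.2.val) % 16

/-- The symmetric subset of `Cube` containing the basis vectors, with given values on the other
representatives. -/
def cubeSet (b : Fin 1024) (v : Cube) : Bool := (b.val + 2 ^ 14).testBit (cubeIdx v)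

/-- The inner product with the `k`-th representative vanishes. -/
def cubeFun (k : Fin 13) (v : Cube) : Bool :=
  ((cubeRep k).1.1.val * v.1.1.val + (cubeRep k).1.2.val * v.1.2.val +
    (cubeRep k).2.val * v.2.val) % 3 = 0

set_option synthInstance.maxHeartbeats 400000 in
set_option synthInstance.maxSize 1000 in
set_option maxRecDepth 10000 in
theorem cubeSet_cnt : ∀ b : Fin 1024,
    (∃ i, cubeSet b (cubeRep i) = true ∧
      cnt (cubeSet b) (cubeSet b) (cubeRep i) ≠ cnt (cubeSet b) (cubeSet b) (cubeRep 10)) ∨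
      b.val = 1023 ∨
    (∃ i, (Finset.univ.filter fun v => (cubeSet b v = cubeSet b (cubeRep i) ∧
      cnt (cubeSet b) (cubeSet b) v = cnt (cubeSet b) (cubeSet b) (cubeRep i)) ∧ v ≠ 0).card = 6) ∨
    (∃ k i, ∀ v, (cubeSet b v = cubeSet b (cubeRep i) ∧
      cnt (cubeSet b) (cubeSet b) v = cnt (cubeSet b) (cubeSet b) (cubeRep i)) → v ≠ 0 →
      cubeFun k v = true) := by
  decide +kernel

section

variable {G H C : Type} [CommGroup G] [CommGroup H] {c : G → C} {d : H → C} {L : Subgroup G}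

theorem exists_subgroup_nine [Finite G] (hG : Nat.card G = 27) (h3 : ∀ g : G, g ^ 3 = 1) {x y : G}
    (hx : x ≠ 1) (hy : ∀ n : ℤ, y ≠ x ^ n) :
    ∃ K : Subgroup G, Nat.card K = 9 ∧ x ∈ K ∧ y ∈ K ∧ ∀ m n : ℤ, x ^ m * y ^ n ∈ K := by
  have hxz : Nat.card (Subgroup.zpowers x) = 3 := by
    rw [Nat.card_zpowers, orderOf_eq_prime (p := 3) (h3 x) hx]
  let K := Subgroup.zpowers x ⊔ Subgroup.zpowers y
  have hxK : Subgroup.zpowers x ≤ K := le_sup_left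
  have hyK : y ∈ K := (le_sup_right : Subgroup.zpowers y ≤ K) (Subgroup.mem_zpowers y)
  have hxm : x ∈ K := hxK (Subgroup.mem_zpowers x)
  refine ⟨K, ?_, hxm, hyK, fun m n => K.mul_mem (K.zpow_mem hxm _) (K.zpow_mem hyK _)⟩
  have h1 : Nat.card K ≤ 9 := by
    have hs : Function.Surjective (fun k : Subgroup.zpowers x × Subgroup.zpowers y =>
        (⟨k.1 * k.2, K.mul_mem (hxK k.1.2)
          ((le_sup_right : Subgroup.zpowers y ≤ K) k.2.2)⟩ : K)) := by
      rintro ⟨k, hk⟩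
      obtain ⟨a, ha, b, hb, rfl⟩ := Subgroup.mem_sup.1 hk
      exact ⟨(⟨a, ha⟩, ⟨b, hb⟩), rfl⟩
    have h2 := Nat.card_le_card_of_surjective _ hs
    have h4 : Nat.card (Subgroup.zpowers y) ≤ 3 := by
      rw [Nat.card_zpowers]
      exact Nat.le_of_dvd (by norm_num) (orderOf_dvd_of_pow_eq_one (h3 y))
    rw [Nat.card_prod, hxz] at h2
    omega
  have h2 : 3 < Nat.card K := by
    rw [← hxz]
    refine lt_of_le_of_ne (Nat.card_le_card_of_injective _ (Subgroup.inclusion_injective hxK)) ?_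
    intro h
    have h5 := Subgroup.eq_of_le_of_card_ge hxK h.ge
    have h6 : y ∈ Subgroup.zpowers x := by rw [h5]; exact hyK
    obtain ⟨n, hn⟩ := h6
    exact hy n hn.symm
  have h4 : Nat.card K ∣ 27 := hG ▸ Subgroup.card_subgroup_dvd_card K
  have h5 : Nat.card K ∈ Nat.divisors 27 := Nat.mem_divisors.2 ⟨h4, by norm_num⟩
  have h6 : Nat.divisors 27 = {1, 3, 9, 27} := by decide
  rw [h6] at h5
  simp only [Finset.mem_insert, Finset.mem_singleton] at h5
  omega

theorem Joint.exists_notMem [Finite G] (J : Joint c c) (hno : NoNine c) (hno3 : NoThree c) {x : G}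
    (hx : x ≠ 1) {K : Subgroup G} (hK : Nat.card K = 9) : ∃ y, c y = c x ∧ y ∉ K := by
  by_contra! h
  exact hx (J.eq_one_of_subset hno hno3 (JS.cls rfl) hK (fun y hy => h y hy) self_mem_cls)

/-- Every nontrivial class contains a basis. -/
theorem Joint.exists_basis [Finite G] (J : Joint c c) (hno : NoNine c) (hno3 : NoThree c)
    (hG : Nat.card G = 27) (h3 : ∀ g : G, g ^ 3 = 1) {x : G} (hx : x ≠ 1) :
    ∃ e : Cube ≃+ Additive G, c (e ((1, 0), 0)).toMul = c x ∧ c (e ((0, 1), 0)).toMul = c x ∧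
      c (e ((0, 0), 1)).toMul = c x := by
  obtain ⟨y₀, hy₀⟩ : ∃ y : G, ∀ n : ℤ, y ≠ x ^ n := by
    by_contra! h
    have h1 : Subgroup.zpowers x = ⊤ := by
      rw [Subgroup.eq_top_iff']
      exact fun y => (h y).imp fun n hn => hn.symm
    have h2 : Nat.card (Subgroup.zpowers x) = 27 := by rw [h1, Subgroup.card_top, hG]
    rw [Nat.card_zpowers, orderOf_eq_prime (p := 3) (h3 x) hx] at h2
    omega
  obtain ⟨K, hK, hxK, -, -⟩ := exists_subgroup_nine hG h3 hx hy₀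
  obtain ⟨y, hy, hyK⟩ := J.exists_notMem hno hno3 hx hK
  have hyx : ∀ n : ℤ, y ≠ x ^ n := fun n h => hyK (h ▸ K.zpow_mem hxK n)
  obtain ⟨M, hM, -, -, hxyM⟩ := exists_subgroup_nine hG h3 hx hyx
  obtain ⟨z, hz, hzM⟩ := J.exists_notMem hno hno3 hx hM
  obtain ⟨e, e1, e2, e3⟩ := exists_equiv_cube hG h3 hx hyx
    (fun m n (h : z = _) => hzM (h ▸ hxyM m n))
  exact ⟨e, by rw [e1], by rw [e2, hy], by rw [e3, hz]⟩

theorem cubeFun_closed : ∀ k, cubeFun k 0 = true ∧ (∀ u v, cubeFun k u = true →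
    cubeFun k v = true → cubeFun k (u + v) = true) ∧
    (∀ u, cubeFun k u = true → cubeFun k (-u) = true) ∧
    (Finset.univ.filter fun v => cubeFun k v = true).card = 9 := by
  decide +kernel

theorem cubeRep_orbit : ∀ v, v = 0 ∨ ∃ i, v = cubeRep i ∨ v = -cubeRep i := by
  decide +kernel

theorem cubeRep_ne : ∀ i, cubeRep i ≠ 0 := by
  decide +kernel

theorem cubeIdx_rep : ∀ i, cubeIdx (-cubeRep i) = cubeIdx (cubeRep i) ∧
    cubeIdx (cubeRep i) = if i.val < 10 then i.val else 14 := by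
  decide +kernel

theorem testBit_add_pow : ∀ b : Fin 1024, (b.val + 2 ^ 14).testBit 14 = true ∧
    (b.val + 2 ^ 14).testBit 15 = false ∧
    ∀ i : Fin 10, (b.val + 2 ^ 14).testBit i = b.val.testBit i := by
  decide +kernel

theorem cubeSet_zero (b : Fin 1024) : cubeSet b 0 = false := (testBit_add_pow b).2.1

theorem exists_cubeSet {p : Cube → Bool} (h0 : p 0 = false) (h1 : p ((1, 0), 0) = true)
    (h2 : p ((0, 1), 0) = true) (h3 : p ((0, 0), 1) = true) (hn : ∀ v, p (-v) = p v) :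
    ∃ b, p = cubeSet b := by
  obtain ⟨b, hb⟩ := exists_testBit 10 fun i => p (cubeRep (i.castLE (by norm_num)))
  have key : ∀ i, p (cubeRep i) = cubeSet b (cubeRep i) := fun i => by
    unfold cubeSet
    rw [(cubeIdx_rep i).2]
    split_ifs with h
    · rw [(testBit_add_pow b).2.2 ⟨i.val, h⟩, hb]; rfl
    · rw [(testBit_add_pow b).1]
      have : i = 10 ∨ i = 11 ∨ i = 12 := by omega
      rcases this with rfl | rfl | rfl
      exacts [h1, h2, h3]
  refine ⟨b, funext fun v => ?_⟩
  rcases cubeRep_orbit v with rfl | ⟨i, rfl | rfl⟩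
  · rw [h0, cubeSet_zero]
  · exact key i
  · rw [hn, key i]
    unfold cubeSet
    rw [(cubeIdx_rep i).1]

theorem cubeSet_full : ∀ b : Fin 1024, b.val = 1023 → ∀ v, v ≠ 0 → cubeSet b v = true := by
  have : ∀ v : Cube, v ≠ 0 → (1023 + 2 ^ 14).testBit (cubeIdx v) = true := by decide +kernel
  intro b hb v hv
  unfold cubeSet
  rw [hb]; exact this v hv

theorem card_filter_pred {V : Type} [AddCommGroup V] [Fintype V] (e : V ≃+ Additive G)
    {p : V → Bool} {X : Set G} (hp : ∀ v, p v ↔ (e v).toMul ∈ X) :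
    (Finset.univ.filter fun v => p v = true).card = Nat.card X := by
  rw [← Fintype.card_subtype, ← Nat.card_eq_fintype_card]
  exact Nat.card_congr ((e.toEquiv.trans Additive.toMul).subtypeEquiv hp)

theorem Joint.cover_or_small [Finite G] (J : Joint c c) (hno : NoNine c) (hno3 : NoThree c)
    (hG : Nat.card G = 27) (h3 : ∀ g : G, g ^ 3 = 1) :
    (∃ x, x ≠ 1 ∧ ∀ g, g ≠ 1 → c g = c x ∨ c g = c x⁻¹) ∨
      ∃ x, x ≠ 1 ∧ Nat.card ↥(cls c x ∪ cls c x⁻¹) ≤ 6 := by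
  have : Nontrivial G := (Finite.one_lt_card_iff_nontrivial (α := G)).1 (by rw [hG]; norm_num)
  obtain ⟨x, hx⟩ := exists_ne (1 : G)
  obtain ⟨e, e1, e2, e3⟩ := J.exists_basis hno hno3 hG h3 hx
  obtain ⟨r, hr, hrn, hr0⟩ := J.exists_union e hx
  have hR : JS c c (cls c x ∪ cls c x⁻¹) (cls c x ∪ cls c x⁻¹) := (JS.cls rfl).union (JS.cls rfl)
  have h1 : ∀ v, c (e v).toMul = c x → r v = true := fun v h => (hr v).2 (Or.inl h)
  obtain ⟨b, rfl⟩ := exists_cubeSet hr0 (h1 _ e1) (h1 _ e2) (h1 _ e3) hrn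
  rcases cubeSet_cnt b with ⟨i, h, h'⟩ | h | ⟨i, h⟩ | ⟨k, i, h⟩
  · exact absurd (J.cnt_union_eq e hr hrn h (h1 _ e1)) h'
  · refine Or.inl ⟨x, hx, fun g hg => ?_⟩
    have h3 := cubeSet_full b h (e.symm (Additive.ofMul g)) (by
      rw [← toMul_ne_one e]; simpa using hg)
    rw [hr] at h3
    simp only [AddEquiv.apply_symm_apply, toMul_ofMul] at h3
    exact h3
  · right
    set w := cubeRep i
    have hy1 : (e w).toMul ≠ 1 := (toMul_ne_one e).2 (cubeRep_ne i)
    refine ⟨(e w).toMul, hy1, ?_⟩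
    obtain ⟨s, hs, hsn, hs0⟩ := J.exists_union e hy1
    rw [← card_filter_pred e hs, ← h]
    refine Finset.card_le_card fun v hv => ?_
    simp only [Finset.mem_filter, Finset.mem_univ, true_and] at hv ⊢
    have hv0 : v ≠ 0 := fun h => by rw [h, hs0] at hv; cases hv
    refine ⟨?_, hv0⟩
    have key : ∀ v, c (e v).toMul = c (e w).toMul → cubeSet b v = cubeSet b w ∧
        cnt (cubeSet b) (cubeSet b) v = cnt (cubeSet b) (cubeSet b) w := fun v h =>
      ⟨by rw [Bool.eq_iff_iff, hr, hr]; exact hR h, J.cnt_eq e e hR hR hr hr hr hr h⟩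
    rw [hs] at hv
    rcases hv with hv | hv
    · exact key v hv
    · have := key (-v) (by
        have := J.inv hv
        rwa [inv_inv, ← toMul_neg] at this)
      rwa [hrn, cnt_neg hrn] at this
  · obtain ⟨K, hK, hKf⟩ := exists_subgroup_of_pred e (cubeFun_closed k)
    exact (J.not_level_le hno hno3 e hR hr (cubeRep_ne i) hK
      fun v h1 h2 => (hKf v).2 (h v h1 h2)).elim

end

section

variable {G H C : Type} [CommGroup G] [CommGroup H] {c : G → C} {d : H → C} {L : Subgroup G}

/-- The number of nonzero coordinates. -/
def cubeWt (v : Cube) : ℕ :=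
  (if v.1.1 = 0 then 0 else 1) + (if v.1.2 = 0 then 0 else 1) + if v.2 = 0 then 0 else 1

/-- The vectors with one nonzero coordinate. -/
def axes (v : Cube) : Bool := cubeWt v = 1

theorem axes_iff : ∀ v, axes v = true ↔ v = ((1, 0), 0) ∨ v = ((0, 1), 0) ∨ v = ((0, 0), 1) ∨
    v = -((1, 0), 0) ∨ v = -((0, 1), 0) ∨ v = -((0, 0), 1) := by
  decide +kernel

theorem axes_card : (Finset.univ.filter fun v => axes v = true).card = 6 := by
  decide +kernel

theorem cnt_axes : ∀ v w, cnt axes axes v = cnt axes axes w → cubeWt v = cubeWt w := by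
  decide +kernel

theorem Joint.exists_axes [Finite G] (J : Joint c c) (hno : NoNine c) (hno3 : NoThree c)
    (hG : Nat.card G = 27) (h3 : ∀ g : G, g ^ 3 = 1) {x : G} (hx : x ≠ 1)
    (hc : Nat.card ↥(cls c x ∪ cls c x⁻¹) ≤ 6) :
    ∃ e : Cube ≃+ Additive G, (∀ v, axes v = true ↔ (e v).toMul ∈ cls c x ∪ cls c x⁻¹) ∧
      c (e ((1, 0), 0)).toMul = c x ∧ c (e ((0, 1), 0)).toMul = c x ∧
      c (e ((0, 0), 1)).toMul = c x := by
  obtain ⟨e, e1, e2, e3⟩ := J.exists_basis hno hno3 hG h3 hx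
  obtain ⟨r, hr, hrn, hr0⟩ := J.exists_union e hx
  refine ⟨e, fun v => ?_, e1, e2, e3⟩
  rw [← hr]
  rw [← card_filter_pred e hr, ← axes_card] at hc
  have h1 : ∀ v, c (e v).toMul = c x → r v = true := fun v h => (hr v).2 (Or.inl h)
  have h2 := Finset.eq_of_subset_of_card_le (fun v hv => ?_) hc
  · simpa using Finset.ext_iff.1 h2 v
  · simp only [Finset.mem_filter, Finset.mem_univ, true_and] at hv ⊢
    rcases (axes_iff v).1 hv with rfl | rfl | rfl | rfl | rfl | rfl
    · exact h1 _ e1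
    · exact h1 _ e2
    · exact h1 _ e3
    · rw [hrn]; exact h1 _ e1
    · rw [hrn]; exact h1 _ e2
    · rw [hrn]; exact h1 _ e3

/-- The standard basis. -/
def basisSet (v : Cube) : Bool := v = ((1, 0), 0) ∨ v = ((0, 1), 0) ∨ v = ((0, 0), 1)

theorem cnt_basisSet : ∀ v, cnt basisSet (fun u => decide (cnt basisSet basisSet u = 2)) v = 3 ↔
    v = ((1, 1), 1) := by
  decide +kernel

/-- A class with few elements is symmetric. -/
theorem Joint.axes_symmetric [Finite G] (J : Joint c c) (hno : NoNine c) (hno3 : NoThree c)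
    {x : G} {e : Cube ≃+ Additive G} (hx : x ≠ 1)
    (h : ∀ v, axes v = true ↔ (e v).toMul ∈ cls c x ∪ cls c x⁻¹)
    (e1 : c (e ((1, 0), 0)).toMul = c x) (e2 : c (e ((0, 1), 0)).toMul = c x)
    (e3 : c (e ((0, 0), 1)).toMul = c x) : c x⁻¹ = c x := by
  by_contra hs
  have hneg : ∀ v, c (e v).toMul = c x → c (e (-v)).toMul ≠ c x := fun v hv h => by
    rw [toMul_neg, J.inv hv] at h
    exact hs h
  have hB : ∀ v, basisSet v = true ↔ (e v).toMul ∈ cls c x := fun v => by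
    constructor
    · intro hv
      have hv' := of_decide_eq_true hv
      rcases hv' with rfl | rfl | rfl
      exacts [e1, e2, e3]
    · intro hv
      rcases (axes_iff v).1 ((h v).2 (Or.inl hv)) with rfl | rfl | rfl | rfl | rfl | rfl
      · decide
      · decide
      · decide
      · exact (hneg _ e1 hv).elim
      · exact (hneg _ e2 hv).elim
      · exact (hneg _ e3 hv).elim
  have hX : JS c c (cls c x) (cls c x) := JS.cls rfl
  have hP := J.js_cnt e hX hX hB hB 2
  have hS := J.js_cnt e hX hP hB (q := fun u => decide (cnt basisSet basisSet u = 2))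
    (fun v => by simp) 3
  obtain ⟨K, hK, hKf⟩ := exists_subgroup_of_pred e (cubeFun_closed 1)
  refine (toMul_ne_one e (v := ((1, 1), 1))).2 (by decide)
    (J.eq_one_of_subset hno hno3 hS hK (fun g hg => ?_) ?_)
  · have h1 := (cnt_basisSet _).1 hg
    have h2 := (hKf ((1, 1), 1)).2 (by decide)
    rw [← h1] at h2
    simpa using h2
  · refine (cnt_basisSet _).2 ?_
    simp

/-- The set consisting of `((1, 1), 0)` and of further vectors of weight two. -/
def pairSet (b : Fin 2048) (v : Cube) : Bool :=
  (b.val + 2 ^ 11).testBit (324122287722022697373555816988671 /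
    16 ^ (9 * v.1.1.val + 3 * v.1.2.val + v.2.val) % 16)

/-- The vectors of weight two in the order used by `pairSet`. -/
def pairVec (i : Fin 12) : Cube :=
  match i with
  | 0 => ((0, 1), 1) | 1 => ((0, 1), 2) | 2 => ((0, 2), 1) | 3 => ((0, 2), 2) | 4 => ((1, 0), 1)
  | 5 => ((1, 0), 2) | 6 => ((1, 2), 0) | 7 => ((2, 0), 1) | 8 => ((2, 0), 2) | 9 => ((2, 1), 0)
  | 10 => ((2, 2), 0) | 11 => ((1, 1), 0)

theorem pairVec_surj : ∀ v, cubeWt v = 2 → ∃ i, v = pairVec i := by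
  decide +kernel

/-- The set consisting of `((1, 1), 1)` and of further vectors of weight three. -/
def tripleSet (b : Fin 128) (v : Cube) : Bool :=
  (b.val + 2 ^ 7).testBit (129242178037336692002672359768063 /
    16 ^ (9 * v.1.1.val + 3 * v.1.2.val + v.2.val) % 16)

/-- The vectors of weight three in the order used by `tripleSet`. -/
def tripleVec (i : Fin 8) : Cube :=
  match i with
  | 0 => ((1, 1), 2) | 1 => ((1, 2), 1) | 2 => ((1, 2), 2) | 3 => ((2, 1), 1) | 4 => ((2, 1), 2)
  | 5 => ((2, 2), 1) | 6 => ((2, 2), 2) | 7 => ((1, 1), 1)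

theorem tripleVec_surj : ∀ v, cubeWt v = 3 → ∃ i, v = tripleVec i := by
  decide +kernel

set_option synthInstance.maxHeartbeats 400000 in
set_option synthInstance.maxSize 1000 in
set_option maxRecDepth 10000 in
theorem pairSet_cnt : ∀ b : Fin 2048,
    cnt axes (pairSet b) ((1, 0), 0) ≠ cnt axes (pairSet b) ((0, 1), 0) ∨
    cnt axes (pairSet b) ((1, 0), 0) ≠ cnt axes (pairSet b) ((0, 0), 1) ∨
    (∃ v, axes v = true ∧ cnt axes (pairSet b) ((1, 0), 0) ≠ cnt axes (pairSet b) v) ∨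
    (∃ i, pairSet b (pairVec i) = true ∧
      cnt axes (pairSet b) (pairVec i) ≠ cnt axes (pairSet b) ((1, 1), 0)) ∨
    b.val = 2047 ∨
    (∃ k, ∀ i, pairSet b (pairVec i) = true → cubeFun k (pairVec i) = true) ∨
    (∃ k, ∀ i, pairSet b (pairVec i) = false → cubeFun k (pairVec i) = true) := by
  decide +kernel

/-- The product of the coordinates. -/
def cubeProd (v : Cube) : ZMod 3 := v.1.1 * v.1.2 * v.2

set_option synthInstance.maxHeartbeats 400000 in
set_option synthInstance.maxSize 1000 in
set_option maxRecDepth 10000 in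
theorem tripleSet_cnt : ∀ b : Fin 128,
    (∃ v, axes v = true ∧ cnt axes (tripleSet b) ((1, 0), 0) ≠ cnt axes (tripleSet b) v) ∨
    (∃ i, tripleSet b (tripleVec i) = true ∧
      cnt axes (tripleSet b) (tripleVec i) ≠ cnt axes (tripleSet b) ((1, 1), 1)) ∨
    (∃ v, axes v = true ∧ cnt (tripleSet b) (tripleSet b) ((1, 0), 0) ≠
      cnt (tripleSet b) (tripleSet b) v) ∨
    (∃ i, tripleSet b (tripleVec i) = true ∧ cnt (tripleSet b) (tripleSet b) (tripleVec i) ≠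
      cnt (tripleSet b) (tripleSet b) ((1, 1), 1)) ∨
    b.val = 127 ∨ (∀ i, tripleSet b (tripleVec i) = decide (cubeProd (tripleVec i) = 1)) ∨
    (∃ k, ∀ i, tripleSet b (tripleVec i) = true → cubeFun k (tripleVec i) = true) ∨
    (∃ k, ∀ i, tripleSet b (tripleVec i) = false → cubeFun k (tripleVec i) = true) := by
  decide +kernel

end

section

variable {G H C : Type} [CommGroup G] [CommGroup H] {c : G → C} {d : H → C} {L : Subgroup G}

theorem pairSet_of_ne (b : Fin 2048) {v : Cube} (hv : cubeWt v ≠ 2) : pairSet b v = false := by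
  have h1 : ∀ v : Cube, cubeWt v ≠ 2 → 324122287722022697373555816988671 /
    16 ^ (9 * v.1.1.val + 3 * v.1.2.val + v.2.val) % 16 = 15 := by decide +kernel
  have h2 : ∀ b : Fin 2048, (b.val + 2 ^ 11).testBit 15 = false := by decide +kernel
  rw [pairSet, h1 v hv, h2]

theorem pairSet_vec (b : Fin 2048) (i : Fin 12) :
    pairSet b (pairVec i) = if i.val < 11 then b.val.testBit i else true := by
  have h1 : ∀ i, 324122287722022697373555816988671 /
    16 ^ (9 * (pairVec i).1.1.val + 3 * (pairVec i).1.2.val + (pairVec i).2.val) % 16 = i.val := by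
    decide +kernel
  have h2 : ∀ b : Fin 2048, ∀ i : Fin 12, (b.val + 2 ^ 11).testBit i =
    if i.val < 11 then b.val.testBit i else true := by decide +kernel
  rw [pairSet, h1 i, h2]

theorem exists_pairSet {q : Cube → Bool} (h : ∀ v, q v = true → cubeWt v = 2)
    (h1 : q ((1, 1), 0) = true) : ∃ b, q = pairSet b := by
  obtain ⟨b, hb⟩ := exists_testBit 11 fun i => q (pairVec (i.castLE (by norm_num)))
  refine ⟨b, funext fun v => ?_⟩
  by_cases hv : cubeWt v = 2
  · obtain ⟨i, rfl⟩ := pairVec_surj v hv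
    rw [pairSet_vec]
    split_ifs with hi
    · exact (hb ⟨i.val, hi⟩).symm
    · have : i = 11 := by omega
      rw [this]; exact h1
  · rw [pairSet_of_ne b hv, Bool.eq_false_iff]
    exact fun hq => hv (h v hq)

theorem tripleSet_of_ne (b : Fin 128) {v : Cube} (hv : cubeWt v ≠ 3) : tripleSet b v = false := by
  have h1 : ∀ v : Cube, cubeWt v ≠ 3 → 129242178037336692002672359768063 /
    16 ^ (9 * v.1.1.val + 3 * v.1.2.val + v.2.val) % 16 = 15 := by decide +kernel
  have h2 : ∀ b : Fin 128, (b.val + 2 ^ 7).testBit 15 = false := by decide +kernel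
  rw [tripleSet, h1 v hv, h2]

theorem tripleSet_vec (b : Fin 128) (i : Fin 8) :
    tripleSet b (tripleVec i) = if i.val < 7 then b.val.testBit i else true := by
  have h1 : ∀ i, 129242178037336692002672359768063 / 16 ^ (9 * (tripleVec i).1.1.val +
    3 * (tripleVec i).1.2.val + (tripleVec i).2.val) % 16 = i.val := by
    decide +kernel
  have h2 : ∀ b : Fin 128, ∀ i : Fin 8, (b.val + 2 ^ 7).testBit i =
    if i.val < 7 then b.val.testBit i else true := by decide +kernel
  rw [tripleSet, h1 i, h2]

theorem exists_tripleSet {q : Cube → Bool} (h : ∀ v, q v = true → cubeWt v = 3)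
    (h1 : q ((1, 1), 1) = true) : ∃ b, q = tripleSet b := by
  obtain ⟨b, hb⟩ := exists_testBit 7 fun i => q (tripleVec (i.castLE (by norm_num)))
  refine ⟨b, funext fun v => ?_⟩
  by_cases hv : cubeWt v = 3
  · obtain ⟨i, rfl⟩ := tripleVec_surj v hv
    rw [tripleSet_vec]
    split_ifs with hi
    · exact (hb ⟨i.val, hi⟩).symm
    · have : i = 7 := by omega
      rw [this]; exact h1
  · rw [tripleSet_of_ne b hv, Bool.eq_false_iff]
    exact fun hq => hv (h v hq)

theorem Joint.cubeWt_eq (J : Joint c d) {x : G} {x' : H} (hxx : c x = d x')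
    {e : Cube ≃+ Additive G} {e' : Cube ≃+ Additive H}
    (h : ∀ v, axes v = true ↔ (e v).toMul ∈ cls c x)
    (h' : ∀ v, axes v = true ↔ (e' v).toMul ∈ cls d x') {v w : Cube}
    (hvw : c (e v).toMul = d (e' w).toMul) : cubeWt v = cubeWt w :=
  cnt_axes v w (J.cnt_eq e e' (JS.cls hxx) (JS.cls hxx) h h h' h' hvw)

theorem subset_of_forall (e : Cube ≃+ Additive G) {K : Subgroup G} {X : Set G}
    (h : ∀ v, (e v).toMul ∈ X → (e v).toMul ∈ K) : X ⊆ K := fun g hg => by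
  have := h (e.symm (Additive.ofMul g)) (by simpa using hg)
  simpa using this

theorem Joint.js_wt (J : Joint c c) {x : G} {e : Cube ≃+ Additive G}
    (h : ∀ v, axes v = true ↔ (e v).toMul ∈ cls c x) (n : ℕ) :
    JS c c {g : G | cubeWt (e.symm (Additive.ofMul g)) = n}
      {g : G | cubeWt (e.symm (Additive.ofMul g)) = n} := fun a b hab => by
  have := J.cubeWt_eq (c := c) rfl h h (v := e.symm (Additive.ofMul a))
    (w := e.symm (Additive.ofMul b)) (by simpa using hab)
  rw [Set.mem_ofPred_eq, Set.mem_ofPred_eq, this]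

theorem Joint.pair_class [Finite G] (J : Joint c c) (hno : NoNine c) (hno3 : NoThree c) {x : G}
    {e : Cube ≃+ Additive G} (h : ∀ v, axes v = true ↔ (e v).toMul ∈ cls c x) {v : Cube}
    (hv : cubeWt v = 2) : c (e v).toMul = c (e ((1, 1), 0)).toMul := by
  set y := (e ((1, 1), 0)).toMul with hy
  have hX : JS c c (cls c x) (cls c x) := JS.cls rfl
  have hY : JS c c (cls c y) (cls c y) := JS.cls rfl
  have hy1 : y ≠ 1 := (toMul_ne_one e).2 (by decide)
  obtain ⟨q, hq⟩ := exists_pred e (cls c y)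
  have hq2 : ∀ v, q v = true → cubeWt v = 2 := fun v hv =>
    J.cubeWt_eq rfl h h (w := ((1, 1), 0)) ((hq v).1 hv)
  obtain ⟨b, rfl⟩ := exists_pairSet hq2 ((hq _).2 rfl)
  have hT : ∀ v w, axes v = true → axes w = true → cnt axes (pairSet b) v =
      cnt axes (pairSet b) w := fun v w hv hw =>
    J.cnt_eq e e hX hY h hq h hq (((h v).1 hv).trans ((h w).1 hw).symm)
  rcases pairSet_cnt b with h1 | h1 | ⟨w, hw, h1⟩ | ⟨i, hi, h1⟩ | h1 | ⟨k, h1⟩ | ⟨k, h1⟩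
  · exact (h1 (hT _ _ (by decide) (by decide))).elim
  · exact (h1 (hT _ _ (by decide) (by decide))).elim
  · exact (h1 (hT _ _ (by decide) hw)).elim
  · exact (h1 (J.cnt_eq e e hX hY h hq h hq ((hq _).1 hi))).elim
  · refine (hq v).1 ?_
    obtain ⟨i, rfl⟩ := pairVec_surj v hv
    have h2 : ∀ i : Fin 12, (if i.val < 11 then (2047).testBit i else true) = true := by
      decide +kernel
    rw [pairSet_vec, h1, h2]
  · obtain ⟨K, hK, hKf⟩ := exists_subgroup_of_pred e (cubeFun_closed k)
    refine (hy1 (J.eq_one_of_subset hno hno3 hY hK (subset_of_forall e fun v hv => ?_)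
      self_mem_cls)).elim
    rw [← hq] at hv
    obtain ⟨i, rfl⟩ := pairVec_surj v (hq2 v hv)
    exact (hKf _).2 (h1 i hv)
  · refine (hq v).1 ?_
    by_contra hvq
    obtain ⟨K, hK, hKf⟩ := exists_subgroup_of_pred e (cubeFun_closed k)
    refine (toMul_ne_one e (v := v)).2 (fun h0 => by rw [h0] at hv; revert hv; decide)
      (J.eq_one_of_subset hno hno3 ((J.js_wt h 2).inter hY.compl) hK
      (subset_of_forall e fun u hu => ?_) ⟨?_, ?_⟩)
    · obtain ⟨hu1, hu2⟩ := hu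
      rw [Set.mem_ofPred_eq] at hu1
      simp only [ofMul_toMul, AddEquiv.symm_apply_apply] at hu1
      obtain ⟨i, rfl⟩ := pairVec_surj u hu1
      exact (hKf _).2 (h1 i (by rw [Bool.eq_false_iff, Ne, hq]; exact hu2))
    · rw [Set.mem_ofPred_eq]
      simpa using hv
    · rw [Set.mem_compl_iff, ← hq]; exact hvq

theorem Joint.triple_class [Finite G] (J : Joint c c) (hno : NoNine c) (hno3 : NoThree c) {x : G}
    {e : Cube ≃+ Additive G} (h : ∀ v, axes v = true ↔ (e v).toMul ∈ cls c x) {v : Cube}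
    (hv : cubeWt v = 3) (hv1 : cubeProd v = 1) :
    c (e v).toMul = c (e ((1, 1), 1)).toMul := by
  set y := (e ((1, 1), 1)).toMul with hy
  have hX : JS c c (cls c x) (cls c x) := JS.cls rfl
  have hY : JS c c (cls c y) (cls c y) := JS.cls rfl
  have hy1 : y ≠ 1 := (toMul_ne_one e).2 (by decide)
  obtain ⟨q, hq⟩ := exists_pred e (cls c y)
  have hq2 : ∀ v, q v = true → cubeWt v = 3 := fun v hv =>
    J.cubeWt_eq rfl h h (w := ((1, 1), 1)) ((hq v).1 hv)
  obtain ⟨b, rfl⟩ := exists_tripleSet hq2 ((hq _).2 rfl)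
  rcases tripleSet_cnt b with ⟨w, hw, h1⟩ | ⟨i, hi, h1⟩ | ⟨w, hw, h1⟩ | ⟨i, hi, h1⟩ | h1 | h1 |
    ⟨k, h1⟩ | ⟨k, h1⟩
  · exact (h1 (J.cnt_eq e e hX hY h hq h hq (((h _).1 (by decide)).trans
      ((h w).1 hw).symm))).elim
  · exact (h1 (J.cnt_eq e e hX hY h hq h hq ((hq _).1 hi))).elim
  · exact (h1 (J.cnt_eq e e hY hY hq hq hq hq (((h _).1 (by decide)).trans
      ((h w).1 hw).symm))).elim
  · exact (h1 (J.cnt_eq e e hY hY hq hq hq hq ((hq _).1 hi))).elim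
  · refine (hq v).1 ?_
    obtain ⟨i, rfl⟩ := tripleVec_surj v hv
    have h2 : ∀ i : Fin 8, (if i.val < 7 then (127).testBit i else true) = true := by
      decide +kernel
    rw [tripleSet_vec, h1, h2]
  · refine (hq v).1 ?_
    obtain ⟨i, rfl⟩ := tripleVec_surj v hv
    rw [h1, hv1]; rfl
  · obtain ⟨K, hK, hKf⟩ := exists_subgroup_of_pred e (cubeFun_closed k)
    refine (hy1 (J.eq_one_of_subset hno hno3 hY hK (subset_of_forall e fun v hv => ?_)
      self_mem_cls)).elim
    rw [← hq] at hv
    obtain ⟨i, rfl⟩ := tripleVec_surj v (hq2 v hv)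
    exact (hKf _).2 (h1 i hv)
  · refine (hq v).1 ?_
    by_contra hvq
    obtain ⟨K, hK, hKf⟩ := exists_subgroup_of_pred e (cubeFun_closed k)
    refine (toMul_ne_one e (v := v)).2 (fun h0 => by rw [h0] at hv; revert hv; decide)
      (J.eq_one_of_subset hno hno3 ((J.js_wt h 3).inter hY.compl) hK
      (subset_of_forall e fun u hu => ?_) ⟨?_, ?_⟩)
    · obtain ⟨hu1, hu2⟩ := hu
      rw [Set.mem_ofPred_eq] at hu1
      simp only [ofMul_toMul, AddEquiv.symm_apply_apply] at hu1
      obtain ⟨i, rfl⟩ := tripleVec_surj u hu1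
      exact (hKf _).2 (h1 i (by rw [Bool.eq_false_iff, Ne, hq]; exact hu2))
    · rw [Set.mem_ofPred_eq]
      simpa using hv
    · rw [Set.mem_compl_iff, ← hq]; exact hvq

/-- The class of a vector is determined by its weight and the product of its coordinates. -/
theorem Joint.cube_class [Finite G] (J : Joint c c) (hno : NoNine c) (hno3 : NoThree c) {x : G}
    {e : Cube ≃+ Additive G} (h : ∀ v, axes v = true ↔ (e v).toMul ∈ cls c x) {v w : Cube}
    (hvw : cubeWt v = cubeWt w) (hp : cubeProd v = cubeProd w) :
    c (e v).toMul = c (e w).toMul := by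
  have h0 : ∀ v : Cube, cubeWt v = 0 ∨ cubeWt v = 1 ∨ cubeWt v = 2 ∨
      cubeWt v = 3 ∧ (cubeProd v = 1 ∨ cubeProd v = -1) := by decide +kernel
  have h00 : ∀ v : Cube, cubeWt v = 0 → v = 0 := by decide +kernel
  have hneg : ∀ v : Cube, cubeWt (-v) = cubeWt v ∧ cubeProd (-v) = -cubeProd v := by
    decide +kernel
  rcases h0 v with h1 | h1 | h1 | ⟨h1, h2 | h2⟩
  · rw [h00 v h1, h00 w (hvw ▸ h1)]
  · exact ((h v).1 (decide_eq_true h1)).trans ((h w).1 (decide_eq_true (hvw ▸ h1))).symm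
  · rw [J.pair_class hno hno3 h h1, J.pair_class hno hno3 h (v := w) (hvw ▸ h1)]
  · rw [J.triple_class hno hno3 h h1 h2, J.triple_class hno hno3 h (v := w) (hvw ▸ h1) (hp ▸ h2)]
  · have key : ∀ v, cubeWt v = 3 → cubeProd v = -1 →
        c (e v).toMul = c (e ((1, 1), 1)).toMul⁻¹ := fun v hv hp => by
      have := J.inv (J.triple_class hno hno3 h (v := -v) ((hneg v).1.trans hv)
        (by rw [(hneg v).2, hp, neg_neg]))
      rwa [toMul_neg, inv_inv] at this
    rw [key v h1 h2, key w (hvw ▸ h1) (hp ▸ h2)]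

theorem exists_ji_of_equiv {V : Type} [AddCommGroup V] (e : V ≃+ Additive G) (e' : V ≃+ Additive H)
    (h : ∀ v, c (e v).toMul = d (e' v).toMul) : ∃ f, JI c d f := by
  refine ⟨_, ji_of_hom (MonoidHom.mk' (fun g => (e' (e.symm (Additive.ofMul g))).toMul)
    fun a b => by rw [ofMul_mul, map_add, map_add]; rfl) fun g => ?_⟩
  have := h (e.symm (Additive.ofMul g))
  simp only [AddEquiv.apply_symm_apply, toMul_ofMul] at this
  exact this

/-- Matching classes of axes in two elementary abelian groups. -/
theorem Joint.exists_ji_of_axes [Finite G] [Finite H] (J : Joint c d) (hno : NoNine c)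
    (hno3 : NoThree c) {x : G} {x' : H} (hxx : c x = d x') {e : Cube ≃+ Additive G}
    {e' : Cube ≃+ Additive H} (h : ∀ v, axes v = true ↔ (e v).toMul ∈ cls c x)
    (h' : ∀ v, axes v = true ↔ (e' v).toMul ∈ cls d x') : ∃ f, JI c d f := by
  have Jd := J.right
  have hnod := hno.transfer J
  have hno3d := hno3.transfer J
  have hneg : ∀ v : Cube, cubeWt (-v) = cubeWt v ∧ cubeProd (-v) = -cubeProd v := by
    decide +kernel
  have key : ∀ e' : Cube ≃+ Additive H, (∀ v, axes v = true ↔ (e' v).toMul ∈ cls d x') →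
      c (e ((1, 1), 1)).toMul = d (e' ((1, 1), 1)).toMul → ∃ f, JI c d f := by
    intro e' h' h1
    have h2 : ∀ v, c (e v).toMul = d (e' v).toMul := by
      intro v
      have h0 : ∀ v : Cube, cubeWt v = 3 ∧ cubeProd v = 1 ∨ cubeWt v = 3 ∧ cubeProd v = -1 ∨
        cubeWt v ≠ 3 := by decide +kernel
      rcases h0 v with ⟨h3, h4⟩ | ⟨h3, h4⟩ | h3
      · rw [J.left.triple_class hno hno3 h h3 h4, h1, Jd.triple_class hnod hno3d h' h3 h4]
      · have := J.inv h1
        rw [← toMul_neg, ← toMul_neg] at this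
        rw [J.left.cube_class hno hno3 h (w := -((1, 1), 1)) (h3.trans (by decide))
          (h4.trans (by decide)), this, Jd.cube_class hnod hno3d h' (w := -((1, 1), 1))
          (h3.trans (by decide)) (h4.trans (by decide))]
      · obtain ⟨b, hb⟩ := J.exists_right (e v).toMul
        obtain ⟨w, rfl⟩ : ∃ w, b = (e' w).toMul := ⟨e'.symm (Additive.ofMul b), by simp⟩
        rw [hb]
        have h4 := J.cubeWt_eq hxx h h' hb
        have h5 : ∀ v : Cube, cubeWt v ≠ 3 → cubeProd v = 0 := by decide +kernel
        exact Jd.cube_class hnod hno3d h' h4.symm ((h5 w (h4 ▸ h3)).trans (h5 v h3).symm)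
    exact exists_ji_of_equiv e e' h2
  obtain ⟨b, hb⟩ := J.exists_right (e ((1, 1), 1)).toMul
  obtain ⟨w, rfl⟩ : ∃ w, b = (e' w).toMul := ⟨e'.symm (Additive.ofMul b), by simp⟩
  have hw : cubeWt w = 3 := (J.cubeWt_eq hxx h h' hb).symm
  have h0 : ∀ v : Cube, cubeWt v = 3 → cubeProd v = 1 ∨ cubeProd (-v) = 1 := by decide +kernel
  rcases h0 w hw with hw1 | hw1
  · refine key e' h' (hb.trans (Jd.triple_class hnod hno3d h' hw hw1))
  · refine key ((AddEquiv.neg Cube).trans e') (fun v => ?_) ?_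
    · rw [← show axes (-v) = axes v by unfold axes; rw [(hneg v).1]]
      exact h' (-v)
    · refine hb.trans ?_
      have := Jd.inv (Jd.triple_class hnod hno3d h' ((hneg w).1.trans hw) hw1)
      rwa [toMul_neg, inv_inv, ← toMul_neg] at this

end

section

variable {G H C : Type} [CommGroup G] [CommGroup H] {c : G → C} {d : H → C} {L : Subgroup G}

/-- The first nonzero coordinate is `2`. -/
def cubeNeg (v : Cube) : Bool :=
  v.1.1 = 2 ∨ v.1.1 = 0 ∧ (v.1.2 = 2 ∨ v.1.2 = 0 ∧ v.2 = 2)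

/-- The subset of `Cube` containing the basis vectors and exactly one of `v` and `-v` for each
`v ≠ 0`, with given values on representatives. -/
def cubeHalf (b : Fin 1024) (v : Cube) : Bool := cubeSet b v != cubeNeg v

/-- The entries of some matrices moving one difference set to the others. -/
def halfEntry (k : Fin 36) (r j : ℕ) : ZMod 3 :=
  match 10586409725447905258911890461631992148498987340113389277897293428642095720988016280544575799815417193623366497601639181432847226892867338076363122296006721
    / 3 ^ (9 * k.val + 3 * r + j) % 3 with
  | 0 => 0 | 1 => 1 | _ => 2

/-- The linear maps given by `halfEntry`. -/
def halfMap (k : Fin 36) : Cube →+ Cube where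
  toFun v :=
    ((v.1.1 * halfEntry k 0 0 + v.1.2 * halfEntry k 1 0 + v.2 * halfEntry k 2 0,
      v.1.1 * halfEntry k 0 1 + v.1.2 * halfEntry k 1 1 + v.2 * halfEntry k 2 1),
      v.1.1 * halfEntry k 0 2 + v.1.2 * halfEntry k 1 2 + v.2 * halfEntry k 2 2)
  map_zero' := by ext <;> simp
  map_add' u v := by ext <;> simp <;> ring

theorem halfMap_injective : ∀ k v, halfMap k v = 0 → v = 0 := by
  decide +kernel

set_option synthInstance.maxHeartbeats 400000 in
set_option synthInstance.maxSize 1000 in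
set_option maxRecDepth 10000 in
theorem cubeHalf_cnt : ∀ b : Fin 1024, (∃ v, cubeHalf b v = true ∧
      cnt (cubeHalf b) (cubeHalf b) v ≠ cnt (cubeHalf b) (cubeHalf b) ((1, 0), 0)) ∨
    ∃ k, ∀ v, cubeHalf b (halfMap k v) = cubeHalf 26 v := by
  decide +kernel

theorem cubeNeg_rep : ∀ i, cubeNeg (cubeRep i) = false ∧ cubeNeg (-cubeRep i) = true := by
  decide +kernel

theorem exists_cubeHalf {p : Cube → Bool} (h0 : p 0 = false) (h1 : p ((1, 0), 0) = true)
    (h2 : p ((0, 1), 0) = true) (h3 : p ((0, 0), 1) = true) (hn : ∀ v, v ≠ 0 → p (-v) = !p v) :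
    ∃ b, p = cubeHalf b := by
  have hnn : cubeNeg 0 = false := by decide
  have hn1 : cubeNeg ((1, 0), 0) = false ∧ cubeNeg ((0, 1), 0) = false ∧
    cubeNeg ((0, 0), 1) = false := by decide
  obtain ⟨b, hb⟩ := exists_cubeSet (p := fun v => p v != cubeNeg v) (by simp [h0, hnn])
    (by simp [h1, hn1]) (by simp [h2, hn1]) (by simp [h3, hn1]) (fun v => by
      rcases cubeRep_orbit v with rfl | ⟨i, rfl | rfl⟩
      · simp
      · simp only [hn _ (cubeRep_ne i), cubeNeg_rep]; simp
      · simp only [neg_neg, hn _ (cubeRep_ne i), cubeNeg_rep]; simp)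
  refine ⟨b, funext fun v => ?_⟩
  unfold cubeHalf
  rw [← hb]
  simp

/-- A skew class of size thirteen has a normal form. -/
theorem Joint.exists_half_normal [Finite G] (J : Joint c c) (hno : NoNine c) (hno3 : NoThree c)
    (hG : Nat.card G = 27) (h3 : ∀ g : G, g ^ 3 = 1) {x : G} (hx : x ≠ 1)
    (hcov : ∀ g, g ≠ 1 → c g = c x ∨ c g = c x⁻¹) (hs : c x⁻¹ ≠ c x) :
    ∃ e : Cube ≃+ Additive G, ∀ v, cubeHalf 26 v = true ↔ (e v).toMul ∈ cls c x := by
  obtain ⟨e, e1, e2, e3⟩ := J.exists_basis hno hno3 hG h3 hx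
  obtain ⟨p, hp, hpn⟩ := J.exists_half e hcov hs
  obtain ⟨b, rfl⟩ := exists_cubeHalf (p := p) (by
    rw [Bool.eq_false_iff, Ne, hp, mem_cls, map_zero]
    exact fun h => hx ((J.one_iff h).1 rfl)) ((hp _).2 e1) ((hp _).2 e2) ((hp _).2 e3) hpn
  rcases cubeHalf_cnt b with ⟨v, hv, h⟩ | ⟨k, hk⟩
  · exact (h (J.cnt_eq e e (JS.cls rfl) (JS.cls rfl) hp hp hp hp
      (((hp v).1 hv).trans e1.symm))).elim
  · obtain ⟨e', he'⟩ := exists_equiv_of_injective (e.toAddMonoidHom.comp (halfMap k))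
      (e.injective.comp ((injective_iff_map_eq_zero _).2 (halfMap_injective k)))
      (Nat.card_congr (e.toEquiv.trans Additive.toMul))
    refine ⟨e', fun v => ?_⟩
    rw [← hk, hp, he']
    rfl

theorem Joint.exists_ji_of_half [Finite G] [Finite H] (J : Joint c d) (hno : NoNine c)
    (hno3 : NoThree c) (hG : Nat.card G = 27) (h3 : ∀ g : G, g ^ 3 = 1) (h3' : ∀ g : H, g ^ 3 = 1)
    {x : G} (hx : x ≠ 1) (hcov : ∀ g, g ≠ 1 → c g = c x ∨ c g = c x⁻¹) : ∃ f, JI c d f := by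
  by_cases hs : c x⁻¹ = c x
  · exact J.exists_ji_of_rank_two (x := x) fun g hg => (hcov g hg).elim id fun h => h.trans hs
  obtain ⟨x', hxx⟩ := J.exists_right x
  have hxi := J.inv hxx
  have hx' : x' ≠ 1 := fun h => hx ((J.one_iff hxx).2 h)
  obtain ⟨e, he⟩ := J.left.exists_half_normal hno hno3 hG h3 hx hcov hs
  obtain ⟨e', he'⟩ := J.right.exists_half_normal (hno.transfer J) (hno3.transfer J)
    (by rw [← J.card_eq, hG]) h3' hx' (fun g hg => by
      obtain ⟨a, ha⟩ := J.exists_left g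
      rw [← ha, ← hxx, ← hxi]
      exact hcov a fun h => hg ((J.one_iff ha).1 h)) (by rwa [← hxx, ← hxi])
  have key : ∀ v, v ≠ 0 → cubeHalf 26 v = true ∨ cubeHalf 26 (-v) = true := by decide +kernel
  have h1 : ∀ v, cubeHalf 26 v = true → c (e v).toMul = d (e' v).toMul := fun v hv =>
    ((he v).1 hv).trans (hxx.trans ((he' v).1 hv).symm)
  refine exists_ji_of_equiv e e' fun v => ?_
  by_cases hv : v = 0
  · rw [hv, map_zero e, map_zero e']; exact J.map_one
  rcases key v hv with h | h
  · exact h1 v h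
  · have := J.inv (h1 _ h)
    rwa [← toMul_neg, ← toMul_neg, neg_neg] at this

end

section

variable {G H C : Type} [CommGroup G] [CommGroup H] {c : G → C} {d : H → C} {L : Subgroup G}

theorem orderOf_eq_of_pow_ne [Finite G] (hG : Nat.card G = 27) {y : G} (hy : y ^ 9 ≠ 1) :
    orderOf y = 27 :=
  orderOf_eq_prime_pow (p := 3) (n := 2) hy (by
    have := pow_card_eq_one' (x := y)
    rwa [hG] at this)

theorem Joint.exists_ji_of_cubes [Finite G] [Finite H] (J : Joint c d) (hno : NoNine c)
    (hno3 : NoThree c) (hG : Nat.card G = 27) (h3 : ∀ g : G, g ^ 3 = 1)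
    (h3' : ∀ g : H, g ^ 3 = 1) : ∃ f, JI c d f := by
  rcases J.left.cover_or_small hno hno3 hG h3 with ⟨x, hx, hcov⟩ | ⟨x, hx, hc⟩
  · exact J.exists_ji_of_half hno hno3 hG h3 h3' hx hcov
  obtain ⟨x', hxx⟩ := J.exists_right x
  have hx' : x' ≠ 1 := fun h => hx ((J.one_iff hxx).2 h)
  have hc' : Nat.card ↥(cls d x' ∪ cls d x'⁻¹) ≤ 6 := by
    rwa [← J.card_set_eq ((JS.cls hxx).union (JS.cls (J.inv hxx)))]
  have hnod := hno.transfer J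
  have hno3d := hno3.transfer J
  have hH : Nat.card H = 27 := by rw [← J.card_eq, hG]
  obtain ⟨e, he, e1, e2, e3⟩ := J.left.exists_axes hno hno3 hG h3 hx hc
  obtain ⟨e', he', e1', e2', e3'⟩ := J.right.exists_axes hnod hno3d hH h3' hx' hc'
  have hs := J.left.axes_symmetric hno hno3 hx he e1 e2 e3
  have hs' := J.right.axes_symmetric hnod hno3d hx' he' e1' e2' e3'
  have h1 : cls c x ∪ cls c x⁻¹ = cls c x := by
    ext g; simp [mem_cls, hs]
  have h2 : cls d x' ∪ cls d x'⁻¹ = cls d x' := by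
    ext g; simp [mem_cls, hs']
  rw [h1] at he
  rw [h2] at he'
  exact J.exists_ji_of_axes hno hno3 hxx he he'

theorem Joint.rank_two_of_pow_ne [Finite G] (J : Joint c c) (hno : NoNine c) (hno3 : NoThree c)
    (hG : Nat.card G = 27) (h3 : ¬ ∀ g : G, g ^ 3 = 1) : ∃ x, ∀ g, g ≠ 1 → c g = c x := by
  by_cases h9 : ∀ g : G, g ^ 9 = 1
  · push Not at h3
    obtain ⟨y, hy⟩ := h3
    exact J.rank_two_nine_three hno hno3 hG h9 hy
  · push Not at h9
    obtain ⟨y, hy⟩ := h9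
    exact J.rank_two_cyclic hno hno3 hG (y := y) (orderOf_eq_of_pow_ne hG hy)

theorem sep_27 : Sep 27 := by
  intro G H C _ _ _ _ c d hG J
  by_cases hno : NoNine c
  swap
  · unfold NoNine at hno
    push Not at hno
    obtain ⟨U, hcU, hU⟩ := hno
    obtain ⟨V, hV⟩ := J.exists_subgroup U hU
    exact J.exists_ji_of_subgroup hV hG hcU
  by_cases hno3 : NoThree c
  · by_cases h3 : ∀ g : G, g ^ 3 = 1
    swap
    · obtain ⟨x, hx⟩ := J.left.rank_two_of_pow_ne hno hno3 hG h3
      exact J.exists_ji_of_rank_two hx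
    by_cases h3' : ∀ g : H, g ^ 3 = 1
    · exact J.exists_ji_of_cubes hno hno3 hG h3 h3'
    obtain ⟨x', hx'⟩ := J.right.rank_two_of_pow_ne (hno.transfer J) (hno3.transfer J)
      (by rw [← J.card_eq, hG]) h3'
    obtain ⟨x, hx⟩ := J.exists_left x'
    refine J.exists_ji_of_rank_two (x := x) fun g hg => ?_
    obtain ⟨h, hh⟩ := J.exists_right g
    rw [hh, hx]
    exact hx' h fun h1 => hg ((J.one_iff hh).2 h1)
  · unfold NoThree at hno3
    push Not at hno3
    obtain ⟨L, hcL, hL⟩ := hno3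
    refine J.exists_ji_of_full hG hL hcL ?_
    by_cases h9 : ∀ g : G, g ^ 9 = 1
    · by_cases h3 : ∀ g : G, g ^ 3 = 1
      · exact J.left.full_cube hno hG h3 hL hcL
      · push Not at h3
        obtain ⟨y, hy⟩ := h3
        exact J.left.full_nine_three hno hG h9 hL hcL hy
    · push Not at h9
      obtain ⟨y, hy⟩ := h9
      exact J.left.full_cyclic hno hG hL hcL (orderOf_eq_of_pow_ne hG hy)

theorem sep_nine_mul_prime {p : ℕ} (hp : p.Prime) : Sep (9 * p) := by
  by_cases h3 : p = 3
  · rw [h3]; exact sep_27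
  · exact sep_nine_mul hp h3

end

theorem JI.bijective {G H C : Type} [CommGroup G] [CommGroup H] [Finite G] [Finite H]
    {c : G → C} {d : H → C} (J : Joint c d) {f : G → H} (hf : JI c d f) :
    Function.Bijective f :=
  (Nat.bijective_iff_injective_and_card f).2 ⟨hf.injective J, J.card_eq⟩

section

variable {G : Type} [CommGroup G] [Fintype G] [DecidableEq G]

theorem structConst_pos_iff {X Y : Finset G} {z : G} :
    0 < structConst X Y z ↔ ∃ x ∈ X, ∃ y ∈ Y, x * y = z := by
  rw [structConst, Finset.card_pos]
  constructor
  · rintro ⟨⟨a, b⟩, h⟩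
    simp only [Finset.mem_filter, Finset.mem_product] at h
    exact ⟨a, h.1.1, b, h.1.2, h.2⟩
  · rintro ⟨a, ha, b, hb, h⟩
    exact ⟨(a, b), by simp [ha, hb, h]⟩

/-- The basic set containing `g`. -/
noncomputable def blk (A : SRing G) (g : G) : Finset G := (A.exists_mem g).choose

theorem blk_mem (A : SRing G) (g : G) : blk A g ∈ A.basicSets := (A.exists_mem g).choose_spec.1

theorem self_mem_blk (A : SRing G) (g : G) : g ∈ blk A g := (A.exists_mem g).choose_spec.2

theorem mem_iff_blk_eq (A : SRing G) {X : Finset G} (hX : X ∈ A.basicSets) {g : G} :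
    g ∈ X ↔ blk A g = X := by
  constructor
  · intro h
    by_contra hne
    exact Finset.disjoint_left.1 (A.disj _ (blk_mem A g) _ hX hne) (self_mem_blk A g) h
  · rintro rfl
    exact self_mem_blk A g

theorem card_eq_structConst (A : SRing G) {X Y : Finset G} (hX : X ∈ A.basicSets)
    (hY : Y ∈ A.basicSets) (z : G) :
    Nat.card {x // blk A x = X ∧ blk A (x⁻¹ * z) = Y} = structConst X Y z := by
  rw [structConst, Nat.card_eq_fintype_card, Fintype.card_subtype]
  refine Finset.card_bij' (fun x _ => (x, x⁻¹ * z)) (fun q _ => q.1) ?_ ?_ ?_ ?_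
  · intro x hx
    simpa [mem_iff_blk_eq A hX, mem_iff_blk_eq A hY] using hx
  · intro q hq
    simp only [mem_iff_blk_eq A hX, mem_iff_blk_eq A hY, Finset.mem_filter,
      Finset.mem_product] at hq
    simp only [Finset.mem_filter, Finset.mem_univ, true_and]
    rw [← hq.2, inv_mul_cancel_left]
    exact hq.1
  · intro x hx
    rfl
  · intro q hq
    simp only [Finset.mem_filter] at hq
    ext
    · rfl
    · simp [← hq.2]

theorem structConst_one_left (A : SRing G) {Y : Finset G} (z : G) :
    0 < structConst {1} Y z ↔ z ∈ Y := by
  rw [structConst_pos_iff]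
  simp

variable {H : Type} [CommGroup H] [Fintype H] [DecidableEq H]

theorem joint_of_isAlgIso {A : SRing G} {B : SRing H} {φ : Finset G → Finset H}
    (h : A.IsAlgIso B φ) : Joint (fun g => φ (blk A g)) (blk B) := by
  obtain ⟨hb, hc⟩ := h
  have hinj : ∀ X ∈ A.basicSets, ∀ Y ∈ A.basicSets, φ X = φ Y → X = Y :=
    fun X hX Y hY e => hb.2.1 hX hY e
  have hmaps : ∀ X ∈ A.basicSets, φ X ∈ B.basicSets := fun X hX => hb.1 hX
  have hsurj : ∀ Y ∈ B.basicSets, ∃ X ∈ A.basicSets, φ X = Y := fun Y hY => hb.2.2 hY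
  have hφ1 : φ {1} = {1} := by
    obtain ⟨Y, hY, hY1⟩ := hsurj _ B.one_mem
    obtain ⟨z, hz⟩ := A.nonempty_mem _ hY
    have h1 := hc _ A.one_mem _ hY _ hY z hz 1 (by simp [hY1])
    have h2 := (structConst_one_left A z).2 hz
    rw [h1, structConst_pos_iff, hY1] at h2
    obtain ⟨x, hx, y, hy, e⟩ := h2
    rw [Finset.mem_singleton.1 hy, mul_one] at e
    subst e
    rw [(mem_iff_blk_eq B (hmaps _ A.one_mem)).1 hx |>.symm]
    exact (mem_iff_blk_eq B B.one_mem).1 (by simp)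
  have hblk1 : blk A 1 = {1} := (mem_iff_blk_eq A A.one_mem).1 (by simp)
  have hblk1' : blk B 1 = {1} := (mem_iff_blk_eq B B.one_mem).1 (by simp)
  have hone : ∀ {g h}, φ (blk A g) = blk B h → (g = 1 ↔ h = 1) := by
    intro g h e
    constructor
    · rintro rfl
      rw [hblk1, hφ1] at e
      have := self_mem_blk B h
      rwa [← e, Finset.mem_singleton] at this
    · rintro rfl
      rw [hblk1', ← hφ1] at e
      have := hinj _ (blk_mem A g) _ A.one_mem e
      have h2 := self_mem_blk A g
      rwa [this, Finset.mem_singleton] at h2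
  refine ⟨?_, hone, ?_, ?_⟩
  · change φ (blk A 1) = blk B 1
    rw [hblk1, hblk1', hφ1]
  · intro g h e
    have h1 := hc _ (blk_mem A g) _ (blk_mem A g⁻¹) _ A.one_mem 1 (by simp) 1 (by simp [hφ1])
    have h2 : 0 < structConst (blk A g) (blk A g⁻¹) 1 :=
      structConst_pos_iff.2 ⟨g, self_mem_blk A g, g⁻¹, self_mem_blk A _, by simp⟩
    rw [h1, structConst_pos_iff] at h2
    obtain ⟨x, hx, y, hy, exy⟩ := h2
    have hy' : y = x⁻¹ := (inv_eq_of_mul_eq_one_right exy).symm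
    subst hy'
    have e' : φ (blk A g) = blk B h := e
    rw [e'] at hx
    have hinv := B.inv_mem _ (blk_mem B h)
    have m1 : x⁻¹ ∈ (blk B h).image (fun x => x⁻¹) := Finset.mem_image_of_mem _ hx
    have m2 : h⁻¹ ∈ (blk B h).image (fun x => x⁻¹) :=
      Finset.mem_image_of_mem _ (self_mem_blk B h)
    rw [mem_iff_blk_eq B hinv] at m1 m2
    rw [mem_iff_blk_eq B (hmaps _ (blk_mem A _)), m1, ← m2] at hy
    exact hy.symm
  · intro z z' e
    have key : ∀ k : Finset H × Finset H,
        Nat.card {x // (φ (blk A x), φ (blk A (x⁻¹ * z))) = k} =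
        Nat.card {x // (blk B x, blk B (x⁻¹ * z')) = k} := by
      rintro ⟨k, j⟩
      by_cases hk : k ∈ B.basicSets ∧ j ∈ B.basicSets
      · obtain ⟨X, hX, rfl⟩ := hsurj _ hk.1
        obtain ⟨Y, hY, rfl⟩ := hsurj _ hk.2
        have h1 := card_eq_structConst A hX hY z
        have h2 := card_eq_structConst B hk.1 hk.2 z'
        have e' : φ (blk A z) = blk B z' := e
        rw [hc _ hX _ hY _ (blk_mem A z) z (self_mem_blk A z) z'
          (e' ▸ self_mem_blk B z'), ← h2] at h1
        simp only [Prod.mk.injEq]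
        rw [← h1]
        refine Nat.card_congr (Equiv.subtypeEquivRight fun x => ?_)
        refine and_congr ⟨fun t => ?_, fun t => by rw [t]⟩ ⟨fun t => ?_, fun t => by rw [t]⟩
        · exact hinj _ (blk_mem A _) _ hX t
        · exact hinj _ (blk_mem A _) _ hY t
      · have e1 : IsEmpty {x // (φ (blk A x), φ (blk A (x⁻¹ * z))) = (k, j)} := by
          refine ⟨fun ⟨x, hx⟩ => hk ?_⟩
          simp only [Prod.mk.injEq] at hx
          exact ⟨hx.1 ▸ hmaps _ (blk_mem A _), hx.2 ▸ hmaps _ (blk_mem A _)⟩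
        have e2 : IsEmpty {x // (blk B x, blk B (x⁻¹ * z')) = (k, j)} := by
          refine ⟨fun ⟨x, hx⟩ => hk ?_⟩
          simp only [Prod.mk.injEq] at hx
          exact ⟨hx.1 ▸ blk_mem B _, hx.2 ▸ blk_mem B _⟩
        rw [Nat.card_of_isEmpty, Nat.card_of_isEmpty]
    obtain ⟨f, hf⟩ := exists_equiv_of_card_fiber _ _ key
    exact ⟨f, fun x => ⟨(Prod.ext_iff.1 (hf x)).1, (Prod.ext_iff.1 (hf x)).2⟩⟩

theorem separableA_of_sep {n : ℕ} (hn : Sep n) (hG : Fintype.card G = n) (A : SRing G) :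
    A.SeparableA := by
  intro H _ _ _ B φ h
  have J := joint_of_isAlgIso h
  obtain ⟨f, hf⟩ := hn G H (Finset H) _ _ (by rw [Nat.card_eq_fintype_card, hG]) J
  refine ⟨f, hf.bijective J, fun X hX g k => ?_⟩
  rw [mem_iff_blk_eq A hX, mem_iff_blk_eq B (h.1.1 hX)]
  have e : φ (blk A (k * g⁻¹)) = blk B (f k * (f g)⁻¹) := hf g k
  rw [← e]
  exact ⟨fun t => by rw [t], fun t => h.1.2.1 (blk_mem A _) hX t⟩

end

end SchurSep

/-- Main Theorem: every abelian group of order `9p` (`p` prime) is separable with respect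
to the class of all finite abelian groups. -/
theorem stmt0 (p : ℕ) (hp : p.Prime) (G : Type) [CommGroup G] [Fintype G] [DecidableEq G]
    (hcard : Fintype.card G = 9 * p) :
    ∀ A : SRing G, A.SeparableA := by
  exact fun A => SchurSep.separableA_of_sep (SchurSep.sep_nine_mul_prime hp) hcard A
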